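/- Let m_par(ξ,η) := Σ_{j≥0} 1_{[−(j+1),−j)}(ξ)·1_{[2^{−j},1)}(η) + Σ_{j≥1} 1_{(0,j)}(ξ)·1_{[2^j,2^{j+1})}(η) + 1_{(−∞,0]}(ξ)·1_{[1,∞)}(η), the indicator function of a staircase set inscribed by the exponential curve η = 2^ξ. Then for every triple of exponents with 2 ≤ p₁ < ∞, 1 < p₂ < ∞, 2 ≤ p₃ < ∞ and 1/p₁ + 1/p₂ + 1/p₃ = 1, there exists a finite constant C = C(p₁,p₂) such that ‖B_{m_par}(f,g)‖_{L^{p₃'}(ℝ)} ≤ C ‖f‖_{L^{p₁}(ℝ)} ‖g‖_{L^{p₂}(ℝ)} for all Schwartz functions f, g on ℝ. -/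

import Mathlib

open MeasureTheory Set
open scoped ENNReal NNReal

noncomputable section

/-- The character `e^{2π i t x}`. -/
def eChar (t x : ℝ) : ℂ := Complex.exp (2 * Real.pi * Complex.I * t * x)

/-- The Fourier transform `f̂(ξ) = ∫ f(x) e^{-2π i ξ x} dx`. -/
def fourierT (f : ℝ → ℂ) (ξ : ℝ) : ℂ := ∫ x : ℝ, f x * eChar (-ξ) x

/-- The bilinear multiplier operator `B_m` with symbol `m`. -/
def Bm (m : ℝ → ℝ → ℂ) (f g : ℝ → ℂ) (x : ℝ) : ℂ :=
  ∫ ξ : ℝ, ∫ η : ℝ, m ξ η * fourierT f ξ * fourierT g η * eChar (ξ + η) x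

/-- Complex-valued indicator function of a set of reals. -/
def indC (s : Set ℝ) (x : ℝ) : ℂ := s.indicator 1 x

/-- The set `-A - B = {-x-y : x ∈ A, y ∈ B}`. -/
def mink2 (A B : Set ℝ) : Set ℝ := Set.image2 (fun x y => -x - y) A B

/-- The paraproduct symbol `m_{a,b}(ξ,η) = Σ_{j≥1} 1_{[a_{j+1},a_j)}(ξ) 1_{[b_j,b_0)}(η)`. -/
def mab (a b : ℕ → ℝ) (ξ η : ℝ) : ℂ :=
  ∑' j : ℕ, indC (Ico (a (j + 2)) (a (j + 1))) ξ * indC (Ico (b (j + 1)) (b 0)) η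

/-- The interval `-[a_{j+1},a_j) - [b_j, b_0)` from the collection `I_{a,b}`. -/
def Iab (a b : ℕ → ℝ) (j : ℕ) : Set ℝ := mink2 (Ico (a (j + 1)) (a j)) (Ico (b j) (b 0))

/-- The interval `-[a_{j+1},a_j) - (b_∞, b_j)` from the collection `J_{a,b}`. -/
def Jab (a b : ℕ → ℝ) (binf : ℝ) (j : ℕ) : Set ℝ :=
  mink2 (Ico (a (j + 1)) (a j)) (Ioo binf (b j))

/-- The symbol `m̃_{u,v}(ξ,η) = Σ_{j≥1} 1_{(u_0,u_j]}(ξ) 1_{[v_j,v_{j+1})}(η)`. -/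
def muv (u v : ℕ → ℝ) (ξ η : ℝ) : ℂ :=
  ∑' j : ℕ, indC (Ioc (u 0) (u (j + 1))) ξ * indC (Ico (v (j + 1)) (v (j + 2))) η

/-- The interval `-(u_0,u_j] - [v_j, v_{j+1})`. -/
def Iuv (u v : ℕ → ℝ) (j : ℕ) : Set ℝ :=
  mink2 (Ioc (u 0) (u j)) (Ico (v j) (v (j + 1)))

/-- The frequency projection `(1_S f̂)^∨`. -/
def fproj (S : Set ℝ) (f : ℝ → ℂ) (x : ℝ) : ℂ := ∫ ξ in S, fourierT f ξ * eChar ξ x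

/-- The `L^p(ℓ²)` norm of the family of frequency projections onto the sets `T i`. -/
def sqNormLp {ι : Type*} (T : ι → Set ℝ) (f : ℝ → ℂ) (p : ℝ) : ℝ≥0∞ :=
  (∫⁻ x : ℝ, (∑' i, ((‖fproj (T i) f x‖₊ : ℝ≥0∞)) ^ 2) ^ (p / 2)) ^ (1 / p)

/-- The collection of connected components of a set `U ⊆ ℝ`. -/
def componentsOf (U : Set ℝ) : Set (Set ℝ) := {S | ∃ x ∈ U, S = connectedComponentIn U x}

/-- A closed Lebesgue-null set `E ⊆ ℝ` is Littlewood–Paley if for every `1 < p < ∞` the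
square function associated with the connected components of `ℝ \ E` is comparable with the
`L^p` norm (stated on the dense class of Schwartz functions). -/
def IsLPSet (E : Set ℝ) : Prop :=
  IsClosed E ∧ volume E = 0 ∧
    ∀ p : ℝ, 1 < p → ∃ c : ℝ, 0 < c ∧ ∃ C : ℝ, 0 < C ∧
      ∀ f : SchwartzMap ℝ ℂ,
        ENNReal.ofReal c * eLpNorm (⇑f) (ENNReal.ofReal p) volume ≤
            sqNormLp (fun ω : componentsOf Eᶜ => (ω : Set ℝ)) (⇑f) p ∧
          sqNormLp (fun ω : componentsOf Eᶜ => (ω : Set ℝ)) (⇑f) p ≤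
            ENNReal.ofReal C * eLpNorm (⇑f) (ENNReal.ofReal p) volume

/-- A strictly monotone real sequence is Littlewood–Paley if the closure of its range is a
Littlewood–Paley set. -/
def IsLPSeq (a : ℕ → ℝ) : Prop := IsLPSet (closure (Set.range a))

/-- A family of (pairwise disjoint) intervals is Littlewood–Paley if for every `1 < p < ∞`
the associated square function is bounded by the `L^p` norm. -/
def IsLPFamily {ι : Type*} (T : ι → Set ℝ) : Prop :=
  ∀ p : ℝ, 1 < p → ∃ C : ℝ, 0 < C ∧ ∀ f : SchwartzMap ℝ ℂ,
    sqNormLp T (⇑f) p ≤ ENNReal.ofReal C * eLpNorm (⇑f) (ENNReal.ofReal p) volume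

/-- Slope of the `j`-th segment of the piecewise linear curve with vertices `(a_j, b_j)`. -/
def pslope (a b : ℕ → ℝ) (j : ℕ) : ℝ := (b j - b (j + 1)) / (a j - a (j + 1))

/-- The epigraph of the piecewise linear curve with vertices `(a_j, b_j)`. -/
def polyEpi (a b : ℕ → ℝ) : Set (ℝ × ℝ) :=
  ⋃ j : ℕ, {p : ℝ × ℝ | a (j + 1) ≤ p.1 ∧ p.1 ≤ a j ∧
    b (j + 1) + pslope a b j * (p.1 - a (j + 1)) ≤ p.2}

end

/-- Complex-valued indicator function of a set in the plane, as a bilinear symbol. -/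
noncomputable def indC2 (S : Set (ℝ × ℝ)) (ξ η : ℝ) : ℂ := S.indicator 1 (ξ, η)

/-- The staircase symbol inscribed by the exponential curve `η = 2^ξ`. -/
noncomputable def mpar (ξ η : ℝ) : ℂ :=
  (∑' j : ℕ, indC (Ico (-(j : ℝ) - 1) (-(j : ℝ))) ξ * indC (Ico (((2 : ℝ) ^ j)⁻¹) 1) η) +
    (∑' j : ℕ, indC (Ioo 0 ((j : ℝ) + 1)) ξ *
      indC (Ico ((2 : ℝ) ^ (j + 1)) ((2 : ℝ) ^ (j + 2))) η) +
    indC (Iic 0) ξ * indC (Ici 1) η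

open scoped FourierTransform SchwartzMap

/-- Bounded strongly measurable functions supported on a set of finite measure. -/
structure IsTame {E : Type*} [NormedAddCommGroup E] (f : ℝ → E) : Prop where
  meas : StronglyMeasurable f
  bdd : ∃ C : ℝ, ∀ x, ‖f x‖ ≤ C
  supp : volume (Function.support f) < ∞

namespace IsTame

variable {E : Type*} [NormedAddCommGroup E]

lemma zero : IsTame (0 : ℝ → E) := ⟨stronglyMeasurable_zero, ⟨0, by simp⟩, by simp⟩

lemma add {f g : ℝ → E} (hf : IsTame f) (hg : IsTame g) : IsTame (f + g) := by
  obtain ⟨C, hC⟩ := hf.bdd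
  obtain ⟨D, hD⟩ := hg.bdd
  refine ⟨hf.meas.add hg.meas, ⟨C + D, fun x => (norm_add_le _ _).trans (add_le_add (hC x) (hD x))⟩,
    ?_⟩
  exact (measure_mono (Function.support_add f g)).trans_lt
    ((measure_union_le _ _).trans_lt (ENNReal.add_lt_top.2 ⟨hf.supp, hg.supp⟩))

lemma smul {𝕜 : Type*} [NormedField 𝕜] [NormedSpace 𝕜 E] {f : ℝ → E} (c : 𝕜) (hf : IsTame f) :
    IsTame (c • f) := by
  obtain ⟨C, hC⟩ := hf.bdd
  refine ⟨hf.meas.const_smul c, ⟨‖c‖ * C, fun x => ?_⟩, ?_⟩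
  · simpa [norm_smul] using mul_le_mul_of_nonneg_left (hC x) (norm_nonneg c)
  · exact (measure_mono (Function.support_const_smul_subset c f)).trans_lt hf.supp

lemma indicator {f : ℝ → E} (hf : IsTame f) {s : Set ℝ} (hs : MeasurableSet s) :
    IsTame (s.indicator f) := by
  obtain ⟨C, hC⟩ := hf.bdd
  refine ⟨hf.meas.indicator hs, ⟨C, fun x => (norm_indicator_le_norm_self f x).trans (hC x)⟩, ?_⟩
  exact (measure_mono (Function.support_subset_iff'.2 fun x hx => by
    simp [Function.notMem_support.1 hx])).trans_lt hf.supp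

lemma sum {ι : Type*} {f : ι → ℝ → E} (s : Finset ι) (hf : ∀ i ∈ s, IsTame (f i)) :
    IsTame (∑ i ∈ s, f i) :=
  Finset.sum_induction f IsTame (fun _ _ h h' => h.add h') zero hf

lemma of_bound {f : ℝ → E} (hf : StronglyMeasurable f) {s : Set ℝ} (hs : volume s < ∞) {C : ℝ}
    (hC : ∀ x, ‖f x‖ ≤ C) (h0 : ∀ x, x ∉ s → f x = 0) : IsTame f :=
  ⟨hf, ⟨C, hC⟩, (measure_mono (Function.support_subset_iff'.2 h0)).trans_lt hs⟩

lemma memLp {f : ℝ → E} (hf : IsTame f) (p : ℝ≥0∞) : MemLp f p volume := by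
  obtain ⟨C, hC⟩ := hf.bdd
  have h1 : MemLp f ∞ volume :=
    memLp_top_of_bound hf.meas.aestronglyMeasurable C (Filter.Eventually.of_forall hC)
  exact h1.mono_exponent_of_measure_support_ne_top (s := Function.support f)
    (fun x hx => Function.notMem_support.1 hx) hf.supp.ne le_top

lemma integrable {f : ℝ → E} (hf : IsTame f) : Integrable f := memLp_one_iff_integrable.1 (hf.memLp 1)

lemma lintegral_rpow_lt_top {f : ℝ → E} (hf : IsTame f) {p : ℝ} (hp : 0 < p) :
    ∫⁻ x, ‖f x‖ₑ ^ p < ∞ := by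
  have := (hf.memLp (ENNReal.ofReal p)).eLpNorm_lt_top
  have h := lintegral_rpow_enorm_lt_top_of_eLpNorm_lt_top (f := f) (μ := volume)
    (p := ENNReal.ofReal p) (by simpa using hp) (by simp) this
  simpa [ENNReal.toReal_ofReal hp.le] using h

end IsTame

lemma ENNReal.two_rpow_ne_zero (x : ℝ) : (2 : ℝ≥0∞) ^ x ≠ 0 := by simp
lemma ENNReal.two_rpow_ne_top (x : ℝ) : (2 : ℝ≥0∞) ^ x ≠ ∞ := by simp

lemma ENNReal.two_rpow_add (x y : ℝ) : (2 : ℝ≥0∞) ^ (x + y) = 2 ^ x * 2 ^ y :=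
  ENNReal.rpow_add _ _ (by simp) (by simp)

lemma ENNReal.two_rpow_neg_mul (x : ℝ) : (2 : ℝ≥0∞) ^ (-x) * 2 ^ x = 1 := by
  rw [← ENNReal.two_rpow_add]; simp

/-- Two-sided geometric sums over the integers are finite. -/
lemma tsum_two_rpow_neg_abs_lt_top {ε : ℝ} (hε : 0 < ε) :
    ∑' j : ℤ, (2 : ℝ≥0∞) ^ (-(ε * |(j : ℝ)|)) < ∞ := by
  have hr : (2 : ℝ≥0∞) ^ (-ε) < 1 := by
    rw [ENNReal.rpow_neg, ENNReal.inv_lt_one]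
    exact ENNReal.one_lt_rpow (by norm_num) hε
  have hgeo : ∑' n : ℕ, (2 : ℝ≥0∞) ^ (-(ε * (n : ℝ))) < ∞ := by
    have : ∀ n : ℕ, (2 : ℝ≥0∞) ^ (-(ε * (n : ℝ))) = (2 ^ (-ε)) ^ n := fun n => by
      rw [← ENNReal.rpow_natCast, ← ENNReal.rpow_mul]; ring_nf
    simp_rw [this, ENNReal.tsum_geometric]
    exact ENNReal.inv_lt_top.2 (tsub_pos_of_lt hr)
  have hle : ∑' j : ℤ, (2 : ℝ≥0∞) ^ (-(ε * |(j : ℝ)|)) ≤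
      ∑' n : ℕ, (2 : ℝ≥0∞) ^ (-(ε * (n : ℝ))) + ∑' n : ℕ, (2 : ℝ≥0∞) ^ (-(ε * (n : ℝ))) := by
    rw [← tsum_of_nat_of_neg_add_one (f := fun j : ℤ => (2 : ℝ≥0∞) ^ (-(ε * |(j : ℝ)|)))
      ENNReal.summable ENNReal.summable |>.symm]
    gcongr with n n
    · norm_num
    · simp
    · norm_num
    · push_cast
      rw [abs_of_nonpos (by have : (0:ℝ) ≤ n := n.cast_nonneg; linarith)]; linarith
  exact hle.trans_lt (ENNReal.add_lt_top.2 ⟨hgeo, hgeo⟩)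

/-- A dyadic layer-cake bound. -/
lemma lintegral_rpow_le_tsum_zpow {u : ℝ → ℝ≥0∞} (hu : AEMeasurable u) {p : ℝ} (hp : 0 < p) :
    ∫⁻ x, u x ^ p ≤ 2 ^ p * ∑' l : ℤ, 2 ^ ((l : ℝ) * p) * volume {x | (2:ℝ≥0∞) ^ (l : ℝ) < u x} := by
  have hpt : ∀ x, u x ^ p ≤ 2 ^ p * ∑' l : ℤ, 2 ^ ((l : ℝ) * p) *
      {x | (2:ℝ≥0∞) ^ (l : ℝ) < u x}.indicator 1 x := by
    intro x
    rcases eq_or_ne (u x) 0 with h0 | h0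
    · simp [h0, hp]
    rcases eq_or_ne (u x) ∞ with h1 | h1
    · have h2 : ∑' l : ℤ, (2:ℝ≥0∞) ^ ((l : ℝ) * p) *
          {x | (2:ℝ≥0∞) ^ (l : ℝ) < u x}.indicator 1 x = ∞ := by
        have h3 : ∀ l : ℤ, (2:ℝ≥0∞) ^ ((l : ℝ) * p) * {x | (2:ℝ≥0∞) ^ (l : ℝ) < u x}.indicator 1 x
            = (2:ℝ≥0∞) ^ ((l : ℝ) * p) := fun l => by
          rw [indicator_of_mem (by rw [mem_ofPred_eq, h1]; exact (ENNReal.two_rpow_ne_top _).lt_top)]; simp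
        simp_rw [h3]
        rw [← top_le_iff]
        calc (∞:ℝ≥0∞) = ∑' n : ℕ, (1:ℝ≥0∞) := by simp
          _ ≤ ∑' n : ℕ, (2:ℝ≥0∞) ^ (((n:ℤ) : ℝ) * p) :=
              ENNReal.tsum_le_tsum fun n => by
                rcases n.eq_zero_or_pos with rfl | hn
                · simp
                · exact ENNReal.one_le_rpow (by norm_num) (by push_cast; positivity)
          _ ≤ _ := ENNReal.tsum_comp_le_tsum_of_injective Nat.cast_injective
              (fun l : ℤ => (2:ℝ≥0∞) ^ ((l : ℝ) * p))
      rw [h2, ENNReal.mul_top (by simp)]; exact le_top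
    · obtain ⟨l, hl, hl'⟩ := ENNReal.exists_mem_Ioc_zpow h0 h1 (by norm_num : (1:ℝ≥0∞) < 2) (by simp)
      calc u x ^ p ≤ (2 ^ (l + 1)) ^ p := by gcongr
        _ = 2 ^ p * (2 ^ ((l : ℝ) * p) * {x | (2:ℝ≥0∞) ^ (l : ℝ) < u x}.indicator 1 x) := by
          rw [indicator_of_mem (by simpa using hl), Pi.one_apply, mul_one, ← ENNReal.two_rpow_add,
            ← ENNReal.rpow_intCast, ← ENNReal.rpow_mul]
          push_cast; ring_nf
        _ ≤ _ := by gcongr; exact ENNReal.le_tsum l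
  refine (lintegral_mono hpt).trans ?_
  rw [lintegral_const_mul' _ _ (by simp), lintegral_tsum]
  · gcongr with l
    rw [lintegral_const_mul' _ _ (by simp)]
    gcongr
    exact lintegral_indicator_one_le _
  · intro l
    refine AEMeasurable.const_mul ?_ _
    exact (aemeasurable_indicator_const_iff (1:ℝ≥0∞)).2 (nullMeasurableSet_lt aemeasurable_const hu)

/-- A convenient integer-valued logarithmic size function, bounded below by `-K`. -/
private noncomputable def levelIndex {E : Type*} [NormedAddCommGroup E] (f : ℝ → E) (K : ℕ)
    (x : ℝ) : ℤ := max (-(K : ℤ)) (⌈Real.logb 2 ‖f x‖⌉ - 1)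

private lemma norm_le_levelIndex {E : Type*} [NormedAddCommGroup E] (f : ℝ → E) (K : ℕ) (x : ℝ) :
    ‖f x‖ ≤ 2 ^ ((levelIndex f K x : ℝ) + 1) := by
  rcases (norm_nonneg (f x)).eq_or_lt with h | h
  · rw [← h]; positivity
  rw [← Real.logb_le_iff_le_rpow (by norm_num) h]
  have h1 := Int.le_ceil (Real.logb 2 ‖f x‖)
  have h2 : ((⌈Real.logb 2 ‖f x‖⌉ - 1 : ℤ) : ℝ) ≤ levelIndex f K x := by
    exact_mod_cast le_max_right _ _
  push_cast at h2; linarith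

private lemma levelIndex_lt_norm {E : Type*} [NormedAddCommGroup E] {f : ℝ → E} {K : ℕ} {x : ℝ}
    (h0 : f x ≠ 0) (h : -(K : ℤ) < levelIndex f K x) : (2:ℝ) ^ (levelIndex f K x : ℝ) < ‖f x‖ := by
  rw [← Real.lt_logb_iff_rpow_lt (by norm_num) (norm_pos_iff.2 h0)]
  have : levelIndex f K x = ⌈Real.logb 2 ‖f x‖⌉ - 1 := by
    unfold levelIndex at h ⊢; rcases max_choice (-(K : ℤ)) (⌈Real.logb 2 ‖f x‖⌉ - 1) with h' | h'
    · rw [h'] at h; exact absurd h (lt_irrefl _)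
    · exact h'
  rw [this]; push_cast
  linarith [Int.ceil_lt_add_one (Real.logb 2 ‖f x‖)]

/-- Restricted weak-type interpolation for sublinear operators on tame functions. -/
theorem restricted_weak_interpolation {p0 p p1 : ℝ} (h0 : 0 < p0) (h01 : p0 < p) (h1 : p < p1)
    {A : ℝ≥0∞} (hA : A ≠ ∞) :
    ∃ C : ℝ≥0∞, C ≠ ∞ ∧ ∀ (E : Type) [NormedAddCommGroup E] [NormedSpace ℝ E]
      (T : (ℝ → E) → ℝ → ℝ≥0∞), (∀ f, IsTame f → AEMeasurable (T f)) →
      (∀ f g, IsTame f → IsTame g → ∀ x, T (f + g) x ≤ T f x + T g x) →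
      (∀ f, IsTame f → ∀ a : ℝ, 0 < a → ∀ x, T (a • f) x ≤ ENNReal.ofReal a * T f x) →
      (∀ q ∈ ({p0, p1} : Set ℝ), ∀ F : Set ℝ, MeasurableSet F → ∀ f, IsTame f →
        (∀ x, ‖f x‖ ≤ F.indicator 1 x) → ∀ t : ℝ≥0∞, t ≠ 0 → t ≠ ∞ →
        volume {x | t < T f x} ≤ A * t ^ (-q) * volume F) →
      ∀ f, IsTame f → ∫⁻ x, T f x ^ p ≤ C * ∫⁻ x, ‖f x‖ₑ ^ p := by
  set δ : ℝ := min ((p - p0) / (2 * p0)) ((p1 - p) / (2 * p1)) with hδ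
  set ε : ℝ := min ((p - p0) / 2) ((p1 - p) / 2) with hε
  have hp1 : 0 < p1 := by linarith
  have hp : 0 < p := by linarith
  have hδ0 : 0 < δ := lt_min (div_pos (by linarith) (by linarith)) (div_pos (by linarith) (by linarith))
  have hε0 : 0 < ε := lt_min (by linarith) (by linarith)
  have hδ1 : δ * p0 ≤ (p - p0) / 2 := by
    calc δ * p0 ≤ (p - p0) / (2 * p0) * p0 := by gcongr; exact min_le_left _ _
      _ = _ := by field_simp
  have hδ2 : δ * p1 ≤ (p1 - p) / 2 := by
    calc δ * p1 ≤ (p1 - p) / (2 * p1) * p1 := by gcongr; exact min_le_right _ _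
      _ = _ := by field_simp
  have hε1 : ε ≤ (p - p0) / 2 := min_le_left _ _
  have hε2 : ε ≤ (p1 - p) / 2 := min_le_right _ _
  set S : ℝ≥0∞ := ∑' j : ℤ, (2 : ℝ≥0∞) ^ (-(δ * |(j : ℝ)|)) with hS
  set Sε : ℝ≥0∞ := ∑' j : ℤ, (2 : ℝ≥0∞) ^ (-(ε * |(j : ℝ)|)) with hSε
  have hST : S ≠ ∞ := (tsum_two_rpow_neg_abs_lt_top hδ0).ne
  have hSεT : Sε ≠ ∞ := (tsum_two_rpow_neg_abs_lt_top hε0).ne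
  have hS1 : S ≠ 0 := by
    have : (2 : ℝ≥0∞) ^ (-(δ * |((0:ℤ) : ℝ)|)) ≤ S := ENNReal.le_tsum (0:ℤ)
    intro h; rw [h] at this; simp at this
  set D : ℝ≥0∞ := A * ((2 * S) ^ p0 + (2 * S) ^ p1) with hD
  have hDT : D ≠ ∞ := by
    have := ENNReal.mul_ne_top (by simp : (2:ℝ≥0∞) ≠ ∞) hST
    exact ENNReal.mul_ne_top hA (ENNReal.add_ne_top.2
      ⟨ENNReal.rpow_ne_top_of_nonneg h0.le this, ENNReal.rpow_ne_top_of_nonneg hp1.le this⟩)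
  refine ⟨2 ^ p * (D * Sε), by finiteness, ?_⟩
  intro E _ _ T hTm hadd hsmul hweak f hf
  -- the bound at level `K`
  have key : ∀ K : ℕ, ∫⁻ x, T f x ^ p ≤ 2 ^ p * (D * Sε) *
      ((∫⁻ x, ‖f x‖ₑ ^ p) + 2 ^ (-(K : ℝ) * p) * volume (Function.support f)) := by
    intro K
    obtain ⟨B, hB⟩ := hf.bdd
    set K0 : ℤ := max (-(K : ℤ)) (⌈Real.logb 2 (max B 1)⌉ - 1) with hK0
    have hle0 : ∀ x, f x ≠ 0 → levelIndex f K x ≤ K0 := fun x hx => by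
      refine max_le_max le_rfl (sub_le_sub_right (Int.ceil_le_ceil ?_) _)
      exact Real.logb_le_logb_of_le (by norm_num) (norm_pos_iff.2 hx)
        ((hB x).trans (le_max_left _ _))
    have hκm : Measurable (levelIndex f K) := by
      have h1 : Measurable fun x => ‖f x‖ := hf.meas.norm.measurable
      have h2 : Measurable fun x => Real.logb 2 ‖f x‖ := by
        unfold Real.logb; exact (Real.measurable_log.comp h1).div_const _
      exact measurable_const.max ((Int.measurable_ceil.comp h2).sub_const 1)
    set s : Finset ℤ := Finset.Icc (-(K:ℤ)) K0 with hs
    set L : ℤ → Set ℝ := fun k => Function.support f ∩ levelIndex f K ⁻¹' {k} with hL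
    have hsupp : MeasurableSet (Function.support f) := hf.meas.measurableSet_support
    have hLm : ∀ k, MeasurableSet (L k) := fun k => hsupp.inter (hκm (measurableSet_singleton k))
    set g : ℤ → ℝ → E := fun k => (L k).indicator f with hg
    have hgt : ∀ k, IsTame (g k) := fun k => hf.indicator (hLm k)
    have hsum : ∑ k ∈ s, g k = f := by
      ext x
      rw [Finset.sum_apply]
      by_cases hx : f x = 0
      · rw [hx]; exact Finset.sum_eq_zero fun k _ => by
          simp [hg, indicator, hx]
      · rw [Finset.sum_eq_single (levelIndex f K x)]
        · exact indicator_of_mem (show x ∈ L _ from ⟨hx, rfl⟩) f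
        · intro k _ hk; exact indicator_of_notMem (fun h => hk h.2.symm) f
        · intro h; exact absurd (Finset.mem_Icc.2 ⟨le_max_left _ _, hle0 x hx⟩) h
    have hsne : s.Nonempty := ⟨-(K:ℤ), Finset.mem_Icc.2 ⟨le_rfl, le_max_left _ _⟩⟩
    have hTsum : ∀ x, T f x ≤ ∑ k ∈ s, T (g k) x := fun x => by
      conv_lhs => rw [← hsum]
      exact Finset.le_sum_nonempty_of_subadditive_on_pred (fun h => T h x) IsTame
        (fun a b ha hb => hadd a b ha hb x) (fun a b ha hb => ha.add hb) g s hsne (fun k _ => hgt k)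
    have hpiece : ∀ k l : ℤ, 2 ^ ((l:ℝ) * p) *
        volume {x | S⁻¹ * 2 ^ ((l:ℝ) - δ * |((k - l : ℤ):ℝ)|) < T (g k) x} ≤
        D * 2 ^ (-(ε * |((k - l : ℤ):ℝ)|)) * (2 ^ ((k:ℝ) * p) * volume (L k)) := by
      intro k l
      set j : ℝ := ((k - l : ℤ) : ℝ) with hj
      have hjl : (l:ℝ) = k - j := by rw [hj]; push_cast; ring
      set h : ℝ → E := ((2:ℝ) ^ (-((k:ℝ) + 1))) • g k with hh
      have hht : IsTame h := (hgt k).smul _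
      have hgh : g k = ((2:ℝ) ^ ((k:ℝ) + 1)) • h := by
        rw [hh, smul_smul, ← Real.rpow_add (by norm_num)]; simp
      have hbd : ∀ x, ‖h x‖ ≤ (L k).indicator 1 x := fun x => by
        by_cases hx : x ∈ L k
        · have e1 : h x = ((2:ℝ) ^ (-((k:ℝ) + 1))) • f x := by simp [hh, hg, hx]
          have e2 := norm_le_levelIndex f K x
          rw [hx.2] at e2
          rw [indicator_of_mem hx, Pi.one_apply, e1, norm_smul, Real.norm_of_nonneg (by positivity)]
          calc _ ≤ (2:ℝ) ^ (-((k:ℝ) + 1)) * 2 ^ ((k:ℝ) + 1) := by gcongr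
            _ = 1 := by rw [← Real.rpow_add (by norm_num)]; simp
        · simp [hh, hg, hx]
      have hscale : ∀ x, T (g k) x ≤ 2 ^ ((k:ℝ) + 1) * T h x := fun x => by
        rw [hgh]
        refine (hsmul h hht _ (by positivity) x).trans_eq ?_
        rw [← ENNReal.ofReal_rpow_of_pos (by norm_num)]; simp
      set t : ℝ≥0∞ := S⁻¹ * 2 ^ (-j - 1 - δ * |j|) with ht
      have ht0 : t ≠ 0 := mul_ne_zero (ENNReal.inv_ne_zero.2 hST) (by simp)
      have htT : t ≠ ∞ := ENNReal.mul_ne_top (ENNReal.inv_ne_top.2 hS1) (by simp)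
      have hincl : {x | S⁻¹ * 2 ^ ((l:ℝ) - δ * |j|) < T (g k) x} ⊆ {x | t < T h x} := by
        intro x hx
        by_contra hcon
        rw [mem_ofPred_eq, not_lt] at hcon
        refine absurd (hx.trans_le ((hscale x).trans (mul_le_mul_right hcon _))) ?_
        rw [not_lt, ht, mul_left_comm, ← ENNReal.two_rpow_add, hjl]
        refine le_of_eq ?_; ring_nf
      have main : ∀ q ∈ ({p0, p1} : Set ℝ), (j + δ * |j|) * q - j * p ≤ -(ε * |j|) →
          2 ^ ((l:ℝ) * p) * volume {x | S⁻¹ * 2 ^ ((l:ℝ) - δ * |j|) < T (g k) x} ≤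
            A * (2 * S) ^ q * 2 ^ (-(ε * |j|)) * (2 ^ ((k:ℝ) * p) * volume (L k)) := by
        intro q hq hexp
        have hq0 : 0 < q := by rcases hq with rfl | rfl <;> assumption
        have e1 : t ^ (-q) = (2 * S) ^ q * 2 ^ ((j + δ * |j|) * q) := by
          rw [ht, ENNReal.mul_rpow_of_ne_top (ENNReal.inv_ne_top.2 hS1) (by simp),
            ENNReal.mul_rpow_of_ne_top (by simp) hST, ← ENNReal.rpow_mul, ENNReal.inv_rpow,
            ENNReal.rpow_neg, inv_inv, mul_comm (2 ^ q) (S ^ q), mul_assoc, ← ENNReal.two_rpow_add]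
          ring_nf
        calc _ ≤ 2 ^ ((l:ℝ) * p) * (A * t ^ (-q) * volume (L k)) := by
              gcongr
              exact (measure_mono hincl).trans (hweak q hq (L k) (hLm k) h hht hbd t ht0 htT)
          _ = A * (2 * S) ^ q * 2 ^ ((j + δ * |j|) * q - j * p) * (2 ^ ((k:ℝ) * p) * volume (L k)) := by
              have e2 : (2:ℝ≥0∞) ^ ((l:ℝ) * p) * 2 ^ ((j + δ * |j|) * q) =
                  2 ^ ((j + δ * |j|) * q - j * p) * 2 ^ ((k:ℝ) * p) := by
                rw [← ENNReal.two_rpow_add, ← ENNReal.two_rpow_add, hjl]; ring_nf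
              rw [e1]
              calc _ = A * (2 * S) ^ q * ((2:ℝ≥0∞) ^ ((l:ℝ) * p) * 2 ^ ((j + δ * |j|) * q)) *
                    volume (L k) := by ring
                _ = _ := by rw [e2]; ring
          _ ≤ _ := by gcongr; norm_num
      rcases le_total 0 j with hj0 | hj0
      · refine (main p0 (by simp) ?_).trans ?_
        · rw [abs_of_nonneg hj0]
          nlinarith
        · rw [hD]; gcongr; exact le_self_add
      · refine (main p1 (by simp) ?_).trans ?_
        · rw [abs_of_nonpos hj0]
          nlinarith
        · rw [hD]; gcongr; exact le_add_self
    have hlevel : ∀ l : ℤ, volume {x | (2:ℝ≥0∞) ^ (l:ℝ) < T f x} ≤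
        ∑ k ∈ s, volume {x | S⁻¹ * 2 ^ ((l:ℝ) - δ * |((k - l : ℤ):ℝ)|) < T (g k) x} := by
      intro l
      refine (measure_mono ?_).trans (measure_biUnion_finset_le s _)
      intro x hx
      by_contra hcon
      simp only [mem_iUnion, mem_ofPred_eq, not_exists, not_lt] at hcon
      refine absurd (lt_of_lt_of_le hx ((hTsum x).trans (Finset.sum_le_sum hcon))) ?_
      rw [not_lt]
      calc ∑ k ∈ s, S⁻¹ * 2 ^ ((l:ℝ) - δ * |((k - l : ℤ):ℝ)|)
          ≤ ∑' k : ℤ, S⁻¹ * 2 ^ ((l:ℝ) - δ * |((k - l : ℤ):ℝ)|) := ENNReal.sum_le_tsum s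
        _ = ∑' j : ℤ, S⁻¹ * 2 ^ ((l:ℝ) - δ * |(j:ℝ)|) :=
            (Equiv.subRight l).tsum_eq (fun j : ℤ => S⁻¹ * 2 ^ ((l:ℝ) - δ * |(j:ℝ)|))
        _ = 2 ^ (l:ℝ) * (S⁻¹ * S) := by
            rw [ENNReal.tsum_mul_left, mul_left_comm]
            congr 1
            rw [hS, ← ENNReal.tsum_mul_left]
            refine tsum_congr fun j => ?_
            rw [← ENNReal.two_rpow_add]; ring_nf
        _ = 2 ^ (l:ℝ) := by rw [ENNReal.inv_mul_cancel hS1 hST, mul_one]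
    have hLsum : ∑ k ∈ s, 2 ^ ((k:ℝ) * p) * volume (L k) ≤
        (∫⁻ x, ‖f x‖ₑ ^ p) + 2 ^ (-(K : ℝ) * p) * volume (Function.support f) := by
      have e1 : ∀ k : ℤ, 2 ^ ((k:ℝ) * p) * volume (L k) =
          ∫⁻ x, (L k).indicator (fun _ => (2:ℝ≥0∞) ^ ((k:ℝ) * p)) x := fun k => by
        rw [lintegral_indicator_const (hLm k)]
      have e2 : 2 ^ (-(K : ℝ) * p) * volume (Function.support f) =
          ∫⁻ x, (Function.support f).indicator (fun _ => (2:ℝ≥0∞) ^ (-(K : ℝ) * p)) x := by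
        rw [lintegral_indicator_const hsupp]
      simp_rw [e1]
      rw [e2, ← lintegral_finsetSum _ (fun k _ => measurable_const.indicator (hLm k)),
        ← lintegral_add_right _ (measurable_const.indicator hsupp)]
      refine lintegral_mono fun x => ?_
      by_cases hx : f x = 0
      · rw [Finset.sum_eq_zero]
        · exact zero_le
        · intro k _; exact indicator_of_notMem (fun h => h.1 hx) _
      rw [Finset.sum_eq_single (levelIndex f K x)]
      · rw [indicator_of_mem (show x ∈ L _ from ⟨hx, rfl⟩), indicator_of_mem (show x ∈ _ from hx)]
        rcases (le_max_left (-(K:ℤ)) (⌈Real.logb 2 ‖f x‖⌉ - 1)).eq_or_lt with h | h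
        · refine le_add_left (le_of_eq ?_)
          unfold levelIndex; rw [← h]; push_cast; rfl
        · refine le_add_right ?_
          have e3 := levelIndex_lt_norm (f := f) (K := K) hx h
          rw [ENNReal.rpow_mul]
          gcongr
          rw [← ofReal_norm, ← ENNReal.ofReal_ofNat, ENNReal.ofReal_rpow_of_pos (by norm_num)]
          exact ENNReal.ofReal_le_ofReal e3.le
      · intro k _ hk; exact indicator_of_notMem (fun h => hk h.2.symm) _
      · intro h; exact absurd (Finset.mem_Icc.2 ⟨le_max_left _ _, hle0 x hx⟩) h
    calc ∫⁻ x, T f x ^ p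
        ≤ 2 ^ p * ∑' l : ℤ, 2 ^ ((l : ℝ) * p) * volume {x | (2:ℝ≥0∞) ^ (l : ℝ) < T f x} :=
          lintegral_rpow_le_tsum_zpow (hTm f hf) hp
      _ ≤ 2 ^ p * ∑' l : ℤ, ∑ k ∈ s,
            D * 2 ^ (-(ε * |((k - l : ℤ):ℝ)|)) * (2 ^ ((k:ℝ) * p) * volume (L k)) := by
          gcongr with l
          refine (mul_le_mul_right (hlevel l) _).trans ?_
          rw [Finset.mul_sum]
          exact Finset.sum_le_sum fun k _ => hpiece k l
      _ = 2 ^ p * (D * Sε * ∑ k ∈ s, 2 ^ ((k:ℝ) * p) * volume (L k)) := by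
          rw [Summable.tsum_finsetSum (fun _ _ => ENNReal.summable), Finset.mul_sum (a := D * Sε)]
          congr 1
          refine Finset.sum_congr rfl fun k _ => ?_
          rw [ENNReal.tsum_mul_right, ENNReal.tsum_mul_left]
          congr 2
          exact (Equiv.subLeft k).tsum_eq (fun j : ℤ => (2:ℝ≥0∞) ^ (-(ε * |(j:ℝ)|)))
      _ ≤ _ := by rw [← mul_assoc]; gcongr
  -- let `K → ∞`
  have hlim : Filter.Tendsto (fun K : ℕ => 2 ^ p * (D * Sε) *
      ((∫⁻ x, ‖f x‖ₑ ^ p) + (2:ℝ≥0∞) ^ (-(K : ℝ) * p) * volume (Function.support f))) Filter.atTop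
      (nhds (2 ^ p * (D * Sε) * ((∫⁻ x, ‖f x‖ₑ ^ p) + 0 * volume (Function.support f)))) := by
    refine ENNReal.Tendsto.const_mul (tendsto_const_nhds.add
      (ENNReal.Tendsto.mul_const ?_ (Or.inr hf.supp.ne))) (Or.inr (by finiteness))
    have : ∀ K : ℕ, (2:ℝ≥0∞) ^ (-(K : ℝ) * p) = (2 ^ (-p)) ^ K := fun K => by
      rw [← ENNReal.rpow_natCast, ← ENNReal.rpow_mul]; ring_nf
    simp_rw [this]
    refine ENNReal.tendsto_pow_atTop_nhds_zero_of_lt_one ?_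
    rw [ENNReal.rpow_neg, ENNReal.inv_lt_one]
    exact ENNReal.one_lt_rpow (by norm_num) hp
  have := ge_of_tendsto' hlim key
  simpa using this

/-- The uncentered Hardy–Littlewood maximal function on the line. -/
noncomputable def maxFn (f : ℝ → ℝ≥0∞) (x : ℝ) : ℝ≥0∞ :=
  ⨆ (c : ℝ) (r : ℝ) (_ : x ∈ Metric.ball c r),
    (ENNReal.ofReal (2 * r))⁻¹ * ∫⁻ y in Metric.ball c r, f y

namespace maxFn

lemma lintegral_le {f : ℝ → ℝ≥0∞} {s : Set ℝ} {c r x : ℝ} (hx : x ∈ Metric.ball c r)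
    (hs : s ⊆ Metric.ball c r) : ∫⁻ y in s, f y ≤ ENNReal.ofReal (2 * r) * maxFn f x := by
  have hr : 0 < r := Metric.pos_of_mem_ball hx
  have h1 : (ENNReal.ofReal (2 * r))⁻¹ * ∫⁻ y in Metric.ball c r, f y ≤ maxFn f x :=
    le_iSup₂_of_le c r (le_iSup_of_le hx le_rfl)
  refine (lintegral_mono_set hs).trans ?_
  rwa [ENNReal.inv_mul_le_iff (by simpa using hr) ENNReal.ofReal_ne_top] at h1

lemma le_iff {f : ℝ → ℝ≥0∞} {x : ℝ} {t : ℝ≥0∞} : maxFn f x ≤ t ↔ ∀ c r, x ∈ Metric.ball c r →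
    ∫⁻ y in Metric.ball c r, f y ≤ ENNReal.ofReal (2 * r) * t := by
  simp only [maxFn, iSup_le_iff]
  refine forall_congr' fun c => forall_congr' fun r => forall_congr' fun h => ?_
  have := Metric.pos_of_mem_ball h
  rw [ENNReal.inv_mul_le_iff (by simpa using this) ENNReal.ofReal_ne_top]

lemma mono {f g : ℝ → ℝ≥0∞} (h : ∀ x, f x ≤ g x) (x : ℝ) : maxFn f x ≤ maxFn g x :=
  le_iff.2 fun _ _ hx => (lintegral_mono h).trans (lintegral_le hx subset_rfl)

lemma mono_ae {f g : ℝ → ℝ≥0∞} (h : f ≤ᵐ[volume] g) (x : ℝ) : maxFn f x ≤ maxFn g x :=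
  le_iff.2 fun _ _ hx => (lintegral_mono_ae (ae_restrict_of_ae h)).trans (lintegral_le hx subset_rfl)

lemma isOpen_lt (f : ℝ → ℝ≥0∞) (t : ℝ≥0∞) : IsOpen {x | t < maxFn f x} := by
  have : {x | t < maxFn f x} = ⋃ (c : ℝ) (r : ℝ)
      (_ : t < (ENNReal.ofReal (2 * r))⁻¹ * ∫⁻ y in Metric.ball c r, f y), Metric.ball c r := by
    ext x; simp only [maxFn, mem_ofPred_eq, lt_iSup_iff, mem_iUnion]
    exact ⟨fun ⟨c, r, h, h'⟩ => ⟨c, r, h', h⟩, fun ⟨c, r, h, h'⟩ => ⟨c, r, h', h⟩⟩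
  rw [this]
  exact isOpen_iUnion fun _ => isOpen_iUnion fun _ => isOpen_iUnion fun _ => Metric.isOpen_ball

lemma measurable (f : ℝ → ℝ≥0∞) : Measurable (maxFn f) :=
  measurable_of_Ioi fun t => (isOpen_lt f t).measurableSet

lemma add_le {f : ℝ → ℝ≥0∞} (hf : Measurable f) (g : ℝ → ℝ≥0∞) (x : ℝ) :
    maxFn (fun y => f y + g y) x ≤ maxFn f x + maxFn g x :=
  le_iff.2 fun _ _ hx => by
    rw [lintegral_add_left hf, mul_add]
    exact add_le_add (lintegral_le hx subset_rfl) (lintegral_le hx subset_rfl)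

lemma const_mul_le {f : ℝ → ℝ≥0∞} {a : ℝ≥0∞} (ha : a ≠ ∞) (x : ℝ) :
    maxFn (fun y => a * f y) x ≤ a * maxFn f x :=
  le_iff.2 fun _ _ hx => by
    rw [lintegral_const_mul' _ _ ha, mul_left_comm]
    exact mul_le_mul_right (lintegral_le hx subset_rfl) _

lemma iSup_le {f : ℕ → ℝ → ℝ≥0∞} (hf : ∀ n, Measurable (f n)) (hm : Monotone f) (x : ℝ) :
    maxFn (fun y => ⨆ n, f n y) x ≤ ⨆ n, maxFn (f n) x :=
  le_iff.2 fun _ _ hx => by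
    rw [lintegral_iSup hf hm, ENNReal.mul_iSup]
    exact iSup_mono fun n => lintegral_le hx subset_rfl

lemma le_const {f : ℝ → ℝ≥0∞} {a : ℝ≥0∞} (h : ∀ x, f x ≤ a) (x : ℝ) : maxFn f x ≤ a :=
  le_iff.2 fun c r _ => by
    refine (lintegral_mono h).trans ?_
    rw [setLIntegral_const, Real.volume_ball, mul_comm]

/-- The weak-type `(1,1)` inequality. -/
theorem weak_one (f : ℝ → ℝ≥0∞) (t : ℝ≥0∞) :
    t * volume {x | t < maxFn f x} ≤ 5 * ∫⁻ x, f x := by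
  rcases eq_or_ne t 0 with rfl | ht; · simp
  rcases eq_or_ne (∫⁻ x, f x) ∞ with hi | hi; · simp [hi]
  rcases eq_or_ne t ∞ with rfl | htT; · simp
  set S : Set (ℝ × ℝ) := {q | 0 < q.2 ∧ t < (ENNReal.ofReal (2 * q.2))⁻¹ *
    ∫⁻ y in Metric.ball q.1 q.2, f y} with hS
  have hS' : ∀ q ∈ S, t * ENNReal.ofReal (2 * q.2) ≤ ∫⁻ y in Metric.ball q.1 q.2, f y := by
    rintro q ⟨hq, h⟩
    have := ENNReal.mul_lt_of_lt_div (a := t) (b := ∫⁻ y in Metric.ball q.1 q.2, f y)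
      (c := ENNReal.ofReal (2 * q.2)) (by rwa [ENNReal.div_eq_inv_mul])
    exact this.le
  have hR : ∀ q ∈ S, q.2 ≤ ((∫⁻ x, f x) / t).toReal := by
    intro q hq
    have h1 : ENNReal.ofReal (2 * q.2) ≤ (∫⁻ x, f x) / t := by
      rw [ENNReal.le_div_iff_mul_le (Or.inl ht) (Or.inl htT), mul_comm]
      exact (hS' q hq).trans (setLIntegral_le_lintegral _ _)
    have h2 := (ENNReal.ofReal_le_iff_le_toReal (by finiteness)).1 h1
    linarith [hq.1]
  obtain ⟨u, huS, hdis, hcov⟩ := Vitali.exists_disjoint_subfamily_covering_enlargement_closedBall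
    S Prod.fst Prod.snd _ hR 5 (by norm_num)
  have hd2 : u.PairwiseDisjoint fun q => Metric.ball q.1 q.2 := fun a ha b hb hab =>
    (hdis ha hb hab).mono Metric.ball_subset_closedBall Metric.ball_subset_closedBall
  have huc : u.Countable := hd2.countable_of_isOpen (fun _ _ => Metric.isOpen_ball)
    fun q hq => Metric.nonempty_ball.2 (huS hq).1
  have hsub : {x | t < maxFn f x} ⊆ ⋃ q ∈ u, Metric.closedBall q.1 (5 * q.2) := by
    intro x hx
    simp only [maxFn, mem_ofPred_eq, lt_iSup_iff] at hx
    obtain ⟨c, r, hxc, h⟩ := hx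
    obtain ⟨q, hq, hsub⟩ := hcov (c, r) ⟨Metric.pos_of_mem_ball hxc, h⟩
    exact mem_biUnion hq (hsub (Metric.ball_subset_closedBall hxc))
  calc t * volume {x | t < maxFn f x}
      ≤ t * ∑' q : u, volume (Metric.closedBall q.1.1 (5 * q.1.2)) := by
        gcongr; exact (measure_mono hsub).trans (measure_biUnion_le _ huc _)
    _ = 5 * ∑' q : u, t * ENNReal.ofReal (2 * q.1.2) := by
        rw [← ENNReal.tsum_mul_left, ← ENNReal.tsum_mul_left]
        refine tsum_congr fun q => ?_
        rw [Real.volume_closedBall, show 2 * (5 * q.1.2) = 5 * (2 * q.1.2) by ring,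
          ENNReal.ofReal_mul (by norm_num)]
        simp; ring
    _ ≤ 5 * ∑' q : u, ∫⁻ y in Metric.ball q.1.1 q.1.2, f y := by
        gcongr with q; exact hS' q (huS q.2)
    _ ≤ 5 * ∫⁻ x, f x := by
        gcongr
        rw [← lintegral_biUnion huc (fun _ _ => Metric.isOpen_ball.measurableSet) hd2]
        exact setLIntegral_le_lintegral _ _

lemma weak_restricted {q : ℝ} (hq1 : 1 ≤ q) {F : Set ℝ} (hF : MeasurableSet F) {f : ℝ → ℝ}
    (hfF : ∀ x, ‖f x‖ ≤ F.indicator 1 x) {t : ℝ≥0∞} (ht0 : t ≠ 0) (htT : t ≠ ∞) :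
    volume {x | t < maxFn (fun y => ‖f y‖ₑ) x} ≤ 5 * t ^ (-q) * volume F := by
  have hb : ∀ y, ‖f y‖ₑ ≤ F.indicator 1 y := fun y => by
    by_cases hy : y ∈ F
    · have := hfF y
      rw [indicator_of_mem hy, Pi.one_apply] at this ⊢
      rw [← ofReal_norm]; simpa using ENNReal.ofReal_le_ofReal this
    · have := hfF y
      rw [indicator_of_notMem hy] at this ⊢
      simpa using this
  rcases le_or_gt 1 t with h1 | h1
  · have : {x | t < maxFn (fun y => ‖f y‖ₑ) x} = ∅ := by
      refine eq_empty_of_forall_notMem fun x hx => ?_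
      refine absurd (lt_of_lt_of_le hx ((le_const fun y => (hb y).trans ?_) x)) (not_lt.2 h1)
      exact indicator_le' (fun _ _ => le_rfl) (fun _ _ => zero_le) y
    rw [this]; simp
  · have h2 := (weak_one (fun y => ‖f y‖ₑ) t).trans
      (mul_le_mul_right (lintegral_mono hb) _)
    rw [lintegral_indicator_one hF] at h2
    calc volume {x | t < maxFn (fun y => ‖f y‖ₑ) x}
        = t⁻¹ * (t * volume {x | t < maxFn (fun y => ‖f y‖ₑ) x}) := by
          rw [← mul_assoc, ENNReal.inv_mul_cancel ht0 htT, one_mul]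
      _ ≤ t ^ (-q) * (5 * volume F) := by
          gcongr
          rw [← ENNReal.rpow_neg_one]
          exact ENNReal.rpow_le_rpow_of_exponent_ge h1.le (by linarith)
      _ = _ := by ring

/-- Nonnegative measurable functions are increasing limits of tame ones. -/
lemma exists_tame_approx {f : ℝ → ℝ≥0∞} (hf : Measurable f) : ∃ g : ℕ → ℝ → ℝ≥0∞,
    (∀ n, Measurable (g n)) ∧ Monotone g ∧ (∀ x, ⨆ n, g n x = f x) ∧
    (∀ n, IsTame fun x => (g n x).toReal) ∧ (∀ n x, ‖(g n x).toReal‖ₑ = g n x) := by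
  set g : ℕ → ℝ → ℝ≥0∞ := fun n => (Icc (-(n:ℝ)) n).indicator fun x => min (f x) n with hg
  have hgm : ∀ n, Measurable (g n) := fun n => (hf.min measurable_const).indicator measurableSet_Icc
  have hgmono : Monotone g := by
    intro n m hnm x
    have : (n:ℝ) ≤ m := by exact_mod_cast hnm
    refine (indicator_le_indicator_of_subset (Icc_subset_Icc (neg_le_neg this) this)
      (fun _ => zero_le) x).trans (indicator_le_indicator ?_)
    exact min_le_min le_rfl (by exact_mod_cast hnm)
  have hgsup : ∀ x, ⨆ n, g n x = f x := by
    intro x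
    refine le_antisymm (_root_.iSup_le fun n => (indicator_le_self _ _ x).trans (min_le_left _ _)) ?_
    refine le_of_forall_lt fun c hc => ?_
    obtain ⟨n, hn⟩ := ENNReal.exists_nat_gt (ne_top_of_lt hc)
    obtain ⟨m, hm⟩ := exists_nat_ge |x|
    rw [lt_iSup_iff]
    refine ⟨max n m, ?_⟩
    have hx : x ∈ Icc (-((max n m : ℕ):ℝ)) ((max n m : ℕ):ℝ) := by
      rw [mem_Icc, ← abs_le]; exact hm.trans (by exact_mod_cast le_max_right n m)
    simp only [hg]
    rw [indicator_of_mem hx, lt_min_iff]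
    exact ⟨hc, hn.trans_le (by exact_mod_cast le_max_left n m)⟩
  have hgt : ∀ n, IsTame fun x => (g n x).toReal := fun n => by
    refine IsTame.of_bound (hgm n).ennreal_toReal.stronglyMeasurable (s := Icc (-(n:ℝ)) n)
      (by simp) (C := n) (fun x => ?_) fun x hx => by simp only [hg]; rw [indicator_of_notMem hx]; rfl
    rw [Real.norm_of_nonneg ENNReal.toReal_nonneg]
    refine ENNReal.toReal_le_of_le_ofReal n.cast_nonneg ?_
    rw [ENNReal.ofReal_natCast]
    exact (indicator_le_self _ _ x).trans (min_le_right _ _)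
  have hgn : ∀ n x, ‖(g n x).toReal‖ₑ = g n x := fun n x => by
    rw [Real.enorm_of_nonneg ENNReal.toReal_nonneg, ENNReal.ofReal_toReal]
    exact ne_top_of_le_ne_top (ENNReal.natCast_ne_top n)
      ((indicator_le_self _ _ x).trans (min_le_right _ _))
  exact ⟨g, hgm, hgmono, hgsup, hgt, hgn⟩

/-- Strong-type bounds for the maximal function. -/
theorem strong {p : ℝ} (hp : 1 < p) : ∃ C : ℝ≥0∞, C ≠ ∞ ∧ ∀ f : ℝ → ℝ≥0∞, Measurable f →
    ∫⁻ x, maxFn f x ^ p ≤ C * ∫⁻ x, f x ^ p := by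
  obtain ⟨C, hC, H⟩ := restricted_weak_interpolation (p0 := 1) (p := p) (p1 := p + 1) one_pos hp
    (by linarith) (A := 5) (by simp)
  refine ⟨C, hC, ?_⟩
  have key := H ℝ (fun f => maxFn fun y => ‖f y‖ₑ) (fun f _ => (measurable _).aemeasurable)
    (fun f g hf hg x => by
      refine le_trans ?_ (add_le (f := fun y => ‖f y‖ₑ) hf.meas.enorm (fun y => ‖g y‖ₑ) x)
      exact mono (fun y => enorm_add_le (f y) (g y)) x)
    (fun f hf a ha x => by
      have : (fun y => ‖(a • f) y‖ₑ) = fun y => ENNReal.ofReal a * ‖f y‖ₑ := by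
        ext y; simp [enorm_mul, Real.enorm_of_nonneg ha.le]
      simp only [this]
      exact const_mul_le ENNReal.ofReal_ne_top x)
    (fun q hq F hF f _ hfF t ht0 htT => weak_restricted (by rcases hq with rfl | rfl <;> linarith)
      hF hfF ht0 htT)
  intro f hf
  obtain ⟨g, hgm, hgmono, hgsup, hgt, hgn⟩ := exists_tame_approx hf
  have hp0 : (0:ℝ) < p := by linarith
  calc ∫⁻ x, maxFn f x ^ p ≤ ∫⁻ x, ⨆ n, maxFn (g n) x ^ p := by
        refine lintegral_mono fun x => ?_
        have h1 : maxFn f x ≤ ⨆ n, maxFn (g n) x := by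
          have := iSup_le hgm hgmono x
          simp only [hgsup] at this; exact this
        refine (ENNReal.rpow_le_rpow h1 hp0.le).trans_eq ?_
        exact (ENNReal.orderIsoRpow p hp0).map_iSup fun n => maxFn (g n) x
    _ = ⨆ n, ∫⁻ x, maxFn (g n) x ^ p :=
        lintegral_iSup (fun n => (measurable _).pow_const _)
          fun n m h x => ENNReal.rpow_le_rpow (mono (hgmono h) x) hp0.le
    _ ≤ C * ∫⁻ x, f x ^ p := by
        refine _root_.iSup_le fun n => ?_
        have := key _ (hgt n)
        simp only [hgn] at this
        refine this.trans ?_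
        gcongr with x
        rw [← hgsup x]; exact le_iSup (fun n => g n x) n

/-- Averages against integrable bump weights are controlled by the maximal function. -/
theorem weight_le (f : ℝ → ℝ≥0∞) (hf : Measurable f) {r x x' : ℝ} (hr : 0 < r) (h : |x - x'| ≤ r) :
    ∫⁻ y, ENNReal.ofReal (r⁻¹ * ((1 + |x - y| / r) ^ 2)⁻¹) * f y ≤ 32 * maxFn f x' := by
  have hpt : ∀ y, ENNReal.ofReal (r⁻¹ * ((1 + |x - y| / r) ^ 2)⁻¹) * f y ≤
      ∑' n : ℕ, ENNReal.ofReal (r⁻¹ * (4 * (4 ^ n)⁻¹)) * (Metric.ball x (2 ^ n * r)).indicator f y := by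
    intro y
    set u := |x - y| / r with hu
    have hu0 : 0 ≤ u := by positivity
    obtain ⟨n, hn1, hn2⟩ : ∃ n : ℕ, u < 2 ^ n ∧ 2 ^ n ≤ 2 * (1 + u) := by
      rcases lt_or_ge u 1 with h1 | h1
      · exact ⟨0, by simpa using h1, by simp; linarith⟩
      · obtain ⟨n, hn, hn'⟩ := exists_nat_pow_near h1 (by norm_num : (1:ℝ) < 2)
        exact ⟨n + 1, hn', by rw [pow_succ]; linarith⟩
    have hy : y ∈ Metric.ball x (2 ^ n * r) := by
      rw [Metric.mem_ball, dist_comm, Real.dist_eq]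
      rwa [hu, div_lt_iff₀ hr] at hn1
    refine le_trans ?_ (ENNReal.le_tsum n)
    rw [indicator_of_mem hy]
    gcongr
    have h4 : (4:ℝ) ^ n ≤ 4 * (1 + u) ^ 2 := by
      calc (4:ℝ) ^ n = (2 ^ n) ^ 2 := by rw [← pow_mul, mul_comm, pow_mul]; norm_num
        _ ≤ (2 * (1 + u)) ^ 2 := by gcongr
        _ = _ := by ring
    rw [inv_le_iff_one_le_mul₀ (by positivity)]
    calc (1:ℝ) = (4 ^ n)⁻¹ * 4 ^ n := by field_simp
      _ ≤ (4 ^ n)⁻¹ * (4 * (1 + u) ^ 2) := by gcongr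
      _ = _ := by ring
  calc _ ≤ ∫⁻ y, ∑' n : ℕ, ENNReal.ofReal (r⁻¹ * (4 * (4 ^ n)⁻¹)) *
          (Metric.ball x (2 ^ n * r)).indicator f y := lintegral_mono hpt
    _ = ∑' n : ℕ, ENNReal.ofReal (r⁻¹ * (4 * (4 ^ n)⁻¹)) * ∫⁻ y in Metric.ball x (2 ^ n * r), f y := by
        rw [lintegral_tsum fun n =>
          ((hf.indicator measurableSet_ball).const_mul _).aemeasurable]
        refine tsum_congr fun n => ?_
        rw [lintegral_const_mul' _ _ ENNReal.ofReal_ne_top, lintegral_indicator measurableSet_ball]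
    _ ≤ ∑' n : ℕ, ENNReal.ofReal (16 * (2⁻¹) ^ n) * maxFn f x' := by
        refine ENNReal.tsum_le_tsum fun n => ?_
        have h1 : (1:ℝ) ≤ 2 ^ n := one_le_pow₀ (by norm_num)
        have hsub : Metric.ball x (2 ^ n * r) ⊆ Metric.ball x' (2 * (2 ^ n * r)) :=
          Metric.ball_subset_ball' (by rw [Real.dist_eq]; nlinarith)
        refine (mul_le_mul_right (lintegral_le (Metric.mem_ball_self (by positivity)) hsub) _).trans ?_
        rw [← mul_assoc, ← ENNReal.ofReal_mul (by positivity)]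
        refine mul_le_mul_left (ENNReal.ofReal_le_ofReal ?_) _
        rw [show (4:ℝ) ^ n = 2 ^ n * 2 ^ n by rw [← mul_pow]; norm_num, inv_pow]
        refine le_of_eq ?_; field_simp; norm_num
    _ = 32 * maxFn f x' := by
        rw [ENNReal.tsum_mul_right, ← ENNReal.ofReal_tsum_of_nonneg (fun n => by positivity)
          ((summable_geometric_of_lt_one (by norm_num) (by norm_num)).mul_left _), tsum_mul_left,
          tsum_geometric_of_lt_one (by norm_num) (by norm_num)]
        norm_num

end maxFn

/-- The dyadic interval `[m 2^k, (m+1) 2^k)`. -/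
def dy (k m : ℤ) : Set ℝ := Ico (m * (2:ℝ) ^ k) ((m + 1) * (2:ℝ) ^ k)

lemma two_zpow_pos (k : ℤ) : (0:ℝ) < 2 ^ k := by positivity

lemma mem_dy {k m : ℤ} {x : ℝ} : x ∈ dy k m ↔ ⌊x / 2 ^ k⌋ = m := by
  rw [Int.floor_eq_iff, le_div_iff₀ (two_zpow_pos k), div_lt_iff₀ (two_zpow_pos k)]; rfl

lemma mem_dy' {k m : ℤ} {x : ℝ} : x ∈ dy k m ↔ m * (2:ℝ) ^ k ≤ x ∧ x < (m + 1) * (2:ℝ) ^ k := Iff.rfl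

lemma mem_dy_floor (k : ℤ) (x : ℝ) : x ∈ dy k ⌊x / 2 ^ k⌋ := mem_dy.2 rfl

lemma left_mem_dy (k m : ℤ) : (m * (2:ℝ) ^ k) ∈ dy k m :=
  ⟨le_rfl, by have := two_zpow_pos k; nlinarith⟩

lemma dy_nonempty (k m : ℤ) : (dy k m).Nonempty := ⟨_, left_mem_dy k m⟩

lemma measurableSet_dy (k m : ℤ) : MeasurableSet (dy k m) := measurableSet_Ico

lemma volume_dy (k m : ℤ) : volume (dy k m) = ENNReal.ofReal (2 ^ k) := by
  rw [dy, Real.volume_Ico]; ring_nf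

lemma volume_dy_ne_top (k m : ℤ) : volume (dy k m) ≠ ∞ := by rw [volume_dy]; exact ENNReal.ofReal_ne_top

lemma volume_dy_ne_zero (k m : ℤ) : volume (dy k m) ≠ 0 := by
  rw [volume_dy]; simpa using two_zpow_pos k

lemma dy_disjoint {k m m' : ℤ} (h : m ≠ m') : Disjoint (dy k m) (dy k m') :=
  Set.disjoint_left.2 fun _ h1 h2 => h ((mem_dy.1 h1).symm.trans (mem_dy.1 h2))

lemma dy_eq_of_mem {k m m' : ℤ} {x : ℝ} (h : x ∈ dy k m) (h' : x ∈ dy k m') : m = m' :=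
  (mem_dy.1 h).symm.trans (mem_dy.1 h')

lemma dy_subset_of_le {k k' m m' : ℤ} (hk : k ≤ k') {x : ℝ} (h : x ∈ dy k m) (h' : x ∈ dy k' m') :
    dy k m ⊆ dy k' m' := by
  obtain ⟨n, rfl⟩ : ∃ n : ℕ, k' = k + n := ⟨(k' - k).toNat, by omega⟩
  have e : ∀ y : ℝ, ⌊y / 2 ^ (k + n : ℤ)⌋ = ⌊y / 2 ^ k⌋ / (2 ^ n : ℕ) := fun y => by
    rw [← Int.floor_div_natCast]
    push_cast
    rw [zpow_add₀ (by norm_num), zpow_natCast, div_div]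
  intro y hy
  rw [mem_dy] at *
  rw [← h', e, e, hy, h]

lemma le_of_dy_subset {k k' m m' : ℤ} (h : dy k m ⊆ dy k' m') : k ≤ k' := by
  have := measure_mono (μ := volume) h
  rw [volume_dy, volume_dy, ENNReal.ofReal_le_ofReal_iff (by positivity)] at this
  exact (zpow_le_zpow_iff_right₀ (by norm_num)).1 this

lemma dy_inj {k k' m m' : ℤ} (h : dy k m = dy k' m') : k = k' ∧ m = m' := by
  have h1 : k = k' := le_antisymm (le_of_dy_subset h.subset) (le_of_dy_subset h.symm.subset)
  subst h1
  exact ⟨rfl, dy_eq_of_mem (left_mem_dy k m) (h ▸ left_mem_dy k m)⟩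

lemma exists_dy_superset {k k' : ℤ} (h : k ≤ k') (m : ℤ) : ∃ m', dy k m ⊆ dy k' m' :=
  ⟨_, dy_subset_of_le h (left_mem_dy k m) (mem_dy_floor k' _)⟩

lemma dy_subset_or_disjoint {k k' m m' : ℤ} (hk : k ≤ k') :
    dy k m ⊆ dy k' m' ∨ Disjoint (dy k m) (dy k' m') := by
  by_cases h : Disjoint (dy k m) (dy k' m')
  · exact Or.inr h
  · obtain ⟨x, h1, h2⟩ := Set.not_disjoint_iff.1 h
    exact Or.inl (dy_subset_of_le hk h1 h2)

lemma iUnion_dy (k : ℤ) : ⋃ m, dy k m = univ :=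
  eq_univ_of_forall fun x => mem_iUnion.2 ⟨_, mem_dy_floor k x⟩

lemma lintegral_eq_tsum_dy (k : ℤ) (f : ℝ → ℝ≥0∞) : ∫⁻ x, f x = ∑' m, ∫⁻ x in dy k m, f x := by
  rw [← lintegral_iUnion (fun m => measurableSet_dy k m) (fun _ _ h => dy_disjoint h), iUnion_dy,
    setLIntegral_univ]

lemma dy_zero (m : ℤ) : dy 0 m = Ico (m:ℝ) (m + 1) := by simp [dy]

lemma dy_left_child (k m : ℤ) : dy (k - 1) (2 * m) ⊆ dy k m := by
  have h := two_zpow_pos k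
  have e : (2:ℝ) ^ (k - 1) = 2 ^ k / 2 := by rw [zpow_sub₀ (by norm_num)]; simp
  refine dy_subset_of_le (by omega) (left_mem_dy _ _) ⟨?_, ?_⟩ <;> rw [e] <;> push_cast <;> nlinarith

lemma dy_right_child (k m : ℤ) : dy (k - 1) (2 * m + 1) ⊆ dy k m := by
  have h := two_zpow_pos k
  have e : (2:ℝ) ^ (k - 1) = 2 ^ k / 2 := by rw [zpow_sub₀ (by norm_num)]; simp
  refine dy_subset_of_le (by omega) (left_mem_dy _ _) ⟨?_, ?_⟩ <;> rw [e] <;> push_cast <;> nlinarith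

/-- The maximal elements of a collection of dyadic intervals. -/
def dyMax (D : Set (ℤ × ℤ)) : Set (ℤ × ℤ) :=
  {q ∈ D | ∀ q' ∈ D, dy q.1 q.2 ⊆ dy q'.1 q'.2 → q' = q}

lemma exists_dyMax {D : Set (ℤ × ℤ)} {K : ℤ} (hK : ∀ q ∈ D, q.1 ≤ K) {q : ℤ × ℤ} (hq : q ∈ D) :
    ∃ q' ∈ dyMax D, dy q.1 q.2 ⊆ dy q'.1 q'.2 := by
  obtain ⟨k, ⟨m, hm, hsub⟩, hmax⟩ := Int.exists_greatest_of_bdd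
    (P := fun k => ∃ m, (k, m) ∈ D ∧ dy q.1 q.2 ⊆ dy k m)
    ⟨K, fun k ⟨m, hm, _⟩ => hK _ hm⟩ ⟨q.1, q.2, hq, subset_rfl⟩
  refine ⟨(k, m), ⟨hm, fun q' hq' h => ?_⟩, hsub⟩
  have h1 := hmax q'.1 ⟨q'.2, hq', hsub.trans h⟩
  have h2 := le_of_dy_subset h
  have h3 : q'.1 = k := le_antisymm h1 h2
  have h4 := dy_inj (h.antisymm (dy_subset_of_le h3.le (h (left_mem_dy k m)) (left_mem_dy k m)))
  exact Prod.ext h4.1.symm h4.2.symm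

lemma dyMax_pairwiseDisjoint (D : Set (ℤ × ℤ)) :
    (dyMax D).PairwiseDisjoint fun q => dy q.1 q.2 := by
  intro a ha b hb hab
  rcases le_total a.1 b.1 with h | h
  · exact (dy_subset_or_disjoint h).resolve_left fun h' => hab (ha.2 b hb.1 h').symm
  · exact ((dy_subset_or_disjoint h).resolve_left fun h' => hab (hb.2 a ha.1 h')).symm

lemma continuous_fourier_of_integrable {E : Type*} [NormedAddCommGroup E] [NormedSpace ℂ E]
    {f : ℝ → E} (hf : Integrable f) : Continuous (𝓕 f) :=
  VectorFourier.fourierIntegral_continuous Real.continuous_fourierChar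
    (by exact continuous_inner) hf

lemma fourier_toLp_ae {E : Type*} [NormedAddCommGroup E] [InnerProductSpace ℂ E] [CompleteSpace E]
    {f : ℝ → E} (h1 : Integrable f) (h2 : MemLp f 2 volume) :
    (𝓕 (h2.toLp f) : Lp E 2 (volume : Measure ℝ)) =ᵐ[volume] 𝓕 f := by
  refine ae_eq_of_integral_contDiff_smul_eq ?_ ?_ fun g hg hc => ?_
  · exact (Lp.memLp _).locallyIntegrable (by norm_num)
  · exact (continuous_fourier_of_integrable h1).locallyIntegrable
  · set G : ℝ → ℂ := fun x => (g x : ℂ)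
    have hGc : HasCompactSupport G := hc.comp_left (g := fun t : ℝ => (t : ℂ)) (by simp)
    have hGd : ContDiff ℝ (⊤ : ℕ∞) G := Complex.ofRealCLM.contDiff.comp hg
    set φ : 𝓢(ℝ, ℂ) := hGc.toSchwartzMap hGd
    have key := congrArg (fun T => T φ) (Lp.fourier_toTemperedDistribution_eq (h2.toLp f))
    simp only [Lp.toTemperedDistribution_apply, TemperedDistribution.fourier_apply] at key
    have e1 : ∀ x, φ x = (g x : ℂ) := fun x => rfl
    have e3 : ∫ x, g x • (𝓕 (h2.toLp f) : Lp E 2 (volume : Measure ℝ)) x =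
        ∫ x, φ x • (𝓕 (h2.toLp f) : Lp E 2 (volume : Measure ℝ)) x :=
      integral_congr_ae (Filter.Eventually.of_forall fun x => by simp [e1])
    rw [e3, ← key]
    have e2 : ∫ x, (𝓕 φ : 𝓢(ℝ, ℂ)) x • (h2.toLp f) x = ∫ x, (𝓕 φ : 𝓢(ℝ, ℂ)) x • f x := by
      refine integral_congr_ae ?_
      filter_upwards [h2.coeFn_toLp] with x hx
      rw [hx]
    rw [e2]
    have := VectorFourier.integral_fourierIntegral_smul_eq_flip (L := innerₗ ℝ)
      (e := Real.fourierChar) (μ := volume) (ν := volume) (f := φ) (g := f)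
      Real.continuous_fourierChar (by exact continuous_inner) φ.integrable h1
    have f1 : ∀ x, (𝓕 φ : 𝓢(ℝ, ℂ)) x = VectorFourier.fourierIntegral Real.fourierChar volume (innerₗ ℝ) φ x := by
      intro x
      rw [SchwartzMap.fourier_coe]; rfl
    simp only [f1]
    rw [this]
    refine integral_congr_ae (Filter.Eventually.of_forall fun x => ?_)
    have : VectorFourier.fourierIntegral Real.fourierChar volume (innerₗ ℝ).flip f x = 𝓕 f x := by
      rw [flip_innerₗ]; rfl
    change φ x • _ = g x • 𝓕 f x
    rw [this, e1]; rfl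

/-- Plancherel's theorem for integrable and square integrable vector-valued functions. -/
lemma lintegral_fourier_sq {E : Type*} [NormedAddCommGroup E] [InnerProductSpace ℂ E]
    [CompleteSpace E] {f : ℝ → E} (h1 : Integrable f) (h2 : MemLp f 2 volume) :
    ∫⁻ ξ, ‖𝓕 f ξ‖ₑ ^ 2 = ∫⁻ x, ‖f x‖ₑ ^ 2 := by
  have h := Lp.norm_fourier_eq (h2.toLp f)
  have h' : eLpNorm (𝓕 f) 2 volume = eLpNorm f 2 volume := by
    have e := eLpNorm_congr_ae (p := 2) (fourier_toLp_ae h1 h2)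
    have e' := eLpNorm_congr_ae (p := 2) h2.coeFn_toLp
    rw [← e, ← e', ← Lp.enorm_def, ← Lp.enorm_def, ← ofReal_norm, ← ofReal_norm, h]
  have e := fun g : ℝ → E => eLpNorm_nnreal_pow_eq_lintegral (f := g) (μ := volume) (p := 2) (by norm_num)
  have a := e f
  have b := e (𝓕 f)
  simp only [NNReal.coe_ofNat, ENNReal.rpow_ofNat, ENNReal.coe_ofNat] at a b
  rw [← a, ← b, h']

lemma exists_sum_min_zpow_le : ∃ C : ℝ, 0 ≤ C ∧ ∀ (S : Finset ℤ) (a : ℝ), 0 ≤ a →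
    ∑ k ∈ S, min ((2 : ℝ) ^ k * a) ((2 : ℝ) ^ k * a)⁻¹ ≤ C := by
  have hsum : Summable fun k : ℤ => ((1 / 2 : ℝ)) ^ k.natAbs :=
    Summable.of_nat_of_neg (by simpa using summable_geometric_two)
      (by simpa using summable_geometric_two)
  refine ⟨2 * ∑' k : ℤ, ((1 / 2 : ℝ)) ^ k.natAbs, by positivity, fun S a ha => ?_⟩
  rcases ha.eq_or_lt with rfl | ha
  · simp; positivity
  obtain ⟨n, hn, hn'⟩ := exists_mem_Ico_zpow (y := (2 : ℝ)) ha (by norm_num)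
  have key : ∀ k : ℤ, min ((2 : ℝ) ^ k * a) ((2 : ℝ) ^ k * a)⁻¹ ≤
      2 * (1 / 2 : ℝ) ^ (k + n).natAbs := by
    intro k
    have hk : (0 : ℝ) < 2 ^ k := by positivity
    rcases le_total 0 (k + n) with h | h
    · refine (min_le_right _ _).trans ?_
      have e : (1 / 2 : ℝ) ^ (k + n).natAbs = ((2 : ℝ) ^ (k + n))⁻¹ := by
        rw [one_div, inv_pow, ← zpow_natCast, Int.natAbs_of_nonneg h]
      rw [e]
      have : ((2 : ℝ) ^ k * a)⁻¹ ≤ ((2 : ℝ) ^ (k + n))⁻¹ := by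
        rw [zpow_add₀ (by norm_num)]
        gcongr
      have h3 : (0 : ℝ) ≤ ((2 : ℝ) ^ (k + n))⁻¹ := by positivity
      linarith
    · refine (min_le_left _ _).trans ?_
      have e : (1 / 2 : ℝ) ^ (k + n).natAbs = (2 : ℝ) ^ (k + n) := by
        rw [one_div, inv_pow, ← zpow_natCast, Int.ofNat_natAbs_of_nonpos h, zpow_neg, inv_inv]
      rw [e, zpow_add₀ (by norm_num)]
      rw [zpow_add_one₀ (by norm_num)] at hn'
      nlinarith
  calc _ ≤ ∑ k ∈ S, 2 * (1 / 2 : ℝ) ^ (k + n).natAbs := Finset.sum_le_sum fun k _ => key k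
    _ = 2 * ∑ k ∈ S, (1 / 2 : ℝ) ^ (k + n).natAbs := by rw [Finset.mul_sum]
    _ = 2 * ∑ k ∈ S.map (addRightEmbedding n), (1 / 2 : ℝ) ^ k.natAbs := by simp
    _ ≤ _ := by
      gcongr
      exact hsum.sum_le_tsum _ fun _ _ => by positivity

/-- Smooth kernels with quadratic decay whose Fourier transform is small near `0` and `∞`. -/
structure IsLPKernel (K : ℝ → ℂ) (B : ℝ) : Prop where
  diff : Differentiable ℝ K
  bound : ∀ x, ‖K x‖ ≤ B * ((1 + |x|) ^ 2)⁻¹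
  deriv_bound : ∀ x, ‖deriv K x‖ ≤ B * ((1 + |x|) ^ 3)⁻¹
  fourier_bound : ∀ ξ, ‖𝓕 K ξ‖ ≤ B * min |ξ| |ξ|⁻¹

section
variable {E F : Type*} [NormedAddCommGroup E] [InnerProductSpace ℂ E]
  [NormedAddCommGroup F] [InnerProductSpace ℂ F]

/-- Superposition of dyadic dilates of `K` with operator coefficients. -/
noncomputable def lpKernel (K : ℝ → ℂ) (S : Finset ℤ) (A : ℤ → E →L[ℂ] F) (x : ℝ) : E →L[ℂ] F :=
  ∑ k ∈ S, ((2 : ℂ) ^ k * K ((2 : ℝ) ^ k * x)) • A k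

/-- Convolution with an operator-valued kernel. -/
noncomputable def convOp (κ : ℝ → E →L[ℂ] F) (f : ℝ → E) (x : ℝ) : F := ∫ y, κ (x - y) (f y)

end

namespace IsLPKernel

variable {E F : Type*} [NormedAddCommGroup E] [InnerProductSpace ℂ E]
  [NormedAddCommGroup F] [InnerProductSpace ℂ F]

variable {K : ℝ → ℂ} {B : ℝ}

lemma nonneg (hK : IsLPKernel K B) : 0 ≤ B := by
  have := (norm_nonneg _).trans (hK.bound 0)
  simpa using this

lemma integrable (hK : IsLPKernel K B) : Integrable K := by
  refine (integrable_inv_one_add_sq.const_mul B).mono' hK.diff.continuous.aestronglyMeasurable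
    (Filter.Eventually.of_forall fun x => (hK.bound x).trans ?_)
  refine mul_le_mul_of_nonneg_left (inv_anti₀ (by positivity) ?_) hK.nonneg
  nlinarith [abs_nonneg x, sq_abs x]

lemma norm_le (hK : IsLPKernel K B) (x : ℝ) : ‖K x‖ ≤ B := by
  refine (hK.bound x).trans (mul_le_of_le_one_right hK.nonneg (inv_le_one_of_one_le₀ ?_))
  nlinarith [abs_nonneg x]

lemma integrable_dilate (hK : IsLPKernel K B) (k : ℤ) :
    Integrable fun x => (2 : ℂ) ^ k * K ((2 : ℝ) ^ k * x) :=
  (hK.integrable.comp_mul_left' (by positivity)).const_mul _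

lemma fourier_dilate (K : ℝ → ℂ) (k : ℤ) (ξ : ℝ) :
    𝓕 (fun x => (2 : ℂ) ^ k * K ((2 : ℝ) ^ k * x)) ξ = 𝓕 K ((2 : ℝ) ^ (-k) * ξ) := by
  have h2 : (0 : ℝ) < 2 ^ k := by positivity
  rw [Real.fourier_eq', Real.fourier_eq']
  have := Measure.integral_comp_mul_left (fun v : ℝ =>
    Complex.exp (((-2 * Real.pi * inner ℝ v ((2 : ℝ) ^ (-k) * ξ) : ℝ)) * Complex.I) • K v) ((2 : ℝ) ^ k)
  rw [abs_of_pos (inv_pos.2 h2)] at this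
  have h3 : ∀ I J : ℂ, I = ((2 : ℝ) ^ k)⁻¹ • J → J = (2 : ℂ) ^ k * I := by
    rintro I J rfl
    rw [Complex.real_smul]; push_cast
    rw [mul_inv_cancel_left₀ (zpow_ne_zero _ two_ne_zero)]
  rw [h3 _ _ this, ← integral_const_mul]
  congr 1; ext v
  have e : inner ℝ ((2 : ℝ) ^ k * v) ((2 : ℝ) ^ (-k) * ξ) = inner ℝ v ξ := by
    simp only [RCLike.inner_apply, conj_trivial, zpow_neg]
    field_simp
  simp only [smul_eq_mul]
  rw [e]; ring

variable (S : Finset ℤ) (A : ℤ → E →L[ℂ] F)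

lemma continuous_lpKernel (hK : IsLPKernel K B) : Continuous (lpKernel K S A) := by
  have := hK.diff.continuous
  exact continuous_finsetSum _ fun k _ => (continuous_const.mul
    (this.comp (continuous_const.mul continuous_id))).smul continuous_const

lemma integrable_lpKernel (hK : IsLPKernel K B) : Integrable (lpKernel K S A) := by
  refine integrable_finsetSum S (f := fun k x => ((2 : ℂ) ^ k * K ((2 : ℝ) ^ k * x)) • A k)
    fun k _ => ?_
  exact Integrable.smul_const (hK.integrable_dilate k) (A k)

lemma norm_lpKernel_le (hK : IsLPKernel K B) : ∃ C, ∀ x, ‖lpKernel K S A x‖ ≤ C := by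
  refine ⟨∑ k ∈ S, ‖(2 : ℂ) ^ k‖ * B * ‖A k‖, fun x => (norm_sum_le _ _).trans ?_⟩
  refine Finset.sum_le_sum fun k _ => ?_
  rw [norm_smul, norm_mul]
  gcongr
  exact hK.norm_le _

lemma fourier_smul_const {G : Type*} [NormedAddCommGroup G] [NormedSpace ℂ G] [CompleteSpace G]
    (g : ℝ → ℂ) (c : G) (ξ : ℝ) : 𝓕 (fun x => g x • c) ξ = 𝓕 g ξ • c := by
  rw [Real.fourier_eq', Real.fourier_eq', ← integral_smul_const (𝕜 := ℂ)]
  simp only [smul_assoc]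

lemma fourier_finsetSum {G ι : Type*} [NormedAddCommGroup G] [NormedSpace ℂ G]
    (S : Finset ι) {g : ι → ℝ → G} (hg : ∀ k ∈ S, Integrable (g k)) (ξ : ℝ) :
    𝓕 (fun x => ∑ k ∈ S, g k x) ξ = ∑ k ∈ S, 𝓕 (g k) ξ := by
  simp only [Real.fourier_eq, Finset.smul_sum]
  exact integral_finsetSum _ fun k hk => (Real.fourierIntegral_convergent_iff ξ).2 (hg k hk)

lemma fourier_lpKernel [CompleteSpace F] (hK : IsLPKernel K B) (ξ : ℝ) :
    𝓕 (lpKernel K S A) ξ = ∑ k ∈ S, 𝓕 K ((2 : ℝ) ^ (-k) * ξ) • A k := by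
  unfold lpKernel
  refine (fourier_finsetSum S (g := fun k x => ((2 : ℂ) ^ k * K ((2 : ℝ) ^ k * x)) • A k)
    (fun k _ => Integrable.smul_const (hK.integrable_dilate k) (A k)) ξ).trans ?_
  refine Finset.sum_congr rfl fun k _ => ?_
  refine (fourier_smul_const (fun x => (2 : ℂ) ^ k * K ((2 : ℝ) ^ k * x)) (A k) ξ).trans ?_
  rw [fourier_dilate]

end IsLPKernel

lemma lpKernel_fourier_le : ∃ C : ℝ, 0 ≤ C ∧ ∀ {E F : Type*} [NormedAddCommGroup E]
    [InnerProductSpace ℂ E] [NormedAddCommGroup F] [InnerProductSpace ℂ F]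
    [CompleteSpace F] {K : ℝ → ℂ} {B : ℝ} (S : Finset ℤ) (A : ℤ → E →L[ℂ] F), IsLPKernel K B → (∀ k, ‖A k‖ ≤ 1) → ∀ ξ,
    ‖𝓕 (lpKernel K S A) ξ‖ ≤ C * B := by
  obtain ⟨C, hC0, hC⟩ := exists_sum_min_zpow_le
  refine ⟨C, hC0, fun {E F} _ _ _ _ _ {K B} S A hK hA ξ => ?_⟩
  rw [hK.fourier_lpKernel]
  calc _ ≤ ∑ k ∈ S, B * min ((2 : ℝ) ^ k * |ξ|⁻¹) ((2 : ℝ) ^ k * |ξ|⁻¹)⁻¹ := by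
        refine (norm_sum_le _ _).trans (Finset.sum_le_sum fun k _ => ?_)
        rw [norm_smul]
        refine (mul_le_of_le_one_right (norm_nonneg _) (hA k)).trans ((hK.fourier_bound _).trans ?_)
        rw [min_comm, abs_mul, abs_of_pos (by positivity : (0 : ℝ) < 2 ^ (-k)), zpow_neg]
        simp only [mul_inv, inv_inv]
        exact le_rfl
    _ ≤ B * C := by
        rw [← Finset.mul_sum]
        exact mul_le_mul_of_nonneg_left (hC S _ (by positivity)) hK.nonneg
    _ = _ := mul_comm _ _

/-- Continuous bounded integrable operator-valued kernels. -/
structure IsConvKernel {E F : Type*} [NormedAddCommGroup E] [InnerProductSpace ℂ E]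
    [NormedAddCommGroup F] [InnerProductSpace ℂ F] (κ : ℝ → E →L[ℂ] F) : Prop where
  cont : Continuous κ
  int : Integrable κ
  bdd : ∃ C, ∀ x, ‖κ x‖ ≤ C

namespace IsConvKernel

variable {E F : Type*} [NormedAddCommGroup E] [InnerProductSpace ℂ E]
  [NormedAddCommGroup F] [InnerProductSpace ℂ F] {κ : ℝ → E →L[ℂ] F} {f g : ℝ → E}

lemma integrable_apply (hκ : IsConvKernel κ) (hf : IsTame f) (x : ℝ) :
    Integrable fun y => κ (x - y) (f y) := by
  obtain ⟨C, hC⟩ := hκ.bdd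
  refine (hf.integrable.norm.const_mul C).mono' ?_ (Filter.Eventually.of_forall fun y => ?_)
  · exact (ContinuousLinearMap.id ℂ (E →L[ℂ] F)).aestronglyMeasurable_comp₂
      (hκ.cont.comp (continuous_const.sub continuous_id)).aestronglyMeasurable
      hf.meas.aestronglyMeasurable
  · exact ((κ (x - y)).le_opNorm _).trans (by gcongr; exact hC _)

lemma convOp_add (hκ : IsConvKernel κ) (hf : IsTame f) (hg : IsTame g) (x : ℝ) :
    convOp κ (f + g) x = convOp κ f x + convOp κ g x := by
  simp only [convOp, Pi.add_apply, map_add]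
  exact integral_add (hκ.integrable_apply hf x) (hκ.integrable_apply hg x)

lemma convOp_smul (c : ℂ) (x : ℝ) : convOp κ (c • f) x = c • convOp κ f x := by
  simp only [convOp, Pi.smul_apply, map_smul]
  exact integral_smul c _

lemma convOp_eq_convolution (κ : ℝ → E →L[ℂ] F) (f : ℝ → E) :
    convOp κ f = convolution κ f (ContinuousLinearMap.id ℂ (E →L[ℂ] F)) volume := by
  ext x
  rw [convolution_eq_swap]; rfl

lemma integrable_convOp (hκ : IsConvKernel κ) (hf : IsTame f) : Integrable (convOp κ f) := by
  rw [convOp_eq_convolution]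
  exact hκ.int.integrable_convolution _ hf.integrable

lemma norm_convOp_le (hκ : IsConvKernel κ) (hf : IsTame f) : ∃ C, ∀ x, ‖convOp κ f x‖ ≤ C := by
  obtain ⟨C, hC⟩ := hκ.bdd
  refine ⟨∫ y, C * ‖f y‖, fun x => norm_integral_le_of_norm_le (hf.integrable.norm.const_mul C)
    (Filter.Eventually.of_forall fun y => ?_)⟩
  exact ((κ (x - y)).le_opNorm _).trans (by gcongr; exact hC _)

lemma continuous_convOp (hκ : IsConvKernel κ) (hf : IsTame f) : Continuous (convOp κ f) := by
  obtain ⟨C, hC⟩ := hκ.bdd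
  refine continuous_of_dominated (bound := fun y => C * ‖f y‖)
    (fun x => (hκ.integrable_apply hf x).aestronglyMeasurable)
    (fun x => Filter.Eventually.of_forall fun y => ?_) (hf.integrable.norm.const_mul C)
    (Filter.Eventually.of_forall fun y => ?_)
  · exact ((κ (x - y)).le_opNorm _).trans (by gcongr; exact hC _)
  · exact (hκ.cont.comp (continuous_id.sub continuous_const)).clm_apply continuous_const

lemma memLp_convOp (hκ : IsConvKernel κ) (hf : IsTame f) : MemLp (convOp κ f) 2 volume := by
  obtain ⟨C, hC⟩ := hκ.norm_convOp_le hf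
  have hm := (hκ.continuous_convOp hf).aestronglyMeasurable (μ := volume)
  refine (memLp_two_iff_integrable_sq_norm hm).2 (((hκ.integrable_convOp hf).norm.const_mul C).mono'
    (hm.norm.pow 2) (Filter.Eventually.of_forall fun x => ?_))
  rw [Real.norm_of_nonneg (by positivity), sq]
  exact mul_le_mul_of_nonneg_right (hC x) (norm_nonneg _)

lemma lintegral_convOp_sq_le [CompleteSpace E] [CompleteSpace F] (hκ : IsConvKernel κ) {M : ℝ}
    (hM : ∀ ξ, ‖𝓕 κ ξ‖ ≤ M) (hf : IsTame f) :
    ∫⁻ x, ‖convOp κ f x‖ₑ ^ 2 ≤ ENNReal.ofReal (M ^ 2) * ∫⁻ x, ‖f x‖ₑ ^ 2 := by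
  have hM0 : 0 ≤ M := (norm_nonneg _).trans (hM 0)
  rw [← lintegral_fourier_sq (hκ.integrable_convOp hf) (hκ.memLp_convOp hf),
    ← lintegral_fourier_sq hf.integrable (hf.memLp 2), ← lintegral_const_mul']
  · refine lintegral_mono fun ξ => ?_
    rw [convOp_eq_convolution, Real.fourier_bilin_convolution_eq _ hκ.int hf.integrable,
      ENNReal.ofReal_pow hM0, ← mul_pow]
    gcongr
    rw [← ofReal_norm, ← ofReal_norm, ← ENNReal.ofReal_mul hM0]
    refine ENNReal.ofReal_le_ofReal ((ContinuousLinearMap.le_opNorm _ _).trans ?_)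
    gcongr
    exact hM ξ
  · exact ENNReal.ofReal_ne_top

end IsConvKernel

lemma lintegral_hormander_weight_le {r : ℝ} (hr : 0 < r) (c : ℝ) :
    ∫⁻ x in {x | 2 * r ≤ |x - c|}, ENNReal.ofReal (r * (|x - c| ^ 2)⁻¹) ≤ 72 := by
  have h := maxFn.weight_le (fun _ => 1) measurable_const hr (x := c) (x' := c) (by simpa using hr.le)
  have h1 : maxFn (fun _ => 1) c ≤ 1 := maxFn.le_const (fun _ => le_rfl) c
  have h2 : MeasurableSet {x : ℝ | 2 * r ≤ |x - c|} :=
    measurableSet_le measurable_const (by fun_prop)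
  calc _ ≤ ∫⁻ x in {x | 2 * r ≤ |x - c|},
        ENNReal.ofReal (9 / 4) * (ENNReal.ofReal (r⁻¹ * ((1 + |c - x| / r) ^ 2)⁻¹) * 1) := by
        refine setLIntegral_mono' h2 fun x hx => ?_
        rw [mul_one, ← ENNReal.ofReal_mul (by norm_num), abs_sub_comm c x]
        refine ENNReal.ofReal_le_ofReal ?_
        have hx' : 2 * r ≤ |x - c| := hx
        have hpos : 0 < |x - c| := by linarith
        rw [← div_eq_mul_inv, div_le_iff₀ (by positivity)]
        have : (1 + |x - c| / r) = (r + |x - c|) / r := by field_simp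
        rw [this]
        have e : 9 / 4 * (r⁻¹ * (((r + |x - c|) / r) ^ 2)⁻¹) * |x - c| ^ 2 =
          r * (9 / 4 * |x - c| ^ 2 / (r + |x - c|) ^ 2) := by field_simp
        rw [e]
        refine le_mul_of_one_le_right hr.le ?_
        rw [one_le_div (by positivity)]
        nlinarith
    _ ≤ ENNReal.ofReal (9 / 4) * ∫⁻ x, (ENNReal.ofReal (r⁻¹ * ((1 + |c - x| / r) ^ 2)⁻¹) * 1) := by
        rw [← lintegral_const_mul' _ _ ENNReal.ofReal_ne_top]
        exact setLIntegral_le_lintegral _ _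
    _ ≤ ENNReal.ofReal (9 / 4) * (32 * 1) := by gcongr; exact h.trans (by gcongr)
    _ = 72 := by
      rw [mul_one, ← ENNReal.ofReal_ofNat 32, ← ENNReal.ofReal_mul (by norm_num)]
      norm_num

lemma IsLPKernel.isConvKernel {E F : Type*} [NormedAddCommGroup E] [InnerProductSpace ℂ E]
    [NormedAddCommGroup F] [InnerProductSpace ℂ F] {K : ℝ → ℂ} {B : ℝ} (hK : IsLPKernel K B)
    (S : Finset ℤ) (A : ℤ → E →L[ℂ] F) : IsConvKernel (lpKernel K S A) :=
  ⟨hK.continuous_lpKernel S A, hK.integrable_lpKernel S A, hK.norm_lpKernel_le S A⟩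

lemma IsLPKernel.norm_sub_le {K : ℝ → ℂ} {B : ℝ} (hK : IsLPKernel K B) {u h : ℝ}
    (huh : 2 * |h| ≤ |u|) : ‖K (u - h) - K u‖ ≤ 8 * B * |h| * ((1 + |u|) ^ 3)⁻¹ := by
  have key := Convex.norm_image_sub_le_of_norm_deriv_le (𝕜 := ℝ) (f := K)
    (s := uIcc u (u - h)) (C := 8 * B * ((1 + |u|) ^ 3)⁻¹) (x := u) (y := u - h)
    (fun x _ => hK.diff x) (fun x hx => ?_) (convex_uIcc _ _) left_mem_uIcc right_mem_uIcc
  · refine key.trans (le_of_eq ?_)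
    rw [show u - h - u = -h by ring, norm_neg, Real.norm_eq_abs]; ring
  · refine (hK.deriv_bound x).trans ?_
    have hB := hK.nonneg
    have hx' : |x - u| ≤ |h| := by
      have := abs_sub_left_of_mem_uIcc hx
      rwa [show u - h - u = -h by ring, abs_neg] at this
    have h3 : |u| ≤ |x| + |x - u| := by
      have := abs_sub_abs_le_abs_sub u x
      rw [abs_sub_comm u x] at this; linarith
    have h4 : (1 + |u|) ≤ 2 * (1 + |x|) := by linarith [abs_nonneg x]
    have h5 : (1 + |u|) ^ 3 ≤ 8 * (1 + |x|) ^ 3 := by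
      calc (1 + |u|) ^ 3 ≤ (2 * (1 + |x|)) ^ 3 := by gcongr
        _ = _ := by ring
    rw [← div_eq_mul_inv, ← div_eq_mul_inv, div_le_div_iff₀ (by positivity) (by positivity)]
    nlinarith [mul_le_mul_of_nonneg_left h5 hB]

lemma lpKernel_hormander : ∃ C : ℝ≥0∞, C ≠ ∞ ∧ ∀ {E F : Type*} [NormedAddCommGroup E]
    [InnerProductSpace ℂ E] [NormedAddCommGroup F] [InnerProductSpace ℂ F] {K : ℝ → ℂ} {B : ℝ}
    (S : Finset ℤ) (A : ℤ → E →L[ℂ] F), IsLPKernel K B → (∀ k, ‖A k‖ ≤ 1) → ∀ c y r, 0 < r →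
    |y - c| ≤ r → ∫⁻ x in {x | 2 * r ≤ |x - c|}, ‖lpKernel K S A (x - y) - lpKernel K S A (x - c)‖ₑ
      ≤ C * ENNReal.ofReal B := by
  obtain ⟨C, hC0, hC⟩ := exists_sum_min_zpow_le
  refine ⟨ENNReal.ofReal (8 * C) * 72, by finiteness,
    fun {E F} _ _ _ _ {K B} S A hK hA c y r hr hyc => ?_⟩
  have hB := hK.nonneg
  have h2 : MeasurableSet {x : ℝ | 2 * r ≤ |x - c|} :=
    measurableSet_le measurable_const (by fun_prop)
  calc _ ≤ ∫⁻ x in {x | 2 * r ≤ |x - c|}, ENNReal.ofReal (8 * C * B) *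
        ENNReal.ofReal (r * (|x - c| ^ 2)⁻¹) := by
        refine setLIntegral_mono' h2 fun x hx => ?_
        have hx' : 2 * r ≤ |x - c| := hx
        have hpos : 0 < |x - c| := by linarith
        rw [← ofReal_norm, ← ENNReal.ofReal_mul (by positivity)]
        refine ENNReal.ofReal_le_ofReal ?_
        have e : lpKernel K S A (x - y) - lpKernel K S A (x - c) = ∑ k ∈ S, ((2 : ℂ) ^ k *
            (K ((2 : ℝ) ^ k * (x - c) - (2 : ℝ) ^ k * (y - c)) - K ((2 : ℝ) ^ k * (x - c)))) • A k := by
          rw [lpKernel, lpKernel, ← Finset.sum_sub_distrib]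
          refine Finset.sum_congr rfl fun k _ => ?_
          rw [← sub_smul, mul_sub]
          congr 4; ring_nf
        rw [e]
        calc _ ≤ ∑ k ∈ S, 8 * B * r * (|x - c| ^ 2)⁻¹ *
              min ((2 : ℝ) ^ k * |x - c|) ((2 : ℝ) ^ k * |x - c|)⁻¹ := by
              refine (norm_sum_le _ _).trans (Finset.sum_le_sum fun k _ => ?_)
              have hk : (0 : ℝ) < 2 ^ k := by positivity
              rw [norm_smul, norm_mul]
              refine (mul_le_of_le_one_right (by positivity) (hA k)).trans ?_
              have h3 := hK.norm_sub_le (u := (2 : ℝ) ^ k * (x - c)) (h := (2 : ℝ) ^ k * (y - c)) (by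
                rw [abs_mul, abs_mul, abs_of_pos hk]; nlinarith)
              rw [abs_mul, abs_mul, abs_of_pos hk] at h3
              have h4 : ‖(2 : ℂ) ^ k‖ = (2 : ℝ) ^ k := by simp
              rw [h4]
              set u := (2 : ℝ) ^ k * |x - c| with hu
              have hu0 : 0 < u := by positivity
              calc _ ≤ (2 : ℝ) ^ k * (8 * B * ((2 : ℝ) ^ k * r) * ((1 + u) ^ 3)⁻¹) := by
                    refine mul_le_mul_of_nonneg_left (h3.trans ?_) hk.le
                    gcongr
                _ = 8 * B * r * (|x - c| ^ 2)⁻¹ * (u ^ 2 * ((1 + u) ^ 3)⁻¹) := by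
                    rw [hu]; field_simp
                _ ≤ _ := by
                    gcongr
                    rw [← div_eq_mul_inv, div_le_iff₀ (by positivity)]
                    rcases min_cases u u⁻¹ with ⟨h, _⟩ | ⟨h, _⟩
                    · rw [h]
                      have : u ≤ (1 + u) ^ 3 := by nlinarith [pow_pos hu0 3, pow_pos hu0 2]
                      nlinarith
                    · rw [h, inv_mul_eq_div, le_div_iff₀ hu0]
                      nlinarith [pow_pos hu0 3, pow_pos hu0 2]
          _ ≤ 8 * B * r * (|x - c| ^ 2)⁻¹ * C := by
              rw [← Finset.mul_sum]
              exact mul_le_mul_of_nonneg_left (hC S _ hpos.le) (by positivity)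
          _ = _ := by ring
    _ ≤ ENNReal.ofReal (8 * C * B) * 72 := by
        rw [lintegral_const_mul' _ _ ENNReal.ofReal_ne_top]
        gcongr
        exact lintegral_hormander_weight_le hr c
    _ = _ := by rw [ENNReal.ofReal_mul (by positivity)]; ring

open Filter Topology in
lemma ae_exists_dy_density {G : Set ℝ} {t : ℝ≥0∞} (ht : t < 1) :
    ∀ᵐ x ∂(volume.restrict G), ∃ k m, x ∈ dy k m ∧ t * volume (dy k m) < volume (G ∩ dy k m) := by
  filter_upwards [IsUnifLocDoublingMeasure.ae_tendsto_measure_inter_div volume G 1] with x hx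
  set k : ℕ → ℤ := fun n => -(n : ℤ)
  set m : ℕ → ℤ := fun n => ⌊x / 2 ^ k n⌋
  set δ : ℕ → ℝ := fun n => (2 : ℝ) ^ k n / 2
  set w : ℕ → ℝ := fun n => m n * 2 ^ k n + δ n
  have e1 : ∀ n, Metric.closedBall (w n) (δ n) = Icc (m n * (2 : ℝ) ^ k n) ((m n + 1) * 2 ^ k n) := by
    intro n
    rw [Real.closedBall_eq_Icc]
    congr 1 <;> simp only [w, δ] <;> ring
  have e2 : ∀ n, dy (k n) (m n) =ᵐ[volume] Metric.closedBall (w n) (δ n) := fun n => by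
    rw [e1]; exact Ico_ae_eq_Icc
  have h := hx w δ (l := atTop) ?_ ?_
  · have h3 := h.eventually (lt_mem_nhds ht)
    obtain ⟨n, hn⟩ := h3.exists
    refine ⟨k n, m n, mem_dy_floor _ _, ?_⟩
    rw [measure_congr (e2 n), measure_congr ((ae_eq_refl G).inter (e2 n))]
    rwa [ENNReal.lt_div_iff_mul_lt (Or.inl ?_) (Or.inl ?_)] at hn
    · rw [← measure_congr (e2 n)]; exact volume_dy_ne_zero _ _
    · rw [← measure_congr (e2 n)]; exact volume_dy_ne_top _ _
  · refine tendsto_nhdsWithin_iff.2 ⟨?_, Eventually.of_forall fun n => ?_⟩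
    · have h4 := (tendsto_pow_atTop_nhds_zero_of_lt_one (r := (1 / 2 : ℝ)) (by norm_num)
        (by norm_num)).div_const 2
      simpa [δ, k, zpow_neg, div_eq_mul_inv] using h4
    · simp only [δ]; exact div_pos (two_zpow_pos _) two_pos
  · refine Eventually.of_forall fun n => ?_
    rw [one_mul, e1]
    exact Ico_subset_Icc_self (mem_dy_floor _ _)

lemma exists_scale_bound {V t : ℝ≥0∞} (hV : V ≠ ∞) (ht : t ≠ 0) :
    ∃ K : ℤ, ∀ k m : ℤ, t * volume (dy k m) ≤ V → k ≤ K := by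
  have h : V / t ≠ ∞ := ENNReal.div_ne_top hV ht
  obtain ⟨n, hn⟩ := pow_unbounded_of_one_lt (V / t).toReal (by norm_num : (1 : ℝ) < 2)
  refine ⟨n, fun k m hk => ?_⟩
  rw [mul_comm, ← ENNReal.le_div_iff_mul_le (Or.inl ht) (Or.inr hV), volume_dy,
    ENNReal.ofReal_le_iff_le_toReal h] at hk
  have : (2 : ℝ) ^ k < 2 ^ (n : ℤ) := by rw [zpow_natCast]; exact hk.trans_lt hn
  exact ((zpow_lt_zpow_iff_right₀ (by norm_num)).1 this).le

lemma tsum_volume_inter_dyMax_le (D : Set (ℤ × ℤ)) {G : Set ℝ} (hG : MeasurableSet G) :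
    ∑' q : dyMax D, volume (G ∩ dy q.1.1 q.1.2) ≤ volume G := by
  rw [← measure_iUnion]
  · exact measure_mono (iUnion_subset fun _ => inter_subset_left)
  · intro a b hab
    exact ((dyMax_pairwiseDisjoint D a.2 b.2 (fun h => hab (Subtype.ext h))).mono
      inter_subset_right inter_subset_right)
  · exact fun q => hG.inter (measurableSet_dy _ _)

/-- Finitely many disjoint dyadic intervals capturing most of `G` at density about `t`. -/
lemma exists_dy_selection {G : Set ℝ} (hG : MeasurableSet G) (hGt : volume G ≠ ∞) {t : ℝ≥0∞}
    (ht0 : t ≠ 0) (ht : t < 1) : ∃ M : Finset (ℤ × ℤ),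
      (M : Set (ℤ × ℤ)).PairwiseDisjoint (fun q => dy q.1 q.2) ∧
      (∀ q ∈ M, volume (G ∩ dy q.1 q.2) ≤ 2 * t * volume (dy q.1 q.2)) ∧
      (∀ q ∈ M, t * volume (dy q.1 q.2) ≤ volume (G ∩ dy q.1 q.2)) ∧
      volume (G \ ⋃ q ∈ M, dy q.1 q.2) ≤ t * volume G := by
  set D : Set (ℤ × ℤ) := {q | t * volume (dy q.1 q.2) < volume (G ∩ dy q.1 q.2)} with hD
  obtain ⟨K, hK⟩ := exists_scale_bound hGt ht0
  have hDK : ∀ q ∈ D, q.1 ≤ K := fun q hq =>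
    hK q.1 q.2 ((le_of_lt hq).trans (measure_mono inter_subset_left))
  have hfull : volume G ≤ ∑' q : dyMax D, volume (G ∩ dy q.1.1 q.1.2) := by
    have h1 : volume (G \ ⋃ q : dyMax D, dy q.1.1 q.1.2) = 0 := by
      have h2 := ae_exists_dy_density (G := G) ht
      rw [ae_restrict_iff' hG] at h2
      rw [measure_eq_zero_iff_ae_notMem]
      filter_upwards [h2] with x hx hx'
      obtain ⟨k, m, hkm, hlt⟩ := hx hx'.1
      obtain ⟨q', hq', hsub⟩ := exists_dyMax hDK (q := (k, m)) hlt
      exact hx'.2 (mem_iUnion.2 ⟨⟨q', hq'⟩, hsub hkm⟩)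
    calc volume G ≤ volume (⋃ q : dyMax D, G ∩ dy q.1.1 q.1.2) +
          volume (G \ ⋃ q : dyMax D, dy q.1.1 q.1.2) := by
          refine (measure_mono (fun x hx => ?_)).trans (measure_union_le _ _)
          by_cases h : x ∈ ⋃ q : dyMax D, dy q.1.1 q.1.2
          · rw [← inter_iUnion]; exact Or.inl ⟨hx, h⟩
          · exact Or.inr ⟨hx, h⟩
      _ ≤ _ := by rw [h1, add_zero]; exact measure_iUnion_le _
  obtain ⟨s, hs⟩ : ∃ s : Finset (dyMax D), (1 - t) * volume G ≤ ∑ q ∈ s, volume (G ∩ dy q.1.1 q.1.2) := by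
    rcases eq_or_ne (volume G) 0 with h0 | h0
    · exact ⟨∅, by simp [h0]⟩
    · have h1 : (1 - t) * volume G < ∑' q : dyMax D, volume (G ∩ dy q.1.1 q.1.2) := by
        refine lt_of_lt_of_le ?_ hfull
        conv_rhs => rw [← one_mul (volume G)]
        exact (ENNReal.mul_lt_mul_iff_left h0 hGt).2
          (ENNReal.sub_lt_self ENNReal.one_ne_top one_ne_zero ht0)
      rw [ENNReal.tsum_eq_iSup_sum, lt_iSup_iff] at h1
      exact h1.imp fun _ h => h.le
  refine ⟨s.map (Function.Embedding.subtype _), ?_, ?_, ?_, ?_⟩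
  · refine (dyMax_pairwiseDisjoint D).subset fun q hq => ?_
    simp only [Finset.coe_map, mem_image] at hq
    obtain ⟨a, -, rfl⟩ := hq
    exact a.2
  · intro q hq
    obtain ⟨a, -, rfl⟩ := Finset.mem_map.1 hq
    obtain ⟨⟨k, m⟩, ha⟩ := a
    simp only [Function.Embedding.subtype_apply]
    obtain ⟨m', hm'⟩ := exists_dy_superset (k := k) (k' := k + 1) (by omega) m
    have hn : (k + 1, m') ∉ D := fun h => by
      have := ha.2 _ h hm'
      simp at this
    simp only [hD, mem_ofPred_eq, not_lt] at hn
    refine (measure_mono (inter_subset_inter_right _ hm')).trans (hn.trans ?_)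
    rw [volume_dy, volume_dy, zpow_add_one₀ (by norm_num), mul_comm _ (2 : ℝ),
      ENNReal.ofReal_mul (by norm_num), ENNReal.ofReal_ofNat, mul_comm 2 t, mul_assoc]
  · intro q hq
    obtain ⟨a, -, rfl⟩ := Finset.mem_map.1 hq
    exact le_of_lt a.2.1
  · set U := ⋃ q ∈ s.map (Function.Embedding.subtype _), dy q.1 q.2 with hU
    have hUm : MeasurableSet U := Finset.measurableSet_biUnion _ fun q _ => measurableSet_dy _ _
    have h1 : ∑ q ∈ s, volume (G ∩ dy q.1.1 q.1.2) ≤ volume (G ∩ U) := by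
      rw [← measure_biUnion_finset (f := fun q : dyMax D => G ∩ dy q.1.1 q.1.2)]
      · refine measure_mono (iUnion₂_subset fun q hq => ?_)
        refine inter_subset_inter_right _ (subset_biUnion_of_mem (u := fun q : ℤ × ℤ => dy q.1 q.2) ?_)
        exact Finset.mem_map.2 ⟨q, hq, rfl⟩
      · intro a _ b _ hab
        exact ((dyMax_pairwiseDisjoint D a.2 b.2 (fun h => hab (Subtype.ext h))).mono
          inter_subset_right inter_subset_right)
      · exact fun q _ => hG.inter (measurableSet_dy _ _)
    have h2 := measure_inter_add_sdiff G hUm (μ := volume)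
    have h3 : volume (G ∩ U) ≠ ∞ := ne_top_of_le_ne_top hGt (measure_mono inter_subset_left)
    have h4 : volume (G ∩ U) + volume (G \ U) ≤ volume (G ∩ U) + t * volume G := by
      rw [h2]
      calc volume G = ((1 - t) + t) * volume G := by rw [tsub_add_cancel_of_le ht.le, one_mul]
        _ ≤ _ := by rw [add_mul]; gcongr; exact hs.trans h1
    exact (ENNReal.add_le_add_iff_left h3).1 h4

namespace IsConvKernel

variable {E F : Type*} [NormedAddCommGroup E] [InnerProductSpace ℂ E]
  [NormedAddCommGroup F] [InnerProductSpace ℂ F] {κ : ℝ → E →L[ℂ] F}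

lemma convOp_finsetSum {ι : Type*} (hκ : IsConvKernel κ) (s : Finset ι) {f : ι → ℝ → E}
    (hf : ∀ i ∈ s, IsTame (f i)) (x : ℝ) :
    convOp κ (∑ i ∈ s, f i) x = ∑ i ∈ s, convOp κ (f i) x := by
  simp only [convOp, Finset.sum_apply, map_sum]
  exact integral_finsetSum _ fun i hi => hκ.integrable_apply (hf i hi) x

lemma lintegral_convOp_atom_le (hκ : IsConvKernel κ) {A : ℝ≥0∞} {c r : ℝ}
    [CompleteSpace E] [CompleteSpace F] (hA : ∀ y, |y - c| ≤ r → ∫⁻ x in {x | 2 * r ≤ |x - c|}, ‖κ (x - y) - κ (x - c)‖ₑ ≤ A)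
    {b : ℝ → E} (hb : IsTame b) (hsupp : ∀ y, r < |y - c| → b y = 0) (h0 : ∫ y, b y = 0) :
    ∫⁻ x in {x | 2 * r ≤ |x - c|}, ‖convOp κ b x‖ₑ ≤ A * ∫⁻ y, ‖b y‖ₑ := by
  have hc := hκ.cont
  have hbm := hb.meas.enorm
  have hm : Measurable fun z : ℝ × ℝ => ‖κ (z.1 - z.2) - κ (z.1 - c)‖ₑ * ‖b z.2‖ₑ := by
    refine Measurable.mul ?_ (hbm.comp measurable_snd)
    refine Continuous.measurable (f := fun z : ℝ × ℝ => ‖κ (z.1 - z.2) - κ (z.1 - c)‖ₑ) ?_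
    exact ((hc.comp (continuous_fst.sub continuous_snd)).sub
      (hc.comp (continuous_fst.sub continuous_const))).enorm
  calc _ ≤ ∫⁻ x in {x | 2 * r ≤ |x - c|}, ∫⁻ y, ‖κ (x - y) - κ (x - c)‖ₑ * ‖b y‖ₑ := by
        refine lintegral_mono fun x => ?_
        have e : convOp κ b x = ∫ y, (κ (x - y) - κ (x - c)) (b y) := by
          simp only [sub_apply]
          rw [integral_sub (hκ.integrable_apply hb x) ((κ (x - c)).integrable_comp hb.integrable),
            (κ (x - c)).integral_comp_comm hb.integrable, h0, map_zero, sub_zero]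
          rfl
        rw [e]
        exact (enorm_integral_le_lintegral_enorm _).trans
          (lintegral_mono fun y => ContinuousLinearMap.le_opENorm _ _)
    _ = ∫⁻ y, ∫⁻ x in {x | 2 * r ≤ |x - c|}, ‖κ (x - y) - κ (x - c)‖ₑ * ‖b y‖ₑ :=
        lintegral_lintegral_swap hm.aemeasurable
    _ ≤ ∫⁻ y, A * ‖b y‖ₑ := by
        refine lintegral_mono fun y => ?_
        rw [lintegral_mul_const' _ _ enorm_ne_top]
        by_cases hy : |y - c| ≤ r
        · gcongr; exact hA y hy
        · simp [hsupp y (not_le.1 hy)]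
    _ = _ := lintegral_const_mul _ hbm

theorem weak_type_one [CompleteSpace E] [CompleteSpace F] (hκ : IsConvKernel κ) {A : ℝ≥0∞}
    (hL2 : ∀ f : ℝ → E, IsTame f → ∫⁻ x, ‖convOp κ f x‖ₑ ^ 2 ≤ A * ∫⁻ x, ‖f x‖ₑ ^ 2)
    (hH : ∀ c y r, 0 < r → |y - c| ≤ r →
      ∫⁻ x in {x | 2 * r ≤ |x - c|}, ‖κ (x - y) - κ (x - c)‖ₑ ≤ A)
    {G : Set ℝ} (hG : MeasurableSet G) {f : ℝ → E} (hf : IsTame f)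
    (hfG : ∀ x, ‖f x‖ ≤ G.indicator 1 x) {t : ℝ≥0∞} (ht0 : t ≠ 0) (htt : t ≠ ∞) :
    volume {x | t < ‖convOp κ f x‖ₑ} ≤ (28 * A + 5) * t⁻¹ * volume G := by
  have hfe : ∀ x, ‖f x‖ₑ ≤ G.indicator 1 x := fun x => by
    have := hfG x
    by_cases hx : x ∈ G
    · rw [indicator_of_mem hx] at this ⊢
      rw [← ofReal_norm]; exact ENNReal.ofReal_le_one.2 this
    · rw [indicator_of_notMem hx] at this ⊢
      rw [← ofReal_norm]; simpa using this
  have cheb : ∀ (h : ℝ → F) (s : ℝ≥0∞), s ≠ 0 → s ≠ ∞ → Continuous h →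
      volume {x | s < ‖h x‖ₑ} ≤ (s ^ 2)⁻¹ * ∫⁻ x, ‖h x‖ₑ ^ 2 := by
    intro h s hs hs' hc
    rw [← ENNReal.div_eq_inv_mul]
    refine (measure_mono fun x hx => ?_).trans (meas_ge_le_lintegral_div
      (hc.enorm.measurable.pow_const 2).aemeasurable (by simpa using hs) (by simpa using hs'))
    have hx' : s < ‖h x‖ₑ := hx
    change s ^ 2 ≤ ‖h x‖ₑ ^ 2
    gcongr
  have hfint : ∀ s : Set ℝ, MeasurableSet s → ∫⁻ x in s, ‖f x‖ₑ ≤ volume (G ∩ s) := fun s hs => by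
    refine (lintegral_mono fun x => hfe x).trans ?_
    rw [lintegral_indicator_one hG, Measure.restrict_apply hG]
  rcases eq_or_ne (volume G) ∞ with hGt | hGt
  · rw [hGt, ENNReal.mul_top]
    · exact le_top
    · exact mul_ne_zero (by simp) (ENNReal.inv_ne_zero.2 htt)
  rcases le_or_gt 1 t with ht1 | ht1
  · calc _ ≤ (t ^ 2)⁻¹ * (A * ∫⁻ x, ‖f x‖ₑ ^ 2) :=
          (cheb _ t ht0 htt (hκ.continuous_convOp hf)).trans (by gcongr; exact hL2 f hf)
      _ ≤ t⁻¹ * (A * volume G) := by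
          gcongr
          · exact le_self_pow₀ ht1 two_ne_zero
          · rw [← lintegral_indicator_one hG]
            refine lintegral_mono fun x => ?_
            have := hfe x
            by_cases hx : x ∈ G
            · rw [indicator_of_mem hx] at this ⊢
              exact pow_le_one₀ zero_le this
            · rw [indicator_of_notMem hx] at this ⊢
              simp [nonpos_iff_eq_zero.1 this]
      _ = (1 * A + 0) * t⁻¹ * volume G := by rw [one_mul, add_zero]; ring
      _ ≤ _ := by gcongr <;> norm_num
  obtain ⟨M, hMd, hM2, hM1, hMr⟩ := exists_dy_selection hG hGt ht0 ht1
  set I : ℤ × ℤ → Set ℝ := fun q => dy q.1 q.2 with hI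
  have hIm : ∀ q, MeasurableSet (I q) := fun q => measurableSet_dy _ _
  set a : ℤ × ℤ → E := fun q => ((2 : ℝ) ^ q.1)⁻¹ • ∫ x in I q, f x with ha
  set b : ℤ × ℤ → ℝ → E := fun q => (I q).indicator fun x => f x - a q with hb
  have hsumI : ∑ q ∈ M, volume (G ∩ I q) ≤ volume G := by
    rw [← measure_biUnion_finset (f := fun q => G ∩ I q)]
    · exact measure_mono (iUnion₂_subset fun q _ => inter_subset_left)
    · exact fun p hp q hq hpq => (hMd hp hq hpq).mono inter_subset_right inter_subset_right
    · exact fun q _ => hG.inter (hIm q)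
  have hav : ∀ q, ‖a q‖ₑ * volume (I q) ≤ volume (G ∩ I q) := fun q => by
    have hp := two_zpow_pos q.1
    rw [ha, hI]
    simp only
    rw [enorm_smul, volume_dy, mul_comm, ← mul_assoc, ← ofReal_norm, Real.norm_of_nonneg (by positivity),
      ← ENNReal.ofReal_mul hp.le, mul_inv_cancel₀ hp.ne', ENNReal.ofReal_one, one_mul]
    exact (enorm_integral_le_lintegral_enorm _).trans (hfint _ (hIm q))
  have ha2 : ∀ q ∈ M, ‖a q‖ₑ ≤ 2 * t := fun q hq => by
    have := (hav q).trans (hM2 q hq)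
    exact (ENNReal.mul_le_mul_iff_left (volume_dy_ne_zero _ _) (volume_dy_ne_top _ _)).1 this
  have hbt : ∀ q, IsTame (b q) := fun q => by
    obtain ⟨C, hC⟩ := hf.bdd
    refine IsTame.of_bound (s := I q) (C := C + ‖a q‖)
      ((hf.meas.sub stronglyMeasurable_const).indicator (hIm q))
      (volume_dy_ne_top _ _).lt_top (fun x => ?_) (fun x hx => indicator_of_notMem hx _)
    refine (norm_indicator_le_norm_self _ x).trans ((norm_sub_le _ _).trans ?_)
    gcongr; exact hC x
  have hb0 : ∀ q, ∫ x, b q x = 0 := fun q => by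
    have hp := two_zpow_pos q.1
    simp only [hb]
    rw [integral_indicator (hIm q), integral_sub hf.integrable.integrableOn
      (integrableOn_const (volume_dy_ne_top _ _)), setIntegral_const, Measure.real, volume_dy,
      ENNReal.toReal_ofReal hp.le, ha]
    simp only
    rw [smul_smul, mul_inv_cancel₀ hp.ne', one_smul, sub_self]
  have hb1 : ∀ q, ∫⁻ x, ‖b q x‖ₑ ≤ 2 * volume (G ∩ I q) := fun q => by
    calc _ ≤ ∫⁻ x in I q, (‖f x‖ₑ + ‖a q‖ₑ) := by
          rw [← lintegral_indicator (hIm q)]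
          refine lintegral_mono fun x => ?_
          simp only [hb]
          by_cases hx : x ∈ I q
          · simp only [indicator_of_mem hx]; exact enorm_sub_le
          · simp [indicator_of_notMem hx]
      _ ≤ volume (G ∩ I q) + volume (G ∩ I q) := by
          rw [lintegral_add_left hf.meas.enorm, setLIntegral_const]
          exact add_le_add (hfint _ (hIm q)) (hav q)
      _ = _ := (two_mul _).symm
  set g : ℝ → E := f + (-1 : ℂ) • ∑ q ∈ M, b q with hg
  have hgt : IsTame g := hf.add ((IsTame.sum M fun q _ => hbt q).smul _)
  have hfg : f = g + ∑ q ∈ M, b q := by rw [hg]; simp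
  have hg2 : ∫⁻ x, ‖g x‖ₑ ^ 2 ≤ 5 * t * volume G := by
    set U := ⋃ q ∈ M, I q with hU
    have hUm : MeasurableSet U := Finset.measurableSet_biUnion _ fun q _ => hIm q
    calc _ ≤ ∫⁻ x, ((∑ q ∈ M, (I q).indicator (fun _ => (2 * t) ^ 2) x) + (G \ U).indicator 1 x) := by
          refine lintegral_mono fun x => ?_
          by_cases hx : x ∈ U
          · obtain ⟨q, hq, hxq⟩ := mem_iUnion₂.1 hx
            have e : g x = a q := by
              have : ∑ p ∈ M, b p x = b q x := by
                refine Finset.sum_eq_single_of_mem q hq fun p hp hpq => ?_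
                exact indicator_of_notMem (fun h => (hMd hp hq hpq).le_bot ⟨h, hxq⟩) _
              simp only [hg, Pi.add_apply, Pi.smul_apply, Finset.sum_apply, this]
              simp [hb, indicator_of_mem hxq]
            rw [e]
            refine le_trans ?_ le_self_add
            refine le_trans ?_ (Finset.single_le_sum (f := fun q => (I q).indicator
              (fun _ => (2 * t) ^ 2) x) (fun _ _ => zero_le) hq)
            simp only [indicator_of_mem hxq]
            gcongr; exact ha2 q hq
          · have e : g x = f x := by
              have : ∑ p ∈ M, b p x = 0 := Finset.sum_eq_zero fun p hp =>
                indicator_of_notMem (fun h => hx (mem_iUnion₂.2 ⟨p, hp, h⟩)) _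
              simp [hg, this]
            rw [e]
            refine le_trans ?_ le_add_self
            have := hfe x
            by_cases hxG : x ∈ G
            · rw [indicator_of_mem hxG] at this
              rw [indicator_of_mem (show x ∈ G \ U from ⟨hxG, hx⟩)]
              exact pow_le_one₀ zero_le this
            · rw [indicator_of_notMem hxG] at this
              simp [nonpos_iff_eq_zero.1 this]
      _ = (∑ q ∈ M, (2 * t) ^ 2 * volume (I q)) + volume (G \ U) := by
          rw [lintegral_add_left (Finset.measurable_fun_sum _ fun q _ =>
            measurable_const.indicator (hIm q)), lintegral_finsetSum _ fun q _ =>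
            measurable_const.indicator (hIm q), lintegral_indicator_one (hG.diff hUm)]
          simp_rw [lintegral_indicator (hIm _), setLIntegral_const]
      _ ≤ (∑ q ∈ M, 4 * t * volume (G ∩ I q)) + t * volume G := by
          refine add_le_add (Finset.sum_le_sum fun q hq => ?_) hMr
          calc (2 * t) ^ 2 * volume (I q) = 4 * t * (t * volume (I q)) := by ring
            _ ≤ _ := by gcongr; exact hM1 q hq
      _ ≤ 4 * t * volume G + t * volume G := by
          rw [← Finset.mul_sum]; gcongr
      _ = _ := by ring
  set c : ℤ × ℤ → ℝ := fun q => q.2 * (2 : ℝ) ^ q.1 with hc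
  set r : ℤ × ℤ → ℝ := fun q => (2 : ℝ) ^ q.1 with hr
  set Ω := ⋃ q ∈ M, Metric.ball (c q) (2 * r q) with hΩ
  have hΩm : MeasurableSet Ω := Finset.measurableSet_biUnion _ fun q _ => measurableSet_ball
  have hΩv : volume Ω ≤ 4 * t⁻¹ * volume G := by
    calc volume Ω ≤ ∑ q ∈ M, volume (Metric.ball (c q) (2 * r q)) := measure_biUnion_finset_le _ _
      _ ≤ ∑ q ∈ M, 4 * t⁻¹ * volume (G ∩ I q) := by
          refine Finset.sum_le_sum fun q hq => ?_
          rw [Real.volume_ball, show 2 * (2 * r q) = 4 * (2 : ℝ) ^ q.1 by simp only [hr]; ring,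
            ENNReal.ofReal_mul (by norm_num), ENNReal.ofReal_ofNat, ← volume_dy q.1 q.2, mul_assoc]
          gcongr
          rw [← ENNReal.div_eq_inv_mul, ENNReal.le_div_iff_mul_le (Or.inl ht0) (Or.inl htt), mul_comm]
          exact hM1 q hq
      _ ≤ _ := by rw [← Finset.mul_sum]; gcongr
  have hbad : ∫⁻ x in Ωᶜ, ‖∑ q ∈ M, convOp κ (b q) x‖ₑ ≤ 2 * A * volume G := by
    calc _ ≤ ∫⁻ x in Ωᶜ, ∑ q ∈ M, ‖convOp κ (b q) x‖ₑ := lintegral_mono fun x => enorm_sum_le _ _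
      _ = ∑ q ∈ M, ∫⁻ x in Ωᶜ, ‖convOp κ (b q) x‖ₑ := lintegral_finsetSum _ fun q _ =>
          (hκ.continuous_convOp (hbt q)).enorm.measurable
      _ ≤ ∑ q ∈ M, 2 * A * volume (G ∩ I q) := by
          refine Finset.sum_le_sum fun q hq => ?_
          have h1 := hκ.lintegral_convOp_atom_le (c := c q) (r := r q) (A := A)
            (fun y hy => hH _ _ _ (two_zpow_pos _) hy) (hbt q) (fun y hy => ?_) (hb0 q)
          · refine (lintegral_mono_set ?_).trans (h1.trans ?_)
            · intro x hx
              by_contra h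
              refine hx (mem_iUnion₂.2 ⟨q, hq, ?_⟩)
              rw [mem_ofPred_eq, not_le] at h
              rwa [Metric.mem_ball, Real.dist_eq]
            · rw [mul_comm 2 A, mul_assoc]; gcongr; exact hb1 q
          · refine indicator_of_notMem (fun h => ?_) _
            have h' : q.2 * (2 : ℝ) ^ q.1 ≤ y ∧ y < (q.2 + 1) * (2 : ℝ) ^ q.1 := h
            simp only [hc, hr] at hy
            rw [abs_of_nonneg (by linarith)] at hy
            linarith
      _ ≤ _ := by rw [← Finset.mul_sum]; gcongr
  have ht20 : t / 2 ≠ 0 := by simpa using ht0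
  have ht2t : t / 2 ≠ ∞ := ENNReal.div_ne_top htt two_ne_zero
  have hsub : {x | t < ‖convOp κ f x‖ₑ} ⊆ {x | t / 2 < ‖convOp κ g x‖ₑ} ∪ Ω ∪
      ({x | t / 2 ≤ ‖∑ q ∈ M, convOp κ (b q) x‖ₑ} ∩ Ωᶜ) := by
    intro x hx
    by_contra h
    simp only [mem_union, mem_inter_iff, mem_ofPred_eq, mem_compl_iff, not_or, not_and_or, not_lt,
      not_not, not_le] at h hx
    obtain ⟨⟨h1, h2⟩, h3⟩ := h
    have h3 := h3.resolve_right h2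
    have e : convOp κ f x = convOp κ g x + ∑ q ∈ M, convOp κ (b q) x := by
      conv_lhs => rw [hfg]
      rw [hκ.convOp_add hgt (IsTame.sum M fun q _ => hbt q), hκ.convOp_finsetSum M fun q _ => hbt q]
    rw [e] at hx
    have := hx.trans_le ((enorm_add_le _ _).trans (add_le_add h1 h3.le))
    rw [ENNReal.add_halves] at this
    exact lt_irrefl _ this
  calc _ ≤ volume {x | t / 2 < ‖convOp κ g x‖ₑ} + volume Ω +
        volume ({x | t / 2 ≤ ‖∑ q ∈ M, convOp κ (b q) x‖ₑ} ∩ Ωᶜ) :=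
        (measure_mono hsub).trans ((measure_union_le _ _).trans
          (add_le_add_left (measure_union_le _ _) _))
    _ ≤ ((t / 2) ^ 2)⁻¹ * (A * (5 * t * volume G)) + 4 * t⁻¹ * volume G +
        (t / 2)⁻¹ * (2 * A * volume G) := by
        gcongr
        · exact (cheb _ _ ht20 ht2t (hκ.continuous_convOp hgt)).trans (by
            gcongr; exact (hL2 g hgt).trans (by gcongr))
        · rw [← Measure.restrict_apply' hΩm.compl]
          rw [← ENNReal.div_eq_inv_mul]
          refine (meas_ge_le_lintegral_div ?_ ht20 ht2t).trans (by gcongr)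
          exact (continuous_finsetSum _ fun q _ =>
            hκ.continuous_convOp (hbt q)).enorm.measurable.aemeasurable
    _ = (20 * (t * t⁻¹) * A + 4 * A + 4) * t⁻¹ * volume G := by
        rw [ENNReal.inv_pow, ENNReal.inv_div (by simp) (by simp), div_eq_mul_inv]
        ring
    _ ≤ _ := by
        rw [ENNReal.mul_inv_cancel ht0 htt]
        have h : 20 * 1 * A + 4 * A + 4 ≤ 28 * A + 5 := by
          calc 20 * 1 * A + 4 * A + 4 = 24 * A + 4 := by ring
            _ ≤ _ := by gcongr <;> norm_num
        exact mul_le_mul_left (mul_le_mul_left h _) _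

end IsConvKernel

section Duality

variable {F : Type*} [NormedAddCommGroup F] [InnerProductSpace ℂ F]

lemma enorm_integral_inner_le {E : Type*} [NormedAddCommGroup E] [InnerProductSpace ℂ E] {p q : ℝ}
    (hpq : p.HolderConjugate q) {u v : ℝ → E} (hu : AEStronglyMeasurable u volume)
    (hv : AEStronglyMeasurable v volume) :
    ‖∫ x, inner ℂ (u x) (v x)‖ₑ ≤ (∫⁻ x, ‖u x‖ₑ ^ p) ^ (1 / p) * (∫⁻ x, ‖v x‖ₑ ^ q) ^ (1 / q) := by
  refine (enorm_integral_le_lintegral_enorm _).trans (le_trans (lintegral_mono fun x => ?_)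
    (ENNReal.lintegral_mul_le_Lp_mul_Lq volume hpq hu.enorm hv.enorm))
  simp only [Pi.mul_apply, ← ofReal_norm]
  rw [← ENNReal.ofReal_mul (norm_nonneg _)]
  exact ENNReal.ofReal_le_ofReal (norm_inner_le_norm _ _)

lemma ENNReal.le_rpow_of_le_mul_rpow {p q : ℝ} (hpq : p.HolderConjugate q) {I C : ℝ≥0∞}
    (hI : I ≠ ∞) (h : I ≤ C * I ^ (1 / q)) : I ≤ C ^ p := by
  rcases eq_or_ne I 0 with rfl | h0
  · simp
  have h1 : I ^ (1 / p) * I ^ (1 / q) ≤ C * I ^ (1 / q) := by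
    rw [← ENNReal.rpow_add _ _ h0 hI, hpq.one_div_add_one_div]; simpa using h
  have h2 : I ^ (1 / p) ≤ C := by
    refine (ENNReal.mul_le_mul_iff_left ?_ ?_).1 h1
    · simp [ENNReal.rpow_eq_zero_iff, h0, hI]
    · simp [ENNReal.rpow_eq_top_iff, h0, hI]
  calc I = (I ^ (1 / p)) ^ p := by rw [← ENNReal.rpow_mul, one_div_mul_cancel hpq.ne_zero, rpow_one]
    _ ≤ _ := ENNReal.rpow_le_rpow h2 hpq.nonneg

theorem lintegral_rpow_le_of_dual {p q : ℝ} (hpq : p.HolderConjugate q) {u : ℝ → F}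
    (hu : StronglyMeasurable u) {C : ℝ≥0∞}
    (h : ∀ G : ℝ → F, IsTame G →
      ‖∫ x, inner ℂ (G x) (u x)‖ₑ ≤ C * (∫⁻ x, ‖G x‖ₑ ^ q) ^ (1 / q)) :
    ∫⁻ x, ‖u x‖ₑ ^ p ≤ C ^ p := by
  have hp := hpq.pos
  have hp1 := hpq.sub_one_pos
  set S : ℕ → Set ℝ := fun n => {x | ‖u x‖ ≤ n} ∩ Icc (-(n : ℝ)) n with hS
  have hSm : ∀ n, MeasurableSet (S n) := fun n =>
    (measurableSet_le hu.norm.measurable measurable_const).inter measurableSet_Icc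
  have hSv : ∀ n, volume (S n) < ∞ := fun n =>
    (measure_mono inter_subset_right).trans_lt (by simp)
  have hSmono : Monotone S := fun m n hmn x hx => by
    have : (m : ℝ) ≤ n := Nat.cast_le.2 hmn
    exact ⟨le_trans (show ‖u x‖ ≤ m from hx.1) this, by linarith [hx.2.1], by linarith [hx.2.2]⟩
  have hSU : ⋃ n, S n = univ := eq_univ_of_forall fun x => by
    obtain ⟨n, hn⟩ := exists_nat_ge (max ‖u x‖ |x|)
    have h2 := abs_le.1 ((le_max_right _ _).trans hn)
    exact mem_iUnion.2 ⟨n, (le_max_left _ _).trans hn, h2.1, h2.2⟩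
  rw [← setLIntegral_univ, ← hSU, setLIntegral_iUnion_of_directed _ hSmono.directed_le]
  refine iSup_le fun n => ?_
  have hbound : ∀ x ∈ S n, ‖u x‖ₑ ^ p ≤ ENNReal.ofReal ((n : ℝ) ^ p) := fun x hx => by
    rw [← ofReal_norm, ENNReal.ofReal_rpow_of_nonneg (norm_nonneg _) hp.le]
    exact ENNReal.ofReal_le_ofReal (Real.rpow_le_rpow (norm_nonneg _) hx.1 hp.le)
  refine ENNReal.le_rpow_of_le_mul_rpow hpq ?_ ?_
  · refine ((setLIntegral_mono measurable_const hbound).trans_lt ?_).ne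
    rw [setLIntegral_const]
    exact ENNReal.mul_lt_top ENNReal.ofReal_lt_top (hSv n)
  set G : ℝ → F := (S n).indicator fun x => (‖u x‖ ^ (p - 2)) • u x with hG
  have hnorm : ∀ x, ‖(‖u x‖ ^ (p - 2)) • u x‖ = ‖u x‖ ^ (p - 1) := fun x => by
    rw [norm_smul, Real.norm_of_nonneg (by positivity)]
    rcases eq_or_ne (‖u x‖) 0 with h0 | h0
    · rw [h0, mul_zero, Real.zero_rpow hp1.ne']
    · rw [← Real.rpow_add_one h0]; ring_nf
  have hGt : IsTame G := by
    refine IsTame.of_bound (s := S n) (C := (n : ℝ) ^ (p - 1)) ?_ (hSv n) (fun x => ?_)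
      fun x hx => indicator_of_notMem hx _
    · exact ((hu.norm.measurable.pow_const _).stronglyMeasurable.smul hu).indicator (hSm n)
    · by_cases hx : x ∈ S n
      · rw [hG, indicator_of_mem hx, hnorm]
        exact Real.rpow_le_rpow (norm_nonneg _) hx.1 hp1.le
      · rw [hG, indicator_of_notMem hx, norm_zero]; positivity
  have hGe : ∀ x, ‖G x‖ₑ ^ q = (S n).indicator (fun x => ‖u x‖ₑ ^ p) x := fun x => by
    by_cases hx : x ∈ S n
    · rw [hG, indicator_of_mem hx, indicator_of_mem hx, ← ofReal_norm, hnorm, ← ofReal_norm,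
        ENNReal.ofReal_rpow_of_nonneg (by positivity) hpq.symm.nonneg,
        ENNReal.ofReal_rpow_of_nonneg (norm_nonneg _) hp.le, ← Real.rpow_mul (norm_nonneg _),
        hpq.sub_one_mul_conj]
    · rw [hG, indicator_of_notMem hx, indicator_of_notMem hx, enorm_zero,
        ENNReal.zero_rpow_of_pos hpq.symm.pos]
  have hin : ∀ x, inner ℂ (G x) (u x) = (((S n).indicator (fun x => ‖u x‖ ^ p) x : ℝ) : ℂ) := fun x => by
    by_cases hx : x ∈ S n
    · rw [hG, indicator_of_mem hx, indicator_of_mem hx, ← Complex.coe_smul, inner_smul_left,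
        Complex.conj_ofReal, inner_self_eq_norm_sq_to_K]
      rcases eq_or_ne (‖u x‖) 0 with h0 | h0
      · rw [h0, Real.zero_rpow hp.ne']; simp
      · rw [show ‖u x‖ ^ p = ‖u x‖ ^ (p - 2) * ‖u x‖ ^ 2 by
          rw [← Real.rpow_add_natCast h0]; norm_num]
        simp
    · rw [hG, indicator_of_notMem hx, indicator_of_notMem hx, inner_zero_left, Complex.ofReal_zero]
  have hint : IntegrableOn (fun x => ‖u x‖ ^ p) (S n) := by
    refine Measure.integrableOn_of_bounded (M := (n : ℝ) ^ p) (hSv n).ne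
      (hu.norm.measurable.pow_const _).aestronglyMeasurable ?_
    refine (ae_restrict_mem (hSm n)).mono fun x hx => ?_
    rw [Real.norm_of_nonneg (by positivity)]
    exact Real.rpow_le_rpow (norm_nonneg _) hx.1 hp.le
  have key := h G hGt
  simp_rw [hGe, hin] at key
  rw [integral_complex_ofReal, lintegral_indicator (hSm n), integral_indicator (hSm n)] at key
  refine le_trans (le_of_eq ?_) key
  rw [← ofReal_norm, Complex.norm_real, Real.norm_of_nonneg (integral_nonneg fun x => by positivity),
    ofReal_integral_eq_lintegral_ofReal hint (Filter.Eventually.of_forall fun x => by positivity)]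
  refine lintegral_congr fun x => ?_
  rw [← ofReal_norm, ENNReal.ofReal_rpow_of_nonneg (norm_nonneg _) hp.le]

end Duality

section Adjoint

variable {E F : Type*} [NormedAddCommGroup E] [InnerProductSpace ℂ E] [CompleteSpace E]
  [NormedAddCommGroup F] [InnerProductSpace ℂ F] [CompleteSpace F]

lemma IsLPKernel.conj_neg {K : ℝ → ℂ} {B : ℝ} (hK : IsLPKernel K B) :
    IsLPKernel (fun x => star (K (-x))) B where
  diff := (hK.diff.comp differentiable_neg).star
  bound x := by simpa using hK.bound (-x)
  deriv_bound x := by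
    have : deriv (fun x => star (K (-x))) x = star (-deriv K (-x)) := by
      rw [deriv.star, deriv_comp_neg]
    rw [this]; simpa using hK.deriv_bound (-x)
  fourier_bound ξ := by
    have : 𝓕 (fun x => star (K (-x))) ξ = star (𝓕 K ξ) := by
      rw [Real.fourier_eq, Real.fourier_eq, ← integral_neg_eq_self]
      simp only [neg_neg]
      refine Eq.trans ?_ integral_conj
      refine integral_congr_ae (Filter.Eventually.of_forall fun x => ?_)
      simp [Circle.smul_def]
    rw [this]; simpa using hK.fourier_bound ξ

lemma adjoint_lpKernel_neg (K : ℝ → ℂ) (S : Finset ℤ) (A : ℤ → E →L[ℂ] F) (x : ℝ) :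
    (lpKernel K S A (-x)).adjoint = lpKernel (fun x => star (K (-x))) S (fun k => (A k).adjoint) x := by
  have h2 : (starRingEnd ℂ) 2 = 2 := Complex.conj_ofNat 2
  simp only [lpKernel, map_sum, map_smulₛₗ]
  simp [h2]

lemma integral_inner_convOp {κ : ℝ → E →L[ℂ] F} {κ' : ℝ → F →L[ℂ] E} (hκ : IsConvKernel κ)
    (hκ' : IsConvKernel κ') (h : ∀ x, κ' x = (κ (-x)).adjoint) {f : ℝ → E} {G : ℝ → F}
    (hf : IsTame f) (hG : IsTame G) :
    ∫ x, inner ℂ (G x) (convOp κ f x) = ∫ y, inner ℂ (convOp κ' G y) (f y) := by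
  obtain ⟨C, hC⟩ := hκ.bdd
  have hint : Integrable (fun z : ℝ × ℝ => inner ℂ (G z.1) (κ (z.1 - z.2) (f z.2)))
      (volume.prod volume) := by
    have hb : Integrable (fun z : ℝ × ℝ => C * (‖G z.1‖ * ‖f z.2‖)) (volume.prod volume) :=
      (hG.integrable.norm.mul_prod hf.integrable.norm).const_mul C
    refine hb.mono' ?_ (Filter.Eventually.of_forall fun z => ?_)
    · refine AEStronglyMeasurable.inner
        (hG.meas.comp_measurable measurable_fst).aestronglyMeasurable ?_
      exact (ContinuousLinearMap.id ℂ (E →L[ℂ] F)).aestronglyMeasurable_comp₂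
        (hκ.cont.comp (continuous_fst.sub continuous_snd)).aestronglyMeasurable
        (hf.meas.comp_measurable measurable_snd).aestronglyMeasurable
    · refine (norm_inner_le_norm _ _).trans ?_
      calc _ ≤ ‖G z.1‖ * (C * ‖f z.2‖) := by
            gcongr; exact ((κ _).le_opNorm _).trans (by gcongr; exact hC _)
        _ = _ := by ring
  calc _ = ∫ x, ∫ y, inner ℂ (G x) (κ (x - y) (f y)) :=
        integral_congr_ae (Filter.Eventually.of_forall fun x =>
          (integral_inner (hκ.integrable_apply hf x) _).symm)
    _ = ∫ y, ∫ x, inner ℂ (G x) (κ (x - y) (f y)) := integral_integral_swap hint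
    _ = _ := by
        refine integral_congr_ae (Filter.Eventually.of_forall fun y => ?_)
        simp only [convOp]
        rw [← inner_conj_symm, ← integral_inner (hκ'.integrable_apply hG y), ← integral_conj]
        refine integral_congr_ae (Filter.Eventually.of_forall fun x => ?_)
        simp only [inner_conj_symm, h, neg_sub, ContinuousLinearMap.adjoint_inner_left]

end Adjoint

theorem lpKernel_strong_lt_two {p : ℝ} (hp1 : 1 < p) (hp2 : p < 2) (B : ℝ) :
    ∃ C : ℝ≥0∞, C ≠ ∞ ∧ ∀ (E F : Type) [NormedAddCommGroup E] [InnerProductSpace ℂ E]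
      [CompleteSpace E] [NormedAddCommGroup F] [InnerProductSpace ℂ F] [CompleteSpace F]
      (K : ℝ → ℂ) (S : Finset ℤ) (A : ℤ → E →L[ℂ] F), IsLPKernel K B → (∀ k, ‖A k‖ ≤ 1) →
      ∀ f, IsTame f → ∫⁻ x, ‖convOp (lpKernel K S A) f x‖ₑ ^ p ≤ C * ∫⁻ x, ‖f x‖ₑ ^ p := by
  obtain ⟨M, hM0, hM⟩ := lpKernel_fourier_le
  obtain ⟨D, hD, hDK⟩ := lpKernel_hormander
  set A₀ : ℝ≥0∞ := ENNReal.ofReal ((M * B) ^ 2) + D * ENNReal.ofReal B with hA₀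
  have hA₀t : A₀ ≠ ∞ := by finiteness
  obtain ⟨C, hC, h⟩ := restricted_weak_interpolation one_pos hp1 hp2
    (A := 28 * A₀ + 5) (by finiteness)
  refine ⟨C, hC, fun E F _ _ _ _ _ _ K S A hK hA => ?_⟩
  have hκ := hK.isConvKernel S A
  have hL2 : ∀ f : ℝ → E, IsTame f →
      ∫⁻ x, ‖convOp (lpKernel K S A) f x‖ₑ ^ 2 ≤ A₀ * ∫⁻ x, ‖f x‖ₑ ^ 2 := fun f hf =>
    (hκ.lintegral_convOp_sq_le (hM S A hK hA) hf).trans (by gcongr; exact le_self_add)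
  refine h E (fun f x => ‖convOp (lpKernel K S A) f x‖ₑ)
    (fun f hf => (hκ.continuous_convOp hf).enorm.measurable.aemeasurable)
    (fun f g hf hg x => ?_) (fun f hf a ha x => ?_) fun q hq G hG f hf hfG t ht0 htt => ?_
  · rw [hκ.convOp_add hf hg]; exact enorm_add_le _ _
  · have : a • f = (a : ℂ) • f := by ext x; simp [Complex.coe_smul]
    rw [this, IsConvKernel.convOp_smul, enorm_smul, ← ofReal_norm, Complex.norm_real,
      Real.norm_of_nonneg ha.le]
  · rcases hq with rfl | rfl
    · have := hκ.weak_type_one hL2 (A := A₀) (fun c y r hr hy =>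
        (hDK S A hK hA c y r hr hy).trans le_add_self) hG hf hfG ht0 htt
      simpa [ENNReal.rpow_neg_one] using this
    · have h2 : volume {x | t < ‖convOp (lpKernel K S A) f x‖ₑ} ≤
          (∫⁻ x, ‖convOp (lpKernel K S A) f x‖ₑ ^ 2) / t ^ 2 := by
        refine (measure_mono fun x hx => ?_).trans (meas_ge_le_lintegral_div
          ((hκ.continuous_convOp hf).enorm.measurable.pow_const 2).aemeasurable
          (by simpa using ht0) (by simpa using htt))
        have hx' : t < ‖convOp (lpKernel K S A) f x‖ₑ := hx
        change t ^ 2 ≤ ‖convOp (lpKernel K S A) f x‖ₑ ^ 2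
        gcongr
      have h3 : ∫⁻ x, ‖f x‖ₑ ^ 2 ≤ volume G := by
        rw [← lintegral_indicator_one hG]
        refine lintegral_mono fun x => ?_
        have := hfG x
        by_cases hx : x ∈ G
        · rw [indicator_of_mem hx] at this ⊢
          refine pow_le_one₀ zero_le ?_
          rw [← ofReal_norm]; exact ENNReal.ofReal_le_one.2 this
        · rw [indicator_of_notMem hx, norm_le_zero_iff] at this
          simp [this]
      refine h2.trans ?_
      rw [ENNReal.div_eq_inv_mul, show t ^ (-2 : ℝ) = (t ^ 2)⁻¹ by
        rw [ENNReal.rpow_neg, ENNReal.rpow_ofNat], mul_comm (28 * A₀ + 5), mul_assoc]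
      gcongr
      refine (hL2 f hf).trans ?_
      gcongr
      calc A₀ = 1 * A₀ + 0 := by ring
        _ ≤ _ := by gcongr <;> norm_num

theorem lpKernel_strong_two (B : ℝ) :
    ∃ C : ℝ≥0∞, C ≠ ∞ ∧ ∀ (E F : Type) [NormedAddCommGroup E] [InnerProductSpace ℂ E]
      [CompleteSpace E] [NormedAddCommGroup F] [InnerProductSpace ℂ F] [CompleteSpace F]
      (K : ℝ → ℂ) (S : Finset ℤ) (A : ℤ → E →L[ℂ] F), IsLPKernel K B → (∀ k, ‖A k‖ ≤ 1) →
      ∀ f, IsTame f → ∫⁻ x, ‖convOp (lpKernel K S A) f x‖ₑ ^ (2 : ℝ) ≤ C * ∫⁻ x, ‖f x‖ₑ ^ (2 : ℝ) := by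
  obtain ⟨M, hM0, hM⟩ := lpKernel_fourier_le
  refine ⟨ENNReal.ofReal ((M * B) ^ 2), by finiteness, fun E F _ _ _ _ _ _ K S A hK hA f hf => ?_⟩
  simpa [ENNReal.rpow_ofNat] using
    (hK.isConvKernel S A).lintegral_convOp_sq_le (hM S A hK hA) hf

/-- Littlewood-Paley operators with bounded operator coefficients are bounded on `L^p`. -/
theorem lpKernel_strong {p : ℝ} (hp1 : 1 < p) (B : ℝ) :
    ∃ C : ℝ≥0∞, C ≠ ∞ ∧ ∀ (E F : Type) [NormedAddCommGroup E] [InnerProductSpace ℂ E]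
      [CompleteSpace E] [NormedAddCommGroup F] [InnerProductSpace ℂ F] [CompleteSpace F]
      (K : ℝ → ℂ) (S : Finset ℤ) (A : ℤ → E →L[ℂ] F), IsLPKernel K B → (∀ k, ‖A k‖ ≤ 1) →
      ∀ f, IsTame f → ∫⁻ x, ‖convOp (lpKernel K S A) f x‖ₑ ^ p ≤ C * ∫⁻ x, ‖f x‖ₑ ^ p := by
  rcases lt_trichotomy p 2 with hp2 | rfl | hp2
  · exact lpKernel_strong_lt_two hp1 hp2 B
  · exact lpKernel_strong_two B
  have hpq := Real.HolderConjugate.conjExponent hp1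
  set q := p.conjExponent with hq
  have hq2 : q < 2 := by
    rw [hpq.conjugate_eq, div_lt_iff₀ (by linarith)]; linarith
  obtain ⟨C, hC, h⟩ := lpKernel_strong_lt_two hpq.symm.lt hq2 B
  refine ⟨(C ^ (1 / q)) ^ p, ENNReal.rpow_ne_top_of_nonneg hpq.nonneg
    (ENNReal.rpow_ne_top_of_nonneg hpq.symm.one_div_nonneg hC), fun E F _ _ _ _ _ _ K S A hK hA f hf => ?_⟩
  have hκ := hK.isConvKernel S A
  have hκ' := hK.conj_neg.isConvKernel S fun k => (A k).adjoint
  have key := lintegral_rpow_le_of_dual hpq (hκ.continuous_convOp hf).stronglyMeasurable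
    (C := C ^ (1 / q) * (∫⁻ x, ‖f x‖ₑ ^ p) ^ (1 / p)) fun G hG => ?_
  · rw [ENNReal.mul_rpow_of_nonneg _ _ hpq.nonneg, ← ENNReal.rpow_mul (∫⁻ x, ‖f x‖ₑ ^ p),
      one_div_mul_cancel hpq.ne_zero, ENNReal.rpow_one] at key
    exact key
  · rw [integral_inner_convOp hκ hκ' (fun x => (adjoint_lpKernel_neg K S A x).symm) hf hG]
    refine (enorm_integral_inner_le hpq.symm (hκ'.continuous_convOp hG).aestronglyMeasurable
      hf.meas.aestronglyMeasurable).trans ?_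
    calc _ ≤ (C * ∫⁻ x, ‖G x‖ₑ ^ q) ^ (1 / q) * (∫⁻ x, ‖f x‖ₑ ^ p) ^ (1 / p) := by
          gcongr
          · exact hpq.symm.one_div_nonneg
          · exact h F E _ S _ hK.conj_neg (fun k => by simpa using hA k) G hG
      _ = _ := by
          rw [ENNReal.mul_rpow_of_nonneg _ _ hpq.symm.one_div_nonneg]; ring

lemma SchwartzMap.exists_decay (f : 𝓢(ℝ, ℂ)) (n : ℕ) :
    ∃ C : ℝ, 0 ≤ C ∧ (∀ x, ‖f x‖ ≤ C * ((1 + |x|) ^ n)⁻¹) ∧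
      ∀ x, ‖deriv f x‖ ≤ C * ((1 + |x|) ^ n)⁻¹ := by
  set C : ℝ := 2 ^ n * (Finset.Iic (n, 1)).sup (fun m : ℕ × ℕ => SchwartzMap.seminorm ℂ m.1 m.2) f with hC
  have h := fun (j : ℕ) (hj : j ≤ 1) (x : ℝ) =>
    SchwartzMap.one_add_le_sup_seminorm_apply (𝕜 := ℂ) (m := (n, 1)) (k := n) (n := j) le_rfl hj f x
  simp only [← hC, Real.norm_eq_abs] at h
  refine ⟨C, by positivity, fun x => ?_, fun x => ?_⟩ <;>
    rw [← div_eq_mul_inv, le_div_iff₀ (by positivity), mul_comm]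
  · simpa using h 0 zero_le_one x
  · have := h 1 le_rfl x
    rwa [norm_iteratedFDeriv_eq_norm_iteratedDeriv, iteratedDeriv_one] at this

lemma SchwartzMap.isLPKernel (K : 𝓢(ℝ, ℂ)) {a : ℝ} (ha : 0 < a)
    (h : ∀ ξ, |ξ| < a → 𝓕 (K : ℝ → ℂ) ξ = 0) : ∃ B, IsLPKernel K B := by
  obtain ⟨C₁, h1, h1b, h1d⟩ := K.exists_decay 3
  obtain ⟨C₂, h2, h2b, -⟩ := (𝓕 K).exists_decay 1
  rw [SchwartzMap.fourier_coe] at h2b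
  have hpos : ∀ x : ℝ, 0 < 1 + |x| := fun x => by positivity
  refine ⟨C₁ + C₂ * (1 + a⁻¹), K.differentiable, fun x => (h1b x).trans ?_,
    fun x => (h1d x).trans ?_, fun ξ => ?_⟩
  · gcongr
    · have : 0 ≤ C₂ * (1 + a⁻¹) := by positivity
      linarith
    · linarith [abs_nonneg x]
    · norm_num
  · gcongr
    have : 0 ≤ C₂ * (1 + a⁻¹) := by positivity
    linarith
  · rcases lt_or_ge |ξ| a with hξ | hξ
    · rw [h ξ hξ, norm_zero]; positivity
    have hξ0 : 0 < |ξ| := ha.trans_le hξ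
    have key : ((1 + |ξ|) ^ 1)⁻¹ ≤ (1 + a⁻¹) * min |ξ| |ξ|⁻¹ := by
      rw [pow_one]
      rcases min_cases |ξ| |ξ|⁻¹ with ⟨e, -⟩ | ⟨e, -⟩ <;> rw [e]
      · have h1 : ((1 + |ξ|))⁻¹ ≤ 1 := inv_le_one_of_one_le₀ (by linarith)
        have h2 : 1 ≤ a⁻¹ * |ξ| := by
          rw [← inv_mul_cancel₀ ha.ne']; gcongr
        nlinarith
      · have h1 : (1 + |ξ|)⁻¹ ≤ |ξ|⁻¹ := by gcongr; linarith
        have h2 : 0 ≤ a⁻¹ * |ξ|⁻¹ := by positivity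
        linarith
    calc _ ≤ C₂ * ((1 + |ξ|) ^ 1)⁻¹ := h2b ξ
      _ ≤ C₂ * ((1 + a⁻¹) * min |ξ| |ξ|⁻¹) := by gcongr
      _ = (C₂ * (1 + a⁻¹)) * min |ξ| |ξ|⁻¹ := by ring
      _ ≤ _ := by gcongr; linarith

lemma exists_schwartz_fourier_eq {θ : ℝ → ℝ} (h1 : ContDiff ℝ (⊤ : ℕ∞) θ) {a b : ℝ}
    (h2 : ∀ x ∉ Ioo a b, θ x = 0) : ∃ K : 𝓢(ℝ, ℂ), ∀ ξ, 𝓕 (K : ℝ → ℂ) ξ = θ ξ := by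
  have h : HasCompactSupport fun x => (θ x : ℂ) := .intro (isCompact_Icc (a := a) (b := b))
    fun x hx => by rw [h2 x fun h => hx (Ioo_subset_Icc_self h), Complex.ofReal_zero]
  refine ⟨𝓕⁻ (h.toSchwartzMap (Complex.ofRealCLM.contDiff.comp h1)), fun ξ => ?_⟩
  rw [← SchwartzMap.fourier_coe, FourierTransform.fourier_fourierInv_eq]
  rfl

lemma exists_schwartz_bump {a b c d : ℝ} (hab : a < b) (hcd : c < d) :
    ∃ K : 𝓢(ℝ, ℂ), (∀ u ∈ Icc b c, 𝓕 (K : ℝ → ℂ) u = 1) ∧ ∀ u ∉ Ioo a d, 𝓕 (K : ℝ → ℂ) u = 0 := by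
  have h0 (u : ℝ) (hu : u ∉ Ioo a d) : Real.smoothTransition ((u - a) / (b - a)) *
      Real.smoothTransition ((d - u) / (d - c)) = 0 := by
    rw [mul_eq_zero, Real.smoothTransition.zero_iff_nonpos, Real.smoothTransition.zero_iff_nonpos,
      ← not_lt, ← not_lt, ← not_and_or, div_pos_iff_of_pos_right (sub_pos.2 hab),
      div_pos_iff_of_pos_right (sub_pos.2 hcd), sub_pos, sub_pos]
    exact hu
  obtain ⟨K, hK⟩ := exists_schwartz_fourier_eq (θ := fun u => Real.smoothTransition
    ((u - a) / (b - a)) * Real.smoothTransition ((d - u) / (d - c)))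
    ((Real.smoothTransition.contDiff.comp (by fun_prop)).mul
      (Real.smoothTransition.contDiff.comp (by fun_prop))) h0
  refine ⟨K, fun u hu => ?_, fun u hu => ?_⟩
  · rw [hK, Real.smoothTransition.one_of_one_le ((one_le_div (sub_pos.2 hab)).2 (by linarith [hu.1])),
      Real.smoothTransition.one_of_one_le ((one_le_div (sub_pos.2 hcd)).2 (by linarith [hu.2]))]
    simp
  · rw [hK, h0 u hu, Complex.ofReal_zero]

/-- The weight `(1 + |2^{-k} x - m|)⁻¹` adapted to the dyadic interval `dy k m`. -/
noncomputable def chi (k m : ℤ) (x : ℝ) : ℝ≥0∞ :=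
  ENNReal.ofReal ((1 + |(2:ℝ) ^ (-k) * x - m|)⁻¹)

lemma chi_pos (k m : ℤ) (x : ℝ) : chi k m x ≠ 0 := by
  unfold chi
  simp only [ne_eq, ENNReal.ofReal_eq_zero, not_le]
  positivity

lemma chi_le_one (k m : ℤ) (x : ℝ) : chi k m x ≤ 1 := by
  unfold chi
  rw [ENNReal.ofReal_le_one]
  exact inv_le_one_of_one_le₀ (by linarith [abs_nonneg ((2:ℝ) ^ (-k) * x - m)])

lemma chi_ne_top (k m : ℤ) (x : ℝ) : chi k m x ≠ ∞ := ENNReal.ofReal_ne_top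

lemma chi_pow_le_pow (k m : ℤ) (x : ℝ) {a b : ℕ} (h : b ≤ a) : chi k m x ^ a ≤ chi k m x ^ b :=
  pow_le_pow_right_of_le_one' (chi_le_one k m x) h

lemma continuous_chi (k m : ℤ) : Continuous (chi k m) := by
  unfold chi
  refine ENNReal.continuous_ofReal.comp (Continuous.inv₀ (by fun_prop) fun x => ?_)
  positivity

lemma measurable_chi (k m : ℤ) : Measurable (chi k m) := (continuous_chi k m).measurable

lemma chi_le_of_abs_le {k m k' m' : ℤ} {x y c : ℝ} (hc : 0 ≤ c)
    (h : 1 + |(2:ℝ) ^ (-k') * y - m'| ≤ c * (1 + |(2:ℝ) ^ (-k) * x - m|)) :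
    chi k m x ≤ ENNReal.ofReal c * chi k' m' y := by
  unfold chi
  rw [← ENNReal.ofReal_mul hc]
  refine ENNReal.ofReal_le_ofReal ?_
  rw [← div_eq_mul_inv, inv_eq_one_div, div_le_div_iff₀ (by positivity) (by positivity)]
  linarith

lemma mem_dy_abs {k m : ℤ} {x : ℝ} (h : x ∈ dy k m) :
    0 ≤ (2:ℝ) ^ (-k) * x - m ∧ (2:ℝ) ^ (-k) * x - m < 1 := by
  have h2 : (0:ℝ) < 2 ^ (-k) := by positivity
  have h3 : (2:ℝ) ^ (-k) * 2 ^ k = 1 := by rw [← zpow_add₀ two_ne_zero]; simp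
  obtain ⟨ha, hb⟩ := h
  have := mul_le_mul_of_nonneg_left ha h2.le
  have := mul_lt_mul_of_pos_left hb h2
  have e1 : (2:ℝ) ^ (-k) * (m * 2 ^ k) = m := by linear_combination (m:ℝ) * h3
  have e2 : (2:ℝ) ^ (-k) * ((m + 1) * 2 ^ k) = m + 1 := by linear_combination (m + 1:ℝ) * h3
  constructor <;> linarith

lemma chi_le_of_abs_sub_le {k m : ℤ} {x y A : ℝ} (hA : 0 ≤ A)
    (h : |x - y| ≤ A * (2:ℝ) ^ k) : chi k m x ≤ ENNReal.ofReal (1 + A) * chi k m y := by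
  refine chi_le_of_abs_le (by positivity) ?_
  have h2 : (0:ℝ) < 2 ^ (-k) := by positivity
  have h3 : (2:ℝ) ^ (-k) * 2 ^ k = 1 := by rw [← zpow_add₀ two_ne_zero]; simp
  have h4 : |(2:ℝ) ^ (-k) * (y - x)| ≤ A := by
    rw [abs_mul, abs_of_pos h2, abs_sub_comm]
    calc _ ≤ (2:ℝ) ^ (-k) * (A * 2 ^ k) := by gcongr
      _ = A * ((2:ℝ) ^ (-k) * 2 ^ k) := by ring
      _ = A := by rw [h3, mul_one]
  have h5 : |(2:ℝ) ^ (-k) * y - m| ≤ |(2:ℝ) ^ (-k) * (y - x)| + |(2:ℝ) ^ (-k) * x - m| := by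
    refine (congrArg abs ?_).trans_le (abs_add_le ((2:ℝ) ^ (-k) * (y - x)) ((2:ℝ) ^ (-k) * x - m)); ring
  nlinarith [abs_nonneg ((2:ℝ) ^ (-k) * x - m)]

lemma abs_sub_le_of_mem_dy {k m : ℤ} {x y : ℝ} (hx : x ∈ dy k m) (hy : y ∈ dy k m) :
    |x - y| ≤ (2:ℝ) ^ k := by
  obtain ⟨a, b⟩ := hx
  obtain ⟨c, d⟩ := hy
  rw [abs_le]; constructor <;> nlinarith

lemma chi_le_of_mem_dy {k m j : ℤ} {x y : ℝ} (hx : x ∈ dy k j) (hy : y ∈ dy k j) :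
    chi k m x ≤ 2 * chi k m y := by
  have := chi_le_of_abs_sub_le (k := k) (m := m) zero_le_one
    (by rw [one_mul]; exact abs_sub_le_of_mem_dy hx hy)
  norm_num at this
  exact this

/-- A point in a shorter dyadic interval sees the weight through the weight of that interval. -/
lemma chi_mul_chi_le {k m k' m' : ℤ} (hk : k' ≤ k) {x y : ℝ} (hy : y ∈ dy k' m') :
    chi k m x * chi k' m' x ≤ 2 * chi k m y := by
  obtain ⟨h0, h1⟩ := mem_dy_abs hy
  unfold chi
  rw [← ENNReal.ofReal_mul (by positivity), ← ENNReal.ofReal_ofNat 2,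
    ← ENNReal.ofReal_mul (by positivity)]
  refine ENNReal.ofReal_le_ofReal ?_
  set a := |(2:ℝ) ^ (-k) * x - m| with ha
  set b := |(2:ℝ) ^ (-k') * x - m'| with hb
  have hle : (2:ℝ) ^ (-k) ≤ 2 ^ (-k') := zpow_le_zpow_right₀ (by norm_num) (by omega)
  have h2 : (0:ℝ) < 2 ^ (-k) := by positivity
  have h4 : |(2:ℝ) ^ (-k) * (y - x)| ≤ 1 + b := by
    rw [abs_mul, abs_of_pos h2]
    calc _ ≤ (2:ℝ) ^ (-k') * |y - x| := by gcongr
      _ = |((2:ℝ) ^ (-k') * y - m') - ((2:ℝ) ^ (-k') * x - m')| := by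
        rw [← abs_of_pos (show (0:ℝ) < 2 ^ (-k') by positivity), ← abs_mul,
          abs_of_pos (show (0:ℝ) < 2 ^ (-k') by positivity)]; ring_nf
      _ ≤ |((2:ℝ) ^ (-k') * y - m')| + b := abs_sub _ _
      _ ≤ 1 + b := by rw [abs_of_nonneg h0]; linarith
  have h5 : |(2:ℝ) ^ (-k) * y - m| ≤ |(2:ℝ) ^ (-k) * (y - x)| + a := by
    refine (congrArg abs ?_).trans_le (abs_add_le ((2:ℝ) ^ (-k) * (y - x)) ((2:ℝ) ^ (-k) * x - m)); ring
  have ha0 : 0 ≤ a := abs_nonneg _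
  have hb0 : 0 ≤ b := abs_nonneg _
  rw [← mul_inv, ← div_eq_mul_inv, inv_eq_one_div, div_le_div_iff₀ (by positivity) (by positivity)]
  nlinarith [mul_nonneg ha0 hb0]

lemma chi_le_of_dy_subset {k m k0 m0 : ℤ} (h : dy k m ⊆ dy k0 m0) (x : ℝ) :
    chi k m x ≤ 2 * chi k0 m0 x := by
  have hk := le_of_dy_subset h
  have := chi_le_of_abs_le (k := k) (m := m) (k' := k0) (m' := m0) (x := x) (y := x)
    zero_le_two ?_
  · simpa using this
  have h3 : (2:ℝ) ^ (-k) * 2 ^ k = 1 := by rw [← zpow_add₀ two_ne_zero]; simp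
  have hle : (2:ℝ) ^ (-k0) ≤ 2 ^ (-k) := zpow_le_zpow_right₀ (by norm_num) (by omega)
  obtain ⟨h0, h1⟩ := mem_dy_abs (h (left_mem_dy k m))
  have h2 : (0:ℝ) < 2 ^ (-k0) := by positivity
  have h4 : |(2:ℝ) ^ (-k0) * (x - m * 2 ^ k)| ≤ |(2:ℝ) ^ (-k) * x - m| := by
    rw [abs_mul, abs_of_pos h2]
    calc _ ≤ (2:ℝ) ^ (-k) * |x - m * 2 ^ k| := by gcongr
      _ = |(2:ℝ) ^ (-k) * (x - m * 2 ^ k)| := by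
        rw [abs_mul, abs_of_pos (show (0:ℝ) < 2 ^ (-k) by positivity)]
      _ = _ := by congr 1; linear_combination (-(m:ℝ)) * h3
  have h5 : |(2:ℝ) ^ (-k0) * x - m0| ≤ |(2:ℝ) ^ (-k0) * (x - m * 2 ^ k)| +
      |(2:ℝ) ^ (-k0) * (m * 2 ^ k) - m0| := by
    refine (congrArg abs ?_).trans_le (abs_add_le ((2:ℝ) ^ (-k0) * (x - m * 2 ^ k)) ((2:ℝ) ^ (-k0) * (m * 2 ^ k) - m0)); ring
  rw [abs_of_nonneg h0] at h5
  nlinarith [abs_nonneg ((2:ℝ) ^ (-k) * x - m)]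

lemma tsum_int_inv_sq_lt_top :
    ∑' m : ℤ, ENNReal.ofReal (((1 + |(m:ℝ)|) ^ 2)⁻¹) ≠ ∞ := by
  have hs : Summable fun m : ℤ => ((1 + |(m:ℝ)|) ^ 2)⁻¹ := by
    refine Summable.of_nat_of_neg ?_ ?_
    all_goals
      have := (summable_nat_add_iff 1).2 (Real.summable_nat_pow_inv (p := 2).2 one_lt_two)
      refine this.congr fun n => ?_
      simp [add_comm]
  rw [← ENNReal.ofReal_tsum_of_nonneg (fun _ => by positivity) hs]
  exact ENNReal.ofReal_ne_top

/-- The constant `4 ∑ (1 + |m|)⁻²`. -/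
noncomputable def chiC : ℝ≥0 :=
  (4 * ∑' m : ℤ, ENNReal.ofReal (((1 + |(m:ℝ)|) ^ 2)⁻¹)).toNNReal

lemma coe_chiC : (chiC : ℝ≥0∞) = 4 * ∑' m : ℤ, ENNReal.ofReal (((1 + |(m:ℝ)|) ^ 2)⁻¹) := by
  rw [chiC, ENNReal.coe_toNNReal]
  exact ENNReal.mul_ne_top (by norm_num) tsum_int_inv_sq_lt_top

lemma chi_sq_le_of_mem_dy {k m j : ℤ} {x : ℝ} (hx : x ∈ dy k j) :
    chi k m x ^ 2 ≤ 4 * ENNReal.ofReal (((1 + |((m - j : ℤ):ℝ)|) ^ 2)⁻¹) := by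
  obtain ⟨h0, h1⟩ := mem_dy_abs hx
  unfold chi
  rw [← ENNReal.ofReal_pow (by positivity), ← ENNReal.ofReal_ofNat 4,
    ← ENNReal.ofReal_mul (by positivity)]
  refine ENNReal.ofReal_le_ofReal ?_
  set a := |(2:ℝ) ^ (-k) * x - m| with ha
  have : |((m - j : ℤ):ℝ)| ≤ a + 1 := by
    have := abs_sub ((2:ℝ) ^ (-k) * x - j) ((2:ℝ) ^ (-k) * x - m)
    rw [abs_of_nonneg h0] at this
    push_cast
    calc _ = |((2:ℝ) ^ (-k) * x - j) - ((2:ℝ) ^ (-k) * x - m)| := by ring_nf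
      _ ≤ _ := by linarith
  have hb := abs_nonneg ((m - j : ℤ):ℝ)
  set b := |((m - j : ℤ):ℝ)|
  have ha0 : 0 ≤ a := abs_nonneg _
  rw [inv_pow, ← div_eq_mul_inv, inv_eq_one_div, div_le_div_iff₀ (by positivity) (by positivity)]
  nlinarith

lemma tsum_chi_sq_le (k : ℤ) (x : ℝ) : ∑' m : ℤ, chi k m x ^ 2 ≤ chiC := by
  have hx := mem_dy_floor k x
  rw [coe_chiC, ← ENNReal.tsum_mul_left]
  refine (ENNReal.tsum_le_tsum fun m => chi_sq_le_of_mem_dy hx).trans_eq ?_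
  exact (Equiv.subRight ⌊x / 2 ^ k⌋).tsum_eq
    (fun m : ℤ => 4 * ENNReal.ofReal (((1 + |(m:ℝ)|) ^ 2)⁻¹))

lemma lintegral_chi_sq_le (k m : ℤ) :
    ∫⁻ x, chi k m x ^ 2 ≤ chiC * ENNReal.ofReal (2 ^ k) := by
  rw [lintegral_eq_tsum_dy k, coe_chiC, mul_assoc, ← ENNReal.tsum_mul_right,
    ← ENNReal.tsum_mul_left]
  calc _ ≤ ∑' j : ℤ, 4 * (ENNReal.ofReal (((1 + |((m - j : ℤ):ℝ)|) ^ 2)⁻¹) *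
        ENNReal.ofReal (2 ^ k)) := ENNReal.tsum_le_tsum fun j => by
        refine (setLIntegral_mono' (measurableSet_dy k j)
          fun x hx => chi_sq_le_of_mem_dy hx).trans ?_
        rw [setLIntegral_const, volume_dy, mul_assoc]
    _ = _ := (Equiv.subLeft m).tsum_eq (fun m : ℤ => 4 * (ENNReal.ofReal (((1 + |(m:ℝ)|) ^ 2)⁻¹) *
        ENNReal.ofReal (2 ^ k)))

/-- The character `t ↦ exp (2πit)`, as a complex number. -/
noncomputable def ech (t : ℝ) : ℂ := (Real.fourierChar t : ℂ)

lemma ech_add (s t : ℝ) : ech (s + t) = ech s * ech t := by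
  unfold ech; rw [AddChar.map_add_eq_mul, Circle.coe_mul]
lemma norm_ech (t : ℝ) : ‖ech t‖ = 1 := Circle.norm_coe _
lemma enorm_ech (t : ℝ) : ‖ech t‖ₑ = 1 := by rw [← ofReal_norm, norm_ech, ENNReal.ofReal_one]
lemma continuous_ech : Continuous ech := continuous_subtype_val.comp Real.continuous_fourierChar
lemma fourier_eq_ech (f : ℝ → ℂ) (ξ : ℝ) : 𝓕 f ξ = ∫ x, ech (-(x * ξ)) * f x := by
  rw [Real.fourier_real_eq]; rfl

/-- A tile in the phase plane: time interval `dy k m`, frequency interval `dy (-k) n`. -/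
@[ext] structure Tile where
  (k m n : ℤ)

noncomputable instance : DecidableEq Tile := Classical.decEq _

namespace Tile

/-- Time interval of a tile. -/
def I (s : Tile) : Set ℝ := dy s.k s.m
/-- Frequency interval of a tile. -/
def ω (s : Tile) : Set ℝ := dy (-s.k) s.n
/-- Lower half of the frequency interval. -/
def ω₁ (s : Tile) : Set ℝ := dy (-s.k - 1) (2 * s.n)
/-- Upper half of the frequency interval. -/
def ω₂ (s : Tile) : Set ℝ := dy (-s.k - 1) (2 * s.n + 1)
/-- Length of the time interval. -/
noncomputable def len (s : Tile) : ℝ≥0∞ := ENNReal.ofReal (2 ^ s.k)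

lemma ω₁_subset (s : Tile) : s.ω₁ ⊆ s.ω := dy_left_child _ _
lemma ω₂_subset (s : Tile) : s.ω₂ ⊆ s.ω := dy_right_child _ _
lemma disjoint_ω (s : Tile) : Disjoint s.ω₁ s.ω₂ := dy_disjoint (by omega)
lemma measurableSet_ω₂ (s : Tile) : MeasurableSet s.ω₂ := measurableSet_dy _ _
lemma measurableSet_I (s : Tile) : MeasurableSet s.I := measurableSet_dy _ _
lemma volume_I (s : Tile) : volume s.I = s.len := volume_dy _ _
lemma len_ne_zero (s : Tile) : s.len ≠ 0 := by
  unfold len; simp only [ne_eq, ENNReal.ofReal_eq_zero, not_le]; positivity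
lemma len_ne_top (s : Tile) : s.len ≠ ⊤ := ENNReal.ofReal_ne_top

lemma eq_of_ω {s s' : Tile} (h : s.ω = s'.ω) : s.k = s'.k ∧ s.n = s'.n := by
  have := dy_inj h; exact ⟨by omega, this.2⟩

/-- Frequency intervals of strictly different scales that meet are nested in a half. -/
lemma subset_half {s s' : Tile} (hk : s'.k < s.k) {x : ℝ} (h : x ∈ s.ω) (h' : x ∈ s'.ω) :
    (s.ω ⊆ s'.ω₁ ∧ x ∈ s'.ω₁) ∨ (s.ω ⊆ s'.ω₂ ∧ x ∈ s'.ω₂) := by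
  have hx := mem_dy_floor (-s'.k - 1) x
  rcases dy_subset_or_disjoint (k := -s'.k - 1) (k' := -s'.k) (m := ⌊x / 2 ^ (-s'.k - 1)⌋)
    (m' := s'.n) (by omega) with h1 | h1
  · have key : ⌊x / (2:ℝ) ^ (-s'.k - 1)⌋ = 2 * s'.n ∨ ⌊x / (2:ℝ) ^ (-s'.k - 1)⌋ = 2 * s'.n + 1 := by
      set j := ⌊x / (2:ℝ) ^ (-s'.k - 1)⌋
      obtain ⟨a, b⟩ := h'
      obtain ⟨c, d⟩ := hx
      have h2 : (2:ℝ) ^ (-s'.k) = 2 * 2 ^ (-s'.k - 1) := by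
        rw [zpow_sub₀ two_ne_zero]; simp; ring
      have hp : (0:ℝ) < 2 ^ (-s'.k - 1) := by positivity
      rw [h2] at a b
      have e1 : (j:ℝ) < 2 * s'.n + 2 := by nlinarith
      have e2 : (2 * s'.n:ℝ) < j + 1 := by nlinarith
      have e1' : j < 2 * s'.n + 2 := by exact_mod_cast e1
      have e2' : 2 * s'.n < j + 1 := by exact_mod_cast e2
      omega
    rcases key with e | e
    · rw [e] at hx
      exact Or.inl ⟨dy_subset_of_le (by omega) h hx, hx⟩
    · rw [e] at hx
      exact Or.inr ⟨dy_subset_of_le (by omega) h hx, hx⟩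
  · exact absurd h' (disjoint_left.1 h1 hx)

lemma meet_cases {s s' : Tile} (h : ¬ Disjoint s.ω₁ s'.ω₁) :
    s.ω = s'.ω ∨ (s'.k < s.k ∧ s.ω ⊆ s'.ω₁) ∨ (s.k < s'.k ∧ s'.ω ⊆ s.ω₁) := by
  obtain ⟨x, hx, hx'⟩ := not_disjoint_iff.1 h
  rcases lt_trichotomy s.k s'.k with hk | hk | hk
  · refine Or.inr (Or.inr ⟨hk, ?_⟩)
    rcases subset_half hk (s'.ω₁_subset hx') (s.ω₁_subset hx) with h1 | h1
    · exact h1.1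
    · exact absurd h1.2 (disjoint_left.1 s.disjoint_ω hx)
  · left
    have a := s.ω₁_subset hx
    have b := s'.ω₁_subset hx'
    unfold ω at *
    rw [hk] at a ⊢
    rw [dy_eq_of_mem a b]
  · refine Or.inr (Or.inl ⟨hk, ?_⟩)
    rcases subset_half hk (s.ω₁_subset hx) (s'.ω₁_subset hx') with h1 | h1
    · exact h1.1
    · exact absurd h1.2 (disjoint_left.1 s'.disjoint_ω hx')

lemma eq_of_mem_ω {s s' : Tile} {ξ : ℝ} (hk : s.k = s'.k) (h : ξ ∈ s.ω) (h' : ξ ∈ s'.ω) :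
    s.n = s'.n := by
  unfold ω at *
  rw [hk] at h
  exact dy_eq_of_mem h h'

lemma sum_le_tsum_of_fixed {T : Finset Tile} {k : ℤ} (hk : ∀ s ∈ T, s.k = k)
    (hn : ∀ s ∈ T, ∀ s' ∈ T, s.n = s'.n) (f : ℤ → ℝ≥0∞) :
    ∑ s ∈ T, f s.m ≤ ∑' m, f m := by
  have hinj : Set.InjOn Tile.m (T : Set Tile) := by
    intro s hs s' hs' h
    exact Tile.ext ((hk s hs).trans (hk s' hs').symm) h (hn s hs s' hs')
  rw [← Finset.sum_image (f := f) hinj]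
  exact ENNReal.sum_le_tsum _

/-- The weight adapted to the time interval of a tile. -/
noncomputable def chi (s : Tile) (x : ℝ) : ℝ≥0∞ := _root_.chi s.k s.m x

/-- The `L^∞`-normalised wave packet obtained from `φ`. -/
noncomputable def packet (φ : ℝ → ℂ) (s : Tile) (x : ℝ) : ℂ :=
  φ ((2:ℝ) ^ (-s.k) * x - s.m) * ech ((2:ℝ) ^ (-s.k) * (s.n + 1 / 4) * x)

end Tile

/-- Continuous, rapidly decaying, with Fourier support in `[-1/8, 1/8]`. -/
structure IsPacket (φ : ℝ → ℂ) (C : ℝ≥0) : Prop where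
  cont : Continuous φ
  decay : ∀ x, ‖φ x‖ₑ ≤ C * chi 0 0 x ^ 20
  fourier : ∀ ξ, 1 / 8 < |ξ| → 𝓕 φ ξ = 0

lemma chi_zero_comp (k m : ℤ) (x : ℝ) : chi 0 0 ((2:ℝ) ^ (-k) * x - m) = chi k m x := by
  simp [chi]

/-- Plancherel orthogonality. -/
lemma integral_inner_eq_zero_of_fourier {u v : ℝ → ℂ} (hu : Integrable u) (hu2 : MemLp u 2 volume)
    (hv : Integrable v) (hv2 : MemLp v 2 volume) (h : ∀ ξ, 𝓕 u ξ = 0 ∨ 𝓕 v ξ = 0) :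
    ∫ x, inner ℂ (u x) (v x) = 0 := by
  have h1 := MeasureTheory.Lp.inner_fourier_eq (hu2.toLp u) (hv2.toLp v)
  rw [L2.inner_def, L2.inner_def] at h1
  have e2 : ∫ x, inner ℂ (hu2.toLp u x) (hv2.toLp v x) = ∫ x, inner ℂ (u x) (v x) := by
    refine integral_congr_ae ?_
    filter_upwards [hu2.coeFn_toLp, hv2.coeFn_toLp] with x a b
    rw [a, b]
  rw [← e2, ← h1]
  refine integral_eq_zero_of_ae ?_
  filter_upwards [fourier_toLp_ae hu hu2, fourier_toLp_ae hv hv2] with x a b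
  rw [a, b]
  rcases h x with h | h <;> simp [h]

namespace IsPacket
variable {φ : ℝ → ℂ} {C : ℝ≥0}

lemma continuous_packet (hφ : IsPacket φ C) (s : Tile) : Continuous (s.packet φ) := by
  unfold Tile.packet
  have := hφ.cont
  exact (this.comp (by fun_prop)).mul (continuous_ech.comp (by fun_prop))

lemma enorm_packet_le (hφ : IsPacket φ C) (s : Tile) (x : ℝ) :
    ‖s.packet φ x‖ₑ ≤ C * s.chi x ^ 20 := by
  unfold Tile.packet Tile.chi
  rw [enorm_mul, ← chi_zero_comp, enorm_ech, mul_one]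
  exact hφ.decay _

lemma lintegral_packet_le (hφ : IsPacket φ C) (s : Tile) :
    ∫⁻ x, ‖s.packet φ x‖ₑ ≤ C * (chiC * s.len) := by
  calc _ ≤ ∫⁻ x, C * _root_.chi s.k s.m x ^ 2 := lintegral_mono fun x =>
        (hφ.enorm_packet_le s x).trans (mul_le_mul_right (chi_pow_le_pow _ _ _ (by norm_num)) _)
    _ = C * ∫⁻ x, _root_.chi s.k s.m x ^ 2 := lintegral_const_mul' _ _ ENNReal.coe_ne_top
    _ ≤ _ := by gcongr; exact lintegral_chi_sq_le _ _

lemma integrable_packet (hφ : IsPacket φ C) (s : Tile) : Integrable (s.packet φ) :=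
  ⟨(hφ.continuous_packet s).aestronglyMeasurable, (hφ.lintegral_packet_le s).trans_lt
    (ENNReal.mul_lt_top ENNReal.coe_lt_top (ENNReal.mul_lt_top ENNReal.coe_lt_top
      s.len_ne_top.lt_top))⟩

lemma norm_packet_le (hφ : IsPacket φ C) (s : Tile) (x : ℝ) : ‖s.packet φ x‖ ≤ C := by
  have h := hφ.enorm_packet_le s x
  have h2 : ‖s.packet φ x‖ₑ ≤ (C : ℝ≥0∞) := h.trans
    (mul_le_of_le_one_right zero_le (pow_le_one₀ zero_le (chi_le_one _ _ _)))
  exact_mod_cast h2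

lemma memLp_packet (hφ : IsPacket φ C) (s : Tile) : MemLp (s.packet φ) 2 volume := by
  have hm := (hφ.continuous_packet s).aestronglyMeasurable (μ := volume)
  refine (memLp_two_iff_integrable_sq_norm hm).2 (((hφ.integrable_packet s).norm.const_mul C).mono'
    (hm.norm.pow 2) (Filter.Eventually.of_forall fun x => ?_))
  rw [Real.norm_of_nonneg (by positivity), sq]
  exact mul_le_mul_of_nonneg_right (hφ.norm_packet_le s x) (norm_nonneg _)

lemma fourier_packet (φ : ℝ → ℂ) (s : Tile) (ζ : ℝ) : ∃ c : ℂ,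
    𝓕 (s.packet φ) ζ = c * 𝓕 φ ((2:ℝ) ^ s.k * ζ - (s.n + 1 / 4)) := by
  set v := (2:ℝ) ^ s.k * ζ - (s.n + 1 / 4) with hv
  refine ⟨(2:ℝ) ^ s.k * ech (-(s.m * v)), ?_⟩
  have h3 : (2:ℝ) ^ (-s.k) * 2 ^ s.k = 1 := by rw [← zpow_add₀ two_ne_zero]; simp
  set h : ℝ → ℂ := fun u => ech (-(s.m * v)) * (ech (-(u * v)) * φ u) with hh
  have e : ∀ x : ℝ, ech (-(x * ζ)) * s.packet φ x = h ((2:ℝ) ^ (-s.k) * x - s.m) := by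
    intro x
    have : ech (-(x * ζ)) * ech ((2:ℝ) ^ (-s.k) * (s.n + 1 / 4) * x)
        = ech (-(s.m * v)) * ech (-(((2:ℝ) ^ (-s.k) * x - s.m) * v)) := by
      rw [← ech_add, ← ech_add]
      congr 1
      rw [hv]
      linear_combination (x * ζ) * h3
    simp only [hh, Tile.packet]
    linear_combination φ ((2:ℝ) ^ (-s.k) * x - s.m) * this
  rw [fourier_eq_ech, fourier_eq_ech]
  simp_rw [e]
  rw [Measure.integral_comp_mul_left (fun x => h (x - s.m)),
    integral_sub_right_eq_self (μ := volume) h, hh, integral_const_mul]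
  rw [zpow_neg, inv_inv, abs_of_pos (by positivity), Complex.real_smul]
  push_cast; ring

lemma fourier_packet_eq_zero (hφ : IsPacket φ C) (s : Tile) {ζ : ℝ}
    (h : 1 / 8 < |(2:ℝ) ^ s.k * ζ - (s.n + 1 / 4)|) : 𝓕 (s.packet φ) ζ = 0 := by
  obtain ⟨c, hc⟩ := fourier_packet φ s ζ
  rw [hc, hφ.fourier _ h, mul_zero]

lemma fourier_packet_eq_zero_of_notMem (hφ : IsPacket φ C) (s : Tile) {ζ : ℝ}
    (h : ζ ∉ s.ω₁) : 𝓕 (s.packet φ) ζ = 0 := by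
  refine hφ.fourier_packet_eq_zero s ?_
  by_contra! hc
  apply h
  rw [abs_le] at hc
  have h2 : (2:ℝ) ^ s.k * 2 ^ (-s.k) = 1 := by rw [← zpow_add₀ two_ne_zero]; simp
  have h3 : (2:ℝ) ^ (-s.k - 1) = 2 ^ (-s.k) / 2 := by rw [zpow_sub₀ two_ne_zero]; simp
  have hp : (0:ℝ) < 2 ^ (-s.k) := by positivity
  have a := mul_le_mul_of_nonneg_left hc.1 hp.le
  have b := mul_le_mul_of_nonneg_left hc.2 hp.le
  have e : (2:ℝ) ^ (-s.k) * (2 ^ s.k * ζ - (s.n + 1 / 4)) = ζ - 2 ^ (-s.k) * (s.n + 1 / 4) := by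
    linear_combination ζ * h2
  rw [e] at a b
  unfold Tile.ω₁
  rw [mem_dy', h3]
  push_cast
  constructor <;> nlinarith

end IsPacket

namespace IsPacket
variable {φ : ℝ → ℂ} {C : ℝ≥0}

lemma integrable_inner (hφ : IsPacket φ C) (s s' : Tile) :
    Integrable fun x => inner ℂ (s.packet φ x) (s'.packet φ x) := by
  refine (L2.integrable_inner (𝕜 := ℂ) ((hφ.memLp_packet s).toLp _)
    ((hφ.memLp_packet s').toLp _)).congr ?_
  filter_upwards [(hφ.memLp_packet s).coeFn_toLp, (hφ.memLp_packet s').coeFn_toLp] with x a b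
  rw [a, b]

lemma inner_eq_zero_of_disjoint (hφ : IsPacket φ C) {s s' : Tile} (h : Disjoint s.ω₁ s'.ω₁) :
    ∫ x, inner ℂ (s.packet φ x) (s'.packet φ x) = 0 := by
  refine integral_inner_eq_zero_of_fourier (hφ.integrable_packet s) (hφ.memLp_packet s)
    (hφ.integrable_packet s') (hφ.memLp_packet s') fun ξ => ?_
  by_cases hξ : ξ ∈ s.ω₁
  · exact Or.inr (hφ.fourier_packet_eq_zero_of_notMem s' (disjoint_left.1 h hξ))
  · exact Or.inl (hφ.fourier_packet_eq_zero_of_notMem s hξ)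

lemma enorm_inner_le (hφ : IsPacket φ C) (s s' : Tile) :
    ‖∫ x, inner ℂ (s.packet φ x) (s'.packet φ x)‖ₑ ≤
      C ^ 2 * ∫⁻ x, s.chi x ^ 20 * s'.chi x ^ 20 := by
  refine (enorm_integral_le_lintegral_enorm _).trans ?_
  rw [← lintegral_const_mul' _ _ (by finiteness)]
  refine lintegral_mono fun x => ?_
  have h1 : ‖inner ℂ (s.packet φ x) (s'.packet φ x)‖ₑ ≤ ‖s.packet φ x‖ₑ * ‖s'.packet φ x‖ₑ := by
    rw [← ofReal_norm, ← ofReal_norm, ← ofReal_norm, ← ENNReal.ofReal_mul (norm_nonneg _)]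
    exact ENNReal.ofReal_le_ofReal (norm_inner_le_norm _ _)
  calc _ ≤ _ := h1
    _ ≤ (C * s.chi x ^ 20) * (C * s'.chi x ^ 20) := by
        gcongr <;> exact hφ.enorm_packet_le _ _
    _ = _ := by ring

end IsPacket

lemma lintegral_chi_mul_chi_le {s s' : Tile} (hk : s'.k ≤ s.k) :
    ∫⁻ x, s.chi x ^ 20 * s'.chi x ^ 20 ≤ 2 ^ 18 * chiC * ∫⁻ y in s'.I, s.chi y ^ 18 := by
  have key : ∀ y ∈ s'.I, ∫⁻ x, s.chi x ^ 20 * s'.chi x ^ 20 ≤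
      2 ^ 18 * chiC * s'.len * s.chi y ^ 18 := by
    intro y hy
    calc _ ≤ ∫⁻ x, 2 ^ 18 * s.chi y ^ 18 * s'.chi x ^ 2 := by
          refine lintegral_mono fun x => ?_
          calc s.chi x ^ 20 * s'.chi x ^ 20 = (s.chi x * s'.chi x) ^ 18 * (s.chi x ^ 2 * s'.chi x ^ 2) := by
                ring
            _ ≤ (2 * s.chi y) ^ 18 * (1 * s'.chi x ^ 2) := by
                refine mul_le_mul' (pow_le_pow_left₀ zero_le (chi_mul_chi_le hk hy) _)
                  (mul_le_mul_left (pow_le_one₀ zero_le (chi_le_one _ _ _)) _)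
            _ = _ := by ring
      _ = 2 ^ 18 * s.chi y ^ 18 * ∫⁻ x, s'.chi x ^ 2 := lintegral_const_mul' _ _
          (ENNReal.mul_ne_top (by finiteness) (ENNReal.pow_ne_top (chi_ne_top _ _ _)))
      _ ≤ 2 ^ 18 * s.chi y ^ 18 * (chiC * s'.len) := by gcongr; exact lintegral_chi_sq_le _ _
      _ = _ := by ring
  have h2 : (∫⁻ x, s.chi x ^ 20 * s'.chi x ^ 20) * s'.len ≤
      (2 ^ 18 * chiC * ∫⁻ y in s'.I, s.chi y ^ 18) * s'.len := by
    calc _ = ∫⁻ y in s'.I, ∫⁻ x, s.chi x ^ 20 * s'.chi x ^ 20 := by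
          rw [setLIntegral_const, s'.volume_I]
      _ ≤ ∫⁻ y in s'.I, 2 ^ 18 * chiC * s'.len * s.chi y ^ 18 :=
          setLIntegral_mono' s'.measurableSet_I key
      _ = 2 ^ 18 * chiC * s'.len * ∫⁻ y in s'.I, s.chi y ^ 18 := lintegral_const_mul' _ _
          (ENNReal.mul_ne_top (by finiteness) s'.len_ne_top)
      _ = _ := by ring
  exact (ENNReal.mul_le_mul_iff_left s'.len_ne_zero s'.len_ne_top).1 h2

/-- Two packets of nested frequency. -/
lemma IsPacket.enorm_inner_le_setLIntegral {φ : ℝ → ℂ} {C : ℝ≥0} (hφ : IsPacket φ C) {s s' : Tile}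
    (hk : s'.k ≤ s.k) :
    ‖∫ x, inner ℂ (s.packet φ x) (s'.packet φ x)‖ₑ ≤
      (C ^ 2 * 2 ^ 18 * chiC) * ∫⁻ y in s'.I, s.chi y ^ 18 := by
  refine (hφ.enorm_inner_le s s').trans ?_
  rw [mul_assoc, mul_assoc]
  gcongr
  rw [← mul_assoc]
  exact lintegral_chi_mul_chi_le hk

/-- The wave packet sum. -/
noncomputable def packetSum (φ : ℝ → ℂ) (a : Tile → ℂ) (T : Finset Tile) (x : ℝ) : ℂ :=
  ∑ s ∈ T, a s * s.packet φ x

namespace IsPacket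
variable {φ : ℝ → ℂ} {C : ℝ≥0}

lemma continuous_packetSum (hφ : IsPacket φ C) (a : Tile → ℂ) (T : Finset Tile) :
    Continuous (packetSum φ a T) :=
  continuous_finsetSum _ fun s _ => continuous_const.mul (hφ.continuous_packet s)

lemma integrable_packetSum (hφ : IsPacket φ C) (a : Tile → ℂ) (T : Finset Tile) :
    Integrable (packetSum φ a T) :=
  integrable_finsetSum _ fun s _ => (hφ.integrable_packet s).const_mul (a s)

lemma memLp_packetSum (hφ : IsPacket φ C) (a : Tile → ℂ) (T : Finset Tile) :
    MemLp (packetSum φ a T) 2 volume :=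
  memLp_finsetSum _ fun s _ => (hφ.memLp_packet s).const_mul (a s)

lemma lintegral_packetSum_sq_le (hφ : IsPacket φ C) (a : Tile → ℂ) (T : Finset Tile) :
    ∫⁻ x, ‖packetSum φ a T x‖ₑ ^ 2 ≤ ∑ s ∈ T, ∑ s' ∈ T, ‖a s‖ₑ * ‖a s'‖ₑ *
      ‖∫ x, inner ℂ (s.packet φ x) (s'.packet φ x)‖ₑ := by
  have hL := hφ.memLp_packetSum a T
  have h1 : ∫⁻ x, ‖packetSum φ a T x‖ₑ ^ 2 =
      ‖∫ x, inner ℂ (packetSum φ a T x) (packetSum φ a T x)‖ₑ := by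
    have hi : Integrable fun x => ‖packetSum φ a T x‖ ^ 2 :=
      (memLp_two_iff_integrable_sq_norm hL.1).1 hL
    have e : (fun x => inner ℂ (packetSum φ a T x) (packetSum φ a T x)) =
        fun x => (((‖packetSum φ a T x‖ ^ 2 : ℝ)) : ℂ) := by
      ext x; rw [inner_self_eq_norm_sq_to_K]; norm_cast
    rw [e, integral_complex_ofReal, ← ofReal_norm, Complex.norm_real,
      Real.norm_of_nonneg (integral_nonneg fun x => by positivity),
      ofReal_integral_eq_lintegral_ofReal hi (Filter.Eventually.of_forall fun x => by positivity)]
    refine lintegral_congr fun x => ?_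
    rw [← ofReal_norm, ENNReal.ofReal_pow (norm_nonneg _)]
  have h2 : ∫ x, inner ℂ (packetSum φ a T x) (packetSum φ a T x) =
      ∑ s ∈ T, ∑ s' ∈ T, (starRingEnd ℂ (a s) * a s') *
        ∫ x, inner ℂ (s.packet φ x) (s'.packet φ x) := by
    have e : ∀ x, inner ℂ (packetSum φ a T x) (packetSum φ a T x) =
        ∑ s ∈ T, ∑ s' ∈ T, (starRingEnd ℂ (a s) * a s') *
          inner ℂ (s.packet φ x) (s'.packet φ x) := by
      intro x
      unfold packetSum
      rw [sum_inner]
      refine Finset.sum_congr rfl fun s _ => ?_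
      rw [inner_sum]
      refine Finset.sum_congr rfl fun s' _ => ?_
      simp only [RCLike.inner_apply, map_mul]; ring
    simp_rw [e]
    rw [integral_finsetSum _ fun s _ => integrable_finsetSum _ fun s' _ =>
      (hφ.integrable_inner s s').const_mul _]
    refine Finset.sum_congr rfl fun s _ => ?_
    rw [integral_finsetSum _ fun s' _ => (hφ.integrable_inner s s').const_mul _]
    exact Finset.sum_congr rfl fun s' _ => integral_const_mul _ _
  rw [h1, h2]
  refine (enorm_sum_le _ _).trans (Finset.sum_le_sum fun s _ => (enorm_sum_le _ _).trans
    (Finset.sum_le_sum fun s' _ => ?_))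
  rw [enorm_mul, enorm_mul]
  gcongr
  exact (by rw [← ofReal_norm, ← ofReal_norm, RCLike.norm_conj])

/-- Schur bound for packets with the same frequency interval. -/
lemma sum_inner_same_le (hφ : IsPacket φ C) (T : Finset Tile) (s : Tile)
    (hT : ∀ s' ∈ T, s'.k = s.k ∧ s'.n = s.n) :
    ∑ s' ∈ T, ‖∫ x, inner ℂ (s.packet φ x) (s'.packet φ x)‖ₑ ≤ (C ^ 2 * chiC ^ 2) * s.len := by
  calc _ ≤ ∑ s' ∈ T, C ^ 2 * ∫⁻ x, s.chi x ^ 2 * s'.chi x ^ 2 := by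
        refine Finset.sum_le_sum fun s' _ => (hφ.enorm_inner_le s s').trans ?_
        exact mul_le_mul_right (lintegral_mono fun x => mul_le_mul'
          (chi_pow_le_pow _ _ _ (by norm_num)) (chi_pow_le_pow _ _ _ (by norm_num))) _
    _ = C ^ 2 * ∫⁻ x, ∑ s' ∈ T, s.chi x ^ 2 * s'.chi x ^ 2 := by
        rw [← Finset.mul_sum, lintegral_finsetSum]
        intro s' _
        exact ((measurable_chi _ _).pow_const 2).mul ((measurable_chi _ _).pow_const 2)
    _ ≤ C ^ 2 * ∫⁻ x, s.chi x ^ 2 * chiC := by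
        gcongr with x
        rw [← Finset.mul_sum]
        gcongr
        have := Tile.sum_le_tsum_of_fixed (T := T) (k := s.k) (fun s' h => (hT s' h).1)
          (fun s' h s'' h' => (hT s' h).2.trans (hT s'' h').2.symm) (fun m => _root_.chi s.k m x ^ 2)
        refine le_trans (le_of_eq ?_) (this.trans (tsum_chi_sq_le s.k x))
        refine Finset.sum_congr rfl fun s' h => ?_
        rw [Tile.chi, (hT s' h).1]
    _ = C ^ 2 * ((∫⁻ x, s.chi x ^ 2) * chiC) := by
        rw [lintegral_mul_const' _ _ ENNReal.coe_ne_top]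
    _ ≤ C ^ 2 * ((chiC * s.len) * chiC) := by gcongr; exact lintegral_chi_sq_le _ _
    _ = _ := by ring

lemma mul_le_half_sq (x y : ℝ≥0∞) : x * y ≤ (x ^ 2 + y ^ 2) := by
  rcases le_total x y with h | h
  · calc x * y ≤ y * y := by gcongr
      _ ≤ _ := by rw [← sq]; exact le_add_self
  · calc x * y ≤ x * x := by gcongr
      _ ≤ _ := by rw [← sq]; exact le_self_add

/-- Diagonal part of the `T T*` argument: pairs with equal frequency interval. -/
lemma sum_same_le (hφ : IsPacket φ C) (a : Tile → ℂ) (T : Finset Tile) :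
    ∑ s ∈ T, ∑ s' ∈ T with s'.k = s.k ∧ s'.n = s.n, ‖a s‖ₑ * ‖a s'‖ₑ *
      ‖∫ x, inner ℂ (s.packet φ x) (s'.packet φ x)‖ₑ ≤
    (2 * C ^ 2 * chiC ^ 2) * ∑ s ∈ T, s.len * ‖a s‖ₑ ^ 2 := by
  set ip : Tile → Tile → ℝ≥0∞ := fun s s' => ‖∫ x, inner ℂ (s.packet φ x) (s'.packet φ x)‖ₑ with hip
  have hsymm : ∀ s s', ip s s' = ip s' s := by
    intro s s'
    simp only [hip]
    rw [← ofReal_norm, ← ofReal_norm, ← RCLike.norm_conj, ← integral_conj]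
    simp only [inner_conj_symm]
  have hA : ∑ s ∈ T, ∑ s' ∈ T with s'.k = s.k ∧ s'.n = s.n, ‖a s‖ₑ ^ 2 * ip s s' ≤
      (C ^ 2 * chiC ^ 2) * ∑ s ∈ T, s.len * ‖a s‖ₑ ^ 2 := by
    rw [Finset.mul_sum]
    refine Finset.sum_le_sum fun s _ => ?_
    rw [← Finset.mul_sum]
    calc _ ≤ ‖a s‖ₑ ^ 2 * ((C ^ 2 * chiC ^ 2) * s.len) := by
          gcongr; exact hφ.sum_inner_same_le _ s fun s' h => (Finset.mem_filter.1 h).2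
      _ = _ := by ring
  have hB : ∑ s ∈ T, ∑ s' ∈ T with s'.k = s.k ∧ s'.n = s.n, ‖a s'‖ₑ ^ 2 * ip s s' =
      ∑ s ∈ T, ∑ s' ∈ T with s'.k = s.k ∧ s'.n = s.n, ‖a s‖ₑ ^ 2 * ip s s' := by
    simp only [Finset.sum_filter]
    rw [Finset.sum_comm]
    refine Finset.sum_congr rfl fun s _ => Finset.sum_congr rfl fun s' _ => ?_
    rw [hsymm]
    simp only [eq_comm]
  calc _ ≤ ∑ s ∈ T, ∑ s' ∈ T with s'.k = s.k ∧ s'.n = s.n,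
        (‖a s‖ₑ ^ 2 * ip s s' + ‖a s'‖ₑ ^ 2 * ip s s') := by
        refine Finset.sum_le_sum fun s _ => Finset.sum_le_sum fun s' _ => ?_
        rw [← add_mul]
        exact mul_le_mul_left (mul_le_half_sq _ _) _
    _ = (∑ s ∈ T, ∑ s' ∈ T with s'.k = s.k ∧ s'.n = s.n, ‖a s‖ₑ ^ 2 * ip s s') +
        ∑ s ∈ T, ∑ s' ∈ T with s'.k = s.k ∧ s'.n = s.n, ‖a s'‖ₑ ^ 2 * ip s s' := by
        simp only [Finset.sum_add_distrib]
    _ ≤ _ := by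
        rw [hB]
        refine (add_le_add hA hA).trans_eq ?_
        ring

/-- Bessel inequality for tiles whose upper frequency halves share a point. -/
lemma bessel_tree (hφ : IsPacket φ C) (a : Tile → ℂ) (T : Finset Tile) {ξ : ℝ}
    (hT : ∀ s ∈ T, ξ ∈ s.ω₂) :
    ∫⁻ x, ‖packetSum φ a T x‖ₑ ^ 2 ≤ (2 * C ^ 2 * chiC ^ 2) * ∑ s ∈ T, s.len * ‖a s‖ₑ ^ 2 := by
  refine (hφ.lintegral_packetSum_sq_le a T).trans (le_trans ?_ (hφ.sum_same_le a T))
  refine Finset.sum_le_sum fun s hs => ?_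
  rw [Finset.sum_filter]
  refine Finset.sum_le_sum fun s' hs' => ?_
  split_ifs with h
  · exact le_rfl
  · have : Disjoint s.ω₁ s'.ω₁ := by
      by_contra hd
      have h1 := s.ω₂_subset (hT s hs)
      have h1' := s'.ω₂_subset (hT s' hs')
      rcases Tile.meet_cases hd with h2 | ⟨-, h2⟩ | ⟨-, h2⟩
      · exact h ⟨(Tile.eq_of_ω h2).1.symm, (Tile.eq_of_ω h2).2.symm⟩
      · exact disjoint_left.1 s'.disjoint_ω (h2 h1) (hT s' hs')
      · exact disjoint_left.1 s.disjoint_ω (h2 h1') (hT s hs)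
    rw [hφ.inner_eq_zero_of_disjoint this]
    simp

end IsPacket

namespace Tile

/-- Tiles are ordered by inclusion in time and reverse inclusion in frequency. -/
instance : Preorder Tile where
  le u u' := u.I ⊆ u'.I ∧ u'.ω ⊆ u.ω
  le_refl u := ⟨subset_rfl, subset_rfl⟩
  le_trans _ _ _ h h' := ⟨h.1.trans h'.1, h'.2.trans h.2⟩

lemma le_def {u u' : Tile} : u ≤ u' ↔ u.I ⊆ u'.I ∧ u'.ω ⊆ u.ω := Iff.rfl

lemma eq_of_le_of_le {u u' : Tile} (h : u ≤ u') (h' : u' ≤ u) : u = u' := by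
  have h1 := dy_inj (subset_antisymm h.1 h'.1)
  have h2 := dy_inj (subset_antisymm h.2 h'.2)
  exact Tile.ext h1.1 h1.2 h2.2.symm

lemma le_or_le {u u' : Tile} {x ξ : ℝ} (hx : x ∈ u.I) (hx' : x ∈ u'.I) (hξ : ξ ∈ u.ω)
    (hξ' : ξ ∈ u'.ω) : u ≤ u' ∨ u' ≤ u := by
  rcases le_total u.k u'.k with h | h
  · exact Or.inl ⟨dy_subset_of_le h hx hx', dy_subset_of_le (by omega) hξ' hξ⟩
  · exact Or.inr ⟨dy_subset_of_le h hx' hx, dy_subset_of_le (by omega) hξ hξ'⟩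

/-- The portion of `E ∩ u.I` where the linearising function takes values in `u.ω`. -/
def slab (N : ℝ → ℝ) (E : Set ℝ) (u : Tile) : Set ℝ := E ∩ N ⁻¹' u.ω ∩ u.I

lemma measurableSet_slab {N : ℝ → ℝ} (hN : Measurable N) {E : Set ℝ} (hE : MeasurableSet E)
    (u : Tile) : MeasurableSet (u.slab N E) :=
  (hE.inter (hN (measurableSet_dy _ _))).inter u.measurableSet_I

/-- All generalised tiles above `s` carry density at most `μ`, with polynomial weight. -/
def IsDense (N : ℝ → ℝ) (E : Set ℝ) (μ : ℝ≥0∞) (s : Tile) : Prop :=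
  ∀ k m n : ℤ, s.k ≤ k → s.I ⊆ dy k m → dy (-k) n ⊆ s.ω → ∀ j : ℤ,
    volume ((⟨k, m + j, n⟩ : Tile).slab N E) ≤ μ * ENNReal.ofReal ((1 + |(j:ℝ)|) ^ 4) *
      ENNReal.ofReal (2 ^ k)

lemma IsDense.mono {N : ℝ → ℝ} {E : Set ℝ} {μ μ' : ℝ≥0∞} {s : Tile} (h : IsDense N E μ s)
    (hμ : μ ≤ μ') : IsDense N E μ' s := fun k m n h1 h2 h3 j =>
  (h k m n h1 h2 h3 j).trans (by gcongr)

lemma isDense_one (N : ℝ → ℝ) (E : Set ℝ) (s : Tile) : IsDense N E 1 s := by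
  intro k m n _ _ _ j
  rw [one_mul]
  calc _ ≤ volume (dy k (m + j)) := measure_mono inter_subset_right
    _ = 1 * ENNReal.ofReal (2 ^ k) := by rw [volume_dy, one_mul]
    _ ≤ _ := by
      gcongr
      rw [ENNReal.one_le_ofReal]
      exact one_le_pow₀ (by linarith [abs_nonneg (j:ℝ)])

lemma IsDense.setLIntegral_chi_le {N : ℝ → ℝ} {E : Set ℝ} {μ : ℝ≥0∞} {s : Tile}
    (hE : MeasurableSet E) (hN : Measurable N)
    (h : IsDense N E μ s) : ∫⁻ x in E ∩ N ⁻¹' s.ω, s.chi x ^ 6 ≤ 16 * chiC * μ * s.len := by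
  have hm : MeasurableSet (E ∩ N ⁻¹' s.ω) := hE.inter (hN (measurableSet_dy _ _))
  rw [← lintegral_indicator hm, lintegral_eq_tsum_dy s.k]
  have key : ∀ i : ℤ, ∫⁻ x in dy s.k (s.m + i), (E ∩ N ⁻¹' s.ω).indicator (fun x => s.chi x ^ 6) x ≤
      64 * ENNReal.ofReal (((1 + |(i:ℝ)|) ^ 2)⁻¹) * (μ * s.len) := by
    intro i
    have h1 := h s.k s.m s.n le_rfl subset_rfl subset_rfl i
    set w := ENNReal.ofReal (((1 + |(i:ℝ)|) ^ 2)⁻¹) with hw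
    calc _ ≤ ∫⁻ x in dy s.k (s.m + i), (E ∩ N ⁻¹' s.ω).indicator (fun x => (4 * w) ^ 3) x := by
          refine setLIntegral_mono' (measurableSet_dy _ _) fun x hx => indicator_le_indicator ?_
          rw [show (6:ℕ) = 2 * 3 by norm_num, pow_mul]
          refine pow_le_pow_left₀ zero_le ((chi_sq_le_of_mem_dy (m := s.m) hx).trans ?_) 3
          rw [hw, show s.m - (s.m + i) = -i by ring]; push_cast; rw [abs_neg]
      _ = (4 * w) ^ 3 * volume ((⟨s.k, s.m + i, s.n⟩ : Tile).slab N E) := by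
          rw [lintegral_indicator hm, setLIntegral_const, Measure.restrict_apply hm]
          rfl
      _ ≤ (4 * w) ^ 3 * (μ * ENNReal.ofReal ((1 + |(i:ℝ)|) ^ 4) * ENNReal.ofReal (2 ^ s.k)) := by
          gcongr
      _ = 64 * (w ^ 3 * ENNReal.ofReal ((1 + |(i:ℝ)|) ^ 4)) * (μ * s.len) := by
          unfold len; ring
      _ = _ := by
          congr 2
          rw [hw, ← ENNReal.ofReal_pow (by positivity), ← ENNReal.ofReal_mul (by positivity)]
          congr 1
          field_simp
  calc _ = ∑' i : ℤ, ∫⁻ x in dy s.k (s.m + i), (E ∩ N ⁻¹' s.ω).indicator (fun x => s.chi x ^ 6) x :=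
        ((Equiv.addLeft s.m).tsum_eq
          (fun i => ∫⁻ x in dy s.k i, (E ∩ N ⁻¹' s.ω).indicator (fun x => s.chi x ^ 6) x)).symm
    _ ≤ ∑' i : ℤ, 64 * ENNReal.ofReal (((1 + |(i:ℝ)|) ^ 2)⁻¹) * (μ * s.len) :=
        ENNReal.tsum_le_tsum key
    _ = _ := by
        rw [ENNReal.tsum_mul_right, ENNReal.tsum_mul_left, coe_chiC]; ring

end Tile

/-- A finite set of tiles with a common top interval `dy k m` and a common frequency `ξ`. -/
def IsTree (T : Finset Tile) (k m : ℤ) (ξ : ℝ) : Prop := ∀ s ∈ T, s.I ⊆ dy k m ∧ ξ ∈ s.ω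

lemma abs_sub_le_of_dy_subset {k k' a b a' b' : ℤ} (h : dy k a ⊆ dy k' a') (h' : dy k b ⊆ dy k' b') :
    |a' - b'| ≤ |a - b| := by
  have hk := le_of_dy_subset h
  obtain ⟨h1, h2⟩ := h (left_mem_dy k a)
  obtain ⟨h3, h4⟩ := h' (left_mem_dy k b)
  have hp : (0:ℝ) < 2 ^ k := by positivity
  have hp' : (0:ℝ) < 2 ^ k' := by positivity
  have hkk : (2:ℝ) ^ k ≤ 2 ^ k' := zpow_le_zpow_right₀ (by norm_num) hk
  have key : ∀ x y : ℤ, ∀ X Y : ℤ, X * (2:ℝ) ^ k' ≤ x * 2 ^ k → y * (2:ℝ) ^ k < (Y + 1) * 2 ^ k' →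
      X - Y ≤ |x - y| := by
    intro x y X Y hX hY
    have e1 : ((X - Y - 1 : ℤ) : ℝ) * 2 ^ k' < (|x - y| : ℤ) * 2 ^ k' := by
      calc ((X - Y - 1 : ℤ) : ℝ) * 2 ^ k' < (x - y) * 2 ^ k := by push_cast; linarith
        _ ≤ (|x - y| : ℤ) * 2 ^ k := by
            gcongr; exact_mod_cast le_abs_self (x - y)
        _ ≤ _ := by gcongr
    have e2 : ((X - Y - 1 : ℤ) : ℝ) < (|x - y| : ℤ) := lt_of_mul_lt_mul_right e1 hp'.le
    have e3 : X - Y - 1 < |x - y| := by exact_mod_cast e2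
    omega
  have := key a b a' b' h1 h4
  have h6 := key b a b' a' h3 h2
  rw [abs_sub_comm b a] at h6
  exact abs_le.2 ⟨by omega, by omega⟩

/-- Mass decomposition: the tiles that are not `μ`-dense split into trees of small total length. -/
theorem mass_lemma {N : ℝ → ℝ} (hN : Measurable N) {E : Set ℝ} (hE : MeasurableSet E)
    {μ : ℝ≥0∞} (h0 : μ ≠ 0) (ht : μ ≠ ⊤) (P : Finset Tile) (hP : ∀ s ∈ P, ¬ s.IsDense N E μ) :
    ∃ (ι : Type) (F : Finset ι) (k m : ι → ℤ) (ξ : ι → ℝ),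
      (∀ s ∈ P, ∃ i ∈ F, s.I ⊆ dy (k i) (m i) ∧ ξ i ∈ s.ω) ∧
      ∑ i ∈ F, ENNReal.ofReal (2 ^ k i) ≤ chiC * (volume E / μ) := by
  classical
  have hw : ∀ s : Tile, ∃ k m n j : ℤ, s ∈ P → s.k ≤ k ∧ s.I ⊆ dy k m ∧ dy (-k) n ⊆ s.ω ∧
      μ * ENNReal.ofReal ((1 + |(j:ℝ)|) ^ 4) * ENNReal.ofReal (2 ^ k) <
        volume ((⟨k, m + j, n⟩ : Tile).slab N E) := by
    intro s
    by_cases hs : s ∈ P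
    · have := hP s hs
      unfold Tile.IsDense at this
      push Not at this
      obtain ⟨k, m, n, h1, h2, h3, j, h4⟩ := this
      exact ⟨k, m, n, j, fun _ => ⟨h1, h2, h3, h4⟩⟩
    · exact ⟨0, 0, 0, 0, fun h => absurd h hs⟩
  choose K M n J hw using hw
  set u : Tile → Tile := fun s => ⟨K s, M s + J s, n s⟩ with hu
  set Js := P.image J with hJs
  set U : ℤ → Finset Tile := fun j => (P.filter fun s => J s = j).image u with hU
  set Um : ℤ → Finset Tile := fun j => (U j).filter fun v => Maximal (· ∈ U j) v with hUm
  have hdisj : ∀ j, ((Um j : Finset Tile) : Set Tile).PairwiseDisjoint (Tile.slab N E) := by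
    intro j v hv v' hv' hne
    rw [Function.onFun, disjoint_left]
    rintro x ⟨⟨-, hx1⟩, hx2⟩ ⟨⟨-, hx3⟩, hx4⟩
    have hv := (Finset.mem_filter.1 hv).2
    have hv' := (Finset.mem_filter.1 hv').2
    rcases Tile.le_or_le hx2 hx4 hx1 hx3 with h | h
    · exact hne (Tile.eq_of_le_of_le h (hv.2 hv'.1 h))
    · exact hne (Tile.eq_of_le_of_le (hv'.2 hv.1 h) h)
  have hsum : ∀ j, ∑ v ∈ Um j, v.len ≤
      volume E / μ * ENNReal.ofReal (((1 + |(j:ℝ)|) ^ 4)⁻¹) := by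
    intro j
    have h1 : ∑ v ∈ Um j, μ * ENNReal.ofReal ((1 + |(j:ℝ)|) ^ 4) * v.len ≤ volume E := by
      calc _ ≤ ∑ v ∈ Um j, volume (v.slab N E) := by
            refine Finset.sum_le_sum fun v hv => ?_
            obtain ⟨s, hs, rfl⟩ := Finset.mem_image.1 (Finset.mem_filter.1 hv).1
            obtain ⟨hs', rfl⟩ := Finset.mem_filter.1 hs
            exact (hw s hs').2.2.2.le
        _ = volume (⋃ v ∈ Um j, v.slab N E) :=
            (measure_biUnion_finset (hdisj j) fun v _ => v.measurableSet_slab hN hE).symm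
        _ ≤ volume E := measure_mono (iUnion₂_subset fun v _ => inter_subset_left.trans inter_subset_left)
    rw [← Finset.mul_sum] at h1
    rw [ENNReal.ofReal_inv_of_pos (by positivity), ← div_eq_mul_inv, div_eq_mul_inv _ μ,
      mul_comm _ μ⁻¹, ← ENNReal.div_eq_inv_mul]
    have hj0 : ENNReal.ofReal ((1 + |(j:ℝ)|) ^ 4) ≠ 0 := by
      simp only [ne_eq, ENNReal.ofReal_eq_zero, not_le]; positivity
    rw [ENNReal.le_div_iff_mul_le (Or.inl hj0) (Or.inl ENNReal.ofReal_ne_top),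
      ENNReal.le_div_iff_mul_le (Or.inl h0) (Or.inl ht)]
    refine le_trans (le_of_eq ?_) h1
    ring
  refine ⟨Tile × ℤ × ℤ, Js.biUnion fun j => (Um j) ×ˢ (Finset.Icc (-|j|) |j|) ×ˢ {j},
    fun i => i.1.k, fun i => i.1.m + i.2.1, fun i => i.1.n * (2:ℝ) ^ (-i.1.k), ?_, ?_⟩
  · intro s hs
    obtain ⟨h1, h2, h3, h4⟩ := hw s hs
    have hmem : u s ∈ U (J s) := Finset.mem_image_of_mem _ (Finset.mem_filter.2 ⟨hs, rfl⟩)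
    obtain ⟨v, hv1, hv2⟩ := Finset.exists_le_maximal (U (J s)) hmem
    have hk : K s ≤ v.k := le_of_dy_subset hv1.1
    obtain ⟨m', hm'⟩ := exists_dy_superset hk (M s)
    have habs := abs_sub_le_of_dy_subset hm' hv1.1
    have e : M s - (M s + J s) = -J s := by ring
    simp only [hu] at habs
    rw [e, abs_neg] at habs
    refine ⟨(v, m' - v.m, J s), ?_, ?_, ?_⟩
    · simp only [Finset.mem_biUnion, Finset.mem_product, Finset.mem_Icc, Finset.mem_singleton]
      exact ⟨J s, Finset.mem_image_of_mem _ hs, Finset.mem_filter.2 ⟨hv2.1, hv2⟩,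
        abs_le.1 habs, rfl⟩
    · simpa using h2.trans hm'
    · exact h3 (hv1.2 (left_mem_dy _ _))
  · rw [Finset.sum_biUnion]
    · calc _ ≤ ∑ j ∈ Js, volume E / μ * (4 * ENNReal.ofReal (((1 + |(j:ℝ)|) ^ 2)⁻¹)) := by
            refine Finset.sum_le_sum fun j _ => ?_
            rw [Finset.sum_product]
            simp only [Finset.sum_const, Finset.card_product, Finset.card_singleton, mul_one,
              Int.card_Icc, nsmul_eq_mul]
            rw [← Finset.mul_sum]
            have e1 : (((|j| + 1 - -|j|).toNat : ℕ) : ℝ≥0∞) ≤ ENNReal.ofReal (2 * (1 + |(j:ℝ)|)) := by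
              rw [← ENNReal.ofReal_natCast]
              refine ENNReal.ofReal_le_ofReal ?_
              have : (((|j| + 1 - -|j|).toNat : ℤ) : ℝ) = ((|j| + 1 - -|j| : ℤ) : ℝ) := by
                rw [Int.toNat_of_nonneg (by have := abs_nonneg j; omega)]
              have h2 : (((|j| + 1 - -|j|).toNat : ℕ) : ℝ) = 2 * |(j:ℝ)| + 1 := by
                rw [← Int.cast_natCast, this]; push_cast; ring
              rw [h2]; linarith [abs_nonneg (j:ℝ)]
            calc _ ≤ ENNReal.ofReal (2 * (1 + |(j:ℝ)|)) *
                  (volume E / μ * ENNReal.ofReal (((1 + |(j:ℝ)|) ^ 4)⁻¹)) :=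
                  mul_le_mul' e1 (hsum j)
              _ = volume E / μ * (ENNReal.ofReal (2 * (1 + |(j:ℝ)|)) *
                  ENNReal.ofReal (((1 + |(j:ℝ)|) ^ 4)⁻¹)) := by ring
              _ ≤ _ := by
                refine mul_le_mul_right ?_ _
                rw [← ENNReal.ofReal_mul (by positivity), ← ENNReal.ofReal_ofNat 4,
                  ← ENNReal.ofReal_mul (by positivity)]
                refine ENNReal.ofReal_le_ofReal ?_
                rw [← div_eq_mul_inv, ← div_eq_mul_inv, div_le_div_iff₀ (by positivity) (by positivity)]
                have := abs_nonneg (j:ℝ)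
                set t := |(j:ℝ)|
                nlinarith [pow_nonneg this 2, pow_nonneg this 3, pow_nonneg this 4]
        _ ≤ ∑' j : ℤ, volume E / μ * (4 * ENNReal.ofReal (((1 + |(j:ℝ)|) ^ 2)⁻¹)) :=
            ENNReal.sum_le_tsum _
        _ = _ := by
            rw [ENNReal.tsum_mul_left, ENNReal.tsum_mul_left, ← coe_chiC, mul_comm]
    · intro j _ j' _ hne
      rw [Function.onFun, Finset.disjoint_left]
      rintro ⟨v, i, l⟩ h h'
      simp only [Finset.mem_product, Finset.mem_singleton] at h h'
      exact hne (h.2.2.symm.trans h'.2.2)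

/-- Carleson-type size condition for coefficients indexed by a finite set of tiles. -/
def HasSize (P : Finset Tile) (a : Tile → ℂ) (σ : ℝ≥0∞) : Prop := by
  classical exact ∀ (k m : ℤ) (ξ : ℝ),
    ∑ s ∈ P with s.I ⊆ dy k m ∧ ξ ∈ s.ω₂, s.len * ‖a s‖ₑ ^ 2 ≤ σ ^ 2 * ENNReal.ofReal (2 ^ k)

lemma hasSize_iff {P : Finset Tile} {a : Tile → ℂ} {σ : ℝ≥0∞} : HasSize P a σ ↔
    ∀ (k m : ℤ) (ξ : ℝ) (T : Finset Tile), T ⊆ P → (∀ s ∈ T, s.I ⊆ dy k m ∧ ξ ∈ s.ω₂) →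
      ∑ s ∈ T, s.len * ‖a s‖ₑ ^ 2 ≤ σ ^ 2 * ENNReal.ofReal (2 ^ k) := by
  classical
  constructor
  · intro h k m ξ T hT hs
    refine le_trans (Finset.sum_le_sum_of_subset fun s h' => ?_) (h k m ξ)
    exact Finset.mem_filter.2 ⟨hT h', hs s h'⟩
  · intro h k m ξ
    exact h k m ξ _ (Finset.filter_subset _ _) fun s hs => (Finset.mem_filter.1 hs).2

lemma HasSize.subset {P P' : Finset Tile} {a : Tile → ℂ} {σ : ℝ≥0∞} (h : HasSize P a σ)
    (hP : P' ⊆ P) : HasSize P' a σ :=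
  hasSize_iff.2 fun k m ξ T hT hs => hasSize_iff.1 h k m ξ T (hT.trans hP) hs

lemma HasSize.mono {P : Finset Tile} {a : Tile → ℂ} {σ σ' : ℝ≥0∞} (h : HasSize P a σ)
    (hσ : σ ≤ σ') : HasSize P a σ' :=
  hasSize_iff.2 fun k m ξ T hT hs => (hasSize_iff.1 h k m ξ T hT hs).trans (by gcongr)

lemma Tile.exists_mem_ω₂ (s : Tile) : ∃ ξ, ξ ∈ s.ω₂ := dy_nonempty _ _

lemma HasSize.enorm_le {P : Finset Tile} {a : Tile → ℂ} {σ : ℝ≥0∞} (h : HasSize P a σ)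
    {s : Tile} (hs : s ∈ P) : ‖a s‖ₑ ≤ σ := by
  obtain ⟨ξ, hξ⟩ := s.exists_mem_ω₂
  have := hasSize_iff.1 h s.k s.m ξ {s} (by simpa using hs) (by simp [Tile.I, hξ])
  rw [Finset.sum_singleton, mul_comm] at this
  have h2 := (ENNReal.mul_le_mul_iff_left s.len_ne_zero s.len_ne_top).1 this
  exact (ENNReal.pow_le_pow_left_iff two_ne_zero).1 h2

/-- Selected data: top interval `dy k m`, frequency `ξ`, and a set of tiles. -/
structure SelTree where
  (k m : ℤ) (ξ : ℝ) (T : Finset Tile)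

/-- Every tile of the selected tree lies under the top and has `ξ` in its upper half. -/
def SelTree.IsUpper (t : SelTree) : Prop := ∀ s ∈ t.T, s.I ⊆ dy t.k t.m ∧ t.ξ ∈ s.ω₂

/-- Length of the top interval. -/
noncomputable def SelTree.len (t : SelTree) : ℝ≥0∞ := ENNReal.ofReal (2 ^ t.k)

/-- The tile lies in the full tree with the top data of `t`. -/
def SelTree.Covers (t : SelTree) (s : Tile) : Prop := s.I ⊆ dy t.k t.m ∧ t.ξ ∈ s.ω

lemma exists_selection (a : Tile → ℂ) (τ : ℝ≥0∞) : ∀ P : Finset Tile,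
    ∃ (𝒯 : Finset SelTree) (P' : Finset Tile), P' ⊆ P ∧ HasSize P' a τ ∧
      (∀ t ∈ 𝒯, t.T ⊆ P ∧ t.IsUpper ∧ τ ^ 2 * t.len < ∑ s ∈ t.T, s.len * ‖a s‖ₑ ^ 2) ∧
      (∀ s ∈ P, s ∈ P' ∨ ∃ t ∈ 𝒯, t.Covers s) ∧
      ((𝒯 : Set SelTree).PairwiseDisjoint SelTree.T) ∧
      (∀ t ∈ 𝒯, ∀ t' ∈ 𝒯, t.ξ < t'.ξ → ∀ s ∈ t'.T, ¬ t.Covers s) ∧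
      (∀ t ∈ 𝒯, ∃ s ∈ P, t.ξ = (2 * s.n + 1 : ℤ) * (2:ℝ) ^ (-s.k - 1)) := by
  classical
  intro P
  induction P using Finset.strongInduction with
  | H P ih =>
    set V : Finset ℝ := (P.image fun s => (2 * s.n + 1 : ℤ) * (2:ℝ) ^ (-s.k - 1)).filter fun ξ =>
      ∃ k m : ℤ, τ ^ 2 * ENNReal.ofReal (2 ^ k) <
        ∑ s ∈ P with s.I ⊆ dy k m ∧ ξ ∈ s.ω₂, s.len * ‖a s‖ₑ ^ 2 with hV
    by_cases hne : V.Nonempty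
    · have hmem := V.min'_mem hne
      set ξ₀ := V.min' hne with hξ₀
      obtain ⟨hl, k, m, hviol⟩ := Finset.mem_filter.1 hmem
      set T₀ := P.filter fun s => s.I ⊆ dy k m ∧ ξ₀ ∈ s.ω₂ with hT₀
      set t₀ : SelTree := ⟨k, m, ξ₀, T₀⟩ with ht₀
      set P₁ := P.filter fun s => ¬ t₀.Covers s with hP₁
      have hne0 : T₀.Nonempty := by
        by_contra h
        rw [Finset.not_nonempty_iff_eq_empty.1 h] at hviol
        simp at hviol
      have hT₀P₁ : ∀ s ∈ T₀, s ∉ P₁ := fun s hs h => (Finset.mem_filter.1 h).2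
        ⟨(Finset.mem_filter.1 hs).2.1, s.ω₂_subset (Finset.mem_filter.1 hs).2.2⟩
      have hlt : P₁ ⊂ P := by
        refine (Finset.filter_subset _ _).ssubset_of_ne fun h => ?_
        obtain ⟨s, hs⟩ := hne0
        exact hT₀P₁ s hs (by rw [hP₁, h]; exact (Finset.mem_filter.1 hs).1)
      obtain ⟨𝒯, P', h1, h2, h3, h4, h5, h6, h7⟩ := ih P₁ hlt
      have hmin : ∀ t ∈ 𝒯, ξ₀ ≤ t.ξ := by
        intro t ht
        refine V.min'_le _ (Finset.mem_filter.2 ⟨?_, t.k, t.m, ?_⟩)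
        · obtain ⟨s, hs, he⟩ := h7 t ht
          exact Finset.mem_image.2 ⟨s, hlt.1 hs, he.symm⟩
        · obtain ⟨a1, a2, a3⟩ := h3 t ht
          refine a3.trans_le (Finset.sum_le_sum_of_subset fun s hs => ?_)
          exact Finset.mem_filter.2 ⟨hlt.1 (a1 hs), a2 s hs⟩
      have hd : ∀ t ∈ 𝒯, Disjoint T₀ t.T := fun t ht => by
        rw [Finset.disjoint_left]
        exact fun s hs hs' => hT₀P₁ s hs ((h3 t ht).1 hs')
      refine ⟨insert t₀ 𝒯, P', h1.trans hlt.1, h2, ?_, ?_, ?_, ?_, ?_⟩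
      · intro t ht
        rcases Finset.mem_insert.1 ht with rfl | ht
        · exact ⟨Finset.filter_subset _ _, fun s hs => (Finset.mem_filter.1 hs).2, hviol⟩
        · obtain ⟨a1, a2, a3⟩ := h3 t ht
          exact ⟨a1.trans hlt.1, a2, a3⟩
      · intro s hs
        by_cases hc : t₀.Covers s
        · exact Or.inr ⟨t₀, Finset.mem_insert_self _ _, hc⟩
        · rcases h4 s (Finset.mem_filter.2 ⟨hs, hc⟩) with h | ⟨t, ht, h⟩
          · exact Or.inl h
          · exact Or.inr ⟨t, Finset.mem_insert_of_mem ht, h⟩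
      · rw [Finset.coe_insert]
        exact h5.insert fun t ht _ => hd t ht
      · intro t ht t' ht' hlt' s hs hc
        rcases Finset.mem_insert.1 ht with rfl | ht
        · rcases Finset.mem_insert.1 ht' with rfl | ht'
          · exact lt_irrefl _ hlt'
          · exact (Finset.mem_filter.1 ((h3 t' ht').1 hs)).2 hc
        · rcases Finset.mem_insert.1 ht' with rfl | ht'
          · exact absurd hlt' (not_lt.2 (hmin t ht))
          · exact h6 t ht t' ht' hlt' s hs hc
      · intro t ht
        rcases Finset.mem_insert.1 ht with rfl | ht
        · obtain ⟨s, hs, he⟩ := Finset.mem_image.1 hl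
          exact ⟨s, hs, he.symm⟩
        · obtain ⟨s, hs, he⟩ := h7 t ht
          exact ⟨s, hlt.1 hs, he⟩
    · refine ⟨∅, P, subset_rfl, ?_, by simp, fun s hs => Or.inl hs, by simp, by simp, by simp⟩
      rw [hasSize_iff]
      intro k m ξ T hT hs
      rcases T.eq_empty_or_nonempty with rfl | hTn
      · simp
      obtain ⟨s₀, hs₀, hmax⟩ := T.exists_max_image
        (fun s => ((2 * s.n + 1 : ℤ):ℝ) * (2:ℝ) ^ (-s.k - 1)) hTn
      by_contra! hlt
      refine hne ⟨((2 * s₀.n + 1 : ℤ):ℝ) * (2:ℝ) ^ (-s₀.k - 1), Finset.mem_filter.2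
        ⟨Finset.mem_image_of_mem _ (hT hs₀), k, m, hlt.trans_le
          (Finset.sum_le_sum_of_subset fun s h => Finset.mem_filter.2 ⟨hT h, (hs s h).1, ?_⟩)⟩⟩
      exact ⟨hmax s h, (hs s₀ hs₀).2.1.trans_lt (hs s h).2.2⟩

lemma sum_two_zpow_le (A : Finset ℤ) {K : ℤ} (hA : ∀ k ∈ A, k ≤ K) :
    ∑ k ∈ A, ENNReal.ofReal ((2:ℝ) ^ k) ≤ 2 * ENNReal.ofReal (2 ^ K) := by
  have h1 : ∀ k ∈ A, ENNReal.ofReal ((2:ℝ) ^ k) =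
      ENNReal.ofReal (2 ^ K) * 2⁻¹ ^ (K - k).toNat := by
    intro k hk
    have h2 : (2:ℝ≥0∞)⁻¹ = ENNReal.ofReal 2⁻¹ := by
      rw [ENNReal.ofReal_inv_of_pos two_pos, ENNReal.ofReal_ofNat]
    rw [h2, ← ENNReal.ofReal_pow (by norm_num), ← ENNReal.ofReal_mul (by positivity), inv_pow,
      ← zpow_natCast, Int.toNat_of_nonneg (by have := hA k hk; omega), ← div_eq_mul_inv,
      ← zpow_sub₀ two_ne_zero]
    congr 2; ring
  calc _ = ENNReal.ofReal (2 ^ K) * ∑ k ∈ A, (2:ℝ≥0∞)⁻¹ ^ (K - k).toNat := by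
        rw [Finset.mul_sum]; exact Finset.sum_congr rfl h1
    _ = ENNReal.ofReal (2 ^ K) * ∑ n ∈ A.image fun k => (K - k).toNat, (2:ℝ≥0∞)⁻¹ ^ n := by
        rw [Finset.sum_image]
        intro x hx y hy h
        have := hA x hx; have := hA y hy; simp only at h; omega
    _ ≤ ENNReal.ofReal (2 ^ K) * ∑' n : ℕ, (2:ℝ≥0∞)⁻¹ ^ n := by
        gcongr; exact ENNReal.sum_le_tsum _
    _ = _ := by rw [ENNReal.tsum_geometric, ENNReal.one_sub_inv_two, inv_inv, mul_comm]

lemma sum_le_of_scales {T : Finset Tile} {g : Tile → ℝ≥0∞} {c : ℝ≥0∞} {K : ℤ}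
    (hK : ∀ s ∈ T, s.k ≤ K)
    (h : ∀ k, ∀ T' ⊆ T, (∀ s ∈ T', s.k = k) → ∑ s ∈ T', g s ≤ c * ENNReal.ofReal (2 ^ k)) :
    ∑ s ∈ T, g s ≤ c * (2 * ENNReal.ofReal (2 ^ K)) := by
  classical
  rw [← Finset.sum_fiberwise_of_maps_to (t := T.image Tile.k) (g := Tile.k)
    fun s hs => Finset.mem_image_of_mem _ hs]
  calc _ ≤ ∑ k ∈ T.image Tile.k, c * ENNReal.ofReal ((2:ℝ) ^ k) :=
        Finset.sum_le_sum fun k _ => h k _ (Finset.filter_subset _ _)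
          fun s hs => (Finset.mem_filter.1 hs).2
    _ ≤ _ := by
        rw [← Finset.mul_sum]
        gcongr
        refine sum_two_zpow_le _ fun k hk => ?_
        obtain ⟨s, hs, rfl⟩ := Finset.mem_image.1 hk
        exact hK s hs

/-- Outside `dy K M`, the weight of a subinterval is dominated by the weights at the endpoints. -/
lemma exists_chi_le_of_notMem {k K M : ℤ} (hk : k ≤ K) : ∃ p q : ℤ, ∀ m, dy k m ⊆ dy K M →
    ∀ x ∉ dy K M, chi k m x ≤ chi k p x ∨ chi k m x ≤ chi k q x := by
  obtain ⟨n, rfl⟩ : ∃ n : ℕ, K = k + n := ⟨(K - k).toNat, by omega⟩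
  have e : ∀ L : ℤ, (L : ℝ) * 2 ^ (k + n) = ((L * 2 ^ n : ℤ) : ℝ) * 2 ^ k := by
    intro L; push_cast; rw [zpow_add₀ two_ne_zero, zpow_natCast]; ring
  refine ⟨M * 2 ^ n, (M + 1) * 2 ^ n, fun m hm x hx => ?_⟩
  have h2 := two_zpow_pos k
  have hi : ∀ y : ℝ, (2:ℝ) ^ (-k) * y = y / 2 ^ k := fun y => by
    rw [zpow_neg, div_eq_inv_mul]
  have hl := hm (left_mem_dy k m)
  unfold dy at hl hx
  have e2 := e (M + 1)
  push_cast at e2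
  rw [mem_Ico, e2, e M] at hl
  rw [mem_Ico, e2, e M] at hx
  have hl1 : ((M * 2 ^ n : ℤ) : ℝ) ≤ m := le_of_mul_le_mul_right hl.1 h2
  have hl2 : ((m : ℝ)) < (M + 1) * 2 ^ n := lt_of_mul_lt_mul_right hl.2 h2.le
  unfold chi
  by_cases hx1 : ((M * 2 ^ n : ℤ) : ℝ) * 2 ^ k ≤ x
  · right
    have hx2 : ((M:ℝ) + 1) * 2 ^ n * 2 ^ k ≤ x := by
      by_contra hc; exact hx ⟨hx1, not_le.1 hc⟩
    rw [← le_div_iff₀ h2] at hx2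
    refine ENNReal.ofReal_le_ofReal (inv_anti₀ (by positivity) ?_)
    rw [hi]; push_cast
    rw [abs_of_nonneg (by linarith), abs_of_nonneg (by linarith)]
    linarith
  · left
    push Not at hx1
    rw [← div_lt_iff₀ h2] at hx1
    refine ENNReal.ofReal_le_ofReal (inv_anti₀ (by positivity) ?_)
    rw [hi, abs_of_neg (by linarith), abs_of_neg (by linarith)]
    linarith

lemma sum_setLIntegral_compl_le {T : Finset Tile} {K M : ℤ} {ξ : ℝ}
    (hT : ∀ s ∈ T, s.I ⊆ dy K M ∧ ξ ∈ s.ω) :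
    ∑ s ∈ T, ∫⁻ x in (dy K M)ᶜ, s.chi x ^ 4 ≤
      (2 * chiC ^ 2) * (2 * ENNReal.ofReal (2 ^ K)) := by
  refine sum_le_of_scales (fun s hs => le_of_dy_subset (hT s hs).1) fun k T' hT' hk => ?_
  rcases T'.eq_empty_or_nonempty with rfl | ⟨s₀, hs₀⟩
  · simp
  have hkK : k ≤ K := by
    rw [← hk s₀ hs₀]; exact le_of_dy_subset (hT s₀ (hT' hs₀)).1
  obtain ⟨p, q, hpq⟩ := exists_chi_le_of_notMem (M := M) hkK
  have hm2 : ∀ p, Measurable fun x => chi k p x ^ 2 := fun p => (measurable_chi k p).pow_const 2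
  calc ∑ s ∈ T', ∫⁻ x in (dy K M)ᶜ, s.chi x ^ 4
      = ∫⁻ x in (dy K M)ᶜ, ∑ s ∈ T', s.chi x ^ 4 :=
        (lintegral_finsetSum _ fun s _ => (measurable_chi _ _).pow_const 4).symm
    _ ≤ ∫⁻ x in (dy K M)ᶜ, chiC * (chi k p x ^ 2 + chi k q x ^ 2) := by
        refine setLIntegral_mono_ae' (measurableSet_dy _ _).compl (ae_of_all _ fun x hx => ?_)
        calc ∑ s ∈ T', s.chi x ^ 4
            ≤ ∑ s ∈ T', chi k s.m x ^ 2 * (chi k p x ^ 2 + chi k q x ^ 2) := by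
              refine Finset.sum_le_sum fun s hs => ?_
              have hs2 : s.chi x = chi k s.m x := by unfold Tile.chi; rw [hk s hs]
              have hsub : dy k s.m ⊆ dy K M := by
                rw [← hk s hs]; exact (hT s (hT' hs)).1
              rw [hs2, show (4:ℕ) = 2 + 2 from rfl, pow_add]
              refine mul_le_mul_right ?_ _
              rcases hpq s.m hsub x hx with h | h
              · exact (pow_le_pow_left₀ zero_le h 2).trans le_self_add
              · exact (pow_le_pow_left₀ zero_le h 2).trans le_add_self
          _ = (∑ s ∈ T', chi k s.m x ^ 2) * (chi k p x ^ 2 + chi k q x ^ 2) := by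
              rw [Finset.sum_mul]
          _ ≤ _ := by
              refine mul_le_mul_left ?_ _
              refine (Tile.sum_le_tsum_of_fixed hk (fun s hs s' hs' => ?_)
                (fun m => chi k m x ^ 2)).trans (tsum_chi_sq_le k x)
              exact Tile.eq_of_mem_ω ((hk s hs).trans (hk s' hs').symm) (hT s (hT' hs)).2
                (hT s' (hT' hs')).2
    _ ≤ ∫⁻ x, chiC * (chi k p x ^ 2 + chi k q x ^ 2) := setLIntegral_le_lintegral _ _
    _ = chiC * ((∫⁻ x, chi k p x ^ 2) + ∫⁻ x, chi k q x ^ 2) := by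
        rw [lintegral_const_mul' _ _ ENNReal.coe_ne_top, lintegral_add_left (hm2 p)]
    _ ≤ chiC * (chiC * ENNReal.ofReal (2 ^ k) + chiC * ENNReal.ofReal (2 ^ k)) := by
        refine mul_le_mul_right (add_le_add ?_ ?_) _ <;> exact lintegral_chi_sq_le _ _
    _ = _ := by ring

lemma Tile.lt_of_mem_ω₁_ω₂ {s : Tile} {x y : ℝ} (hx : x ∈ s.ω₁) (hy : y ∈ s.ω₂) : x < y := by
  refine hx.2.trans_le ?_
  have := hy.1
  push_cast at this ⊢
  exact this

section Selection
variable {𝒯 : Finset SelTree}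

lemma SelTree.disjoint_top (hU : ∀ t ∈ 𝒯, t.IsUpper)
    (h : ∀ t ∈ 𝒯, ∀ t' ∈ 𝒯, t.ξ < t'.ξ → ∀ s ∈ t'.T, ¬ t.Covers s) {t t' : SelTree} (ht : t ∈ 𝒯)
    (ht' : t' ∈ 𝒯) {s s' : Tile} (hs : s ∈ t.T) (hs' : s' ∈ t'.T) (hk : s'.k < s.k)
    (hω : s.ω ⊆ s'.ω₁) : Disjoint s'.I (dy t.k t.m) := by
  have h1 : t.ξ ∈ s'.ω₁ := hω (s.ω₂_subset (hU t ht s hs).2)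
  have h2 := h t ht t' ht' (Tile.lt_of_mem_ω₁_ω₂ h1 (hU t' ht' s' hs').2) s' hs'
  have h3 := le_of_dy_subset (hU t ht s hs).1
  rcases dy_subset_or_disjoint (m := s'.m) (m' := t.m) (hk.le.trans h3) with h4 | h4
  · exact absurd ⟨h4, s'.ω₁_subset h1⟩ h2
  · exact h4

lemma SelTree.sum_setLIntegral_le [DecidableEq Tile] (hU : ∀ t ∈ 𝒯, t.IsUpper)
    (h : ∀ t ∈ 𝒯, ∀ t' ∈ 𝒯, t.ξ < t'.ξ → ∀ s ∈ t'.T, ¬ t.Covers s) {t : SelTree} (ht : t ∈ 𝒯)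
    {s : Tile} (hs : s ∈ t.T) (A : Finset Tile) (hA : ∀ s' ∈ A, s' ∈ 𝒯.biUnion SelTree.T ∧
      s'.k < s.k ∧ s.ω ⊆ s'.ω₁) (g : ℝ → ℝ≥0∞) :
    ∑ s' ∈ A, ∫⁻ x in s'.I, g x ≤ ∫⁻ x in (dy t.k t.m)ᶜ, g x := by
  have key : ∀ s' ∈ A, ∀ s'' ∈ A, s'.k < s''.k → Disjoint s'.I s''.I := by
    intro s' hs' s'' hs'' hk
    obtain ⟨a1, a2, a3⟩ := hA s' hs'
    obtain ⟨b1, b2, b3⟩ := hA s'' hs''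
    obtain ⟨t', ht', c'⟩ := Finset.mem_biUnion.1 a1
    obtain ⟨t'', ht'', c''⟩ := Finset.mem_biUnion.1 b1
    obtain ⟨x, hx⟩ : s.ω.Nonempty := dy_nonempty _ _
    have hω : s''.ω ⊆ s'.ω₁ := by
      rcases Tile.subset_half hk (s''.ω₁_subset (b3 hx)) (s'.ω₁_subset (a3 hx)) with h1 | h1
      · exact h1.1
      · exact absurd h1.2 (disjoint_left.1 s'.disjoint_ω (a3 hx))
    exact (SelTree.disjoint_top hU h ht'' ht' c'' c' hk hω).mono_right (hU t'' ht'' s'' c'').1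
  have hd : (A : Set Tile).PairwiseDisjoint Tile.I := by
    intro s' hs' s'' hs'' hne
    rcases lt_trichotomy s'.k s''.k with hk | hk | hk
    · exact key s' hs' s'' hs'' hk
    · obtain ⟨a1, a2, a3⟩ := hA s' hs'
      obtain ⟨b1, b2, b3⟩ := hA s'' hs''
      obtain ⟨x, hx⟩ : s.ω.Nonempty := dy_nonempty _ _
      have hn := Tile.eq_of_mem_ω hk (s'.ω₁_subset (a3 hx)) (s''.ω₁_subset (b3 hx))
      unfold Function.onFun Tile.I
      rw [hk]
      refine dy_disjoint fun hm => hne ?_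
      cases s'; cases s''; simp_all
    · exact (key s'' hs'' s' hs' hk).symm
  rw [← lintegral_biUnion_finset hd fun s _ => s.measurableSet_I]
  refine lintegral_mono_set (iUnion₂_subset fun s' hs' => ?_)
  obtain ⟨a1, a2, a3⟩ := hA s' hs'
  obtain ⟨t', ht', c'⟩ := Finset.mem_biUnion.1 a1
  exact disjoint_left.1 (SelTree.disjoint_top hU h ht ht' hs c' a2 a3)

end Selection

lemma enorm_inner_comm_integral (u v : ℝ → ℂ) :
    ‖∫ x, inner ℂ (u x) (v x)‖ₑ = ‖∫ x, inner ℂ (v x) (u x)‖ₑ := by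
  have : ∫ x, inner ℂ (v x) (u x) = star (∫ x, inner ℂ (u x) (v x)) := by
    rw [← starRingEnd_apply, ← integral_conj]
    simp only [inner_conj_symm]
  rw [this, ← ofReal_norm, ← ofReal_norm, norm_star]

lemma enorm_integral_inner_sq_le {u v : ℝ → ℂ} (hu : AEStronglyMeasurable u)
    (hv : AEStronglyMeasurable v) :
    ‖∫ x, inner ℂ (u x) (v x)‖ₑ ^ 2 ≤ (∫⁻ x, ‖u x‖ₑ ^ 2) * ∫⁻ x, ‖v x‖ₑ ^ 2 := by
  have h := enorm_integral_inner_le Real.HolderConjugate.two_two hu hv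
  have h2 := pow_le_pow_left₀ zero_le h 2
  have e : ∀ I : ℝ≥0∞, (I ^ (1 / (2:ℝ))) ^ 2 = I := fun I => by
    rw [← ENNReal.rpow_natCast, ← ENNReal.rpow_mul]; norm_num
  rw [mul_pow, e, e] at h2
  simpa using h2

/-- Wave packet coefficient of `f` at the tile `s`. -/
noncomputable def coef (φ f : ℝ → ℂ) (s : Tile) : ℂ :=
  ((2:ℝ) ^ (-s.k) : ℝ) * ∫ x, inner ℂ (s.packet φ x) (f x)

lemma mul_inner_left (a z w : ℂ) : inner ℂ (a * z) w = (starRingEnd ℂ) a * inner ℂ z w := by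
  rw [← smul_eq_mul a z, inner_smul_left]

namespace IsPacket
variable {φ : ℝ → ℂ} {C : ℝ≥0}

lemma integrable_inner_right (hφ : IsPacket φ C) {f : ℝ → ℂ} (hf : MemLp f 2) (s : Tile) :
    Integrable fun x => inner ℂ (s.packet φ x) (f x) := by
  refine (L2.integrable_inner (𝕜 := ℂ) ((hφ.memLp_packet s).toLp _) (hf.toLp _)).congr ?_
  filter_upwards [(hφ.memLp_packet s).coeFn_toLp, hf.coeFn_toLp] with x a b
  rw [a, b]

/-- Duality between coefficients and wave packet sums. -/
lemma enorm_integral_packetSum_inner (hφ : IsPacket φ C) {f : ℝ → ℂ} (hf : MemLp f 2)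
    (T : Finset Tile) : ‖∫ x, inner ℂ (packetSum φ (coef φ f) T x) (f x)‖ₑ =
      ∑ s ∈ T, s.len * ‖coef φ f s‖ₑ ^ 2 := by
  have h1 : ∫ x, inner ℂ (packetSum φ (coef φ f) T x) (f x) =
      ((∑ s ∈ T, (2:ℝ) ^ s.k * ‖coef φ f s‖ ^ 2 : ℝ) : ℂ) := by
    unfold packetSum
    simp only [sum_inner, mul_inner_left]
    rw [integral_finsetSum _ fun s _ => (hφ.integrable_inner_right hf s).const_mul _]
    push_cast
    refine Finset.sum_congr rfl fun s _ => ?_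
    rw [integral_const_mul]
    have h2 : ∫ x, inner ℂ (s.packet φ x) (f x) = ((2:ℝ) ^ s.k : ℝ) * coef φ f s := by
      unfold coef
      rw [← mul_assoc, ← Complex.ofReal_mul, ← zpow_add₀ two_ne_zero]
      simp
    rw [h2, mul_left_comm, Complex.conj_mul']
    simp
  rw [h1, ← ofReal_norm, Complex.norm_real, Real.norm_of_nonneg (by positivity),
    ENNReal.ofReal_sum_of_nonneg fun s _ => by positivity]
  refine Finset.sum_congr rfl fun s _ => ?_
  rw [ENNReal.ofReal_mul (by positivity), ENNReal.ofReal_pow (norm_nonneg _), ofReal_norm]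
  rfl

end IsPacket

namespace IsPacket
variable {φ : ℝ → ℂ} {C : ℝ≥0}

lemma sum_nested_le [DecidableEq Tile] (hφ : IsPacket φ C) {a : Tile → ℂ} {σ : ℝ≥0∞}
    {P : Finset Tile} (hσ : HasSize P a σ) {𝒯 : Finset SelTree} (hP : ∀ t ∈ 𝒯, t.T ⊆ P)
    (hU : ∀ t ∈ 𝒯, t.IsUpper) (hd : (𝒯 : Set SelTree).PairwiseDisjoint SelTree.T)
    (h : ∀ t ∈ 𝒯, ∀ t' ∈ 𝒯, t.ξ < t'.ξ → ∀ s ∈ t'.T, ¬ t.Covers s)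
    (R : Tile → Tile → Prop) [∀ s s', Decidable (R s s')]
    (hR : ∀ s s', R s s' → s'.k < s.k ∧ s.ω ⊆ s'.ω₁) :
    ∑ s ∈ 𝒯.biUnion SelTree.T, ∑ s' ∈ 𝒯.biUnion SelTree.T with R s s', ‖a s‖ₑ * ‖a s'‖ₑ *
      ‖∫ x, inner ℂ (s.packet φ x) (s'.packet φ x)‖ₑ ≤
    (C ^ 2 * 2 ^ 18 * chiC * (4 * chiC ^ 2)) * (σ ^ 2 * ∑ t ∈ 𝒯, t.len) := by
  have ha : ∀ s ∈ 𝒯.biUnion SelTree.T, ‖a s‖ₑ ≤ σ := fun s hs => by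
    obtain ⟨t, ht, hs⟩ := Finset.mem_biUnion.1 hs
    exact hσ.enorm_le (hP t ht hs)
  have h1 : ∀ t ∈ 𝒯, ∀ s ∈ t.T, ∑ s' ∈ 𝒯.biUnion SelTree.T with R s s', ‖a s‖ₑ * ‖a s'‖ₑ *
      ‖∫ x, inner ℂ (s.packet φ x) (s'.packet φ x)‖ₑ ≤
      (C ^ 2 * 2 ^ 18 * chiC * σ ^ 2) * ∫⁻ x in (dy t.k t.m)ᶜ, s.chi x ^ 4 := by
    intro t ht s hs
    calc _ ≤ ∑ s' ∈ 𝒯.biUnion SelTree.T with R s s',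
          (C ^ 2 * 2 ^ 18 * chiC * σ ^ 2) * ∫⁻ x in s'.I, s.chi x ^ 18 := by
          refine Finset.sum_le_sum fun s' hs' => ?_
          obtain ⟨h2, h3⟩ := Finset.mem_filter.1 hs'
          calc _ ≤ σ * σ * ((C ^ 2 * 2 ^ 18 * chiC) * ∫⁻ x in s'.I, s.chi x ^ 18) :=
                mul_le_mul' (mul_le_mul' (ha s (Finset.mem_biUnion.2 ⟨t, ht, hs⟩)) (ha s' h2))
                  (hφ.enorm_inner_le_setLIntegral (hR _ _ h3).1.le)
            _ = _ := by ring
      _ ≤ (C ^ 2 * 2 ^ 18 * chiC * σ ^ 2) * ∫⁻ x in (dy t.k t.m)ᶜ, s.chi x ^ 18 := by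
          rw [← Finset.mul_sum]
          refine mul_le_mul_right (SelTree.sum_setLIntegral_le hU h ht hs _ (fun s' hs' => ?_) _) _
          exact ⟨(Finset.mem_filter.1 hs').1, hR _ _ (Finset.mem_filter.1 hs').2⟩
      _ ≤ _ := mul_le_mul_right (lintegral_mono fun x => chi_pow_le_pow _ _ _ (by norm_num)) _
  rw [Finset.sum_biUnion hd]
  calc _ ≤ ∑ t ∈ 𝒯, ∑ s ∈ t.T,
        (C ^ 2 * 2 ^ 18 * chiC * σ ^ 2) * ∫⁻ x in (dy t.k t.m)ᶜ, s.chi x ^ 4 :=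
        Finset.sum_le_sum fun t ht => Finset.sum_le_sum fun s hs => h1 t ht s hs
    _ ≤ ∑ t ∈ 𝒯, (C ^ 2 * 2 ^ 18 * chiC * σ ^ 2) * ((2 * chiC ^ 2) * (2 * t.len)) := by
        refine Finset.sum_le_sum fun t ht => ?_
        rw [← Finset.mul_sum]
        refine mul_le_mul_right (sum_setLIntegral_compl_le (ξ := t.ξ) fun s hs => ?_) _
        exact ⟨(hU t ht s hs).1, s.ω₂_subset (hU t ht s hs).2⟩
    _ = _ := by
        rw [← Finset.mul_sum, ← Finset.mul_sum, ← Finset.mul_sum]; ring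

lemma lintegral_packetSum_biUnion_le [DecidableEq Tile] (hφ : IsPacket φ C) {a : Tile → ℂ}
    {σ : ℝ≥0∞}
    {P : Finset Tile} (hσ : HasSize P a σ) {𝒯 : Finset SelTree} (hP : ∀ t ∈ 𝒯, t.T ⊆ P)
    (hU : ∀ t ∈ 𝒯, t.IsUpper) (hd : (𝒯 : Set SelTree).PairwiseDisjoint SelTree.T)
    (h : ∀ t ∈ 𝒯, ∀ t' ∈ 𝒯, t.ξ < t'.ξ → ∀ s ∈ t'.T, ¬ t.Covers s) :
    ∫⁻ x, ‖packetSum φ a (𝒯.biUnion SelTree.T) x‖ₑ ^ 2 ≤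
      (2 * C ^ 2 * chiC ^ 2) * ∑ s ∈ 𝒯.biUnion SelTree.T, s.len * ‖a s‖ₑ ^ 2 +
      (2 * (C ^ 2 * 2 ^ 18 * chiC * (4 * chiC ^ 2))) * (σ ^ 2 * ∑ t ∈ 𝒯, t.len) := by
  classical
  refine (hφ.lintegral_packetSum_sq_le _ _).trans ?_
  set U := 𝒯.biUnion SelTree.T with hUdef
  set w : Tile → Tile → ℝ≥0∞ := fun s s' => ‖a s‖ₑ * ‖a s'‖ₑ *
      ‖∫ x, inner ℂ (s.packet φ x) (s'.packet φ x)‖ₑ with hw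
  have hsymm : ∀ s s', w s s' = w s' s := fun s s' => by
    simp only [hw]; rw [mul_comm ‖a s‖ₑ, enorm_inner_comm_integral]
  set R : Tile → Tile → Prop := fun s s' => s'.k < s.k ∧ s.ω ⊆ s'.ω₁ with hR
  have hn := hφ.sum_nested_le hσ hP hU hd h R fun s s' => id
  have h3 : ∀ s s', w s s' ≤ ((if s'.k = s.k ∧ s'.n = s.n then w s s' else 0) +
      (if R s s' then w s s' else 0)) + (if R s' s then w s' s else 0) := by
    intro s s'
    by_cases hdis : Disjoint s.ω₁ s'.ω₁
    · have : w s s' = 0 := by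
        simp only [hw]; rw [hφ.inner_eq_zero_of_disjoint hdis]; simp
      rw [this]; exact zero_le
    · rcases Tile.meet_cases hdis with h1 | h1 | h1
      · rw [if_pos ⟨(Tile.eq_of_ω h1).1.symm, (Tile.eq_of_ω h1).2.symm⟩, add_assoc]
        exact le_self_add
      · rw [if_pos (show R s s' from h1), add_right_comm]
        exact le_add_self
      · rw [if_pos (show R s' s from h1), hsymm s s']
        exact le_add_self
  calc ∑ s ∈ U, ∑ s' ∈ U, w s s' ≤ ∑ s ∈ U, ∑ s' ∈ U,
        (((if s'.k = s.k ∧ s'.n = s.n then w s s' else 0) +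
        (if R s s' then w s s' else 0)) + (if R s' s then w s' s else 0)) :=
        Finset.sum_le_sum fun s _ => Finset.sum_le_sum fun s' _ => h3 s s'
    _ = (∑ s ∈ U, ∑ s' ∈ U with s'.k = s.k ∧ s'.n = s.n, w s s') +
        2 * ∑ s ∈ U, ∑ s' ∈ U with R s s', w s s' := by
        simp only [Finset.sum_add_distrib, Finset.sum_filter]
        rw [Finset.sum_comm (f := fun s s' => if R s' s then w s' s else 0)]
        ring
    _ ≤ _ := by
        refine add_le_add (hφ.sum_same_le a U) ?_
        rw [mul_assoc 2]
        exact mul_le_mul_right hn _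

end IsPacket

/-- The size lemma: halving the size at the cost of trees with controlled total top length. -/
theorem size_lemma (C : ℝ≥0) : ∃ A : ℝ≥0∞, A ≠ ⊤ ∧ ∀ (φ f : ℝ → ℂ) (P : Finset Tile) (σ : ℝ≥0∞),
    IsPacket φ C → MemLp f 2 → σ ≠ 0 → σ ≠ ⊤ → HasSize P (coef φ f) σ →
    ∃ P' ⊆ P, HasSize P' (coef φ f) (σ / 2) ∧
      ∃ (ι : Type) (F : Finset ι) (k m : ι → ℤ) (ξ : ι → ℝ),
      (∀ s ∈ P, s ∈ P' ∨ ∃ i ∈ F, s.I ⊆ dy (k i) (m i) ∧ ξ i ∈ s.ω) ∧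
      ∑ i ∈ F, ENNReal.ofReal (2 ^ k i) ≤ A * ((∫⁻ x, ‖f x‖ₑ ^ 2) / σ ^ 2) := by
  classical
  set c : ℝ≥0∞ := (2 * C ^ 2 * chiC ^ 2) + (2 * (C ^ 2 * 2 ^ 18 * chiC * (4 * chiC ^ 2))) * 4
    with hc
  have hct : c ≠ ⊤ := by finiteness
  refine ⟨4 * c, by finiteness, fun φ f P σ hφ hf h0 ht hσ => ?_⟩
  obtain ⟨𝒯, P', h1, h2, h3, h4, h5, h6, -⟩ := exists_selection (coef φ f) (σ / 2) P
  refine ⟨P', h1, h2, SelTree, 𝒯, SelTree.k, SelTree.m, SelTree.ξ, h4, ?_⟩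
  set U := 𝒯.biUnion SelTree.T with hU
  set S := ∑ s ∈ U, s.len * ‖coef φ f s‖ₑ ^ 2 with hS
  have hSt : S ≠ ⊤ := ENNReal.sum_ne_top.2 fun s _ =>
    ENNReal.mul_ne_top s.len_ne_top (by finiteness)
  have hTS : σ ^ 2 * ∑ t ∈ 𝒯, t.len ≤ 4 * S := by
    rw [hS, hU, Finset.sum_biUnion h5, Finset.mul_sum, Finset.mul_sum]
    refine Finset.sum_le_sum fun t ht => ?_
    have := (h3 t ht).2.2.le
    calc σ ^ 2 * t.len = 4 * ((σ / 2) ^ 2 * t.len) := by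
          rw [show (4:ℝ≥0∞) = 2 ^ 2 by norm_num, ← mul_assoc, ← mul_pow,
            ENNReal.mul_div_cancel two_ne_zero ENNReal.ofNat_ne_top]
      _ ≤ _ := by gcongr
  have h7 : ∫⁻ x, ‖packetSum φ (coef φ f) U x‖ₑ ^ 2 ≤ c * S := by
    refine (hφ.lintegral_packetSum_biUnion_le hσ (fun t ht => (h3 t ht).1)
      (fun t ht => (h3 t ht).2.1) h5 h6).trans ?_
    rw [hc, add_mul, mul_assoc _ 4 S]
    exact add_le_add le_rfl (mul_le_mul_right hTS _)
  have h8 : S ≤ c * ∫⁻ x, ‖f x‖ₑ ^ 2 := by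
    have h9 := enorm_integral_inner_sq_le
      (hφ.continuous_packetSum (coef φ f) U).aestronglyMeasurable hf.1
    rw [hφ.enorm_integral_packetSum_inner hf U] at h9
    rcases eq_or_ne S 0 with hz | hz
    · rw [hz]; exact zero_le
    · refine (ENNReal.mul_le_mul_iff_left hz hSt).1 ?_
      calc S * S = S ^ 2 := (sq S).symm
        _ ≤ _ := h9
        _ ≤ (c * S) * ∫⁻ x, ‖f x‖ₑ ^ 2 := mul_le_mul_left h7 _
        _ = _ := by ring
  rw [← mul_div_assoc, ENNReal.le_div_iff_mul_le (Or.inl (by positivity))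
    (Or.inl (by finiteness))]
  calc _ = σ ^ 2 * ∑ t ∈ 𝒯, t.len := mul_comm _ _
    _ ≤ 4 * S := hTS
    _ ≤ 4 * (c * ∫⁻ x, ‖f x‖ₑ ^ 2) := mul_le_mul_right h8 _
    _ = _ := by ring

lemma eq_zero_of_fourier_eq_zero {h : ℝ → ℂ} (hc : Continuous h) (hi : Integrable h)
    (h0 : ∀ ξ, 𝓕 h ξ = 0) : h = 0 := by
  have h1 : 𝓕 h = fun _ => 0 := funext h0
  rw [← hc.fourierInv_fourier_eq hi (by rw [h1]; exact integrable_zero _ _ _), h1]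
  ext x
  simp [Real.fourierInv_eq]

/-- Scalar convolution. -/
noncomputable def sconv (κ u : ℝ → ℂ) (x : ℝ) : ℂ := ∫ y, κ (x - y) * u y

lemma sconv_eq_convolution (κ u : ℝ → ℂ) :
    sconv κ u = convolution κ u (ContinuousLinearMap.mul ℂ ℂ) volume := by
  ext x
  rw [convolution_eq_swap]; rfl

lemma integrable_sconv {κ u : ℝ → ℂ} (hκ : Integrable κ) (hu : Integrable u) :
    Integrable (sconv κ u) := by
  rw [sconv_eq_convolution]; exact hκ.integrable_convolution _ hu

lemma fourier_sconv {κ u : ℝ → ℂ} (hκ : Integrable κ) (hu : Integrable u) (ξ : ℝ) :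
    𝓕 (sconv κ u) ξ = 𝓕 κ ξ * 𝓕 u ξ := by
  rw [sconv_eq_convolution]; exact Real.fourier_mul_convolution_eq hκ hu ξ

lemma continuous_sconv {κ u : ℝ → ℂ} (hκ : Integrable κ) (hu : Continuous u) {B : ℝ}
    (hB : ∀ x, ‖u x‖ ≤ B) : Continuous (sconv κ u) := by
  rw [sconv_eq_convolution]
  exact BddAbove.continuous_convolution_right_of_integrable _
    ⟨B, by rintro _ ⟨x, rfl⟩; exact hB x⟩ hκ hu

lemma sconv_eq_of_fourier {κ u v : ℝ → ℂ} (hκ : Integrable κ) (hu : Continuous u)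
    (hui : Integrable u) {B : ℝ} (hB : ∀ x, ‖u x‖ ≤ B) (hv : Continuous v) (hvi : Integrable v)
    (h : ∀ ξ, 𝓕 κ ξ * 𝓕 u ξ = 𝓕 v ξ) : sconv κ u = v := by
  have h1 := eq_zero_of_fourier_eq_zero ((continuous_sconv hκ hu hB).sub hv)
    ((integrable_sconv hκ hui).sub hvi) fun ξ => by
      have : 𝓕 (sconv κ u - v) ξ = 𝓕 (sconv κ u) ξ - 𝓕 v ξ := by
        simp only [fourier_eq_ech, Pi.sub_apply, mul_sub]
        have hint : ∀ w : ℝ → ℂ, Integrable w → Integrable fun x => ech (-(x * ξ)) * w x :=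
          fun w hw => hw.bdd_mul (c := 1)
            (continuous_ech.comp (by fun_prop : Continuous fun x : ℝ => -(x * ξ))).aestronglyMeasurable
            (ae_of_all _ fun x => (norm_ech _).le)
        exact integral_sub (hint _ (integrable_sconv hκ hui)) (hint _ hvi)
      rw [this, fourier_sconv hκ hui, h, sub_self]
  exact sub_eq_zero.1 h1

/-- Dilated and modulated kernel. -/
noncomputable def modKernel (ψ : ℝ → ℂ) (b : ℤ) (ξ x : ℝ) : ℂ :=
  ((2:ℝ) ^ (-b) : ℝ) * ψ ((2:ℝ) ^ (-b) * x) * ech (x * ξ)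

lemma continuous_modKernel {ψ : ℝ → ℂ} (hψ : Continuous ψ) (b : ℤ) (ξ : ℝ) :
    Continuous (modKernel ψ b ξ) :=
  (continuous_const.mul (hψ.comp (by fun_prop))).mul (continuous_ech.comp (by fun_prop))

lemma norm_modKernel_le {ψ : ℝ → ℂ} {D : ℝ} (hD : ∀ x, ‖ψ x‖ ≤ D * ((1 + |x|) ^ 2)⁻¹) (b : ℤ)
    (ξ x : ℝ) : ‖modKernel ψ b ξ x‖ ≤ D * (((2:ℝ) ^ b)⁻¹ * ((1 + |x| / 2 ^ b) ^ 2)⁻¹) := by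
  have h2 := two_zpow_pos b
  unfold modKernel
  rw [norm_mul, norm_mul, norm_ech, mul_one, Complex.norm_real, Real.norm_of_nonneg (by positivity),
    zpow_neg]
  calc _ ≤ ((2:ℝ) ^ b)⁻¹ * (D * ((1 + |((2:ℝ) ^ b)⁻¹ * x|) ^ 2)⁻¹) := by gcongr; exact hD _
    _ = _ := by
      rw [abs_mul, abs_of_pos (inv_pos.2 h2), div_eq_inv_mul |x|]; ring

lemma integrable_modKernel {ψ : ℝ → ℂ} (hψ : Integrable ψ) (hc : Continuous ψ) (b : ℤ) (ξ : ℝ) :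
    Integrable (modKernel ψ b ξ) := by
  refine (((hψ.comp_mul_left' (R := (2:ℝ) ^ (-b)) (by positivity)).const_mul
    (((2:ℝ) ^ (-b) : ℝ) : ℂ)).norm).mono' (continuous_modKernel hc b ξ).aestronglyMeasurable
    (ae_of_all _ fun x => ?_)
  unfold modKernel
  rw [norm_mul, norm_ech, mul_one]

lemma fourier_modKernel (ψ : ℝ → ℂ) (b : ℤ) (ξ ζ : ℝ) :
    𝓕 (modKernel ψ b ξ) ζ = 𝓕 ψ ((2:ℝ) ^ b * (ζ - ξ)) := by
  rw [fourier_eq_ech, fourier_eq_ech]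
  have h3 : (2:ℝ) ^ (-b) * 2 ^ b = 1 := by rw [← zpow_add₀ two_ne_zero]; simp
  have e : ∀ x : ℝ, ech (-(x * ζ)) * modKernel ψ b ξ x = ((2:ℝ) ^ (-b) : ℝ) *
      (fun u => ech (-(u * ((2:ℝ) ^ b * (ζ - ξ)))) * ψ u) ((2:ℝ) ^ (-b) * x) := by
    intro x
    have : ech (-(x * ζ)) * ech (x * ξ) = ech (-((2:ℝ) ^ (-b) * x * ((2:ℝ) ^ b * (ζ - ξ)))) := by
      rw [← ech_add]; congr 1; linear_combination (x * (ζ - ξ)) * h3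
    simp only [modKernel]
    rw [← this]; ring
  simp_rw [e]
  rw [integral_const_mul, Measure.integral_comp_mul_left
    (fun u => ech (-(u * ((2:ℝ) ^ b * (ζ - ξ)))) * ψ u), Complex.real_smul, ← mul_assoc,
    ← Complex.ofReal_mul, abs_of_pos (by positivity), mul_inv_cancel₀ (by positivity)]
  simp

/-- Convolution with a dilated kernel is dominated by the maximal function, uniformly over points
at distance at most the scale. -/
lemma enorm_sconv_modKernel_le {ψ : ℝ → ℂ} {D : ℝ} (hD0 : 0 ≤ D)
    (hD : ∀ x, ‖ψ x‖ ≤ D * ((1 + |x|) ^ 2)⁻¹) (b : ℤ) (ξ : ℝ) {u : ℝ → ℂ} (hu : Measurable u)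
    {x x' : ℝ} (hx : |x - x'| ≤ 2 ^ b) :
    ‖sconv (modKernel ψ b ξ) u x‖ₑ ≤ ENNReal.ofReal D * (32 * maxFn (fun y => ‖u y‖ₑ) x') := by
  refine (enorm_integral_le_lintegral_enorm _).trans ?_
  refine le_trans ?_ (mul_le_mul_right
    (maxFn.weight_le (fun y => ‖u y‖ₑ) hu.enorm (two_zpow_pos b) hx) _)
  rw [← lintegral_const_mul' _ _ ENNReal.ofReal_ne_top]
  refine lintegral_mono fun y => ?_
  rw [enorm_mul, ← mul_assoc, ← ENNReal.ofReal_mul hD0]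
  refine mul_le_mul_left ?_ _
  rw [← ofReal_norm]
  exact ENNReal.ofReal_le_ofReal (norm_modKernel_le hD b ξ _)

/-- A Schwartz kernel with Fourier transform one near the origin. -/
lemma exists_cutoff : ∃ (ψ : 𝓢(ℝ, ℂ)) (D : ℝ), 0 ≤ D ∧ (∀ x, ‖ψ x‖ ≤ D * ((1 + |x|) ^ 2)⁻¹) ∧
    (∀ u, |u| ≤ 7 / 8 → 𝓕 (ψ : ℝ → ℂ) u = 1) ∧ ∀ u, 2 ≤ |u| → 𝓕 (ψ : ℝ → ℂ) u = 0 := by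
  obtain ⟨ψ, h1, h2⟩ := exists_schwartz_bump (a := -2) (b := -(7/8)) (c := 7/8) (d := 2)
    (by norm_num) (by norm_num)
  obtain ⟨D, hD, hD1, -⟩ := ψ.exists_decay 2
  exact ⟨ψ, D, hD, hD1, fun u hu => h1 u (abs_le.1 hu), fun u hu => h2 u fun h =>
    hu.not_gt (abs_lt.2 h)⟩

/-- One term of the model operator. -/
noncomputable def modelTerm (φ : ℝ → ℂ) (a : Tile → ℂ) (N : ℝ → ℝ) (s : Tile) (x : ℝ) : ℂ :=
  (N ⁻¹' s.ω₂).indicator (fun x => a s * s.packet φ x) x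

/-- The model operator of the Carleson operator, linearised by `N`. -/
noncomputable def modelSum (φ : ℝ → ℂ) (a : Tile → ℂ) (N : ℝ → ℝ) (T : Finset Tile) (x : ℝ) : ℂ :=
  ∑ s ∈ T, modelTerm φ a N s x

lemma Tile.le_and_lt_of_mem_ω₂ {s : Tile} {ξ : ℝ} (hξ : ξ ∈ s.ω₂) :
    (s.n:ℝ) + 1 / 2 ≤ 2 ^ s.k * ξ ∧ 2 ^ s.k * ξ < s.n + 1 := by
  have hk := two_zpow_pos s.k
  obtain ⟨g1, g2⟩ := hξ
  have e1 : (2:ℝ) ^ s.k * 2 ^ (-s.k - 1) = 1 / 2 := by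
    rw [← zpow_add₀ two_ne_zero, show s.k + (-s.k - 1) = -1 by ring]; norm_num
  have g1' := mul_le_mul_of_nonneg_left g1 hk.le
  have g2' := mul_lt_mul_of_pos_left g2 hk
  push_cast at g1' g2'
  constructor
  · linear_combination g1' - (2 * (s.n:ℝ) + 1) * e1
  · linear_combination g2' + (2 * (s.n:ℝ) + 2) * e1

namespace IsPacket

variable {φ : ℝ → ℂ} {C : ℝ≥0} {a : Tile → ℂ} {N : ℝ → ℝ} {σ μ : ℝ≥0∞}

lemma measurable_modelTerm (hφ : IsPacket φ C) (a : Tile → ℂ) (hN : Measurable N) (s : Tile) :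
    Measurable (modelTerm φ a N s) :=
  Measurable.indicator ((continuous_const.mul (hφ.continuous_packet s)).measurable)
    (hN s.measurableSet_ω₂)

lemma measurable_modelSum (hφ : IsPacket φ C) (a : Tile → ℂ) (hN : Measurable N)
    (T : Finset Tile) : Measurable (modelSum φ a N T) :=
  Finset.measurable_sum _ fun s _ => hφ.measurable_modelTerm a hN s

lemma enorm_modelTerm_le (hφ : IsPacket φ C) (s : Tile) (x : ℝ) :
    ‖modelTerm φ a N s x‖ₑ ≤ (N ⁻¹' s.ω).indicator (fun x => ‖a s‖ₑ * (C * s.chi x ^ 20)) x := by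
  unfold modelTerm
  by_cases h : x ∈ N ⁻¹' s.ω₂
  · rw [indicator_of_mem h, indicator_of_mem (show x ∈ N ⁻¹' s.ω from s.ω₂_subset h), enorm_mul]
    exact mul_le_mul_right (hφ.enorm_packet_le s x) _
  · rw [indicator_of_notMem h, enorm_zero]; exact zero_le

/-- Tiles with the same frequency interval contribute a bounded amount at each point. -/
lemma sum_enorm_packet_le (hφ : IsPacket φ C) {T : Finset Tile} {k : ℤ} (hk : ∀ s ∈ T, s.k = k)
    (hn : ∀ s ∈ T, ∀ s' ∈ T, s.n = s'.n) (ha : ∀ s ∈ T, ‖a s‖ₑ ≤ σ) (x : ℝ) :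
    ∑ s ∈ T, ‖a s * s.packet φ x‖ₑ ≤ σ * (C * chiC) := by
  calc ∑ s ∈ T, ‖a s * s.packet φ x‖ₑ ≤ ∑ s ∈ T, σ * (C * (fun m => _root_.chi k m x ^ 2) s.m) := by
        refine Finset.sum_le_sum fun s hs => ?_
        rw [enorm_mul]
        refine mul_le_mul' (ha s hs) ((hφ.enorm_packet_le s x).trans (mul_le_mul_right ?_ _))
        rw [← hk s hs]
        exact chi_pow_le_pow _ _ _ (by norm_num)
    _ = σ * (C * ∑ s ∈ T, (fun m => _root_.chi k m x ^ 2) s.m) := by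
        simp_rw [Finset.mul_sum]
    _ ≤ _ := mul_le_mul_right (mul_le_mul_right
        ((Tile.sum_le_tsum_of_fixed hk hn _).trans (tsum_chi_sq_le k x)) _) _

end IsPacket

/-- If the time interval of a tile is not contained in the triple of `J`, its tail is essentially
constant on `J`. -/
lemma chi_le_of_not_subset {k m κ j : ℤ}
    (h : ¬ dy k m ⊆ Ico (((j:ℝ) - 1) * 2 ^ κ) ((j + 2) * 2 ^ κ)) {x y : ℝ} (hx : x ∈ dy κ j)
    (hy : y ∈ dy κ j) : chi k m x ≤ 2 * chi k m y := by
  have hk := two_zpow_pos k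
  have hκ := two_zpow_pos κ
  have e : (2:ℝ) ^ (-k) * 2 ^ k = 1 := by rw [← zpow_add₀ two_ne_zero]; simp
  have hi : (0:ℝ) < 2 ^ (-k) := two_zpow_pos _
  have hxy := abs_sub_le_of_mem_dy hx hy
  have h1 : (2:ℝ) ^ κ - 2 ^ k ≤ |x - m * 2 ^ k| := by
    by_contra hc
    push Not at hc
    obtain ⟨hc1, hc2⟩ := abs_lt.1 hc
    refine h fun z hz => ?_
    obtain ⟨a1, a2⟩ := hz
    obtain ⟨b1, b2⟩ := hx
    constructor <;> nlinarith
  have e1 : |(2:ℝ) ^ (-k) * x - m| = 2 ^ (-k) * |x - m * 2 ^ k| := by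
    rw [← abs_of_pos hi, ← abs_mul, abs_of_pos hi]; congr 1; linear_combination (m:ℝ) * e
  have e2 : |(2:ℝ) ^ (-k) * y - m| ≤ |(2:ℝ) ^ (-k) * x - m| + 2 ^ (-k) * |x - y| := by
    have e3 : (2:ℝ) ^ (-k) * |x - y| = |-(2 ^ (-k) * (x - y))| := by
      rw [abs_neg, abs_mul, abs_of_pos hi]
    rw [e3]
    exact (congrArg abs (by ring)).trans_le (abs_add_le _ _)
  have := chi_le_of_abs_le (k := k) (m := m) (k' := k) (m' := m) (x := x) (y := y) (c := 2)
    (by norm_num) (by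
      rw [e1] at e2 ⊢
      have := mul_le_mul_of_nonneg_left h1 hi.le
      have h3 := mul_le_mul_of_nonneg_left hxy hi.le
      nlinarith [abs_nonneg (x - m * 2 ^ k)])
  simpa using this

namespace IsPacket

variable {φ : ℝ → ℂ} {C : ℝ≥0} {a : Tile → ℂ} {N : ℝ → ℝ} {σ μ : ℝ≥0∞} {E : Set ℝ}

lemma setLIntegral_modelTerm_le (hφ : IsPacket φ C) (hN : Measurable N) (hE : MeasurableSet E)
    {s : Tile} (hs : s.IsDense N E μ) (ha : ‖a s‖ₑ ≤ σ) {κ j : ℤ}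
    (h : ¬ s.I ⊆ Ico (((j:ℝ) - 1) * 2 ^ κ) ((j + 2) * 2 ^ κ)) {y : ℝ} (hy : y ∈ dy κ j) :
    ∫⁻ x in E ∩ dy κ j, ‖modelTerm φ a N s x‖ₑ ≤
      (σ * C * 2 ^ 14 * (16 * chiC * μ)) * (s.len * s.chi y ^ 14) := by
  have hm : MeasurableSet (E ∩ N ⁻¹' s.ω) := hE.inter (hN (measurableSet_dy _ _))
  calc ∫⁻ x in E ∩ dy κ j, ‖modelTerm φ a N s x‖ₑ
      ≤ ∫⁻ x in E ∩ dy κ j, (N ⁻¹' s.ω).indicator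
          (fun x => (σ * C * (2 * s.chi y) ^ 14) * s.chi x ^ 6) x := by
        refine setLIntegral_mono_ae' (hE.inter (measurableSet_dy _ _)) (ae_of_all _ fun x hx => ?_)
        refine (hφ.enorm_modelTerm_le s x).trans (indicator_le_indicator ?_)
        calc ‖a s‖ₑ * (C * s.chi x ^ 20) ≤ σ * (C * (s.chi x ^ 14 * s.chi x ^ 6)) := by
              rw [← pow_add]; exact mul_le_mul_left ha _
          _ ≤ σ * (C * ((2 * s.chi y) ^ 14 * s.chi x ^ 6)) := by
              refine mul_le_mul_right (mul_le_mul_right (mul_le_mul_left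
                (pow_le_pow_left₀ zero_le ?_ _) _) _) _
              exact chi_le_of_not_subset h hx.2 hy
          _ = _ := by ring
    _ = ∫⁻ x in (E ∩ dy κ j) ∩ N ⁻¹' s.ω, (σ * C * (2 * s.chi y) ^ 14) * s.chi x ^ 6 := by
        have hm' : MeasurableSet (N ⁻¹' s.ω) := hN (measurableSet_dy _ _)
        rw [setLIntegral_indicator hm', inter_comm]
    _ ≤ ∫⁻ x in E ∩ N ⁻¹' s.ω, (σ * C * (2 * s.chi y) ^ 14) * s.chi x ^ 6 :=
        lintegral_mono_set (fun x hx => ⟨hx.1.1, hx.2⟩)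
    _ = (σ * C * (2 * s.chi y) ^ 14) * ∫⁻ x in E ∩ N ⁻¹' s.ω, s.chi x ^ 6 := by
        have hc : Measurable fun x => s.chi x ^ 6 := (measurable_chi _ _).pow_const _
        rw [lintegral_const_mul _ hc]
    _ ≤ (σ * C * (2 * s.chi y) ^ 14) * (16 * chiC * μ * s.len) :=
        mul_le_mul_right (hs.setLIntegral_chi_le hE hN) _
    _ = _ := by ring

/-- The contribution to the tree estimate of the tiles that are short compared with `J`. -/
lemma sum_setLIntegral_modelTerm_le (hφ : IsPacket φ C) (hN : Measurable N) (hE : MeasurableSet E)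
    {T : Finset Tile} {K M : ℤ} {ξ : ℝ} (hT : IsTree T K M ξ) (hs : ∀ s ∈ T, s.IsDense N E μ)
    (ha : ∀ s ∈ T, ‖a s‖ₑ ≤ σ) {κ j : ℤ} (hk : ∀ s ∈ T, s.k ≤ κ + 1)
    (h : ∀ s ∈ T, ¬ s.I ⊆ Ico (((j:ℝ) - 1) * 2 ^ κ) ((j + 2) * 2 ^ κ)) {y : ℝ}
    (hy : y ∈ dy κ j) :
    ∑ s ∈ T, ∫⁻ x in E ∩ dy κ j, ‖modelTerm φ a N s x‖ₑ ≤
      (C * 2 ^ 14 * (16 * chiC) * (16 * chiC)) * (σ * μ * ENNReal.ofReal (2 ^ κ) * chi K M y ^ 2) := by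
  calc _ ≤ ∑ s ∈ T, (σ * C * 2 ^ 14 * (16 * chiC * μ)) * (s.len * s.chi y ^ 14) :=
        Finset.sum_le_sum fun s hsT => hφ.setLIntegral_modelTerm_le hN hE (hs s hsT) (ha s hsT)
          (h s hsT) hy
    _ = (σ * C * 2 ^ 14 * (16 * chiC * μ)) * ∑ s ∈ T, (s.len * s.chi y ^ 14) := by
        rw [Finset.mul_sum]
    _ ≤ (σ * C * 2 ^ 14 * (16 * chiC * μ)) * ((4 * chi K M y ^ 2 * chiC) *
          (2 * ENNReal.ofReal (2 ^ (κ + 1)))) := by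
        refine mul_le_mul_right (sum_le_of_scales hk fun k T' hT' hk' => ?_) _
        have hn : ∀ s ∈ T', ∀ s' ∈ T', s.n = s'.n := fun s hs s' hs' =>
          Tile.eq_of_mem_ω ((hk' s hs).trans (hk' s' hs').symm) (hT s (hT' hs)).2 (hT s' (hT' hs')).2
        calc ∑ s ∈ T', (s.len * s.chi y ^ 14)
            ≤ ∑ s ∈ T', ENNReal.ofReal (2 ^ k) * (4 * chi K M y ^ 2 *
                (fun m => chi k m y ^ 2) s.m) := by
              refine Finset.sum_le_sum fun s hs => ?_
              rw [Tile.len, hk' s hs]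
              refine mul_le_mul_right ?_ _
              have h1 : s.chi y ≤ 2 * chi K M y := chi_le_of_dy_subset (hT s (hT' hs)).1 y
              calc s.chi y ^ 14 ≤ s.chi y ^ 4 := chi_pow_le_pow _ _ _ (by norm_num)
                _ = s.chi y ^ 2 * s.chi y ^ 2 := by ring
                _ ≤ (2 * chi K M y) ^ 2 * s.chi y ^ 2 :=
                  mul_le_mul_left (pow_le_pow_left₀ zero_le h1 _) _
                _ = _ := by rw [Tile.chi, hk' s hs]; ring
          _ = ENNReal.ofReal (2 ^ k) * (4 * chi K M y ^ 2 * ∑ s ∈ T', (fun m => chi k m y ^ 2) s.m) := by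
              simp_rw [Finset.mul_sum]
          _ ≤ ENNReal.ofReal (2 ^ k) * (4 * chi K M y ^ 2 * chiC) :=
              mul_le_mul_right (mul_le_mul_right ((Tile.sum_le_tsum_of_fixed hk' hn _).trans
                (tsum_chi_sq_le k y)) _) _
          _ = _ := mul_comm _ _
    _ = _ := by
        have e : ENNReal.ofReal ((2:ℝ) ^ (κ + 1)) = 2 * ENNReal.ofReal (2 ^ κ) := by
          rw [zpow_add_one₀ two_ne_zero, mul_comm, ENNReal.ofReal_mul (by norm_num)]; simp
        rw [e]; ring

/-- Convolution with a cutoff truncates the scales in a packet sum. -/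
lemma sconv_packetSum (hφ : IsPacket φ C) {ψ : 𝓢(ℝ, ℂ)}
    (h1 : ∀ u, |u| ≤ 7 / 8 → 𝓕 (ψ : ℝ → ℂ) u = 1) (h2 : ∀ u, 2 ≤ |u| → 𝓕 (ψ : ℝ → ℂ) u = 0)
    {T : Finset Tile} {ξ : ℝ} (hT : ∀ s ∈ T, ξ ∈ s.ω₂) {b : ℤ}
    (hb : ∀ s ∈ T, b ≤ s.k ∨ s.k ≤ b - 4) :
    sconv (modKernel ψ b ξ) (packetSum φ a T) = packetSum φ a {s ∈ T | b ≤ s.k} := by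
  have hadd : ∀ (T : Finset Tile) ζ, 𝓕 (packetSum φ a T) ζ = ∑ s ∈ T, a s * 𝓕 (s.packet φ) ζ := by
    intro T ζ
    simp only [fourier_eq_ech, packetSum, Finset.mul_sum]
    rw [integral_finsetSum]
    · refine Finset.sum_congr rfl fun s _ => ?_
      rw [← integral_const_mul]
      exact integral_congr_ae (ae_of_all _ fun x => by ring)
    · intro s _
      exact ((hφ.integrable_packet s).const_mul (a s)).bdd_mul (c := 1)
        (continuous_ech.comp (by fun_prop : Continuous fun x : ℝ => -(x * ζ))).aestronglyMeasurable
        (ae_of_all _ fun x => (norm_ech _).le)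
  have hB : ∀ x, ‖packetSum φ a T x‖ ≤ ∑ s ∈ T, ‖a s‖ * C := fun x => by
    refine (norm_sum_le _ _).trans (Finset.sum_le_sum fun s _ => ?_)
    rw [norm_mul]
    exact mul_le_mul_of_nonneg_left (hφ.norm_packet_le s x) (norm_nonneg _)
  refine sconv_eq_of_fourier (integrable_modKernel ψ.integrable ψ.continuous b ξ)
    (hφ.continuous_packetSum a T) (hφ.integrable_packetSum a T) hB (hφ.continuous_packetSum a _)
    (hφ.integrable_packetSum a _) fun ζ => ?_
  rw [hadd, hadd, fourier_modKernel, Finset.mul_sum, Finset.sum_filter]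
  refine Finset.sum_congr rfl fun s hs => ?_
  by_cases hz : |(2:ℝ) ^ s.k * ζ - (s.n + 1 / 4)| ≤ 1 / 8
  · have hk := two_zpow_pos s.k
    have hbp := two_zpow_pos b
    have hξ := Tile.le_and_lt_of_mem_ω₂ (hT s hs)
    obtain ⟨z1, z2⟩ := abs_le.1 hz
    have hd1 : -(7/8) ≤ (2:ℝ) ^ s.k * (ζ - ξ) := by linarith
    have hd2 : (2:ℝ) ^ s.k * (ζ - ξ) ≤ -(1/8) := by linarith
    split_ifs with hbk
    · rw [h1, one_mul]
      have := zpow_le_zpow_right₀ (one_le_two (α := ℝ)) hbk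
      have hneg : ζ - ξ < 0 := by nlinarith
      rw [abs_le]
      constructor
      · nlinarith
      · nlinarith
    · rw [h2, zero_mul]
      have h3 : s.k ≤ b - 4 := (hb s hs).resolve_left hbk
      have := zpow_le_zpow_right₀ (one_le_two (α := ℝ)) h3
      have e : (2:ℝ) ^ b = 2 ^ (b - 4) * 16 := by rw [zpow_sub₀ two_ne_zero]; norm_num
      have hneg : ζ - ξ < 0 := by nlinarith
      rw [le_abs]; right
      nlinarith
  · rw [hφ.fourier_packet_eq_zero s (not_le.1 hz)]; simp

end IsPacket

open Classical in
lemma modelSum_eq_packetSum (φ : ℝ → ℂ) (a : Tile → ℂ) (N : ℝ → ℝ) (T : Finset Tile) (x : ℝ) :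
    modelSum φ a N T x = packetSum φ a {s ∈ T | N x ∈ s.ω₂} x := by
  unfold modelSum packetSum modelTerm
  rw [Finset.sum_filter]
  exact Finset.sum_congr rfl fun s _ => by simp only [indicator_apply, mem_preimage]

lemma modelSum_filter_add (φ : ℝ → ℂ) (a : Tile → ℂ) (N : ℝ → ℝ) (T : Finset Tile)
    (p : Tile → Prop) [DecidablePred p] (x : ℝ) :
    modelSum φ a N T x = modelSum φ a N {s ∈ T | p s} x + modelSum φ a N {s ∈ T | ¬ p s} x :=
  (Finset.sum_filter_add_sum_filter_not _ _ _).symm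

namespace IsPacket

variable {φ : ℝ → ℂ} {C : ℝ≥0} {a : Tile → ℂ} {N : ℝ → ℝ} {σ μ : ℝ≥0∞} {E : Set ℝ}
  {T : Finset Tile} {ξ : ℝ}

open Classical in
/-- In a tree whose frequency avoids the upper halves at most one scale is active at a point. -/
lemma enorm_modelSum_le_of_notMem (hφ : IsPacket φ C) (hT : ∀ s ∈ T, ξ ∈ s.ω)
    (hT1 : ∀ s ∈ T, ξ ∉ s.ω₂) (ha : ∀ s ∈ T, ‖a s‖ₑ ≤ σ) (x : ℝ) :
    ‖modelSum φ a N T x‖ₑ ≤ σ * (C * chiC) := by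
  rw [modelSum_eq_packetSum]
  have key : ∀ s ∈ T, ∀ s' ∈ T, N x ∈ s.ω₂ → N x ∈ s'.ω₂ → ¬ s'.k < s.k := by
    intro s hs s' hs' h h' hk
    rcases Tile.subset_half hk (s.ω₂_subset h) (s'.ω₂_subset h') with h1 | h1
    · exact disjoint_left.1 s'.disjoint_ω h1.2 h'
    · exact hT1 s' hs' (h1.1 (hT s hs))
  rcases ({s ∈ T | N x ∈ s.ω₂} : Finset Tile).eq_empty_or_nonempty with he | ⟨s0, hs0⟩
  · rw [he]; simp [packetSum]
  have hk : ∀ s ∈ ({s ∈ T | N x ∈ s.ω₂} : Finset Tile), s.k = s0.k := by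
    intro s hs
    rw [Finset.mem_filter] at hs hs0
    exact le_antisymm (not_lt.1 (key s hs.1 s0 hs0.1 hs.2 hs0.2))
      (not_lt.1 (key s0 hs0.1 s hs.1 hs0.2 hs.2))
  refine (enorm_sum_le _ _).trans (hφ.sum_enorm_packet_le hk (fun s hs s' hs' =>
    Tile.eq_of_mem_ω ((hk s hs).trans (hk s' hs').symm) (hT s (Finset.mem_filter.1 hs).1)
      (hT s' (Finset.mem_filter.1 hs').1)) (fun s hs => ha s (Finset.mem_filter.1 hs).1) x)

open Classical in
/-- In a tree whose frequency lies in the upper halves the active scales form an interval. -/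
lemma modelSum_eq_sub (φ : ℝ → ℂ) (a : Tile → ℂ) (hT : ∀ s ∈ T, ξ ∈ s.ω₂) {r : ℤ}
    (hr : ∀ s ∈ T, (4:ℤ) ∣ s.k - r) (κ : ℤ) (x : ℝ) : ∃ b b' : ℤ, κ ≤ b ∧ κ ≤ b' ∧
      (∀ s ∈ T, b ≤ s.k ∨ s.k ≤ b - 4) ∧ (∀ s ∈ T, b' ≤ s.k ∨ s.k ≤ b' - 4) ∧
      modelSum φ a N {s ∈ T | κ ≤ s.k} x =
        packetSum φ a {s ∈ T | b ≤ s.k} x - packetSum φ a {s ∈ T | b' ≤ s.k} x := by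
  have hdown : ∀ s ∈ T, ∀ s' ∈ T, s'.k ≤ s.k → N x ∈ s.ω₂ → N x ∈ s'.ω₂ := by
    intro s hs s' hs' hk h
    rcases hk.lt_or_eq with hk | hk
    · rcases Tile.subset_half hk (s.ω₂_subset (hT s hs)) (s'.ω₂_subset (hT s' hs')) with h1 | h1
      · exact absurd (hT s' hs') (disjoint_left.1 s'.disjoint_ω h1.2)
      · exact h1.1 (s.ω₂_subset h)
    · have := Tile.eq_of_mem_ω hk (s'.ω₂_subset (hT s' hs')) (s.ω₂_subset (hT s hs))
      unfold Tile.ω₂ at h ⊢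
      rwa [hk, this]
  rw [modelSum_eq_packetSum]
  rcases ({s ∈ {s ∈ T | κ ≤ s.k} | N x ∈ s.ω₂} : Finset Tile).eq_empty_or_nonempty with he | hne
  · refine ⟨κ + (r - κ) % 4, κ + (r - κ) % 4, by omega, by omega, fun s hs => ?_, fun s hs => ?_, ?_⟩
    · have := hr s hs; omega
    · have := hr s hs; omega
    · rw [he, sub_self]; simp [packetSum]
  · obtain ⟨s0, hs0, hmax⟩ := Finset.exists_max_image _ (fun s : Tile => s.k) hne
    rw [Finset.mem_filter, Finset.mem_filter] at hs0
    have hr0 := hr s0 hs0.1.1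
    refine ⟨κ + (r - κ) % 4, s0.k + 4, by omega, by omega, fun s hs => ?_, fun s hs => ?_, ?_⟩
    · have := hr s hs; omega
    · have := hr s hs; omega
    · unfold packetSum
      rw [eq_sub_iff_add_eq, ← Finset.sum_union]
      · refine Finset.sum_congr ?_ fun _ _ => rfl
        ext s
        simp only [Finset.mem_union, Finset.mem_filter]
        constructor
        · rintro (⟨⟨h1, h2⟩, h3⟩ | ⟨h1, h2⟩)
          · have := hr s h1; exact ⟨h1, by omega⟩
          · exact ⟨h1, by omega⟩
        · rintro ⟨h1, h2⟩
          by_cases h3 : s0.k + 4 ≤ s.k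
          · exact Or.inr ⟨h1, h3⟩
          · have := hr s h1
            exact Or.inl ⟨⟨h1, by omega⟩, hdown s0 hs0.1.1 s h1 (by omega) hs0.2⟩
      · rw [Finset.disjoint_left]
        intro s hs hs'
        have := hmax s hs
        have := (Finset.mem_filter.1 hs').2
        omega

open Classical in
/-- Pointwise bound for the long tiles of a tree. -/
lemma enorm_modelSum_long_le (hφ : IsPacket φ C) {ψ : 𝓢(ℝ, ℂ)} {D : ℝ} (hD0 : 0 ≤ D)
    (hD : ∀ x, ‖ψ x‖ ≤ D * ((1 + |x|) ^ 2)⁻¹)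
    (h1 : ∀ u, |u| ≤ 7 / 8 → 𝓕 (ψ : ℝ → ℂ) u = 1) (h2 : ∀ u, 2 ≤ |u| → 𝓕 (ψ : ℝ → ℂ) u = 0)
    (hT : ∀ s ∈ T, ξ ∈ s.ω) {r : ℤ} (hr : ∀ s ∈ T, (4:ℤ) ∣ s.k - r)
    (ha : ∀ s ∈ T, ‖a s‖ₑ ≤ σ) {κ : ℤ} {x y : ℝ} (hxy : |x - y| ≤ 2 ^ κ) :
    ‖modelSum φ a N {s ∈ T | κ ≤ s.k} x‖ₑ ≤ (C * chiC + 64 * ENNReal.ofReal D) *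
      (σ + maxFn (fun z => ‖packetSum φ a {s ∈ T | ξ ∈ s.ω₂} z‖ₑ) y) := by
  set T2 : Finset Tile := {s ∈ T | ξ ∈ s.ω₂} with hT2
  have hsplit := modelSum_filter_add φ a N {s ∈ T | κ ≤ s.k} (fun s => ξ ∈ s.ω₂) x
  have hA : ‖modelSum φ a N {s ∈ {s ∈ T | κ ≤ s.k} | ¬ ξ ∈ s.ω₂} x‖ₑ ≤ σ * (C * chiC) := by
    refine hφ.enorm_modelSum_le_of_notMem (ξ := ξ) (fun s hs => ?_) (fun s hs => ?_)
      (fun s hs => ?_) x <;> simp only [Finset.mem_filter] at hs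
    · exact hT s hs.1.1
    · exact hs.2
    · exact ha s hs.1.1
  have hB : ‖modelSum φ a N {s ∈ {s ∈ T | κ ≤ s.k} | ξ ∈ s.ω₂} x‖ₑ ≤
      64 * ENNReal.ofReal D * maxFn (fun z => ‖packetSum φ a T2 z‖ₑ) y := by
    have hT2' : ∀ s ∈ T2, ξ ∈ s.ω₂ := fun s hs => (Finset.mem_filter.1 hs).2
    obtain ⟨b, b', hb, hb', c, c', e⟩ := modelSum_eq_sub (N := N) φ a hT2'
      (fun s hs => hr s (Finset.mem_filter.1 hs).1) κ x
    rw [Finset.filter_comm, ← hT2, e, ← hφ.sconv_packetSum h1 h2 hT2' c,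
      ← hφ.sconv_packetSum h1 h2 hT2' c']
    have hV : ∀ b, κ ≤ b → ‖sconv (modKernel ψ b ξ) (packetSum φ a T2) x‖ₑ ≤
        ENNReal.ofReal D * (32 * maxFn (fun z => ‖packetSum φ a T2 z‖ₑ) y) := fun b hb =>
      enorm_sconv_modKernel_le hD0 hD b ξ (hφ.continuous_packetSum a T2).measurable
        (hxy.trans (zpow_le_zpow_right₀ one_le_two hb))
    refine enorm_sub_le.trans ((add_le_add (hV b hb) (hV b' hb')).trans_eq ?_)
    ring
  rw [hsplit]
  refine (enorm_add_le _ _).trans ((add_le_add hB hA).trans ?_)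
  rw [mul_add, add_mul, add_mul, add_comm]
  refine add_le_add ?_ ?_
  · rw [mul_comm]; exact le_self_add
  · exact le_add_self

end IsPacket

/-- The interval concentric with a dyadic interval and three times as long. -/
def dy3 (k j : ℤ) : Set ℝ := Ico (((j:ℝ) - 1) * 2 ^ k) ((j + 2) * 2 ^ k)

lemma exists_dy_near_of_subset_dy3 {κ j j' k0 m0 : ℤ} (hJ : dy κ j ⊆ dy (κ + 1) j')
    (h0 : dy k0 m0 ⊆ dy3 (κ + 1) j') : k0 ≤ κ + 2 ∧
      (∃ m m', dy κ j ⊆ dy (κ + 2) m ∧ dy k0 m0 ⊆ dy (κ + 2) m' ∧ |m - m'| ≤ 1) ∧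
      ∀ y ∈ dy κ j, ∀ z ∈ dy k0 m0, |y - z| ≤ 2 ^ (κ + 2) := by
  have hp := two_zpow_pos (κ + 1)
  have e : (2:ℝ) ^ (κ + 2) = 2 * 2 ^ (κ + 1) := by
    rw [show κ + 2 = (κ + 1) + 1 by ring, zpow_add_one₀ two_ne_zero, mul_comm]
  have hk : k0 ≤ κ + 2 := by
    by_contra hc
    push Not at hc
    have h4 : (4:ℝ) * 2 ^ (κ + 1) ≤ 2 ^ k0 := by
      have := zpow_le_zpow_right₀ (one_le_two (α := ℝ)) (show κ + 2 + 1 ≤ k0 by omega)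
      rw [zpow_add_one₀ two_ne_zero, e] at this
      linarith
    have ha := h0 (left_mem_dy k0 m0)
    have hz := h0 (show (m0:ℝ) * 2 ^ k0 + 3 * 2 ^ (κ + 1) ∈ dy k0 m0 by
      constructor
      · nlinarith
      · nlinarith)
    have := ha.1
    have := hz.2
    nlinarith
  have hyz : ∀ y ∈ dy κ j, ∀ z ∈ dy k0 m0, |y - z| ≤ 2 ^ (κ + 2) := by
    intro y hy z hz
    obtain ⟨a1, a2⟩ := hJ hy
    obtain ⟨b1, b2⟩ := h0 hz
    rw [e, abs_le]
    constructor <;> nlinarith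
  refine ⟨hk, ?_, hyz⟩
  obtain ⟨m, hm⟩ := exists_dy_superset (k := κ) (k' := κ + 2) (by omega) j
  obtain ⟨m', hm'⟩ := exists_dy_superset hk m0
  refine ⟨m, m', hm, hm', ?_⟩
  have hy := left_mem_dy κ j
  have hz := left_mem_dy k0 m0
  have h := abs_le.1 (hyz _ hy _ hz)
  obtain ⟨c1, c2⟩ := hm hy
  obtain ⟨d1, d2⟩ := hm' hz
  have hp2 := two_zpow_pos (κ + 2)
  have f1 : (m:ℝ) < m' + 2 := by nlinarith
  have f2 : (m':ℝ) < m + 2 := by nlinarith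
  have f1' : m < m' + 2 := by exact_mod_cast f1
  have f2' : m' < m + 2 := by exact_mod_cast f2
  rw [abs_le]; omega

lemma one_le_chi_mul {K M : ℤ} {y z : ℝ} (hz : z ∈ dy K M) (h : |y - z| ≤ 2 ^ K) :
    1 ≤ 9 * chi K M y ^ 2 := by
  have h1 := mem_dy_abs hz
  have hi : (0:ℝ) < 2 ^ (-K) := two_zpow_pos _
  have e : (2:ℝ) ^ (-K) * 2 ^ K = 1 := by rw [← zpow_add₀ two_ne_zero]; simp
  have h2 : |(2:ℝ) ^ (-K) * y - M| ≤ 2 := by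
    obtain ⟨a, b⟩ := abs_le.1 h
    rw [abs_le]
    constructor <;> nlinarith
  have h3 : (3:ℝ≥0∞)⁻¹ ≤ chi K M y := by
    unfold chi
    rw [← ENNReal.ofReal_ofNat 3, ← ENNReal.ofReal_inv_of_pos (by norm_num)]
    apply ENNReal.ofReal_le_ofReal
    gcongr
    linarith
  calc (1:ℝ≥0∞) = 9 * (3⁻¹) ^ 2 := by
        rw [← ENNReal.inv_pow]; norm_num; rw [ENNReal.mul_inv_cancel] <;> norm_num
    _ ≤ _ := mul_le_mul_right (pow_le_pow_left₀ zero_le h3 _) _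

namespace IsPacket

variable {φ : ℝ → ℂ} {C : ℝ≥0} {a : Tile → ℂ} {N : ℝ → ℝ} {σ μ : ℝ≥0∞} {E : Set ℝ}
  {T : Finset Tile} {ξ : ℝ}

open Classical in
/-- The contribution to the tree estimate of the tiles that are long compared with `J`. -/
lemma setLIntegral_modelSum_long_le (hφ : IsPacket φ C) {ψ : 𝓢(ℝ, ℂ)} {D : ℝ} (hD0 : 0 ≤ D)
    (hD : ∀ x, ‖ψ x‖ ≤ D * ((1 + |x|) ^ 2)⁻¹)
    (h1 : ∀ u, |u| ≤ 7 / 8 → 𝓕 (ψ : ℝ → ℂ) u = 1) (h2 : ∀ u, 2 ≤ |u| → 𝓕 (ψ : ℝ → ℂ) u = 0)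
    {K M : ℤ} (hN : Measurable N) (hE : MeasurableSet E)
    (hT : IsTree T K M ξ) {r : ℤ} (hr : ∀ s ∈ T, (4:ℤ) ∣ s.k - r)
    (ha : ∀ s ∈ T, ‖a s‖ₑ ≤ σ) {κ j j' : ℤ} (hκ : κ + 2 ≤ K) (hJ : dy κ j ⊆ dy (κ + 1) j')
    {s0 : Tile} (hs0 : s0 ∈ T) (hd : s0.IsDense N E μ) (h0 : s0.I ⊆ dy3 (κ + 1) j')
    {y : ℝ} (hy : y ∈ dy κ j) :
    ∫⁻ x in E ∩ dy κ j, ‖modelSum φ a N {s ∈ T | κ + 2 ≤ s.k} x‖ₑ ≤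
      (576 * (C * chiC + 64 * ENNReal.ofReal D)) *
        (μ * ENNReal.ofReal (2 ^ κ) * (chi K M y ^ 2 *
          (σ + maxFn (fun z => ‖packetSum φ a {s ∈ T | ξ ∈ s.ω₂} z‖ₑ) y))) := by
  obtain ⟨hk0, ⟨m, m', hm, hm', hmm⟩, hyz⟩ := exists_dy_near_of_subset_dy3 hJ h0
  set G := (σ + maxFn (fun z => ‖packetSum φ a {s ∈ T | ξ ∈ s.ω₂} z‖ₑ) y)
  set c := (C * chiC + 64 * ENNReal.ofReal D)
  set n := ⌊ξ / (2:ℝ) ^ (-(κ + 2))⌋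
  have hξn : ξ ∈ dy (-(κ + 2)) n := mem_dy_floor _ _
  have hpos : (0:ℝ) < 2 ^ κ := two_zpow_pos κ
  have hchi : 1 ≤ 9 * chi K M y ^ 2 :=
    one_le_chi_mul ((hT s0 hs0).1 (left_mem_dy _ _))
      ((hyz y hy _ (left_mem_dy _ _)).trans (zpow_le_zpow_right₀ one_le_two hκ))
  have hslab : volume ((⟨κ + 2, m, n⟩ : Tile).slab N E) ≤ 64 * (μ * ENNReal.ofReal (2 ^ κ)) := by
    have := hd (κ + 2) m' n hk0 hm' (dy_subset_of_le (by omega) hξn (hT s0 hs0).2) (m - m')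
    rw [add_sub_cancel] at this
    refine this.trans ?_
    have hab : |((m - m' : ℤ) : ℝ)| ≤ 1 := by exact_mod_cast hmm
    have e : ENNReal.ofReal ((2:ℝ) ^ (κ + 2)) = 4 * ENNReal.ofReal (2 ^ κ) := by
      rw [zpow_add₀ two_ne_zero, mul_comm, ENNReal.ofReal_mul (by norm_num)]; norm_num
    have h16 : ENNReal.ofReal ((1 + |((m - m' : ℤ) : ℝ)|) ^ 4) ≤ 16 := by
      rw [← ENNReal.ofReal_ofNat 16]
      refine ENNReal.ofReal_le_ofReal ?_
      calc _ ≤ (1 + (1:ℝ)) ^ 4 := by gcongr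
        _ = _ := by norm_num
    rw [e]
    calc _ ≤ μ * 16 * (4 * ENNReal.ofReal (2 ^ κ)) := mul_le_mul_left (mul_le_mul_right h16 _) _
      _ = _ := by ring
  have hsm := (⟨κ + 2, m, n⟩ : Tile).measurableSet_slab hN hE
  calc ∫⁻ x in E ∩ dy κ j, ‖modelSum φ a N {s ∈ T | κ + 2 ≤ s.k} x‖ₑ
      ≤ ∫⁻ x in E ∩ dy κ j, ((⟨κ + 2, m, n⟩ : Tile).slab N E).indicator (fun _ => c * G) x := by
        refine setLIntegral_mono_ae' (hE.inter (measurableSet_dy _ _)) (ae_of_all _ fun x hx => ?_)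
        by_cases hxs : x ∈ (⟨κ + 2, m, n⟩ : Tile).slab N E
        · rw [indicator_of_mem hxs]
          have := hφ.enorm_modelSum_long_le (N := N) hD0 hD h1 h2 (fun s hs => (hT s hs).2) hr ha
            (κ := κ + 2) (x := x) (y := y)
            ((abs_sub_le_of_mem_dy hx.2 hy).trans (zpow_le_zpow_right₀ one_le_two (by omega)))
          exact this
        · rw [indicator_of_notMem hxs]
          refine le_of_eq ?_
          rw [enorm_eq_zero]
          refine Finset.sum_eq_zero fun s hs => ?_
          rw [Finset.mem_filter] at hs
          refine indicator_of_notMem (fun hNs => hxs ⟨⟨hx.1, ?_⟩, hm hx.2⟩) _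
          exact dy_subset_of_le (k := -s.k) (k' := -(κ + 2)) (by omega) (hT s hs.1).2 hξn
            (s.ω₂_subset hNs)
    _ ≤ ∫⁻ x, ((⟨κ + 2, m, n⟩ : Tile).slab N E).indicator (fun _ => c * G) x :=
        setLIntegral_le_lintegral _ _
    _ = c * G * volume ((⟨κ + 2, m, n⟩ : Tile).slab N E) := lintegral_indicator_const hsm _
    _ ≤ c * G * (64 * (μ * ENNReal.ofReal (2 ^ κ))) * (9 * chi K M y ^ 2) :=
        (mul_le_mul_right hslab _).trans (le_mul_of_one_le_right zero_le hchi)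
    _ = _ := by ring

end IsPacket

lemma lintegral_rpow_two_eq (f : ℝ → ℝ≥0∞) : ∫⁻ x, f x ^ (2:ℝ) = ∫⁻ x, f x ^ 2 := by
  simp only [ENNReal.rpow_ofNat]

lemma exists_maxFn_sq : ∃ A : ℝ≥0∞, A ≠ ⊤ ∧ ∀ f : ℝ → ℝ≥0∞, Measurable f →
    ∫⁻ x, maxFn f x ^ 2 ≤ A * ∫⁻ x, f x ^ 2 := by
  obtain ⟨A, hA, h⟩ := maxFn.strong (p := 2) one_lt_two
  exact ⟨A, hA, fun f hf => by simpa only [lintegral_rpow_two_eq] using h f hf⟩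

namespace IsPacket

variable {φ : ℝ → ℂ} {C : ℝ≥0} {a : Tile → ℂ} {N : ℝ → ℝ} {σ μ : ℝ≥0∞} {E : Set ℝ}
  {T : Finset Tile} {ξ : ℝ}

open Classical in
/-- The tree estimate localised to an interval. -/
lemma setLIntegral_modelSum_le (hφ : IsPacket φ C) {ψ : 𝓢(ℝ, ℂ)} {D : ℝ} (hD0 : 0 ≤ D)
    (hD : ∀ x, ‖ψ x‖ ≤ D * ((1 + |x|) ^ 2)⁻¹)
    (h1 : ∀ u, |u| ≤ 7 / 8 → 𝓕 (ψ : ℝ → ℂ) u = 1) (h2 : ∀ u, 2 ≤ |u| → 𝓕 (ψ : ℝ → ℂ) u = 0)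
    {K M : ℤ} (hN : Measurable N) (hE : MeasurableSet E)
    (hT : IsTree T K M ξ) {r : ℤ} (hr : ∀ s ∈ T, (4:ℤ) ∣ s.k - r)
    (ha : ∀ s ∈ T, ‖a s‖ₑ ≤ σ) (hd : ∀ s ∈ T, s.IsDense N E μ) {κ j : ℤ}
    (hJ : ∀ s ∈ T, ¬ s.I ⊆ dy3 κ j)
    (hJ' : κ + 1 ≤ K → ∃ s0 ∈ T, ∃ j', dy κ j ⊆ dy (κ + 1) j' ∧ s0.I ⊆ dy3 (κ + 1) j') :
    ∫⁻ x in E ∩ dy κ j, ‖modelSum φ a N T x‖ₑ ≤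
      (C * 2 ^ 14 * (16 * chiC) * (16 * chiC) + 576 * (C * chiC + 64 * ENNReal.ofReal D)) *
        (μ * ∫⁻ y in dy κ j, (chi K M y ^ 2 *
          (σ + maxFn (fun z => ‖packetSum φ a {s ∈ T | ξ ∈ s.ω₂} z‖ₑ) y))) := by
  set G := fun y => (σ + maxFn (fun z => ‖packetSum φ a {s ∈ T | ξ ∈ s.ω₂} z‖ₑ) y) with hG
  set A1 : ℝ≥0∞ := C * 2 ^ 14 * (16 * chiC) * (16 * chiC)
  set A2 : ℝ≥0∞ := 576 * (C * chiC + 64 * ENNReal.ofReal D)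
  have hEJ : MeasurableSet (E ∩ dy κ j) := hE.inter (measurableSet_dy _ _)
  have key : ∀ y ∈ dy κ j, ∫⁻ x in E ∩ dy κ j, ‖modelSum φ a N T x‖ₑ ≤
      (A1 + A2) * (μ * ENNReal.ofReal (2 ^ κ) * (chi K M y ^ 2 * G y)) := by
    intro y hy
    have hshort : ∫⁻ x in E ∩ dy κ j, ‖modelSum φ a N {s ∈ T | ¬ κ + 2 ≤ s.k} x‖ₑ ≤
        A1 * (μ * ENNReal.ofReal (2 ^ κ) * (chi K M y ^ 2 * G y)) := by
      calc _ ≤ ∫⁻ x in E ∩ dy κ j, ∑ s ∈ T with ¬ κ + 2 ≤ s.k, ‖modelTerm φ a N s x‖ₑ :=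
            lintegral_mono fun x => enorm_sum_le _ _
        _ = ∑ s ∈ T with ¬ κ + 2 ≤ s.k, ∫⁻ x in E ∩ dy κ j, ‖modelTerm φ a N s x‖ₑ :=
            lintegral_finsetSum _ fun s _ => (hφ.measurable_modelTerm a hN s).enorm
        _ ≤ A1 * (σ * μ * ENNReal.ofReal (2 ^ κ) * chi K M y ^ 2) := by
            refine hφ.sum_setLIntegral_modelTerm_le hN hE (ξ := ξ) (fun s hs => ?_) (fun s hs => ?_)
              (fun s hs => ?_) (fun s hs => ?_) (fun s hs => ?_) hy <;>
              rw [Finset.mem_filter] at hs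
            · exact hT s hs.1
            · exact hd s hs.1
            · exact ha s hs.1
            · omega
            · exact hJ s hs.1
        _ ≤ _ := by
            refine mul_le_mul_right ?_ _
            calc _ = μ * ENNReal.ofReal (2 ^ κ) * (chi K M y ^ 2 * σ) := by ring
              _ ≤ _ := mul_le_mul_right (mul_le_mul_right le_self_add _) _
    have hlong : ∫⁻ x in E ∩ dy κ j, ‖modelSum φ a N {s ∈ T | κ + 2 ≤ s.k} x‖ₑ ≤
        A2 * (μ * ENNReal.ofReal (2 ^ κ) * (chi K M y ^ 2 * G y)) := by
      by_cases hκ : κ + 2 ≤ K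
      · obtain ⟨s0, hs0, j', hj', h0⟩ := hJ' (by omega)
        exact hφ.setLIntegral_modelSum_long_le hD0 hD h1 h2 hN hE hT hr ha hκ hj' hs0 (hd s0 hs0)
          h0 hy
      · have : ({s ∈ T | κ + 2 ≤ s.k} : Finset Tile) = ∅ := by
          rw [Finset.filter_eq_empty_iff]
          intro s hs
          have := le_of_dy_subset (hT s hs).1
          omega
        rw [this]; simp [modelSum]
    calc _ ≤ ∫⁻ x in E ∩ dy κ j, (‖modelSum φ a N {s ∈ T | κ + 2 ≤ s.k} x‖ₑ +
          ‖modelSum φ a N {s ∈ T | ¬ κ + 2 ≤ s.k} x‖ₑ) := lintegral_mono fun x => by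
            rw [modelSum_filter_add φ a N T (fun s => κ + 2 ≤ s.k) x]; exact enorm_add_le _ _
      _ = _ := lintegral_add_left (hφ.measurable_modelSum a hN _).enorm _
      _ ≤ _ := add_le_add hlong hshort
      _ = _ := by ring
  set L := ∫⁻ x in E ∩ dy κ j, ‖modelSum φ a N T x‖ₑ
  have hmono : ∫⁻ y in dy κ j, L ≤
      ∫⁻ y in dy κ j, ((A1 + A2) * μ * ENNReal.ofReal (2 ^ κ)) * (chi K M y ^ 2 * G y) := by
    refine setLIntegral_mono_ae' (measurableSet_dy _ _) (ae_of_all _ fun y hy => ?_)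
    refine (key y hy).trans_eq ?_
    ring
  have hGm : Measurable fun y => chi K M y ^ 2 * G y :=
    ((measurable_chi _ _).pow_const _).mul (measurable_const.add (maxFn.measurable _))
  rw [setLIntegral_const, volume_dy, lintegral_const_mul _ hGm] at hmono
  have h0 : ENNReal.ofReal ((2:ℝ) ^ κ) ≠ 0 := by
    simp only [ne_eq, ENNReal.ofReal_eq_zero, not_le]; positivity
  rw [← ENNReal.mul_le_mul_iff_left h0 ENNReal.ofReal_ne_top]
  refine hmono.trans_eq ?_
  ring

/-- The tree estimate for trees with separated scales. -/
lemma tree_estimate_of_dvd (C : ℝ≥0) : ∃ A : ℝ≥0∞, A ≠ ⊤ ∧ ∀ (φ : ℝ → ℂ) (a : Tile → ℂ)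
    (N : ℝ → ℝ) (E : Set ℝ) (σ μ : ℝ≥0∞) (T : Finset Tile) (K M : ℤ) (ξ : ℝ) (r : ℤ),
    IsPacket φ C → Measurable N → MeasurableSet E → σ ≠ 0 → σ ≠ ⊤ → HasSize T a σ →
    (∀ s ∈ T, s.IsDense N E μ) → IsTree T K M ξ → (∀ s ∈ T, (4:ℤ) ∣ s.k - r) →
    ∫⁻ x in E, ‖modelSum φ a N T x‖ₑ ≤ A * (σ * μ * ENNReal.ofReal (2 ^ K)) := by
  classical
  obtain ⟨ψ, D, hD0, hD, h1, h2⟩ := exists_cutoff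
  obtain ⟨A2, hA2, hM⟩ := exists_maxFn_sq
  refine ⟨(C * 2 ^ 14 * (16 * chiC) * (16 * chiC) + 576 * (C * chiC + 64 * ENNReal.ofReal D)) *
    (2 * chiC + A2 * (2 * C ^ 2 * chiC ^ 2)), by finiteness, ?_⟩
  intro φ a N E σ μ T K M ξ r hφ hN hE hσ0 hσ hS hd hT hr
  set A1 : ℝ≥0∞ :=
    C * 2 ^ 14 * (16 * chiC) * (16 * chiC) + 576 * (C * chiC + 64 * ENNReal.ofReal D)
  set F := packetSum φ a {s ∈ T | ξ ∈ s.ω₂} with hF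
  have hFm : Measurable fun z => ‖F z‖ₑ := (hφ.continuous_packetSum a _).measurable.enorm
  set G := fun y => (σ + maxFn (fun z => ‖F z‖ₑ) y) with hG
  let D' : Set (ℤ × ℤ) := {q | q.1 ≤ K ∧ ∀ s ∈ T, ¬ s.I ⊆ dy3 q.1 q.2}
  have hcover : ∀ x : ℝ, ∃ q ∈ dyMax D', x ∈ dy q.1 q.2 := by
    intro x
    obtain ⟨k, hkK, hk⟩ : ∃ k : ℤ, k ≤ K ∧ ∀ s ∈ T, k + 2 ≤ s.k := by
      refine ⟨((insert K (T.image fun s => s.k)).min' (Finset.insert_nonempty _ _)) - 2, ?_, ?_⟩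
      · have := Finset.min'_le (insert K (T.image fun s => s.k)) K (Finset.mem_insert_self _ _)
        omega
      · intro s hs
        have := Finset.min'_le (insert K (T.image fun s => s.k)) s.k
          (Finset.mem_insert_of_mem (Finset.mem_image_of_mem _ hs))
        omega
    have hq : ((k, ⌊x / 2 ^ k⌋) : ℤ × ℤ) ∈ D' := by
      refine ⟨hkK, fun s hs h => ?_⟩
      have h4 : (4:ℝ) * 2 ^ k ≤ 2 ^ s.k := by
        have := zpow_le_zpow_right₀ (one_le_two (α := ℝ)) (hk s hs)
        rw [zpow_add₀ two_ne_zero] at this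
        linarith
      have hp := two_zpow_pos k
      have ha := h (left_mem_dy s.k s.m)
      have hz := h (show (s.m:ℝ) * 2 ^ s.k + 3 * 2 ^ k ∈ dy s.k s.m by
        constructor <;> nlinarith)
      have := ha.1
      have := hz.2
      nlinarith
    obtain ⟨q, hq1, hq2⟩ := exists_dyMax (K := K) (fun q hq => hq.1) hq
    exact ⟨q, hq1, hq2 (mem_dy_floor k x)⟩
  have hloc : ∀ q ∈ dyMax D', ∫⁻ x in E ∩ dy q.1 q.2, ‖modelSum φ a N T x‖ₑ ≤
      A1 * (μ * ∫⁻ y in dy q.1 q.2, chi K M y ^ 2 * G y) := by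
    intro q hq
    refine hφ.setLIntegral_modelSum_le hD0 hD h1 h2 hN hE hT hr (fun s hs => hS.enorm_le hs) hd
      hq.1.2 fun hK => ?_
    obtain ⟨j', hj'⟩ := exists_dy_superset (show q.1 ≤ q.1 + 1 by omega) q.2
    by_contra hc
    push Not at hc
    have := hq.2 (q.1 + 1, j') ⟨hK, fun s hs h => hc s hs j' hj' h⟩ hj'
    have := congrArg Prod.fst this
    simp at this
  have hdisj := dyMax_pairwiseDisjoint D'
  have hcount : (dyMax D').Countable := Set.to_countable _
  have huniv : (⋃ q ∈ dyMax D', dy q.1 q.2) = univ := by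
    refine eq_univ_of_forall fun x => ?_
    obtain ⟨q, hq, hx⟩ := hcover x
    exact mem_biUnion hq hx
  have hGm : Measurable fun y => chi K M y ^ 2 * G y :=
    ((measurable_chi _ _).pow_const _).mul (measurable_const.add (maxFn.measurable _))
  have hsum : ∫⁻ x in E, ‖modelSum φ a N T x‖ₑ ≤ A1 * (μ * ∫⁻ y, chi K M y ^ 2 * G y) := by
    have e1 : E = ⋃ q ∈ dyMax D', E ∩ dy q.1 q.2 := by
      rw [← inter_iUnion₂, huniv, inter_univ]
    calc _ = ∫⁻ x in ⋃ q ∈ dyMax D', E ∩ dy q.1 q.2, ‖modelSum φ a N T x‖ₑ := by rw [← e1]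
      _ = ∑' q : dyMax D', ∫⁻ x in E ∩ dy q.1.1 q.1.2, ‖modelSum φ a N T x‖ₑ :=
          lintegral_biUnion hcount (fun q _ => hE.inter (measurableSet_dy _ _))
            (hdisj.mono fun q => inter_subset_right) _
      _ ≤ ∑' q : dyMax D', A1 * (μ * ∫⁻ y in dy q.1.1 q.1.2, chi K M y ^ 2 * G y) :=
          ENNReal.tsum_le_tsum fun q => hloc q q.2
      _ = A1 * (μ * ∑' q : dyMax D', ∫⁻ y in dy q.1.1 q.1.2, chi K M y ^ 2 * G y) := by
          rw [ENNReal.tsum_mul_left, ENNReal.tsum_mul_left]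
      _ = A1 * (μ * ∫⁻ y in ⋃ q ∈ dyMax D', dy q.1 q.2, chi K M y ^ 2 * G y) := by
          rw [lintegral_biUnion hcount (fun q _ => measurableSet_dy _ _) hdisj]
      _ = _ := by rw [huniv, Measure.restrict_univ]
  have hT2 : ∀ s ∈ ({s ∈ T | ξ ∈ s.ω₂} : Finset Tile), ξ ∈ s.ω₂ :=
    fun s hs => (Finset.mem_filter.1 hs).2
  have hF2 : ∫⁻ x, ‖F x‖ₑ ^ 2 ≤ (2 * C ^ 2 * chiC ^ 2) * (σ ^ 2 * ENNReal.ofReal (2 ^ K)) :=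
    (hφ.bessel_tree a _ hT2).trans (mul_le_mul_right (hasSize_iff.1 hS K M ξ _
      (Finset.filter_subset _ _)
      (fun s hs => ⟨(hT s (Finset.mem_filter.1 hs).1).1, hT2 s hs⟩)) _)
  have hpt : ∀ y, chi K M y ^ 2 * G y ≤
      2 * σ * chi K M y ^ 2 + σ⁻¹ * maxFn (fun z => ‖F z‖ₑ) y ^ 2 := by
    intro y
    set m := maxFn (fun z => ‖F z‖ₑ) y
    have hm : m ≤ σ + σ⁻¹ * m ^ 2 := by
      rcases le_total m σ with h | h
      · exact h.trans le_self_add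
      · refine le_trans ?_ le_add_self
        calc m = σ⁻¹ * (σ * m) := by rw [← mul_assoc, ENNReal.inv_mul_cancel hσ0 hσ, one_mul]
          _ ≤ σ⁻¹ * (m * m) := mul_le_mul_right (mul_le_mul_left h _) _
          _ = _ := by rw [sq]
    calc chi K M y ^ 2 * G y ≤ chi K M y ^ 2 * (σ + (σ + σ⁻¹ * m ^ 2)) :=
          mul_le_mul_right (add_le_add le_rfl hm) _
      _ = 2 * σ * chi K M y ^ 2 + chi K M y ^ 2 * (σ⁻¹ * m ^ 2) := by ring
      _ ≤ _ := add_le_add le_rfl (mul_le_of_le_one_left zero_le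
          (pow_le_one₀ zero_le (chi_le_one _ _ _)))
  have hfin : ∫⁻ y, chi K M y ^ 2 * G y ≤
      (2 * chiC + A2 * (2 * C ^ 2 * chiC ^ 2)) * (σ * ENNReal.ofReal (2 ^ K)) := by
    calc _ ≤ ∫⁻ y, (2 * σ * chi K M y ^ 2 + σ⁻¹ * maxFn (fun z => ‖F z‖ₑ) y ^ 2) :=
          lintegral_mono hpt
      _ = 2 * σ * (∫⁻ y, chi K M y ^ 2) + σ⁻¹ * ∫⁻ y, maxFn (fun z => ‖F z‖ₑ) y ^ 2 := by
          rw [lintegral_add_left (((measurable_chi _ _).pow_const _).const_mul _),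
            lintegral_const_mul _ ((measurable_chi _ _).pow_const _),
            lintegral_const_mul _ ((maxFn.measurable _).pow_const _)]
      _ ≤ 2 * σ * (chiC * ENNReal.ofReal (2 ^ K)) + σ⁻¹ * (A2 * ((2 * C ^ 2 * chiC ^ 2) *
          (σ ^ 2 * ENNReal.ofReal (2 ^ K)))) :=
          add_le_add (mul_le_mul_right (lintegral_chi_sq_le K M) _)
            (mul_le_mul_right ((hM _ hFm).trans (mul_le_mul_right hF2 _)) _)
      _ = 2 * σ * (chiC * ENNReal.ofReal (2 ^ K)) + (σ⁻¹ * σ) * (A2 * ((2 * C ^ 2 * chiC ^ 2) *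
          (σ * ENNReal.ofReal (2 ^ K)))) := by ring
      _ = _ := by rw [ENNReal.inv_mul_cancel hσ0 hσ]; ring
  refine hsum.trans ((mul_le_mul_right (mul_le_mul_right hfin _) _).trans_eq ?_)
  ring

/-- The tree estimate. -/
theorem tree_estimate (C : ℝ≥0) : ∃ A : ℝ≥0∞, A ≠ ⊤ ∧ ∀ (φ : ℝ → ℂ) (a : Tile → ℂ)
    (N : ℝ → ℝ) (E : Set ℝ) (σ μ : ℝ≥0∞) (T : Finset Tile) (K M : ℤ) (ξ : ℝ),
    IsPacket φ C → Measurable N → MeasurableSet E → σ ≠ 0 → σ ≠ ⊤ → HasSize T a σ →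
    (∀ s ∈ T, s.IsDense N E μ) → IsTree T K M ξ →
    ∫⁻ x in E, ‖modelSum φ a N T x‖ₑ ≤ A * (σ * μ * ENNReal.ofReal (2 ^ K)) := by
  obtain ⟨A, hA, h⟩ := tree_estimate_of_dvd C
  refine ⟨4 * A, by finiteness, ?_⟩
  intro φ a N E σ μ T K M ξ hφ hN hE hσ0 hσ hS hd hT
  have hsplit : ∀ x, modelSum φ a N T x =
      ∑ r ∈ Finset.range 4, modelSum φ a N {s ∈ T | s.k % 4 = r} x := by
    intro x
    unfold modelSum
    rw [← Finset.sum_fiberwise_of_maps_to (t := Finset.range 4) (g := fun s => (s.k % 4).toNat)]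
    · refine Finset.sum_congr rfl fun r _ => Finset.sum_congr ?_ fun _ _ => rfl
      ext s
      simp only [Finset.mem_filter, and_congr_right_iff]
      intro _
      omega
    · intro s _
      simp only [Finset.mem_range]
      omega
  calc _ ≤ ∫⁻ x in E, ∑ r ∈ Finset.range 4, ‖modelSum φ a N {s ∈ T | s.k % 4 = r} x‖ₑ :=
        lintegral_mono fun x => by rw [hsplit]; exact enorm_sum_le _ _
    _ = ∑ r ∈ Finset.range 4, ∫⁻ x in E, ‖modelSum φ a N {s ∈ T | s.k % 4 = r} x‖ₑ :=
        lintegral_finsetSum _ fun r _ => (hφ.measurable_modelSum a hN _).enorm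
    _ ≤ ∑ r ∈ Finset.range 4, A * (σ * μ * ENNReal.ofReal (2 ^ K)) :=
        Finset.sum_le_sum fun r _ => h φ a N E σ μ _ K M ξ r hφ hN hE hσ0 hσ
          (hS.subset (Finset.filter_subset _ _)) (fun s hs => hd s (Finset.mem_filter.1 hs).1)
          (fun s hs => hT s (Finset.mem_filter.1 hs).1)
          (fun s hs => by have := (Finset.mem_filter.1 hs).2; omega)
    _ = _ := by rw [Finset.sum_const, Finset.card_range, nsmul_eq_mul]; push_cast; ring

end IsPacket

/-- Fatou's lemma for `L^p` bounds. -/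
lemma lintegral_rpow_le_of_tendsto {E : Type*} [NormedAddCommGroup E] [MeasurableSpace E]
    [BorelSpace E] {p : ℝ} {F : ℕ → ℝ → E} {G : ℝ → E} {B : ℝ≥0∞}
    (hF : ∀ n, Measurable (F n)) (h : ∀ n, ∫⁻ x, ‖F n x‖ₑ ^ p ≤ B)
    (hl : ∀ x, Filter.Tendsto (fun n => F n x) .atTop (nhds (G x))) :
    ∫⁻ x, ‖G x‖ₑ ^ p ≤ B := by
  calc ∫⁻ x, ‖G x‖ₑ ^ p = ∫⁻ x, Filter.liminf (fun n => ‖F n x‖ₑ ^ p) .atTop := by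
        refine lintegral_congr fun x => (Filter.Tendsto.liminf_eq ?_).symm
        exact ((ENNReal.continuous_rpow_const.comp continuous_enorm).tendsto _).comp (hl x)
    _ ≤ Filter.liminf (fun n => ∫⁻ x, ‖F n x‖ₑ ^ p) .atTop :=
        lintegral_liminf_le fun n => ((hF n).enorm.pow_const p)
    _ ≤ B := Filter.liminf_le_of_le (by isBoundedDefault)
        fun b hb => by obtain ⟨n, hn⟩ := hb.exists; exact hn.trans (h n)

/-- Bounds for tame functions extend to bounded functions, by truncation. -/
lemma lintegral_rpow_le_of_truncate {E F : Type*} [NormedAddCommGroup E] [NormedAddCommGroup F]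
    [MeasurableSpace F] [BorelSpace F] {p : ℝ} (hp : 0 < p) {T : (ℝ → E) → ℝ → F} {A : ℝ≥0∞}
    (hT : ∀ f, IsTame f → Measurable (T f) ∧ ∫⁻ x, ‖T f x‖ₑ ^ p ≤ A * ∫⁻ x, ‖f x‖ₑ ^ p)
    {f : ℝ → E} (hf : StronglyMeasurable f) {C : ℝ} (hC : ∀ x, ‖f x‖ ≤ C)
    (hl : ∀ x, Filter.Tendsto (fun n : ℕ => T ((Icc (-(n:ℝ)) n).indicator f) x) .atTop
      (nhds (T f x))) : ∫⁻ x, ‖T f x‖ₑ ^ p ≤ A * ∫⁻ x, ‖f x‖ₑ ^ p := by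
  have ht (n : ℕ) : IsTame ((Icc (-(n:ℝ)) n).indicator f) :=
    .of_bound (s := Icc (-(n:ℝ)) n) (hf.indicator measurableSet_Icc) (by simp) (C := C)
      (fun x => (norm_indicator_le_norm_self _ _).trans (hC x))
      fun x hx => indicator_of_notMem hx _
  refine lintegral_rpow_le_of_tendsto (fun n => (hT _ (ht n)).1)
    (fun n => (hT _ (ht n)).2.trans (mul_le_mul_right (lintegral_mono fun x => ?_) A)) hl
  exact ENNReal.rpow_le_rpow (enorm_indicator_le_enorm_self _ _) hp.le

lemma tendsto_indicator_Icc {E : Type*} [Zero E] [TopologicalSpace E] (f : ℝ → E) (x : ℝ) :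
    Filter.Tendsto (fun n : ℕ => (Icc (-(n:ℝ)) n).indicator f x) .atTop (nhds (f x)) := by
  refine tendsto_const_nhds.congr' ?_
  filter_upwards [Filter.eventually_ge_atTop ⌈|x|⌉₊] with n hn
  have h : |x| ≤ n := (Nat.le_ceil |x|).trans (Nat.cast_le.2 hn)
  exact (indicator_of_mem (s := Icc (-(n:ℝ)) n) (abs_le.1 h) f).symm

/-- The dilate of a kernel to the scale `2 ^ (-k)`. -/
noncomputable def dilate (K : ℝ → ℂ) (k : ℤ) (x : ℝ) : ℂ := (2 : ℂ) ^ k * K ((2 : ℝ) ^ k * x)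

lemma IsConvKernel.integrable_apply_of_bound {E F : Type*} [NormedAddCommGroup E]
    [InnerProductSpace ℂ E] [NormedAddCommGroup F] [InnerProductSpace ℂ F] {κ : ℝ → E →L[ℂ] F}
    (hκ : IsConvKernel κ) {f : ℝ → E} (hf : StronglyMeasurable f) {D : ℝ} (hD : ∀ x, ‖f x‖ ≤ D)
    (x : ℝ) : Integrable fun y => κ (x - y) (f y) :=
  ((hκ.int.comp_sub_left x).norm.mul_const D).mono'
    ((ContinuousLinearMap.id ℂ (E →L[ℂ] F)).aestronglyMeasurable_comp₂
      (hκ.cont.comp (by fun_prop)).aestronglyMeasurable hf.aestronglyMeasurable)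
    (ae_of_all _ fun y => (ContinuousLinearMap.le_opNorm _ _).trans
      (mul_le_mul_of_nonneg_left (hD y) (norm_nonneg _)))

/-- `lpKernel_strong` for bounded functions. -/
theorem lpKernel_strong_of_bound {p : ℝ} (hp : 1 < p) (B : ℝ) : ∃ C : ℝ≥0∞, C ≠ ∞ ∧
    ∀ (E F : Type) [NormedAddCommGroup E] [InnerProductSpace ℂ E] [CompleteSpace E]
      [NormedAddCommGroup F] [InnerProductSpace ℂ F] [CompleteSpace F]
      (K : ℝ → ℂ) (S : Finset ℤ) (A : ℤ → E →L[ℂ] F), IsLPKernel K B → (∀ k, ‖A k‖ ≤ 1) →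
      ∀ (f : ℝ → E) (D : ℝ), StronglyMeasurable f → (∀ x, ‖f x‖ ≤ D) →
        ∫⁻ x, ‖convOp (lpKernel K S A) f x‖ₑ ^ p ≤ C * ∫⁻ x, ‖f x‖ₑ ^ p := by
  obtain ⟨C, hC, h⟩ := lpKernel_strong hp B
  refine ⟨C, hC, fun E F _ _ _ _ _ _ K S A hK hA f D hf hD => ?_⟩
  borelize F
  have hκ := hK.isConvKernel S A
  refine lintegral_rpow_le_of_truncate (by linarith) (fun f hf =>
    ⟨(hκ.continuous_convOp hf).measurable, h E F K S A hK hA f hf⟩) hf hD fun x => ?_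
  refine tendsto_integral_of_dominated_convergence (fun y => ‖lpKernel K S A (x - y)‖ * D)
    (fun n => ?_) ((hκ.int.comp_sub_left x).norm.mul_const D)
    (fun n => ae_of_all _ fun y => ?_) (ae_of_all _ fun y => ?_)
  · exact (hκ.integrable_apply_of_bound (hf.indicator measurableSet_Icc) (fun y =>
      (norm_indicator_le_norm_self _ _).trans (hD y)) x).aestronglyMeasurable
  · exact (ContinuousLinearMap.le_opNorm _ _).trans (mul_le_mul_of_nonneg_left
      ((norm_indicator_le_norm_self _ _).trans (hD y)) (norm_nonneg _))
  · exact ((lpKernel K S A (x - y)).continuous.tendsto _).comp (tendsto_indicator_Icc f y)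

lemma EuclideanSpace.enorm_rpow {ι : Type*} [Fintype ι] (v : EuclideanSpace ℂ ι) (p : ℝ) :
    ‖v‖ₑ ^ p = (∑ i, ‖v i‖ₑ ^ 2) ^ (p / 2) := by
  rw [← mul_div_cancel₀ p two_ne_zero, ENNReal.rpow_mul, mul_div_cancel_left₀ _ two_ne_zero,
    ENNReal.rpow_two, ← ofReal_norm, ← ENNReal.ofReal_pow (norm_nonneg _),
    EuclideanSpace.norm_sq_eq, ENNReal.ofReal_sum_of_nonneg fun _ _ => by positivity]
  simp only [ENNReal.ofReal_pow (norm_nonneg _), ofReal_norm]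

lemma lpKernel_square {p : ℝ} (hp : 1 < p) (B : ℝ) : ∃ C : ℝ≥0∞, C ≠ ∞ ∧
    ∀ (K : ℝ → ℂ) (S : Finset ℤ), IsLPKernel K B → ∀ (f : ℝ → ℂ) (D : ℝ), StronglyMeasurable f →
      (∀ x, ‖f x‖ ≤ D) →
      ∫⁻ x, (∑ k ∈ S, ‖sconv (dilate K k) f x‖ₑ ^ 2) ^ (p / 2) ≤ C * ∫⁻ x, ‖f x‖ₑ ^ p := by
  classical
  obtain ⟨C, hC, h⟩ := lpKernel_strong_of_bound hp B
  refine ⟨C, hC, fun K S hK f D hf hD => ?_⟩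
  let A : ℤ → ℂ →L[ℂ] EuclideanSpace ℂ S := fun k => if h : k ∈ S then
    ContinuousLinearMap.toSpanSingleton ℂ (EuclideanSpace.single ⟨k, h⟩ (1:ℂ)) else 0
  have hA : ∀ k, ‖A k‖ ≤ 1 := by
    intro k
    by_cases hk : k ∈ S
    · simp [A, hk, ContinuousLinearMap.norm_toSpanSingleton]
    · simp [A, hk]
  refine (lintegral_mono fun x => ?_).trans (h ℂ (EuclideanSpace ℂ S) K S A hK hA f D hf hD)
  rw [EuclideanSpace.enorm_rpow, ← Finset.sum_coe_sort S]
  refine le_of_eq ?_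
  congr! 4 with k
  refine Eq.trans ?_ ((EuclideanSpace.proj k : EuclideanSpace ℂ S →L[ℂ] ℂ).integral_comp_comm
    ((hK.isConvKernel S A).integrable_apply_of_bound hf hD x))
  refine integral_congr_ae (ae_of_all _ fun y => ?_)
  simp only [lpKernel, sum_apply, map_sum, smul_apply, map_smul, dilate]
  rw [Finset.sum_eq_single k.1]
  · simp [A]
  · intro j hj hjk
    have hne : k ≠ ⟨j, hj⟩ := fun h => hjk (congrArg Subtype.val h).symm
    simp [A, hj, hne]
  · exact fun h => absurd k.2 h

lemma chi_swap (k m i : ℤ) : chi k m (i * 2 ^ k) = chi k i (m * 2 ^ k) := by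
  unfold chi
  have e : ∀ j : ℤ, (2:ℝ) ^ (-k) * (j * 2 ^ k) = j := fun j => by
    rw [mul_left_comm, ← zpow_add₀ two_ne_zero]; simp
  rw [e, e, abs_sub_comm]

/-- Carleson-measure `L⁴` bound for the square function of a tree. -/
lemma HasSize.lintegral_sq_le {P T : Finset Tile} {a : Tile → ℂ} {σ : ℝ≥0∞} (h : HasSize P a σ)
    (hTP : T ⊆ P) {K M : ℤ} {ξ : ℝ} (hT : ∀ s ∈ T, s.I ⊆ dy K M ∧ ξ ∈ s.ω₂) :
    ∫⁻ x, (∑ s ∈ T, ‖a s‖ₑ ^ 2 * s.chi x ^ 4) ^ 2 ≤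
      32 * chiC ^ 2 * (σ ^ 4 * ENNReal.ofReal (2 ^ K)) := by
  classical
  set b : Tile → ℝ≥0∞ := fun s => ‖a s‖ₑ ^ 2 with hb
  set J : Tile → Tile → ℝ≥0∞ := fun s s' => ∫⁻ x, s.chi x ^ 4 * s'.chi x ^ 4 with hJ
  have hm : ∀ s : Tile, Measurable s.chi := fun s => measurable_chi _ _
  have h1 : ∫⁻ x, (∑ s ∈ T, b s * s.chi x ^ 4) ^ 2 = ∑ s ∈ T, ∑ s' ∈ T, b s * (b s' * J s s') := by
    simp only [sq, Finset.sum_mul_sum]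
    have hp : ∀ s s' : Tile, Measurable fun x => b s * s.chi x ^ 4 * (b s' * s'.chi x ^ 4) :=
      fun s s' => ((hm s).pow_const 4 |>.const_mul _).mul ((hm s').pow_const 4 |>.const_mul _)
    rw [lintegral_finsetSum _ fun s _ => Finset.measurable_fun_sum _ fun s' _ => hp s s']
    refine Finset.sum_congr rfl fun s _ => ?_
    rw [lintegral_finsetSum _ fun s' _ => hp s s']
    refine Finset.sum_congr rfl fun s' _ => ?_
    have e : Measurable fun x => s.chi x ^ 4 * s'.chi x ^ 4 :=
      ((hm s).pow_const 4).mul ((hm s').pow_const 4)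
    rw [hJ, ← mul_assoc, ← lintegral_const_mul _ e]
    exact lintegral_congr fun x => by ring
  have hJs : ∀ s s', J s s' = J s' s := fun s s' => lintegral_congr fun x => mul_comm _ _
  have h2 : ∀ s ∈ T, ∑ s' ∈ T with s'.k ≤ s.k, b s' * J s s' ≤
      16 * chiC ^ 2 * (σ ^ 2 * s.len) := by
    intro s hs
    have hJ1 : ∀ s' : Tile, s'.k ≤ s.k → ∀ i : ℤ, s'.I ⊆ dy s.k i →
        J s s' ≤ 16 * chiC * s'.len * chi s.k i (s.m * 2 ^ s.k) ^ 2 := by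
      intro s' hk i hi
      have : ∀ x, s.chi x ^ 4 * s'.chi x ^ 4 ≤
          (16 * chi s.k i (s.m * 2 ^ s.k) ^ 2) * s'.chi x ^ 2 := by
        intro x
        have hy := left_mem_dy s'.k s'.m
        have g1 : s.chi x * s'.chi x ≤ 2 * _ := chi_mul_chi_le hk hy
        have g2 := chi_le_of_mem_dy (m := s.m) (hi hy) (left_mem_dy s.k i)
        rw [chi_swap] at g2
        have g3 : s.chi x * s'.chi x ≤ 4 * chi s.k i (s.m * 2 ^ s.k) :=
          g1.trans ((mul_le_mul_right g2 _).trans_eq (by ring))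
        calc s.chi x ^ 4 * s'.chi x ^ 4
            = (s.chi x * s'.chi x) ^ 2 * (s.chi x ^ 2 * s'.chi x ^ 2) := by ring
          _ ≤ (4 * chi s.k i (s.m * 2 ^ s.k)) ^ 2 * (1 * s'.chi x ^ 2) :=
              mul_le_mul' (pow_le_pow_left₀ zero_le g3 2)
                (mul_le_mul_left (pow_le_one₀ zero_le (chi_le_one _ _ _)) _)
          _ = _ := by ring
      refine (lintegral_mono this).trans ?_
      rw [lintegral_const_mul _ ((hm s').pow_const 2)]
      refine (mul_le_mul_right (lintegral_chi_sq_le _ _) _).trans_eq ?_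
      rw [Tile.len]; ring
    calc ∑ s' ∈ T with s'.k ≤ s.k, b s' * J s s'
        ≤ ∑ s' ∈ T with s'.k ≤ s.k, ∑' i : ℤ, (if s'.I ⊆ dy s.k i then
            (16 * chiC * chi s.k i (s.m * 2 ^ s.k) ^ 2) * (s'.len * b s') else 0) := by
          refine Finset.sum_le_sum fun s' hs' => ?_
          have hk := (Finset.mem_filter.1 hs').2
          obtain ⟨i, hi⟩ := exists_dy_superset hk s'.m
          refine le_trans ?_ (ENNReal.le_tsum i)
          rw [if_pos (show s'.I ⊆ _ from hi)]
          exact (mul_le_mul_right (hJ1 s' hk i hi) _).trans_eq (by ring)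
      _ = ∑' i : ℤ, ∑ s' ∈ T with s'.k ≤ s.k, (if s'.I ⊆ dy s.k i then
            (16 * chiC * chi s.k i (s.m * 2 ^ s.k) ^ 2) * (s'.len * b s') else 0) :=
          (Summable.tsum_finsetSum fun _ _ => ENNReal.summable).symm
      _ ≤ ∑' i : ℤ, (16 * chiC * (σ ^ 2 * s.len)) * chi s.k i (s.m * 2 ^ s.k) ^ 2 := by
          refine ENNReal.tsum_le_tsum fun i => ?_
          rw [← Finset.sum_filter, ← Finset.mul_sum]
          refine (mul_le_mul_right (hasSize_iff.1 h s.k i ξ _ ?_ ?_) _).trans_eq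
            (by rw [Tile.len]; ring)
          · exact ((Finset.filter_subset _ _).trans (Finset.filter_subset _ _)).trans hTP
          · intro s' hs'
            obtain ⟨h1, h2⟩ := Finset.mem_filter.1 hs'
            exact ⟨h2, (hT s' (Finset.mem_filter.1 h1).1).2⟩
      _ ≤ (16 * chiC * (σ ^ 2 * s.len)) * chiC := by
          rw [ENNReal.tsum_mul_left]
          exact mul_le_mul_right (tsum_chi_sq_le _ _) _
      _ = _ := by ring
  have h3 : ∑ s ∈ T, ∑ s' ∈ T, b s * (b s' * J s s') ≤
      2 * ∑ s ∈ T, b s * ∑ s' ∈ T with s'.k ≤ s.k, b s' * J s s' := by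
    calc ∑ s ∈ T, ∑ s' ∈ T, b s * (b s' * J s s')
        ≤ ∑ s ∈ T, ∑ s' ∈ T, ((if s'.k ≤ s.k then b s * (b s' * J s s') else 0) +
            (if s.k ≤ s'.k then b s' * (b s * J s' s) else 0)) := by
          refine Finset.sum_le_sum fun s _ => Finset.sum_le_sum fun s' _ => ?_
          rcases le_total s'.k s.k with hk | hk
          · rw [if_pos hk]; exact le_self_add
          · rw [if_pos hk, hJs, mul_left_comm]; exact le_add_self
      _ = _ := by
          simp only [Finset.sum_add_distrib]
          rw [Finset.sum_comm (f := fun s s' => if s.k ≤ s'.k then b s' * (b s * J s' s) else 0),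
            ← two_mul]
          simp only [← Finset.sum_filter, Finset.mul_sum]
  rw [h1]
  refine h3.trans ?_
  calc 2 * ∑ s ∈ T, b s * ∑ s' ∈ T with s'.k ≤ s.k, b s' * J s s'
      ≤ 2 * ∑ s ∈ T, b s * (16 * chiC ^ 2 * (σ ^ 2 * s.len)) :=
        mul_le_mul_right (Finset.sum_le_sum fun s hs => mul_le_mul_right (h2 s hs) _) _
    _ = 32 * chiC ^ 2 * σ ^ 2 * ∑ s ∈ T, s.len * b s := by
        simp only [Finset.mul_sum]; exact Finset.sum_congr rfl fun s _ => by ring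
    _ ≤ 32 * chiC ^ 2 * σ ^ 2 * (σ ^ 2 * ENNReal.ofReal (2 ^ K)) :=
        mul_le_mul_right (hasSize_iff.1 h K M ξ T hTP hT) _
    _ = _ := by ring

lemma sconv_dilate_eq (K f : ℝ → ℂ) (k : ℤ) : sconv (dilate K k) f =
    convOp (lpKernel K {k} fun _ => ContinuousLinearMap.id ℂ ℂ) f := by
  funext x
  simp [sconv, convOp, lpKernel, dilate]

lemma IsLPKernel.fourier_sconv_dilate {K : ℝ → ℂ} {B : ℝ} (hK : IsLPKernel K B) {f : ℝ → ℂ}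
    (hf : Integrable f) (k : ℤ) (ζ : ℝ) :
    𝓕 (sconv (dilate K k) f) ζ = 𝓕 K ((2:ℝ) ^ (-k) * ζ) * 𝓕 f ζ := by
  rw [fourier_sconv (κ := dilate K k) (hK.integrable_dilate k) hf]
  exact congrArg (· * _) (IsLPKernel.fourier_dilate K k ζ)

lemma IsTame.ech_mul {f : ℝ → ℂ} (hf : IsTame f) (ξ : ℝ) :
    IsTame fun x => ech (-(x * ξ)) * f x := by
  have hc : Continuous fun x : ℝ => ech (-(x * ξ)) := continuous_ech.comp (by fun_prop)
  obtain ⟨B, hB⟩ := hf.bdd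
  refine ⟨hc.stronglyMeasurable.mul hf.meas, ⟨B, fun x => ?_⟩, ?_⟩
  · rw [norm_mul, norm_ech, one_mul]; exact hB x
  · refine (measure_mono fun x hx => ?_).trans_lt hf.supp
    simp only [Function.mem_support] at hx ⊢
    exact right_ne_zero_of_mul hx

lemma fourier_ech_mul (f : ℝ → ℂ) (ξ ζ : ℝ) :
    𝓕 (fun x => ech (-(x * ξ)) * f x) ζ = 𝓕 f (ζ + ξ) := by
  simp only [fourier_eq_ech]
  refine integral_congr_ae (ae_of_all _ fun x => ?_)
  simp only
  rw [← mul_assoc, ← ech_add]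
  congr 2; ring

lemma inner_ech_mul (t : ℝ) (z w : ℂ) : inner ℂ (ech t * z) (ech t * w) = inner ℂ z w := by
  rw [← smul_eq_mul, ← smul_eq_mul, inner_smul_left, inner_smul_right, ← mul_assoc,
    Complex.conj_mul', norm_ech]
  simp

/-- Frequency localisation of the pairing with a packet of a lacunary tree. -/
lemma IsPacket.integral_inner_eq_sconv {φ : ℝ → ℂ} {C : ℝ≥0} (hφ : IsPacket φ C)
    {K : ℝ → ℂ} {B : ℝ} (hK : IsLPKernel K B) (h1 : ∀ u ∈ Icc (-(7/8)) (-(1/8)), 𝓕 K u = 1)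
    {f : ℝ → ℂ} (hf : IsTame f) {s : Tile} {ξ : ℝ} (hξ : ξ ∈ s.ω₂) :
    ∫ x, inner ℂ (s.packet φ x) (f x) = ∫ x, inner ℂ (ech (-(x * ξ)) * s.packet φ x)
      (sconv (dilate K (-s.k)) (fun x => ech (-(x * ξ)) * f x) x) := by
  set w := fun x => ech (-(x * ξ)) * f x with hw
  have hwt : IsTame w := hf.ech_mul ξ
  set p := fun x => ech (-(x * ξ)) * s.packet φ x with hp
  have hc : Continuous fun x : ℝ => ech (-(x * ξ)) := continuous_ech.comp (by fun_prop)
  have hκ := hK.isConvKernel {-s.k} fun _ => ContinuousLinearMap.id ℂ ℂ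
  set W := sconv (dilate K (-s.k)) w with hW
  have hWi : Integrable W := by rw [hW, sconv_dilate_eq]; exact hκ.integrable_convOp hwt
  have hW2 : MemLp W 2 := by rw [hW, sconv_dilate_eq]; exact hκ.memLp_convOp hwt
  have hpi : Integrable p := (hφ.integrable_packet s).bdd_mul (c := 1) hc.aestronglyMeasurable
    (ae_of_all _ fun x => (norm_ech _).le)
  have hpc : Continuous p := hc.mul (hφ.continuous_packet s)
  have hp2 : MemLp p 2 := (hφ.memLp_packet s).of_le hpc.aestronglyMeasurable
    (ae_of_all _ fun x => by rw [hp]; simp only; rw [norm_mul, norm_ech, one_mul])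
  have hint : ∀ v : ℝ → ℂ, MemLp v 2 → Integrable fun x => inner ℂ (p x) (v x) := by
    intro v hv
    refine (L2.integrable_inner (𝕜 := ℂ) (hp2.toLp _) (hv.toLp _)).congr ?_
    filter_upwards [hp2.coeFn_toLp, hv.coeFn_toLp] with x a b
    rw [a, b]
  have hz : ∫ x, inner ℂ (p x) (w x - W x) = 0 := by
    refine integral_inner_eq_zero_of_fourier hpi hp2 (hwt.integrable.sub hWi)
      ((hwt.memLp 2).sub hW2) fun ζ => ?_
    rw [hp, fourier_ech_mul]
    by_cases hz : |(2:ℝ) ^ s.k * (ζ + ξ) - (s.n + 1 / 4)| ≤ 1 / 8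
    · right
      obtain ⟨g1, g2⟩ := Tile.le_and_lt_of_mem_ω₂ hξ
      obtain ⟨z1, z2⟩ := abs_le.1 hz
      have e : 𝓕 (fun x => w x - W x) ζ = 𝓕 w ζ - 𝓕 W ζ := by
        simp only [fourier_eq_ech, mul_sub]
        have hb : ∀ v : ℝ → ℂ, Integrable v → Integrable fun x => ech (-(x * ζ)) * v x :=
          fun v hv => hv.bdd_mul (c := 1)
            (continuous_ech.comp (by fun_prop : Continuous fun x : ℝ => -(x * ζ))).aestronglyMeasurable
            (ae_of_all _ fun x => (norm_ech _).le)
        exact integral_sub (hb w hwt.integrable) (hb W hWi)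
      rw [e, hW, hK.fourier_sconv_dilate hwt.integrable, neg_neg, h1, one_mul, sub_self]
      constructor <;> linarith
    · left; exact hφ.fourier_packet_eq_zero s (not_le.1 hz)
  simp only [inner_sub_right] at hz
  rw [integral_sub (hint w (hwt.memLp 2)) (hint W hW2), sub_eq_zero] at hz
  rw [← hz]
  exact integral_congr_ae (ae_of_all _ fun x => (inner_ech_mul _ _ _).symm)

lemma sum_mul_le_sqrt {ι : Type*} (T : Finset ι) (f g : ι → ℝ≥0∞) :
    ∑ i ∈ T, f i * g i ≤ (∑ i ∈ T, f i ^ 2) ^ (1 / 2 : ℝ) * (∑ i ∈ T, g i ^ 2) ^ (1 / 2 : ℝ) := by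
  have := ENNReal.inner_le_Lp_mul_Lq T f g Real.HolderConjugate.two_two
  simpa [ENNReal.rpow_ofNat] using this

/-- Pairing of an upper tree with a test function, through the square function. -/
lemma IsPacket.enorm_integral_packetSum_inner_le (C : ℝ≥0) : ∃ A : ℝ≥0∞, A ≠ ∞ ∧
    ∀ (φ : ℝ → ℂ) (a : Tile → ℂ) (P T : Finset Tile) (f : ℝ → ℂ) (K M : ℤ) (ξ : ℝ) (σ : ℝ≥0∞),
      IsPacket φ C → HasSize P a σ → T ⊆ P → (∀ s ∈ T, s.I ⊆ dy K M ∧ ξ ∈ s.ω₂) → IsTame f →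
      ‖∫ x, inner ℂ (packetSum φ a T x) (f x)‖ₑ ≤
        A * (σ * ENNReal.ofReal (2 ^ K) ^ (1 / 4 : ℝ)) *
          (∫⁻ x, ‖f x‖ₑ ^ (4 / 3 : ℝ)) ^ (3 / 4 : ℝ) := by
  classical
  obtain ⟨κ, hκ1, hκ2⟩ := exists_schwartz_bump (a := -1) (b := -(7/8)) (c := -(1/8)) (d := -(1/16))
    (by norm_num) (by norm_num)
  obtain ⟨B, hB⟩ := κ.isLPKernel (a := 1 / 16) (by norm_num) fun u hu =>
    hκ2 u fun h => by have := (abs_lt.1 hu).1; linarith [h.2]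
  obtain ⟨A, hA, hsq⟩ := lpKernel_square (p := 4 / 3) (by norm_num) B
  refine ⟨C * chiC ^ (1 / 2 : ℝ) * (32 * chiC ^ 2) ^ (1 / 4 : ℝ) * A ^ (3 / 4 : ℝ), by finiteness,
    fun φ a P T f K M ξ σ hφ hP hTP hT hf => ?_⟩
  set w := fun x => ech (-(x * ξ)) * f x with hw
  have hwt : IsTame w := hf.ech_mul ξ
  have hwn : ∀ x, ‖w x‖ₑ = ‖f x‖ₑ := fun x => by rw [hw]; simp only; rw [enorm_mul, enorm_ech, one_mul]
  set W : ℤ → ℝ → ℂ := fun k => sconv (dilate κ k) w with hW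
  have hWm : ∀ k, Measurable fun x => ‖W k x‖ₑ := fun k => by
    have : Continuous (W k) := by
      rw [hW]; simp only; rw [sconv_dilate_eq]
      exact (hB.isConvKernel _ _).continuous_convOp hwt
    exact this.enorm.measurable
  set S := T.image fun s => -s.k with hS
  have hTx : ∀ x, ∑ s ∈ T, s.chi x ^ 2 * ‖W (-s.k) x‖ₑ ^ 2 ≤ chiC * ∑ k ∈ S, ‖W k x‖ₑ ^ 2 := by
    intro x
    rw [← Finset.sum_fiberwise_of_maps_to (t := S) (g := fun s : Tile => -s.k)
      fun s hs => Finset.mem_image_of_mem _ hs, Finset.mul_sum]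
    refine Finset.sum_le_sum fun k _ => ?_
    calc ∑ s ∈ T with -s.k = k, s.chi x ^ 2 * ‖W (-s.k) x‖ₑ ^ 2
        = (∑ s ∈ T with -s.k = k, chi (-k) s.m x ^ 2) * ‖W k x‖ₑ ^ 2 := by
          rw [Finset.sum_mul]
          refine Finset.sum_congr rfl fun s hs => ?_
          rw [← (Finset.mem_filter.1 hs).2, neg_neg]; rfl
      _ ≤ _ := by
          refine mul_le_mul_left ((Tile.sum_le_tsum_of_fixed (k := -k) (fun s hs => ?_)
            (fun s hs s' hs' => ?_) fun m => chi (-k) m x ^ 2).trans (tsum_chi_sq_le _ _)) _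
          · rw [← (Finset.mem_filter.1 hs).2, neg_neg]
          · have h1 := Finset.mem_filter.1 hs
            have h2 := Finset.mem_filter.1 hs'
            exact Tile.eq_of_mem_ω (by omega) (s.ω₂_subset (hT s h1.1).2)
              (s'.ω₂_subset (hT s' h2.1).2)
  have h1 : ∫ x, inner ℂ (packetSum φ a T x) (f x) = ∑ s ∈ T, (starRingEnd ℂ) (a s) *
      ∫ x, inner ℂ (ech (-(x * ξ)) * s.packet φ x) (W (-s.k) x) := by
    unfold packetSum
    simp only [sum_inner, mul_inner_left (a _)]
    rw [integral_finsetSum _ fun s _ => (hφ.integrable_inner_right (hf.memLp 2) s).const_mul _]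
    refine Finset.sum_congr rfl fun s hs => ?_
    rw [integral_const_mul, hφ.integral_inner_eq_sconv hB hκ1 hf (hT s hs).2]
  set U : ℝ → ℝ≥0∞ := fun x => ∑ s ∈ T, ‖a s‖ₑ ^ 2 * s.chi x ^ 4 with hU
  set Q : ℝ → ℝ≥0∞ := fun x => ∑ k ∈ S, ‖W k x‖ₑ ^ 2 with hQ
  have hm : ∀ s : Tile, Measurable s.chi := fun s => measurable_chi _ _
  have hUm : Measurable U := Finset.measurable_fun_sum _ fun s _ => ((hm s).pow_const 4).const_mul _
  have hQm : Measurable Q := Finset.measurable_fun_sum _ fun k _ => (hWm k).pow_const 2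
  have h2 : ‖∫ x, inner ℂ (packetSum φ a T x) (f x)‖ₑ ≤
      ∫⁻ x, (C * chiC ^ (1 / 2 : ℝ)) * (U x ^ (1 / 2 : ℝ) * Q x ^ (1 / 2 : ℝ)) := by
    rw [h1]
    refine (enorm_sum_le _ _).trans ?_
    calc ∑ s ∈ T, ‖(starRingEnd ℂ) (a s) * ∫ x, inner ℂ (ech (-(x * ξ)) * s.packet φ x) (W (-s.k) x)‖ₑ
        ≤ ∑ s ∈ T, ∫⁻ x, ‖a s‖ₑ * ((C * s.chi x ^ 20) * ‖W (-s.k) x‖ₑ) := by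
          refine Finset.sum_le_sum fun s _ => ?_
          rw [enorm_mul, RCLike.enorm_conj, lintegral_const_mul' _ _ enorm_ne_top]
          refine mul_le_mul_right ((enorm_integral_le_lintegral_enorm _).trans
            (lintegral_mono fun x => ?_)) _
          rw [RCLike.inner_apply, enorm_mul, RCLike.enorm_conj, mul_comm, enorm_mul, enorm_ech,
            one_mul]
          refine mul_le_mul_left ?_ _
          exact hφ.enorm_packet_le s x
      _ = ∫⁻ x, ∑ s ∈ T, ‖a s‖ₑ * ((C * s.chi x ^ 20) * ‖W (-s.k) x‖ₑ) :=
          (lintegral_finsetSum _ fun s _ =>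
            (((hm s).pow_const 20 |>.const_mul _).mul (hWm _)).const_mul _).symm
      _ ≤ _ := by
          refine lintegral_mono fun x => ?_
          calc ∑ s ∈ T, ‖a s‖ₑ * ((C * s.chi x ^ 20) * ‖W (-s.k) x‖ₑ)
              ≤ C * ∑ s ∈ T, (‖a s‖ₑ * s.chi x ^ 2) * (s.chi x * ‖W (-s.k) x‖ₑ) := by
                rw [Finset.mul_sum]
                refine Finset.sum_le_sum fun s _ => ?_
                calc _ ≤ ‖a s‖ₑ * ((C * s.chi x ^ 3) * ‖W (-s.k) x‖ₑ) :=
                      mul_le_mul_right (mul_le_mul_left (mul_le_mul_right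
                        (chi_pow_le_pow _ _ _ (by norm_num)) _) _) _
                  _ = _ := by ring
            _ ≤ C * (U x ^ (1 / 2 : ℝ) * (chiC * Q x) ^ (1 / 2 : ℝ)) := by
                refine mul_le_mul_right ((sum_mul_le_sqrt _ _ _).trans (mul_le_mul' ?_ ?_)) _
                · apply le_of_eq; congr 1
                  exact Finset.sum_congr rfl fun s _ => by ring
                · refine ENNReal.rpow_le_rpow (le_trans (le_of_eq ?_) (hTx x)) (by norm_num)
                  exact Finset.sum_congr rfl fun s _ => by ring
            _ = _ := by rw [ENNReal.mul_rpow_of_nonneg _ _ (by norm_num)]; ring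
  have h3 := ENNReal.lintegral_mul_le_Lp_mul_Lq volume
    (p := 4) (q := 4 / 3) (Real.holderConjugate_iff.2 (by norm_num))
    (hUm.pow_const (1 / 2 : ℝ)).aemeasurable (hQm.pow_const (1 / 2 : ℝ)).aemeasurable
  have h4 : ∫⁻ x, (U x ^ (1 / 2 : ℝ)) ^ (4:ℝ) ≤ 32 * chiC ^ 2 * (σ ^ 4 * ENNReal.ofReal (2 ^ K)) := by
    refine le_trans (le_of_eq (lintegral_congr fun x => ?_)) (hP.lintegral_sq_le hTP hT)
    rw [← ENNReal.rpow_mul, ← ENNReal.rpow_ofNat]; norm_num [hU]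
  have h5 : ∫⁻ x, (Q x ^ (1 / 2 : ℝ)) ^ (4 / 3 :ℝ) ≤ A * ∫⁻ x, ‖f x‖ₑ ^ (4 / 3 : ℝ) := by
    simp only [← hwn]
    obtain ⟨D, hD⟩ := hwt.bdd
    refine le_trans (le_of_eq (lintegral_congr fun x => ?_)) (hsq κ S hB w D hwt.meas hD)
    rw [← ENNReal.rpow_mul]; norm_num [hQ, hW]
  refine h2.trans ?_
  rw [lintegral_const_mul' _ _ (by finiteness)]
  refine (mul_le_mul_right (h3.trans (mul_le_mul' (ENNReal.rpow_le_rpow h4 (by norm_num))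
    (ENNReal.rpow_le_rpow h5 (by norm_num)))) _).trans_eq ?_
  have e4 : (σ ^ 4) ^ (1 / 4 : ℝ) = σ := by
    rw [← ENNReal.rpow_ofNat, ← ENNReal.rpow_mul]; norm_num
  rw [ENNReal.mul_rpow_of_nonneg _ _ (by norm_num), ENNReal.mul_rpow_of_nonneg (σ ^ 4) _ (by norm_num),
    e4, show (1:ℝ) / (4 / 3) = 3 / 4 by norm_num, ENNReal.mul_rpow_of_nonneg A _ (by norm_num)]
  ring

lemma lintegral_chi_sq_mul_le {F : Set ℝ} (hF : MeasurableSet F) {K M : ℤ} {x : ℝ}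
    (hx : x ∈ dy K M) : ∫⁻ y, chi K M y ^ 2 * F.indicator 1 y ≤
      32 * ENNReal.ofReal (2 ^ K) * maxFn (F.indicator 1) x := by
  have hp := two_zpow_pos K
  have h1 : |(M:ℝ) * 2 ^ K - x| ≤ 2 ^ K := by
    rw [abs_le]; constructor <;> nlinarith [hx.1, hx.2]
  have h := maxFn.weight_le (F.indicator 1) (measurable_one.indicator hF) hp h1
  have e : ∀ y, chi K M y ^ 2 * F.indicator 1 y = ENNReal.ofReal (2 ^ K) *
      (ENNReal.ofReal (((2:ℝ) ^ K)⁻¹ * ((1 + |(M:ℝ) * 2 ^ K - y| / 2 ^ K) ^ 2)⁻¹) *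
        F.indicator 1 y) := by
    intro y
    rw [← mul_assoc, ← ENNReal.ofReal_mul hp.le, ← mul_assoc, mul_inv_cancel₀ hp.ne', one_mul,
      chi, ← ENNReal.ofReal_pow (by positivity), inv_pow]
    congr 5
    rw [abs_sub_comm ((M:ℝ) * 2 ^ K), eq_div_iff hp.ne', ← abs_of_pos hp, ← abs_mul, abs_of_pos hp]
    rw [sub_mul, mul_right_comm, ← zpow_add₀ two_ne_zero]; simp
  simp only [e]
  rw [lintegral_const_mul' _ _ ENNReal.ofReal_ne_top]
  exact (mul_le_mul_right h _).trans_eq (by ring)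

lemma chi_le_div_of_notMem_dy3 {k m K M : ℤ} (h : dy k m ⊆ dy K M) {x : ℝ} (hx : x ∉ dy3 K M) :
    chi k m x ≤ ENNReal.ofReal (2 ^ k) * (ENNReal.ofReal (2 ^ K))⁻¹ := by
  have hp := two_zpow_pos K
  have hk := two_zpow_pos k
  rw [← ENNReal.ofReal_inv_of_pos hp, ← ENNReal.ofReal_mul hk.le]
  apply ENNReal.ofReal_le_ofReal
  have hm := h (left_mem_dy k m)
  have h1 : (2:ℝ) ^ K ≤ |x - m * 2 ^ k| := by
    by_contra hc
    obtain ⟨a, b⟩ := abs_lt.1 (not_le.1 hc)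
    exact hx ⟨by linarith [hm.1], by linarith [hm.2]⟩
  have h2 : |(2:ℝ) ^ (-k) * x - m| = |x - m * 2 ^ k| / 2 ^ k := by
    rw [eq_div_iff hk.ne', ← abs_of_pos hk, ← abs_mul, abs_of_pos hk, sub_mul, mul_right_comm,
      ← zpow_add₀ two_ne_zero]
    simp
  rw [h2, ← div_eq_mul_inv, inv_le_comm₀ (by positivity) (by positivity), inv_div]
  exact (div_le_div_of_nonneg_right h1 hk.le).trans (by linarith)

lemma IsPacket.sum_enorm_packet_far_le {φ : ℝ → ℂ} {C : ℝ≥0} (hφ : IsPacket φ C) {a : Tile → ℂ}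
    {σ : ℝ≥0∞} {T : Finset Tile} {K M : ℤ} {ξ : ℝ} (hT : ∀ s ∈ T, s.I ⊆ dy K M ∧ ξ ∈ s.ω₂)
    (ha : ∀ s ∈ T, ‖a s‖ₑ * s.len ≤ σ * ENNReal.ofReal (2 ^ K)) {x : ℝ} (hx : x ∉ dy3 K M) :
    ∑ s ∈ T, ‖a s * s.packet φ x‖ₑ ≤ 8 * C * chiC * σ * chi K M x ^ 2 := by
  have hL0 : ENNReal.ofReal (2 ^ K) ≠ 0 := by simpa using two_zpow_pos K
  refine (sum_le_of_scales (c := 4 * C * chiC * σ * chi K M x ^ 2 * (ENNReal.ofReal (2 ^ K))⁻¹)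
    (fun s hs => le_of_dy_subset (hT s hs).1) fun k T' hT' hk => ?_).trans_eq ?_
  · calc ∑ s ∈ T', ‖a s * s.packet φ x‖ₑ
        ≤ ∑ s ∈ T', (4 * C * σ * chi K M x ^ 2 * (ENNReal.ofReal (2 ^ k) *
            (ENNReal.ofReal (2 ^ K))⁻¹)) * chi k s.m x ^ 2 := by
          refine Finset.sum_le_sum fun s hs => ?_
          have hI := (hT s (hT' hs)).1
          have h1 : s.chi x ≤ 2 * chi K M x := chi_le_of_dy_subset hI x
          have h2 : s.chi x ≤ _ := chi_le_div_of_notMem_dy3 hI hx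
          have h3 := ha s (hT' hs)
          set L := ENNReal.ofReal (2 ^ K)
          rw [enorm_mul]
          calc ‖a s‖ₑ * ‖s.packet φ x‖ₑ ≤ ‖a s‖ₑ * (C * s.chi x ^ 6) :=
                mul_le_mul_right ((hφ.enorm_packet_le s x).trans
                  (mul_le_mul_right (chi_pow_le_pow _ _ _ (by norm_num)) _)) _
            _ = ‖a s‖ₑ * (C * (s.chi x ^ 2 * (s.chi x * s.chi x) * s.chi x ^ 2)) := by ring
            _ ≤ ‖a s‖ₑ * (C * ((2 * chi K M x) ^ 2 * ((s.len * L⁻¹) * (s.len * L⁻¹)) *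
                  s.chi x ^ 2)) :=
                mul_le_mul_right (mul_le_mul_right (mul_le_mul_left
                  (mul_le_mul' (pow_le_pow_left₀ zero_le h1 2) (mul_le_mul' h2 h2)) _) _) _
            _ = ‖a s‖ₑ * s.len * (L⁻¹ * (4 * C * chi K M x ^ 2 * (s.len * L⁻¹) *
                  s.chi x ^ 2)) := by ring
            _ ≤ σ * L * (L⁻¹ * (4 * C * chi K M x ^ 2 * (s.len * L⁻¹) * s.chi x ^ 2)) :=
                mul_le_mul_left h3 _
            _ = 4 * C * σ * chi K M x ^ 2 * (s.len * L⁻¹) * s.chi x ^ 2 * (L * L⁻¹) := by ring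
            _ = _ := by
                rw [ENNReal.mul_inv_cancel hL0 ENNReal.ofReal_ne_top, mul_one, Tile.chi,
                  Tile.len, hk s hs]
      _ ≤ (4 * C * σ * chi K M x ^ 2 * (ENNReal.ofReal (2 ^ k) *
            (ENNReal.ofReal (2 ^ K))⁻¹)) * chiC := by
          rw [← Finset.mul_sum]
          refine mul_le_mul_right ((Tile.sum_le_tsum_of_fixed hk (fun s hs s' hs' => ?_)
            fun m => chi k m x ^ 2).trans (tsum_chi_sq_le _ _)) _
          exact Tile.eq_of_mem_ω ((hk s hs).trans (hk s' hs').symm)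
            (s.ω₂_subset (hT s (hT' hs)).2) (s'.ω₂_subset (hT s' (hT' hs')).2)
      _ = _ := by ring
  · calc _ = 8 * C * chiC * σ * chi K M x ^ 2 *
        (ENNReal.ofReal (2 ^ K) * (ENNReal.ofReal (2 ^ K))⁻¹) := by ring
      _ = _ := by rw [ENNReal.mul_inv_cancel hL0 ENNReal.ofReal_ne_top, mul_one]

lemma lintegral_rpow_le_of_enorm_le_indicator {E : Type*} [NormedAddCommGroup E] {f : ℝ → E}
    {F : Set ℝ} (hF : MeasurableSet F) (h : ∀ x, ‖f x‖ₑ ≤ F.indicator 1 x) {p : ℝ} (hp : 0 < p) :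
    ∫⁻ x, ‖f x‖ₑ ^ p ≤ volume F := by
  rw [← lintegral_indicator_one hF]
  refine lintegral_mono fun x => (ENNReal.rpow_le_rpow (h x) hp.le).trans_eq ?_
  by_cases hx : x ∈ F <;> simp [hx, hp]

/-- The size of a tree of wave packet coefficients, in terms of the density of `F`. -/
lemma IsPacket.sum_coef_upper_le (C : ℝ≥0) : ∃ A : ℝ≥0∞, A ≠ ∞ ∧
    ∀ (φ f : ℝ → ℂ) (F : Set ℝ) (α σ : ℝ≥0∞) (P T : Finset Tile) (K M : ℤ) (ξ : ℝ),
      IsPacket φ C → IsTame f → MeasurableSet F → (∀ x, ‖f x‖ₑ ≤ F.indicator 1 x) → α ≤ 1 →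
      (∀ s ∈ P, ∃ x ∈ s.I, maxFn (F.indicator 1) x ≤ α) → HasSize P (coef φ f) σ → T ⊆ P →
      (∀ s ∈ T, s.I ⊆ dy K M ∧ ξ ∈ s.ω₂) →
      ∑ s ∈ T, s.len * ‖coef φ f s‖ₑ ^ 2 ≤ A * α ^ (3 / 4 : ℝ) * σ * ENNReal.ofReal (2 ^ K) := by
  obtain ⟨A, hA, hnear⟩ := IsPacket.enorm_integral_packetSum_inner_le C
  refine ⟨A * 4 ^ (3 / 4 : ℝ) + 8 * C * chiC * 32, by finiteness,
    fun φ f F α σ P T K M ξ hφ hf hF hfF hα hmax hσ hTP hT => ?_⟩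
  rcases T.eq_empty_or_nonempty with rfl | ⟨s0, hs0⟩
  · simp
  obtain ⟨x0, hx0, hM⟩ := hmax s0 (hTP hs0)
  have hxK : x0 ∈ dy K M := (hT s0 hs0).1 hx0
  set L := ENNReal.ofReal (2 ^ K) with hL
  set a := coef φ f with ha
  have h3 : MeasurableSet (dy3 K M) := measurableSet_Ico
  set f1 := (dy3 K M).indicator f with hf1
  set f2 := (dy3 K M)ᶜ.indicator f with hf2
  have hf1t : IsTame f1 := hf.indicator h3
  have hf2t : IsTame f2 := hf.indicator h3.compl
  have hn : ‖∫ x, inner ℂ (packetSum φ a T x) (f1 x)‖ₑ ≤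
      A * 4 ^ (3 / 4 : ℝ) * α ^ (3 / 4 : ℝ) * σ * L := by
    refine (hnear φ a P T f1 K M ξ σ hφ hσ hTP hT hf1t).trans ?_
    have hp := two_zpow_pos K
    have hv : ∫⁻ x, ‖f1 x‖ₑ ^ (4 / 3 : ℝ) ≤ 4 * L * α := by
      refine (lintegral_rpow_le_of_enorm_le_indicator (F := F ∩ dy3 K M) (hF.inter h3)
        (fun x => ?_) (by norm_num)).trans ?_
      · by_cases hx : x ∈ dy3 K M
        · rw [hf1, indicator_of_mem hx]
          refine (hfF x).trans (le_of_eq ?_)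
          by_cases hxF : x ∈ F <;> simp [hx, hxF]
        · simp [hf1, hx]
      · have hb : dy3 K M ⊆ Metric.ball (((M:ℝ) + 1 / 2) * 2 ^ K) (2 * 2 ^ K) := by
          intro x hx
          rw [Metric.mem_ball, Real.dist_eq, abs_lt]
          constructor <;> nlinarith [hx.1, hx.2]
        have hxb : x0 ∈ Metric.ball (((M:ℝ) + 1 / 2) * 2 ^ K) (2 * 2 ^ K) := by
          rw [Metric.mem_ball, Real.dist_eq, abs_lt]
          constructor <;> nlinarith [hxK.1, hxK.2]
        have h := maxFn.lintegral_le (f := F.indicator 1) hxb hb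
        rw [lintegral_indicator_one hF, Measure.restrict_apply hF] at h
        refine h.trans ((mul_le_mul_right hM _).trans_eq ?_)
        rw [show (2:ℝ) * (2 * 2 ^ K) = 4 * 2 ^ K by ring, ENNReal.ofReal_mul (by norm_num)]
        norm_num [hL]
    refine (mul_le_mul_right (ENNReal.rpow_le_rpow hv (by norm_num)) _).trans_eq ?_
    have hLL : L ^ (1 / 4 : ℝ) * L ^ (3 / 4 : ℝ) = L := by
      rw [← ENNReal.rpow_add_of_nonneg _ _ (by norm_num) (by norm_num)]; norm_num
    rw [ENNReal.mul_rpow_of_nonneg (4 * L) _ (by norm_num),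
      ENNReal.mul_rpow_of_nonneg 4 _ (by norm_num)]
    calc _ = A * 4 ^ (3 / 4 : ℝ) * α ^ (3 / 4 : ℝ) * σ * (L ^ (1 / 4 : ℝ) * L ^ (3 / 4 : ℝ)) := by
          ring
      _ = _ := by rw [hLL]
  have hfar : ‖∫ x, inner ℂ (packetSum φ a T x) (f2 x)‖ₑ ≤
      8 * C * chiC * 32 * α ^ (3 / 4 : ℝ) * σ * L := by
    have hpt : ∀ x, ‖inner ℂ (packetSum φ a T x) (f2 x)‖ₑ ≤
        8 * C * chiC * σ * (chi K M x ^ 2 * F.indicator 1 x) := by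
      intro x
      by_cases hx : x ∈ dy3 K M
      · simp [hf2, hx]
      · rw [RCLike.inner_apply, enorm_mul, RCLike.enorm_conj, mul_comm, hf2,
          indicator_of_mem (mem_compl hx), ← mul_assoc]
        exact mul_le_mul' ((enorm_sum_le _ _).trans (hφ.sum_enorm_packet_far_le hT
          (fun s hs => mul_le_mul' (hσ.enorm_le (hTP hs)) (ENNReal.ofReal_le_ofReal
            (zpow_le_zpow_right₀ one_le_two (le_of_dy_subset (hT s hs).1)))) hx)) (hfF x)
    refine (enorm_integral_le_lintegral_enorm _).trans ((lintegral_mono hpt).trans ?_)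
    have hmeas : Measurable fun x => chi K M x ^ 2 * F.indicator (1 : ℝ → ℝ≥0∞) x :=
      ((measurable_chi K M).pow_const 2).mul (measurable_one.indicator hF)
    rw [lintegral_const_mul _ hmeas]
    have hα' : α ≤ α ^ (3 / 4 : ℝ) := by
      nth_rw 1 [← ENNReal.rpow_one α]
      exact ENNReal.rpow_le_rpow_of_exponent_ge hα (by norm_num)
    refine (mul_le_mul_right ((lintegral_chi_sq_mul_le hF hxK).trans
      (mul_le_mul_right (hM.trans hα') _)) _).trans_eq ?_
    ring
  have hsplit : ∫ x, inner ℂ (packetSum φ a T x) (f x) =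
      (∫ x, inner ℂ (packetSum φ a T x) (f1 x)) + ∫ x, inner ℂ (packetSum φ a T x) (f2 x) := by
    have hint : ∀ g : ℝ → ℂ, IsTame g → Integrable fun x => inner ℂ (packetSum φ a T x) (g x) := by
      intro g hg
      unfold packetSum
      simp only [sum_inner, mul_inner_left]
      exact integrable_finsetSum _ fun s _ =>
        (hφ.integrable_inner_right (hg.memLp 2) s).const_mul _
    rw [← integral_add (hint f1 hf1t) (hint f2 hf2t)]
    refine integral_congr_ae (ae_of_all _ fun x => ?_)
    simp only
    rw [← inner_add_right, hf1, hf2, indicator_self_add_compl_apply]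
  rw [ha, ← hφ.enorm_integral_packetSum_inner (hf.memLp 2), ← ha, hsplit]
  refine (enorm_add_le _ _).trans ((add_le_add hn hfar).trans_eq ?_)
  ring

/-- The size bound for the coefficients of a function bounded by an indicator. -/
lemma IsPacket.hasSize_coef (C : ℝ≥0) : ∃ A : ℝ≥0∞, A ≠ ∞ ∧
    ∀ (φ f : ℝ → ℂ) (F : Set ℝ) (α : ℝ≥0∞) (P : Finset Tile),
      IsPacket φ C → IsTame f → MeasurableSet F → (∀ x, ‖f x‖ₑ ≤ F.indicator 1 x) → α ≤ 1 →
      (∀ s ∈ P, ∃ x ∈ s.I, maxFn (F.indicator 1) x ≤ α) →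
      HasSize P (coef φ f) (A * α ^ (3 / 4 : ℝ)) := by
  classical
  obtain ⟨A, hA, h⟩ := IsPacket.sum_coef_upper_le C
  refine ⟨A, hA, fun φ f F α P hφ hf hF hfF hα hmax => ?_⟩
  set a := coef φ f with ha
  set R : ℤ → ℤ → ℝ → ℝ≥0∞ := fun k m ξ =>
    (∑ s ∈ P with s.I ⊆ dy k m ∧ ξ ∈ s.ω₂, s.len * ‖a s‖ₑ ^ 2) / ENNReal.ofReal (2 ^ k) with hR
  set S := ⨆ k, ⨆ m, ⨆ ξ, R k m ξ with hS
  have hL0 : ∀ k : ℤ, ENNReal.ofReal (2 ^ k) ≠ 0 := fun k => by simpa using two_zpow_pos k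
  have hRS : ∀ k m ξ, R k m ξ ≤ S := fun k m ξ =>
    le_iSup_of_le k (le_iSup_of_le m (le_iSup_of_le ξ le_rfl))
  have hS2 : (S ^ (1 / 2 : ℝ)) ^ 2 = S := by
    rw [← ENNReal.rpow_ofNat, ← ENNReal.rpow_mul]; norm_num
  have hsz : HasSize P a (S ^ (1 / 2 : ℝ)) := by
    intro k m ξ
    rw [hS2, ← ENNReal.div_le_iff (hL0 k) ENNReal.ofReal_ne_top]
    convert hRS k m ξ
  have hfin : S ≠ ∞ := by
    refine ((iSup_le fun k => iSup_le fun m => iSup_le fun ξ => ?_ :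
      S ≤ ∑ s ∈ P, ‖a s‖ₑ ^ 2).trans_lt
      (ENNReal.sum_lt_top.2 fun s _ => by finiteness)).ne
    refine ENNReal.div_le_of_le_mul ?_
    rw [Finset.sum_mul]
    refine (Finset.sum_le_sum fun s hs => ?_).trans
      (Finset.sum_le_sum_of_subset (Finset.filter_subset _ _))
    rw [mul_comm]
    refine mul_le_mul_right (ENNReal.ofReal_le_ofReal (zpow_le_zpow_right₀ one_le_two ?_)) _
    exact le_of_dy_subset (Finset.mem_filter.1 hs).2.1
  have hle : S ≤ A * α ^ (3 / 4 : ℝ) * S ^ (1 / 2 : ℝ) :=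
    iSup_le fun k => iSup_le fun m => iSup_le fun ξ => ENNReal.div_le_of_le_mul
      (h φ f F α _ P _ k m ξ hφ hf hF hfF hα hmax hsz (Finset.filter_subset _ _)
        fun s hs => (Finset.mem_filter.1 hs).2)
  refine hsz.mono ?_
  have := ENNReal.rpow_le_rpow (ENNReal.le_rpow_of_le_mul_rpow Real.HolderConjugate.two_two hfin hle)
    (show (0:ℝ) ≤ 1 / 2 by norm_num)
  rwa [← ENNReal.rpow_mul, show (2:ℝ) * (1 / 2) = 1 by norm_num, ENNReal.rpow_one] at this

lemma volume_dy3 (K M : ℤ) : volume (dy3 K M) = 3 * ENNReal.ofReal (2 ^ K) := by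
  rw [dy3, Real.volume_Ico, show ((M:ℝ) + 2) * 2 ^ K - (M - 1) * 2 ^ K = 3 * 2 ^ K by ring,
    ENNReal.ofReal_mul (by norm_num)]
  norm_num

lemma IsPacket.enorm_coef_mul_len_le {φ f : ℝ → ℂ} {C : ℝ≥0} (hφ : IsPacket φ C) {F : Set ℝ}
    (hF : MeasurableSet F) (hfF : ∀ x, ‖f x‖ₑ ≤ F.indicator 1 x) {s : Tile} {K M : ℤ}
    (hs : s.I ⊆ dy K M) {x : ℝ} (hx : x ∈ dy K M) :
    ‖coef φ f s‖ₑ * s.len ≤ 128 * C * maxFn (F.indicator 1) x * ENNReal.ofReal (2 ^ K) := by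
  have hk := two_zpow_pos s.k
  have h1 : ‖coef φ f s‖ₑ * s.len = ‖∫ x, inner ℂ (s.packet φ x) (f x)‖ₑ := by
    rw [coef, enorm_mul, ← ofReal_norm (((2 ^ (-s.k) : ℝ) : ℂ)), Complex.norm_real,
      Real.norm_of_nonneg (two_zpow_pos _).le, mul_right_comm, Tile.len, ← ENNReal.ofReal_mul (two_zpow_pos _).le,
      ← zpow_add₀ two_ne_zero]
    simp
  rw [h1]
  refine (enorm_integral_le_lintegral_enorm _).trans ?_
  calc ∫⁻ x, ‖inner ℂ (s.packet φ x) (f x)‖ₑ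
      ≤ ∫⁻ x, 4 * C * (chi K M x ^ 2 * F.indicator 1 x) := by
        refine lintegral_mono fun x => ?_
        rw [RCLike.inner_apply, enorm_mul, RCLike.enorm_conj, mul_comm]
        refine (mul_le_mul' ((hφ.enorm_packet_le s x).trans
          (mul_le_mul_right ((chi_pow_le_pow _ _ _ (b := 2) (by norm_num)).trans
            (pow_le_pow_left₀ zero_le (chi_le_of_dy_subset hs x) 2)) _)) (hfF x)).trans_eq ?_
        ring
    _ ≤ 4 * C * (32 * ENNReal.ofReal (2 ^ K) * maxFn (F.indicator 1) x) := by
        rw [lintegral_const_mul' _ _ (by finiteness)]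
        exact mul_le_mul_right (lintegral_chi_sq_mul_le hF hx) _
    _ = _ := by ring

/-- Tiles whose time intervals lie in the set where the maximal function is large. -/
lemma IsPacket.exists_exceptional (C : ℝ≥0) : ∃ A : ℝ≥0∞, A ≠ ∞ ∧
    ∀ (φ f : ℝ → ℂ) (N : ℝ → ℝ) (F : Set ℝ) (α : ℝ≥0∞) (P : Finset Tile),
      IsPacket φ C → Measurable N → MeasurableSet F → (∀ x, ‖f x‖ₑ ≤ F.indicator 1 x) →
      volume {x | α < maxFn (F.indicator 1) x} ≠ ∞ →
      (∀ s ∈ P, s.I ⊆ {x | α < maxFn (F.indicator 1) x}) →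
      ∃ Ω : Set ℝ, MeasurableSet Ω ∧ volume Ω ≤ 3 * volume {x | α < maxFn (F.indicator 1) x} ∧
        ∫⁻ x in Ωᶜ, ‖modelSum φ (coef φ f) N P x‖ₑ ≤
          A * (α * volume {x | α < maxFn (F.indicator 1) x}) := by
  classical
  refine ⟨8 * C * chiC * (256 * C) * chiC, by finiteness,
    fun φ f N F α P hφ hN hF hfF hfin hP => ?_⟩
  set Ω0 := {x | α < maxFn (F.indicator 1) x} with hΩ0
  set D : Set (ℤ × ℤ) := {q | dy q.1 q.2 ⊆ Ω0} with hD
  obtain ⟨K0, hK0⟩ : ∃ K0 : ℤ, ∀ q ∈ D, q.1 ≤ K0 := by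
    obtain ⟨K0, h⟩ := exists_scale_bound hfin one_ne_zero
    exact ⟨K0, fun q hq => h q.1 q.2 ((one_mul _).trans_le (measure_mono hq))⟩
  have hex : ∀ s, ∃ q, s ∈ P → q ∈ dyMax D ∧ s.I ⊆ dy q.1 q.2 := fun s => by
    by_cases hs : s ∈ P
    · obtain ⟨q, h⟩ := exists_dyMax hK0 (show (s.k, s.m) ∈ D from hP s hs)
      exact ⟨q, fun _ => h⟩
    · exact ⟨(0, 0), fun h => absurd h hs⟩
  choose J hJ using hex
  set Q := P.image J with hQ
  have hQD : ∀ q ∈ Q, q ∈ dyMax D := fun q hq => by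
    obtain ⟨s, hs, rfl⟩ := Finset.mem_image.1 hq
    exact (hJ s hs).1
  have hsum : ∑ q ∈ Q, ENNReal.ofReal (2 ^ q.1) ≤ volume Ω0 := by
    rw [← Finset.sum_congr rfl fun q (_ : q ∈ Q) => volume_dy q.1 q.2,
      ← measure_biUnion_finset (fun a ha b hb => dyMax_pairwiseDisjoint D (hQD a ha) (hQD b hb))
        fun q _ => measurableSet_dy _ _]
    exact measure_mono (iUnion₂_subset fun q hq => (hQD q hq).1)
  have h3 : ∀ q : ℤ × ℤ, MeasurableSet (dy3 q.1 q.2) := fun q => measurableSet_Ico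
  have hpt : ∀ q ∈ Q, ∀ x ∉ dy3 q.1 q.2, ‖modelSum φ (coef φ f) N {s ∈ P | J s = q} x‖ₑ ≤
      8 * C * chiC * (256 * C * α) * chi q.1 q.2 x ^ 2 := by
    intro q hq x hx
    obtain ⟨m', hm'⟩ := exists_dy_superset (show q.1 ≤ q.1 + 1 by lia) q.2
    obtain ⟨y, hy, hyα⟩ : ∃ y ∈ dy (q.1 + 1) m', maxFn (F.indicator 1) y ≤ α := by
      by_contra! hc
      have := (hQD q hq).2 (q.1 + 1, m') (fun y hy => hc y hy) hm'
      have := congrArg Prod.fst this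
      simp at this
    have hmod : modelSum φ (coef φ f) N {s ∈ P | J s = q} x =
        ∑ s ∈ {s ∈ {s ∈ P | J s = q} | N x ∈ s.ω₂}, coef φ f s * s.packet φ x := by
      rw [Finset.sum_filter]
      refine Finset.sum_congr rfl fun s _ => ?_
      by_cases h : N x ∈ s.ω₂ <;> simp [modelTerm, indicator, h]
    rw [hmod]
    refine (enorm_sum_le _ _).trans (hφ.sum_enorm_packet_far_le (ξ := N x) (fun s hs => ?_)
      (fun s hs => ?_) hx) <;> simp only [Finset.mem_filter] at hs <;>
      have hsJ := (hJ s hs.1.1).2 <;> rw [hs.1.2] at hsJ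
    · exact ⟨hsJ, hs.2⟩
    · refine (hφ.enorm_coef_mul_len_le hF hfF (hsJ.trans hm') hy).trans ?_
      refine (mul_le_mul_left (mul_le_mul_right hyα _) _).trans_eq ?_
      rw [zpow_add₀ two_ne_zero, zpow_one, mul_comm ((2:ℝ) ^ q.1), ENNReal.ofReal_mul two_pos.le]
      norm_num
      ring
  refine ⟨⋃ q ∈ Q, dy3 q.1 q.2, Q.measurableSet_biUnion fun q _ => h3 q, ?_, ?_⟩
  · refine (measure_biUnion_finset_le _ _).trans ?_
    simp only [volume_dy3]
    rw [← Finset.mul_sum]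
    exact mul_le_mul_right hsum _
  · set Ω := ⋃ q ∈ Q, dy3 q.1 q.2 with hΩ
    have hsplit : ∀ x, modelSum φ (coef φ f) N P x =
        ∑ q ∈ Q, modelSum φ (coef φ f) N {s ∈ P | J s = q} x := fun x =>
      (Finset.sum_fiberwise_of_maps_to (fun s hs => Finset.mem_image_of_mem J hs) _).symm
    calc ∫⁻ x in Ωᶜ, ‖modelSum φ (coef φ f) N P x‖ₑ
        ≤ ∫⁻ x in Ωᶜ, ∑ q ∈ Q, 8 * C * chiC * (256 * C * α) * chi q.1 q.2 x ^ 2 := by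
          refine setLIntegral_mono_ae' (Q.measurableSet_biUnion fun q _ => h3 q).compl
            (ae_of_all _ fun x hx => ?_)
          rw [hsplit]
          refine (enorm_sum_le _ _).trans (Finset.sum_le_sum fun q hq => hpt q hq x fun h => hx ?_)
          exact mem_biUnion (Finset.mem_coe.2 hq) h
      _ ≤ ∑ q ∈ Q, 8 * C * chiC * (256 * C * α) * (chiC * ENNReal.ofReal (2 ^ q.1)) := by
          refine (setLIntegral_le_lintegral _ _).trans ?_
          rw [lintegral_finsetSum _ fun q _ => ((measurable_chi _ _).pow_const 2).const_mul _]
          refine Finset.sum_le_sum fun q _ => ?_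
          rw [lintegral_const_mul _ ((measurable_chi _ _).pow_const 2)]
          exact mul_le_mul_right (lintegral_chi_sq_le _ _) _
      _ = 8 * C * chiC * (256 * C) * chiC * (α * ∑ q ∈ Q, ENNReal.ofReal (2 ^ q.1)) := by
          rw [← Finset.mul_sum, ← Finset.mul_sum]; ring
      _ ≤ _ := mul_le_mul_right (mul_le_mul_right hsum _) _

lemma IsPacket.lintegral_modelSum_le_of_trees (C : ℝ≥0) : ∃ A : ℝ≥0∞, A ≠ ∞ ∧
    ∀ (φ : ℝ → ℂ) (a : Tile → ℂ) (N : ℝ → ℝ) (E : Set ℝ) (σ μ : ℝ≥0∞) (P' : Finset Tile)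
      (ι : Type) (F : Finset ι) (k m : ι → ℤ) (ξ : ι → ℝ) (P : Finset Tile),
      IsPacket φ C → Measurable N → MeasurableSet E → σ ≠ 0 → σ ≠ ∞ → P' ⊆ P → HasSize P a σ →
      (∀ s ∈ P, s.IsDense N E μ) →
      (∀ s ∈ P, s ∈ P' ∨ ∃ i ∈ F, s.I ⊆ dy (k i) (m i) ∧ ξ i ∈ s.ω) →
      ∫⁻ x in E, ‖modelSum φ a N P x‖ₑ ≤ (∫⁻ x in E, ‖modelSum φ a N P' x‖ₑ) +
        A * (σ * μ * ∑ i ∈ F, ENNReal.ofReal (2 ^ k i)) := by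
  classical
  obtain ⟨A, hA, hT⟩ := IsPacket.tree_estimate C
  refine ⟨A, hA, fun φ a N E σ μ P' ι F k m ξ => ?_⟩
  induction F using Finset.induction_on with
  | empty =>
    intro P hφ hN hE hσ0 hσ hP' hS hd hc
    obtain rfl : P' = P := hP'.antisymm fun s hs => (hc s hs).resolve_right (by simp)
    exact le_self_add
  | insert i F hi ih =>
    intro P hφ hN hE hσ0 hσ hP' hS hd hc
    set p : Tile → Prop := fun s => s ∉ P' ∧ s.I ⊆ dy (k i) (m i) ∧ ξ i ∈ s.ω with hp
    have h1 := hT φ a N E σ μ {s ∈ P | p s} (k i) (m i) (ξ i) hφ hN hE hσ0 hσ (hS.subset (Finset.filter_subset _ _))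
      (fun s hs => hd s (Finset.filter_subset _ _ hs)) (fun s hs => (Finset.mem_filter.1 hs).2.2)
    have h2 := ih {s ∈ P | ¬ p s} hφ hN hE hσ0 hσ
      (fun s hs => Finset.mem_filter.2 ⟨hP' hs, fun h => h.1 hs⟩) (hS.subset (Finset.filter_subset _ _))
      (fun s hs => hd s (Finset.filter_subset _ _ hs)) fun s hs => by
        obtain ⟨hs, hn⟩ := Finset.mem_filter.1 hs
        rcases hc s hs with h | ⟨j, hj, h⟩
        · exact Or.inl h
        · by_cases hsP : s ∈ P'
          · exact Or.inl hsP
          · rcases Finset.mem_insert.1 hj with rfl | hj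
            · exact absurd ⟨hsP, h⟩ hn
            · exact Or.inr ⟨j, hj, h⟩
    calc ∫⁻ x in E, ‖modelSum φ a N P x‖ₑ
        ≤ ∫⁻ x in E, (‖modelSum φ a N {s ∈ P | p s} x‖ₑ +
            ‖modelSum φ a N {s ∈ P | ¬ p s} x‖ₑ) := by
          refine lintegral_mono fun x => ?_
          rw [modelSum_filter_add φ a N P p x]
          exact enorm_add_le _ _
      _ = (∫⁻ x in E, ‖modelSum φ a N {s ∈ P | p s} x‖ₑ) +
            ∫⁻ x in E, ‖modelSum φ a N {s ∈ P | ¬ p s} x‖ₑ :=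
          lintegral_add_left (hφ.measurable_modelSum a hN _).enorm _
      _ ≤ _ := (add_le_add h1 h2).trans_eq (by rw [Finset.sum_insert hi]; ring)

lemma IsPacket.exists_size_density_step (C : ℝ≥0) : ∃ A : ℝ≥0∞, A ≠ ∞ ∧
    ∀ (φ f : ℝ → ℂ) (N : ℝ → ℝ) (E : Set ℝ) (σ σ' μ : ℝ≥0∞) (P : Finset Tile),
      IsPacket φ C → MemLp f 2 → Measurable N → MeasurableSet E → σ ≠ 0 → σ' ≠ ∞ → σ ≤ σ' →
      μ ≠ 0 → μ ≠ ∞ → HasSize P (coef φ f) σ → (∀ s ∈ P, s.IsDense N E μ) →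
      ∃ P' ⊆ P, HasSize P' (coef φ f) (σ' / 2) ∧ (∀ s ∈ P', s.IsDense N E (μ / 4)) ∧
        ∫⁻ x in E, ‖modelSum φ (coef φ f) N P x‖ₑ ≤
          (∫⁻ x in E, ‖modelSum φ (coef φ f) N P' x‖ₑ) +
          A * (σ * (volume E + μ * ((∫⁻ x, ‖f x‖ₑ ^ 2) / σ' ^ 2))) := by
  classical
  obtain ⟨A1, hA1, hT⟩ := IsPacket.lintegral_modelSum_le_of_trees C
  obtain ⟨A2, hA2, hsz⟩ := size_lemma C
  refine ⟨A1 * (4 * chiC + A2), by finiteness,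
    fun φ f N E σ σ' μ P hφ hf hN hE hσ0 hσ' hσσ hμ0 hμ hS hd => ?_⟩
  have h4 : μ / 4 ≠ 0 := by simp [ENNReal.div_eq_zero_iff, hμ0]
  obtain ⟨ι, F, k, m, ξ, hc, hs⟩ := mass_lemma hN hE h4 (by finiteness)
    {s ∈ P | ¬ s.IsDense N E (μ / 4)} fun s hs => (Finset.mem_filter.1 hs).2
  set P1 := {s ∈ P | s.IsDense N E (μ / 4)} with hP1
  have hsub : P1 ⊆ P := Finset.filter_subset _ _
  have hσt : σ ≠ ∞ := (hσσ.trans_lt hσ'.lt_top).ne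
  have hb1 := hT φ (coef φ f) N E σ μ P1 ι F k m ξ P hφ hN hE hσ0 hσt hsub hS hd fun s hs => by
    by_cases h : s.IsDense N E (μ / 4)
    · exact Or.inl (Finset.mem_filter.2 ⟨hs, h⟩)
    · exact Or.inr (hc s (Finset.mem_filter.2 ⟨hs, h⟩))
  have hσ'0 : σ' ≠ 0 := (hσ0.bot_lt.trans_le hσσ).ne'
  obtain ⟨P2, hP2, hS2, ι', F', k', m', ξ', hc', hs'⟩ :=
    hsz φ f P1 σ' hφ hf hσ'0 hσ' ((hS.subset hsub).mono hσσ)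
  have hb2 := hT φ (coef φ f) N E σ μ P2 ι' F' k' m' ξ' P1 hφ hN hE hσ0 hσt hP2
    (hS.subset hsub) (fun s hs => hd s (hsub hs)) hc'
  refine ⟨P2, hP2.trans hsub, hS2, fun s hs => (Finset.mem_filter.1 (hP2 hs)).2, ?_⟩
  have hs2 : μ * ∑ i ∈ F, ENNReal.ofReal (2 ^ k i) ≤ 4 * chiC * volume E := by
    refine (mul_le_mul_right hs μ).trans_eq ?_
    rw [div_eq_mul_inv, ENNReal.inv_div (by simp) (by simp), div_eq_mul_inv]
    calc _ = 4 * chiC * volume E * (μ * μ⁻¹) := by ring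
      _ = _ := by rw [ENNReal.mul_inv_cancel hμ0 hμ, mul_one]
  set S1 := ∑ i ∈ F, ENNReal.ofReal (2 ^ k i)
  set S2 := ∑ i ∈ F', ENNReal.ofReal (2 ^ k' i)
  set V := (∫⁻ x, ‖f x‖ₑ ^ 2) / σ' ^ 2
  set X := ∫⁻ x in E, ‖modelSum φ (coef φ f) N P2 x‖ₑ
  calc _ ≤ X + A1 * (σ * μ * S2) + A1 * (σ * μ * S1) := hb1.trans (add_le_add_left hb2 _)
    _ = X + A1 * (σ * (μ * S2 + μ * S1)) := by ring
    _ ≤ X + A1 * (σ * (μ * (A2 * V) + 4 * chiC * volume E)) :=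
        add_le_add le_rfl (mul_le_mul_right (mul_le_mul_right
          (add_le_add (mul_le_mul_right hs' _) hs2) _) _)
    _ ≤ X + A1 * (σ * ((4 * chiC + A2) * (volume E + μ * V))) := by
        refine add_le_add le_rfl (mul_le_mul_right (mul_le_mul_right ?_ _) _)
        rw [add_mul, mul_add, mul_add, add_comm]
        calc _ = 4 * ↑chiC * volume E + A2 * (μ * V) := by ring
          _ ≤ _ := add_le_add le_self_add le_add_self
    _ = _ := by ring

lemma HasSize.min {P : Finset Tile} {a : Tile → ℂ} {σ σ' : ℝ≥0∞} (h : HasSize P a σ)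
    (h' : HasSize P a σ') : HasSize P a (min σ σ') := by
  rcases le_total σ σ' with hs | hs
  · rwa [min_eq_left hs]
  · rwa [min_eq_right hs]

lemma IsPacket.lintegral_modelSum_le_tsum (C : ℝ≥0) : ∃ A : ℝ≥0∞, A ≠ ∞ ∧
    ∀ (φ f : ℝ → ℂ) (N : ℝ → ℝ) (E : Set ℝ) (σ ρ : ℝ≥0∞) (P : Finset Tile),
      IsPacket φ C → MemLp f 2 → Measurable N → MeasurableSet E → σ ≠ 0 → ρ ≠ ∞ → σ ≤ ρ →
      HasSize P (coef φ f) σ → ∫⁻ x, ‖f x‖ₑ ^ 2 ≤ ρ ^ 2 * volume E →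
      ∫⁻ x in E, ‖modelSum φ (coef φ f) N P x‖ₑ ≤
          A * (volume E * ∑' j : ℕ, min σ (ρ * 2⁻¹ ^ j)) := by
  obtain ⟨A1, hA1, hstep⟩ := IsPacket.exists_size_density_step C
  obtain ⟨A2, hA2, hT⟩ := IsPacket.lintegral_modelSum_le_of_trees C
  refine ⟨2 * A1, by finiteness, fun φ f N E σ ρ P hφ hf hN hE hσ0 hρ hσρ hS hfE => ?_⟩
  have hρ0 : ρ ≠ 0 := (hσ0.bot_lt.trans_le hσρ).ne'
  have key : ∀ n : ℕ, ∃ P' ⊆ P, HasSize P' (coef φ f) (ρ * 2⁻¹ ^ n) ∧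
      (∀ s ∈ P', s.IsDense N E (4⁻¹ ^ n)) ∧ ∫⁻ x in E, ‖modelSum φ (coef φ f) N P x‖ₑ ≤
        (∫⁻ x in E, ‖modelSum φ (coef φ f) N P' x‖ₑ) +
          2 * A1 * (volume E * ∑ j ∈ Finset.range n, min σ (ρ * 2⁻¹ ^ j)) := by
    intro n
    induction n with
    | zero => exact ⟨P, subset_rfl, by simpa using hS.mono hσρ, by simp [Tile.isDense_one], by simp⟩
    | succ n ih =>
      obtain ⟨P1, hP1, hS1, hd1, hb1⟩ := ih
      have h2 : (2⁻¹ : ℝ≥0∞) ^ n ≠ 0 := by simp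
      have h4 : (4⁻¹ : ℝ≥0∞) ^ n ≠ 0 := by simp
      have hn : ρ * 2⁻¹ ^ n ≠ 0 := mul_ne_zero hρ0 h2
      obtain ⟨P2, hP2, hS2, hd2, hb2⟩ := hstep φ f N E (min σ (ρ * 2⁻¹ ^ n)) (ρ * 2⁻¹ ^ n) (4⁻¹ ^ n)
        P1 hφ hf hN hE (lt_min hσ0.bot_lt hn.bot_lt).ne' (by finiteness) (min_le_right _ _) h4 (by finiteness)
        ((hS.subset hP1).min hS1) hd1
      refine ⟨P2, hP2.trans hP1, ?_, ?_, ?_⟩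
      · rwa [pow_succ, ← mul_assoc, ← div_eq_mul_inv]
      · simpa only [pow_succ, ← div_eq_mul_inv] using hd2
      · have hV : 4⁻¹ ^ n * ((∫⁻ x, ‖f x‖ₑ ^ 2) / (ρ * 2⁻¹ ^ n) ^ 2) ≤ volume E := by
          rw [← mul_div_assoc]
          refine ENNReal.div_le_of_le_mul ((mul_le_mul_right hfE _).trans_eq ?_)
          rw [mul_pow, ← pow_mul, mul_comm n, pow_mul, ← ENNReal.inv_pow (n := 2)]
          norm_num
          ring
        calc _ ≤ _ := hb1.trans (add_le_add_left hb2 _)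
          _ ≤ (∫⁻ x in E, ‖modelSum φ (coef φ f) N P2 x‖ₑ) +
                A1 * (min σ (ρ * 2⁻¹ ^ n) * (volume E + volume E)) +
                2 * A1 * (volume E * ∑ j ∈ Finset.range n, min σ (ρ * 2⁻¹ ^ j)) :=
              add_le_add_left (add_le_add le_rfl (mul_le_mul_right (mul_le_mul_right
                (add_le_add le_rfl hV) _) _)) _
          _ = _ := by rw [Finset.sum_range_succ]; ring
  have hfin : ∀ n : ℕ, ∫⁻ x in E, ‖modelSum φ (coef φ f) N P x‖ₑ ≤
      A2 * (ρ * ∑ s ∈ P, ENNReal.ofReal (2 ^ s.k)) * 2⁻¹ ^ n +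
        2 * A1 * (volume E * ∑' j : ℕ, min σ (ρ * 2⁻¹ ^ j)) := by
    intro n
    obtain ⟨P1, hP1, hS1, hd1, hb1⟩ := key n
    choose ξ hξ using Tile.exists_mem_ω₂
    have hb2 := hT φ (coef φ f) N E (ρ * 2⁻¹ ^ n) 1 ∅ Tile P Tile.k Tile.m ξ P1 hφ hN hE
      (by simp [hρ0]) (by finiteness) (Finset.empty_subset _) hS1
      (fun s hs => Tile.isDense_one _ _ _)
      fun s hs => Or.inr ⟨s, hP1 hs, subset_rfl, s.ω₂_subset (hξ s)⟩
    simp only [modelSum, Finset.sum_empty, enorm_zero, lintegral_zero, zero_add] at hb2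
    refine hb1.trans (add_le_add (hb2.trans_eq (by ring)) (mul_le_mul_right (mul_le_mul_right
      (ENNReal.sum_le_tsum _) _) _))
  have hlim := ENNReal.tendsto_pow_atTop_nhds_zero_of_lt_one
    (ENNReal.inv_lt_one.2 ENNReal.one_lt_two : (2⁻¹ : ℝ≥0∞) < 1)
  have hlim2 := (ENNReal.Tendsto.const_mul (a := A2 * (ρ * ∑ s ∈ P, ENNReal.ofReal (2 ^ s.k)))
    hlim (Or.inr (ENNReal.mul_ne_top hA2 (ENNReal.mul_ne_top hρ
      (ENNReal.sum_lt_top.2 fun _ _ => ENNReal.ofReal_lt_top).ne)))).add_const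
        (2 * A1 * (volume E * ∑' j : ℕ, min σ (ρ * 2⁻¹ ^ j)))
  rw [mul_zero, zero_add] at hlim2
  exact ge_of_tendsto' hlim2 hfin

lemma ENNReal.min_le_rpow_mul_rpow (a b : ℝ≥0∞) {t : ℝ} (h0 : 0 ≤ t) (h1 : t ≤ 1) :
    min a b ≤ a ^ (1 - t) * b ^ t := by
  calc min a b = min a b ^ (1 - t) * min a b ^ t := by
        rw [← ENNReal.rpow_add_of_nonneg _ _ (by linarith) h0]; simp
    _ ≤ _ := mul_le_mul' (ENNReal.rpow_le_rpow (min_le_left _ _) (by linarith))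
        (ENNReal.rpow_le_rpow (min_le_right _ _) h0)

lemma ENNReal.min_one_rpow_mul_rpow_le {ρ : ℝ≥0∞} {a b c : ℝ} (ha : 0 ≤ a) (hb : 0 ≤ b)
    (hbc : b ≤ c) (hc : c ≤ a + b) : min 1 ρ ^ a * ρ ^ b ≤ ρ ^ c := by
  rcases le_total 1 ρ with h | h
  · rw [min_eq_left h, ENNReal.one_rpow, one_mul]
    exact ENNReal.rpow_le_rpow_of_exponent_le h hbc
  · rw [min_eq_right h, ← ENNReal.rpow_add_of_nonneg _ _ ha hb]
    exact ENNReal.rpow_le_rpow_of_exponent_ge h hc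

/-- The generalized restricted weak type estimate for the model operator. -/
lemma IsPacket.exists_major_subset (C : ℝ≥0) {p : ℝ} (hp : 3 / 2 ≤ p) :
    ∃ A : ℝ≥0∞, A ≠ ∞ ∧ ∀ (φ f : ℝ → ℂ) (N : ℝ → ℝ) (E F : Set ℝ) (P : Finset Tile),
      IsPacket φ C → IsTame f → Measurable N → MeasurableSet E → MeasurableSet F →
      (∀ x, ‖f x‖ₑ ≤ F.indicator 1 x) → volume E ≠ 0 → volume E ≠ ∞ → volume F ≠ 0 →
      volume F ≠ ∞ → ∃ E' ⊆ E, MeasurableSet E' ∧ volume E ≤ 2 * volume E' ∧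
        ∫⁻ x in E', ‖modelSum φ (coef φ f) N P x‖ₑ ≤
          A * ((volume F / volume E) ^ (1 / p) * volume E) := by
  classical
  obtain ⟨A1, hA1, hex⟩ := IsPacket.exists_exceptional C
  obtain ⟨A2, hA2, hsize⟩ := IsPacket.hasSize_coef C
  obtain ⟨A3, hA3, hsum⟩ := IsPacket.lintegral_modelSum_le_tsum C
  set t : ℝ := min (1 / 3) (2 / p) with ht
  have hp0 : 0 < p := by linarith
  have ht0 : 0 < t := lt_min (by norm_num) (by positivity)
  have ht3 : t ≤ 1 / 3 := min_le_left _ _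
  have htp : t / 2 ≤ 1 / p := by
    have : t ≤ 2 / p := min_le_right _ _
    calc t / 2 ≤ 2 / p / 2 := by gcongr
      _ = _ := by ring
  have hp1 : 1 / p ≤ 2 / 3 := by rw [div_le_div_iff₀ hp0 (by norm_num)]; linarith
  set B := A2 + 1 with hB
  have hB0 : B ≠ 0 := by simp [hB]
  have hBt : B ≠ ∞ := by simp [hB, hA2]
  set Z := ∑' j : ℕ, ((2⁻¹ : ℝ≥0∞) ^ t) ^ j with hZ
  have hZt : Z ≠ ∞ := by
    rw [hZ, ENNReal.tsum_geometric]
    refine ENNReal.inv_ne_top.2 (tsub_pos_of_lt ?_).ne'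
    exact ENNReal.rpow_lt_one (ENNReal.inv_lt_one.2 ENNReal.one_lt_two) ht0
  refine ⟨(A1 + A3 * B * Z) * 30 ^ (1 / p), by finiteness,
    fun φ f N E F P hφ hf hN hE hF hfF hE0 hEt hF0 hFt => ?_⟩
  set ρ := 30 * (volume F / volume E) with hρ
  have hρ0 : ρ ≠ 0 := mul_ne_zero (by simp) (ENNReal.div_ne_zero.2 ⟨hF0, hEt⟩)
  have hρt : ρ ≠ ∞ := ENNReal.mul_ne_top (by simp) (ENNReal.div_ne_top hFt hE0)
  have hρE : 30 * volume F = ρ * volume E := by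
    rw [hρ, mul_assoc, ENNReal.div_mul_cancel hE0 hEt]
  set α := min 1 ρ with hα
  set Ω0 := {x | α < maxFn (F.indicator 1) x} with hΩ0
  have hv : 6 * volume Ω0 ≤ volume E := by
    rcases le_total 1 ρ with h | h
    · have : Ω0 = ∅ := by
        refine eq_empty_of_forall_notMem fun x hx => ?_
        have h1 : α < maxFn (F.indicator 1) x := hx
        rw [hα, min_eq_left h] at h1
        exact absurd h1 (not_lt.2 (maxFn.le_const (fun y => indicator_le_self' (by simp) y) x))
      simp [this]
    · have h1 := maxFn.weak_one (F.indicator 1) α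
      rw [lintegral_indicator_one hF] at h1
      have h2 : ρ * (6 * volume Ω0) ≤ ρ * volume E := by
        rw [← hρE]
        calc ρ * (6 * volume Ω0) = 6 * (α * volume Ω0) := by rw [hα, min_eq_right h]; ring
          _ ≤ 6 * (5 * volume F) := mul_le_mul_right h1 _
          _ = _ := by ring
      exact (ENNReal.mul_le_mul_iff_right hρ0 hρt).1 h2
  have hΩE : volume Ω0 ≤ volume E := (le_mul_of_one_le_left zero_le (by norm_num)).trans hv
  obtain ⟨Ω, hΩ, hΩv, hΩi⟩ := hex φ f N F α {s ∈ P | s.I ⊆ Ω0} hφ hN hF hfF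
    (hΩE.trans_lt hEt.lt_top).ne fun s hs => (Finset.mem_filter.1 hs).2
  have hmaj : volume E ≤ 2 * volume (E \ Ω) := by
    have h2 : 2 * volume Ω ≤ volume E :=
      ((mul_le_mul_right hΩv 2).trans_eq (by ring)).trans hv
    have h3 : volume E ≤ volume (E \ Ω) + volume Ω :=
      (measure_mono (by rw [sdiff_union_self]; exact subset_union_left)).trans
        (measure_union_le _ _)
    have h4 : volume E + volume E ≤ 2 * volume (E \ Ω) + volume E := by
      calc volume E + volume E = 2 * volume E := by ring
        _ ≤ 2 * (volume (E \ Ω) + volume Ω) := mul_le_mul_right h3 _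
        _ ≤ _ := by rw [mul_add]; exact add_le_add le_rfl h2
    exact (ENNReal.add_le_add_iff_right hEt).1 h4
  refine ⟨E \ Ω, sdiff_subset, hE.diff hΩ, hmaj, ?_⟩
  have hα1 : α ≤ 1 := min_le_left _ _
  have hα0 : α ≠ 0 := (lt_min one_pos hρ0.bot_lt).ne'
  have hαt : α ≠ ∞ := (hα1.trans_lt ENNReal.one_lt_top).ne
  have hb1 : ∫⁻ x in E \ Ω, ‖modelSum φ (coef φ f) N {s ∈ P | s.I ⊆ Ω0} x‖ₑ ≤
      A1 * (ρ ^ (1 / p) * volume E) := by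
    refine (lintegral_mono_set (fun x hx => hx.2)).trans (hΩi.trans (mul_le_mul_right
      (mul_le_mul' ?_ hΩE) _))
    have := ENNReal.min_one_rpow_mul_rpow_le (ρ := ρ) (a := 1) (b := 0) (c := 1 / p) zero_le_one
      le_rfl (by positivity) (by linarith)
    rwa [ENNReal.rpow_one, ENNReal.rpow_zero, mul_one] at this
  have hb2 : ∫⁻ x in E \ Ω, ‖modelSum φ (coef φ f) N {s ∈ P | ¬ s.I ⊆ Ω0} x‖ₑ ≤
      A3 * B * Z * (ρ ^ (1 / p) * volume E) := by
    have hαρ : α ^ (3 / 4 : ℝ) ≤ ρ ^ (1 / 2 : ℝ) := by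
      have := ENNReal.min_one_rpow_mul_rpow_le (ρ := ρ) (a := 3 / 4) (b := 0) (c := 1 / 2)
        (by norm_num) le_rfl (by norm_num) (by norm_num)
      simpa using this
    have hρhalf : (ρ ^ (1 / 2 : ℝ)) ^ 2 = ρ := by
      rw [← ENNReal.rpow_ofNat, ← ENNReal.rpow_mul]; norm_num
    have h := hsum φ f N (E \ Ω) (B * α ^ (3 / 4 : ℝ)) (B * ρ ^ (1 / 2 : ℝ))
      {s ∈ P | ¬ s.I ⊆ Ω0} hφ (hf.memLp 2) hN (hE.diff hΩ)
      (mul_ne_zero hB0 (by simp [hα0, hαt])) (by finiteness)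
      (mul_le_mul_right hαρ _) ((hsize φ f F α _ hφ hf hF hfF hα1 fun s hs => ?_).mono
        (mul_le_mul_left le_self_add _)) ?_
    · refine h.trans ?_
      have hj : ∀ j : ℕ, min (B * α ^ (3 / 4 : ℝ)) (B * ρ ^ (1 / 2 : ℝ) * 2⁻¹ ^ j) ≤
          B * ρ ^ (1 / p) * ((2⁻¹ : ℝ≥0∞) ^ t) ^ j := by
        intro j
        refine (ENNReal.min_le_rpow_mul_rpow _ _ ht0.le (by linarith)).trans ?_
        rw [ENNReal.mul_rpow_of_nonneg _ _ (by linarith), ENNReal.mul_rpow_of_nonneg _ _ ht0.le,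
          ENNReal.mul_rpow_of_nonneg _ _ ht0.le, ← ENNReal.rpow_mul, ← ENNReal.rpow_mul,
          ← ENNReal.rpow_natCast, ← ENNReal.rpow_mul, ← ENNReal.rpow_natCast, ← ENNReal.rpow_mul,
          mul_comm (j : ℝ)]
        calc _ = B ^ (1 - t) * B ^ t * (α ^ (3 / 4 * (1 - t)) * ρ ^ (1 / 2 * t)) *
              2⁻¹ ^ (t * j) := by ring
          _ ≤ _ := by
            rw [← ENNReal.rpow_add_of_nonneg _ _ (by linarith) ht0.le, sub_add_cancel,
              ENNReal.rpow_one]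
            exact mul_le_mul_left (mul_le_mul_right (ENNReal.min_one_rpow_mul_rpow_le
              (by linarith) (by linarith) (by linarith) (by linarith)) _) _
      calc _ ≤ A3 * (volume E * (B * ρ ^ (1 / p) * Z)) := by
            rw [hZ, ← ENNReal.tsum_mul_left (a := B * ρ ^ (1 / p))]
            exact mul_le_mul_right (mul_le_mul' (measure_mono sdiff_subset)
              (ENNReal.tsum_le_tsum hj)) _
        _ = _ := by ring
    · obtain ⟨x, hx, hxα⟩ := not_subset.1 (Finset.mem_filter.1 hs).2
      exact ⟨x, hx, not_lt.1 hxα⟩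
    · have h2 := lintegral_rpow_le_of_enorm_le_indicator hF hfF two_pos
      simp only [ENNReal.rpow_two] at h2
      refine h2.trans ?_
      rw [mul_pow, hρhalf]
      have h30 : 30 * volume F ≤ 30 * (ρ * volume (E \ Ω)) := by
        rw [hρE]
        calc ρ * volume E ≤ ρ * (2 * volume (E \ Ω)) := mul_le_mul_right hmaj _
          _ = 2 * (ρ * volume (E \ Ω)) := by ring
          _ ≤ _ := mul_le_mul_left (by norm_num) _
      refine ((ENNReal.mul_le_mul_iff_right (by norm_num) (by norm_num)).1 h30).trans ?_
      rw [mul_assoc (B ^ 2)]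
      exact le_mul_of_one_le_left zero_le (one_le_pow₀ le_add_self)
  calc _ ≤ ∫⁻ x in E \ Ω, (‖modelSum φ (coef φ f) N {s ∈ P | s.I ⊆ Ω0} x‖ₑ +
            ‖modelSum φ (coef φ f) N {s ∈ P | ¬ s.I ⊆ Ω0} x‖ₑ) := by
        refine lintegral_mono fun x => ?_
        rw [modelSum_filter_add φ (coef φ f) N P (fun s => s.I ⊆ Ω0) x]
        exact enorm_add_le _ _
    _ = _ := lintegral_add_left (hφ.measurable_modelSum _ hN _).enorm _
    _ ≤ _ := add_le_add hb1 hb2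
    _ = (A1 + A3 * B * Z) * (ρ ^ (1 / p) * volume E) := by ring
    _ = _ := by
        rw [hρ, ENNReal.mul_rpow_of_nonneg _ _ (by positivity)]
        ring

lemma IsPacket.coef_add {φ f g : ℝ → ℂ} {C : ℝ≥0} (hφ : IsPacket φ C) (hf : MemLp f 2)
    (hg : MemLp g 2) (s : Tile) : coef φ (f + g) s = coef φ f s + coef φ g s := by
  simp only [coef, Pi.add_apply, inner_add_right]
  rw [integral_add (hφ.integrable_inner_right hf s) (hφ.integrable_inner_right hg s), mul_add]

lemma coef_smul (φ f : ℝ → ℂ) (a : ℝ) (s : Tile) : coef φ (a • f) s = a * coef φ f s := by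
  simp only [coef, Pi.smul_apply, inner_smul_right_eq_smul]
  rw [integral_smul, Complex.real_smul]
  ring

/-- The model operator is bounded on `L^p`, uniformly in the tiles and in the linearization. -/
theorem IsPacket.model_strong (C : ℝ≥0) {p : ℝ} (hp : 3 / 2 < p) : ∃ A : ℝ≥0∞, A ≠ ∞ ∧
    ∀ (φ : ℝ → ℂ) (N : ℝ → ℝ) (P : Finset Tile), IsPacket φ C → Measurable N →
      ∀ f : ℝ → ℂ, IsTame f →
        ∫⁻ x, ‖modelSum φ (coef φ f) N P x‖ₑ ^ p ≤ A * ∫⁻ x, ‖f x‖ₑ ^ p := by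
  have hweak : ∀ q : ℝ, 3 / 2 ≤ q → ∃ A : ℝ≥0∞, A ≠ ∞ ∧ A ≠ 0 ∧
      ∀ (φ f : ℝ → ℂ) (N : ℝ → ℝ) (P : Finset Tile) (F : Set ℝ), IsPacket φ C → Measurable N →
      IsTame f → MeasurableSet F → (∀ x, ‖f x‖ₑ ≤ F.indicator 1 x) → ∀ t : ℝ≥0∞, t ≠ 0 → t ≠ ∞ →
      volume {x | t < ‖modelSum φ (coef φ f) N P x‖ₑ} ≤ A * t ^ (-q) * volume F := by
    intro q hq
    have hq0 : 0 < q := by linarith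
    obtain ⟨A, hA, h⟩ := IsPacket.exists_major_subset C hq
    refine ⟨(2 * A) ^ q + 1, by finiteness, by simp, fun φ f N P F hφ hN hf hF hfF t ht0 ht => ?_⟩
    have htq0 : t ^ q ≠ 0 := by simp [ht0, ht]
    have htqt : t ^ q ≠ ∞ := by simp [ht0, ht]
    set E := {x | t < ‖modelSum φ (coef φ f) N P x‖ₑ} with hE
    have hmeas := (hφ.measurable_modelSum (coef φ f) hN P).enorm
    have hEm : MeasurableSet E := measurableSet_lt measurable_const hmeas
    rw [ENNReal.rpow_neg]
    rcases eq_or_ne (volume F) ∞ with hFt | hFt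
    · rw [hFt, ENNReal.mul_top (mul_ne_zero (by simp) (ENNReal.inv_ne_zero.2 htqt))]
      exact le_top
    rcases eq_or_ne (volume E) 0 with hE0 | hE0
    · rw [hE0]; exact zero_le
    rcases eq_or_ne (volume F) 0 with hF0 | hF0
    · exfalso
      have hf0 : f =ᵐ[volume] 0 := by
        have : ∀ᵐ x, x ∉ F := measure_eq_zero_iff_ae_notMem.1 hF0
        filter_upwards [this] with x hx
        simpa [hx] using hfF x
      have hc : ∀ s, coef φ f s = 0 := fun s => by
        rw [coef, integral_congr_ae (g := fun _ => (0 : ℂ)) (by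
          filter_upwards [hf0] with x hx; simp [hx])]
        simp
      refine hE0 (measure_mono_null (fun x hx => ?_) measure_empty)
      simp [hE, modelSum, modelTerm, hc] at hx
    have hint : Integrable (modelSum φ (coef φ f) N P) := integrable_finsetSum _ fun s _ =>
      ((hφ.integrable_packet s).const_mul _).indicator (hN s.measurableSet_ω₂)
    have hEt : volume E ≠ ∞ := by
      have h1 := mul_meas_ge_le_lintegral hmeas t (μ := volume)
      have h2 : t * volume E ≤ ∫⁻ x, ‖modelSum φ (coef φ f) N P x‖ₑ :=
        (mul_le_mul_right (measure_mono fun x (hx : t < _) => hx.le) _).trans h1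
      exact fun hc => (h2.trans_lt hint.2).ne (by rw [hc, ENNReal.mul_top ht0])
    obtain ⟨E', hE'E, hE'm, hmaj, hb⟩ := h φ f N E F P hφ hf hN hEm hF hfF hE0 hEt hF0 hFt
    have h1 : t * volume E ≤ 2 * A * (volume F / volume E) ^ (1 / q) * volume E := by
      calc t * volume E ≤ t * (2 * volume E') := mul_le_mul_right hmaj _
        _ = 2 * ∫⁻ _ in E', t := by rw [setLIntegral_const]; ring
        _ ≤ 2 * ∫⁻ x in E', ‖modelSum φ (coef φ f) N P x‖ₑ := mul_le_mul_right
            (setLIntegral_mono_ae' hE'm (ae_of_all _ fun x hx => le_of_lt (hE'E hx))) _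
        _ ≤ 2 * (A * ((volume F / volume E) ^ (1 / q) * volume E)) := mul_le_mul_right hb _
        _ = _ := by ring
    have h2 := ENNReal.rpow_le_rpow ((ENNReal.mul_le_mul_iff_left hE0 hEt).1 h1) hq0.le
    rw [ENNReal.mul_rpow_of_nonneg _ _ hq0.le, ← ENNReal.rpow_mul, one_div_mul_cancel hq0.ne',
      ENNReal.rpow_one, ← mul_div_assoc, ENNReal.le_div_iff_mul_le (Or.inl hE0) (Or.inl hEt)] at h2
    rw [mul_right_comm, ← div_eq_mul_inv, ENNReal.le_div_iff_mul_le (Or.inl htq0) (Or.inl htqt),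
      mul_comm]
    exact h2.trans (mul_le_mul_left le_self_add _)
  obtain ⟨A0, hA0, -, h0⟩ := hweak (3 / 2) le_rfl
  obtain ⟨A1, hA1, -, h1⟩ := hweak (p + 1) (by linarith)
  obtain ⟨A, hA, h⟩ := restricted_weak_interpolation (p0 := 3 / 2) (p := p) (p1 := p + 1)
    (by norm_num) hp (by linarith) (A := A0 + A1) (by finiteness)
  refine ⟨A, hA, fun φ N P hφ hN => h ℂ (fun f x => ‖modelSum φ (coef φ f) N P x‖ₑ)
    (fun f _ => (hφ.measurable_modelSum _ hN P).enorm.aemeasurable) (fun f g hf hg x => ?_)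
    (fun f hf a ha x => ?_) (fun q hq F hF f hf hfF t ht0 ht => ?_)⟩
  · refine le_trans (le_of_eq ?_) (enorm_add_le _ _)
    congr 1
    simp only [modelSum, ← Finset.sum_add_distrib, modelTerm]
    refine Finset.sum_congr rfl fun s _ => ?_
    rw [← Pi.add_apply, ← indicator_add', hφ.coef_add (hf.memLp 2) (hg.memLp 2)]
    simp only [add_mul]
    rfl
  · have : modelSum φ (coef φ (a • f)) N P x = a * modelSum φ (coef φ f) N P x := by
      simp only [modelSum, modelTerm, Finset.mul_sum, coef_smul]
      refine Finset.sum_congr rfl fun s _ => ?_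
      by_cases hx : x ∈ N ⁻¹' s.ω₂ <;> simp [hx, mul_assoc]
    simp only [this]
    rw [enorm_mul, ← ofReal_norm (a : ℂ), Complex.norm_real, Real.norm_of_nonneg ha.le]
  · have hfF' : ∀ x, ‖f x‖ₑ ≤ F.indicator 1 x := fun x => by
      rw [← ofReal_norm]
      refine (ENNReal.ofReal_le_ofReal (hfF x)).trans_eq ?_
      by_cases hx : x ∈ F <;> simp [hx]
    rcases hq with rfl | rfl
    · exact (h0 φ f N P F hφ hN hf hF hfF' t ht0 ht).trans
        (mul_le_mul_left (mul_le_mul_left le_self_add _) _)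
    · exact (h1 φ f N P F hφ hN hf hF hfF' t ht0 ht).trans
        (mul_le_mul_left (mul_le_mul_left le_add_self _) _)

/-- Minkowski's integral inequality, for an average over a finite measure. -/
lemma lintegral_lintegral_rpow_le {ν : Measure ℝ} [IsFiniteMeasure ν] {q : ℝ} (hq : 1 ≤ q)
    {F : ℝ → ℝ → ℝ≥0∞} (hF : Measurable (Function.uncurry F)) {B : ℝ≥0∞}
    (h : ∀ᵐ t ∂ν, ∫⁻ x, F t x ^ q ≤ B) :
    ∫⁻ x, (∫⁻ t, F t x ∂ν) ^ q ≤ ν univ ^ q * B := by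
  have hq0 : 0 < q := by linarith
  have hm (x : ℝ) : Measurable fun t => F t x := hF.comp (measurable_id.prodMk measurable_const)
  have h1 (x : ℝ) : (∫⁻ t, F t x ∂ν) ^ q ≤ ν univ ^ (q - 1) * ∫⁻ t, F t x ^ q ∂ν := by
    have := eLpNorm'_le_eLpNorm'_mul_rpow_measure_univ (μ := ν) (f := fun t => F t x) one_pos hq
      (hm x).aestronglyMeasurable
    simp only [eLpNorm', ENNReal.rpow_one, enorm_eq_self, div_one] at this
    refine (ENNReal.rpow_le_rpow this hq0.le).trans_eq ?_
    rw [ENNReal.mul_rpow_of_nonneg _ _ hq0.le, ← ENNReal.rpow_mul, ← ENNReal.rpow_mul, mul_comm,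
      one_div_mul_cancel hq0.ne', ENNReal.rpow_one]
    congr 2; field_simp
  calc ∫⁻ x, (∫⁻ t, F t x ∂ν) ^ q ≤ ∫⁻ x, ν univ ^ (q - 1) * ∫⁻ t, F t x ^ q ∂ν :=
        lintegral_mono h1
    _ = ν univ ^ (q - 1) * ∫⁻ t, (∫⁻ x, F t x ^ q) ∂ν := by
        rw [lintegral_const_mul' _ _ (by finiteness [sub_nonneg.2 hq]), lintegral_lintegral_swap]
        exact ((hF.comp measurable_swap).pow_const q).aemeasurable
    _ ≤ ν univ ^ (q - 1) * (B * ν univ) := by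
        exact mul_le_mul_right ((lintegral_mono_ae h).trans_eq (by simp)) _
    _ = ν univ ^ (q - 1 + 1) * B := by
        rw [ENNReal.rpow_add_of_nonneg _ _ (by linarith) one_pos.le, ENNReal.rpow_one]; ring
    _ = _ := by rw [sub_add_cancel]

lemma lintegral_average_rpow_le {ν : Measure ℝ} [IsProbabilityMeasure ν] {p : ℝ}
    (hp : 1 ≤ p)
    {F : ℝ → ℝ → ℂ} (hF : Measurable (Function.uncurry F)) {B : ℝ≥0∞}
    (h : ∀ᵐ t ∂ν, ∫⁻ x, ‖F t x‖ₑ ^ p ≤ B) :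
    ∫⁻ x, ‖∫ t, F t x ∂ν‖ₑ ^ p ≤ B := by
  refine (lintegral_mono fun x => ENNReal.rpow_le_rpow (enorm_integral_le_lintegral_enorm _)
    (zero_le_one.trans hp)).trans ((lintegral_lintegral_rpow_le (ν := ν) (F := fun t x => ‖F t x‖ₑ)
      hp hF.enorm h).trans_eq (by simp))

lemma integral_ech_swap {P F : ℝ → ℂ} (hP : Integrable P) (hF : Integrable F) (c : ℝ) :
    ∫ u, P u * ∫ ζ, F ζ * ech (c * u * ζ) = ∫ ζ, F ζ * ∫ u, P u * ech (c * u * ζ) := by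
  simp_rw [← integral_const_mul]
  rw [integral_integral_swap]
  · simp only [mul_left_comm]
  · refine Integrable.congr ((hP.mul_prod hF).mul_bdd (c := 1) (g := fun z : ℝ × ℝ =>
      ech (c * z.1 * z.2)) ?_ (ae_of_all _ fun z => (norm_ech _).le)) (ae_of_all _ fun z => ?_)
    · exact (continuous_ech.comp (by fun_prop)).aestronglyMeasurable
    · simp [mul_assoc, Function.uncurry]

/-- Continuous integrable functions with integrable Fourier transform. -/
structure IsWiener (f : ℝ → ℂ) : Prop where
  cont : Continuous f
  int : Integrable f
  fint : Integrable (𝓕 f)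

namespace IsWiener
variable {f : ℝ → ℂ}

lemma continuous_fourier (hf : IsWiener f) : Continuous (𝓕 f) :=
  continuous_fourier_of_integrable hf.int

lemma eq_integral (hf : IsWiener f) (x : ℝ) : f x = ∫ ζ, 𝓕 f ζ * ech (x * ζ) := by
  conv_lhs => rw [← hf.cont.fourierInv_fourier_eq hf.int hf.fint, Real.fourierInv_eq]
  refine integral_congr_ae (ae_of_all _ fun ζ => ?_)
  simp [ech, Circle.smul_def, mul_comm]

lemma norm_le (hf : IsWiener f) (x : ℝ) : ‖f x‖ ≤ ∫ ζ, ‖𝓕 f ζ‖ := by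
  rw [hf.eq_integral x]
  exact (norm_integral_le_integral_norm _).trans_eq (by simp [norm_ech])

lemma ech_mul (hf : IsWiener f) (ξ : ℝ) : IsWiener fun x => ech (-(x * ξ)) * f x where
  cont := (continuous_ech.comp (by fun_prop)).mul hf.cont
  int := hf.int.bdd_mul (continuous_ech.comp (by fun_prop)).aestronglyMeasurable
    (ae_of_all _ fun x => (norm_ech _).le)
  fint := by
    simp_rw [funext fun ζ => fourier_ech_mul f ξ ζ]
    exact hf.fint.comp_add_right ξ

lemma fourier_comp_mul (f : ℝ → ℂ) {a : ℝ} (ha : 0 < a) (ζ : ℝ) :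
    𝓕 (fun x => f (a * x)) ζ = ((a⁻¹ : ℝ) : ℂ) * 𝓕 f (a⁻¹ * ζ) := by
  have := Measure.integral_comp_mul_left (fun y => ech (-(y * (a⁻¹ * ζ))) * f y) a
  rw [abs_of_pos (inv_pos.2 ha)] at this
  rw [fourier_eq_ech, fourier_eq_ech, ← Complex.real_smul, ← this]
  refine integral_congr_ae (ae_of_all _ fun x => ?_)
  dsimp only
  congr 2
  field_simp

lemma comp_mul (hf : IsWiener f) {a : ℝ} (ha : 0 < a) : IsWiener fun x => f (a * x) where
  cont := hf.cont.comp (by fun_prop)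
  int := hf.int.comp_mul_left' ha.ne'
  fint := by
    rw [funext fun ζ => fourier_comp_mul f ha ζ]
    exact (hf.fint.comp_mul_left' (inv_pos.2 ha).ne').const_mul _

end IsWiener

lemma IsPacket.comp_sub {φ : ℝ → ℂ} {C : ℝ≥0} (hφ : IsPacket φ C) {τ : ℝ} (hτ : τ ∈ Icc 0 1) :
    IsPacket (fun x => φ (x - τ)) (C * 2 ^ 20) where
  cont := hφ.cont.comp (by fun_prop)
  decay x := by
    have h : chi 0 0 (x - τ) ≤ 2 * chi 0 0 x := by
      refine (chi_le_of_abs_sub_le zero_le_one (y := x) ?_).trans_eq (by norm_num)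
      simpa [abs_of_nonneg hτ.1] using hτ.2
    refine (hφ.decay _).trans ((mul_le_mul_right (pow_le_pow_left₀ zero_le h 20) _).trans_eq ?_)
    push_cast; ring
  fourier ξ hξ := by
    have h := integral_sub_right_eq_self (μ := volume)
      (fun x => ech (-((x + τ) * ξ)) * φ x) τ
    simp only [sub_add_cancel] at h
    rw [fourier_eq_ech, h]
    have : ∀ x, ech (-((x + τ) * ξ)) * φ x = ech (-(τ * ξ)) * (ech (-(x * ξ)) * φ x) := fun x => by
      rw [← mul_assoc, ← ech_add]; congr 2; ring
    simp_rw [this, integral_const_mul, ← fourier_eq_ech, hφ.fourier ξ hξ, mul_zero]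

lemma conj_ech (t : ℝ) : (starRingEnd ℂ) (ech t) = ech (-t) := by
  rw [ech, ech, AddChar.map_neg_eq_inv, Circle.coe_inv_eq_conj]

lemma integral_conj_comp_ech (φ : ℝ → ℂ) {b : ℝ} (hb : 0 < b) (u η : ℝ) :
    ∫ z, starRingEnd ℂ (φ (b * z - u)) * ech (z * η) =
      ((b⁻¹ : ℝ) : ℂ) * (starRingEnd ℂ (𝓕 φ (b⁻¹ * η)) * ech (u * (b⁻¹ * η))) := by
  have h := Measure.integral_comp_mul_left
    (fun y => starRingEnd ℂ (φ (y - u)) * ech (y * (b⁻¹ * η))) b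
  have h2 := integral_sub_right_eq_self (μ := volume)
    (fun y => starRingEnd ℂ (φ y) * ech ((y + u) * (b⁻¹ * η))) u
  simp only [sub_add_cancel] at h2
  rw [abs_of_pos (inv_pos.2 hb), h2, Complex.real_smul] at h
  rw [fourier_eq_ech, ← integral_conj, ← integral_mul_const, ← integral_congr_ae, h]
  · congr 2; ext y
    rw [map_mul, conj_ech, neg_neg, add_mul, ech_add]; ring
  · refine ae_of_all _ fun z => ?_
    dsimp only
    congr 2; field_simp

lemma integral_comp_sub_ech (φ : ℝ → ℂ) (y η : ℝ) :
    ∫ u, φ (y - u) * ech (u * η) = ech (y * η) * 𝓕 φ η := by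
  rw [← integral_sub_left_eq_self _ _ y, fourier_eq_ech, ← integral_const_mul]
  congr 1; ext u
  rw [sub_sub_cancel, sub_mul, sub_eq_add_neg, ech_add]; ring

namespace IsPacket
variable {φ f : ℝ → ℂ} {C : ℝ≥0}

lemma integrable (hφ : IsPacket φ C) : Integrable φ := by
  refine ((hφ.integrable_packet ⟨0, 0, 0⟩).bdd_mul (c := 1) (f := fun x => ech (-(1 / 4 * x)))
    (continuous_ech.comp (by fun_prop)).aestronglyMeasurable
    (ae_of_all _ fun x => (norm_ech _).le)).congr (ae_of_all _ fun x => ?_)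
  dsimp only [Tile.packet]
  rw [mul_left_comm, ← ech_add]
  simp [ech]

lemma coef_comp_sub (hφ : IsPacket φ C) (hf : IsWiener f) (k n : ℤ) (u : ℝ) :
    coef (fun x => φ (x - u)) f ⟨k, 0, n⟩ =
      ∫ ζ, 𝓕 f ζ * starRingEnd ℂ (𝓕 φ (2 ^ k * ζ - (n + 1 / 4))) *
        ech (u * (2 ^ k * ζ - (n + 1 / 4))) := by
  have hb := two_zpow_pos (-k)
  have hP : Integrable fun z : ℝ => starRingEnd ℂ (φ ((2:ℝ) ^ (-k) * z - u)) *
      ech (-((2:ℝ) ^ (-k) * (n + 1 / 4) * z)) := by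
    refine Integrable.mul_bdd (c := 1) ?_
      (continuous_ech.comp (by fun_prop)).aestronglyMeasurable (ae_of_all _ fun x => (norm_ech _).le)
    exact (Complex.conjCLE : ℂ →L[ℝ] ℂ).integrable_comp
      ((hφ.integrable.comp_sub_right u).comp_mul_left' hb.ne')
  have h := integral_ech_swap hP hf.fint 1
  have h0 : ∫ z, inner ℂ ((⟨k, 0, n⟩ : Tile).packet (fun x => φ (x - u)) z) (f z) =
      ∫ z : ℝ, starRingEnd ℂ (φ ((2:ℝ) ^ (-k) * z - u)) *
      ech (-((2:ℝ) ^ (-k) * (n + 1 / 4) * z)) * ∫ ζ, 𝓕 f ζ * ech (1 * z * ζ) := by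
    congr 1; ext z
    simp_rw [one_mul, ← hf.eq_integral, RCLike.inner_apply, Tile.packet, map_mul, conj_ech]
    simp; ring
  rw [coef, h0, h, ← integral_const_mul]
  congr 1; ext ζ
  have h1 := integral_conj_comp_ech φ hb u (ζ - (2:ℝ) ^ (-k) * (n + 1 / 4))
  have e : ((2:ℝ) ^ (-k))⁻¹ * (ζ - 2 ^ (-k) * (n + 1 / 4)) = 2 ^ k * ζ - (n + 1 / 4) := by
    rw [mul_sub, inv_mul_cancel_left₀ hb.ne', zpow_neg, inv_inv]
  rw [e] at h1
  have h2 : ∫ z : ℝ, starRingEnd ℂ (φ ((2:ℝ) ^ (-k) * z - u)) *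
      ech (-((2:ℝ) ^ (-k) * (n + 1 / 4) * z)) * ech (1 * z * ζ) = ∫ z : ℝ,
      starRingEnd ℂ (φ ((2:ℝ) ^ (-k) * z - u)) * ech (z * (ζ - (2:ℝ) ^ (-k) * (n + 1 / 4))) := by
    congr 1; ext z
    rw [mul_assoc, ← ech_add]; congr 2; ring
  rw [h2, h1]
  have e2 : (((2:ℝ) ^ (-k) : ℝ) : ℂ) * (((2:ℝ) ^ (-k))⁻¹ : ℝ) = 1 := by
    rw [← Complex.ofReal_mul, mul_inv_cancel₀ hb.ne', Complex.ofReal_one]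
  dsimp only
  linear_combination (𝓕 f ζ * (starRingEnd ℂ) (𝓕 φ (2 ^ k * ζ - (n + 1 / 4))) *
        ech (u * (2 ^ k * ζ - (n + 1 / 4)))) * e2

/-- A wave packet term, as a function of the continuous translation parameter. -/
noncomputable def wave (φ f : ℝ → ℂ) (k n : ℤ) (x u : ℝ) : ℂ :=
  coef (fun x => φ (x - u)) f ⟨k, 0, n⟩ * (⟨k, 0, n⟩ : Tile).packet (fun x => φ (x - u)) x

lemma coef_mul_packet_eq_wave (φ f : ℝ → ℂ) (k m n : ℤ) (x τ : ℝ) :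
    coef (fun x => φ (x - τ)) f ⟨k, m, n⟩ * (⟨k, m, n⟩ : Tile).packet (fun x => φ (x - τ)) x =
      wave φ f k n x (τ + m) := by
  simp [wave, coef, Tile.packet, sub_sub, add_comm]

lemma integrable_wave_and_integral_wave (hφ : IsPacket φ C) (hf : IsWiener f) (k n : ℤ) (x : ℝ) :
    Integrable (wave φ f k n x) ∧ ∫ u, wave φ f k n x u =
      ∫ ζ, ‖𝓕 φ (2 ^ k * ζ - (n + 1 / 4))‖ ^ 2 • (𝓕 f ζ * ech (x * ζ)) := by
  have hb := two_zpow_pos (-k)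
  set F : ℝ → ℂ := fun ζ => 𝓕 f ζ * starRingEnd ℂ (𝓕 φ (2 ^ k * ζ - (n + 1 / 4))) with hF
  have hFi : Integrable F := by
    obtain ⟨B, hB⟩ : ∃ B, ∀ ζ, ‖𝓕 φ ζ‖ ≤ B := ⟨_, fun ζ => by
      rw [fourier_eq_ech]
      exact (norm_integral_le_integral_norm _).trans_eq
        (by simp [norm_ech] : _ = ∫ x, ‖φ x‖)⟩
    refine hf.fint.mul_bdd (c := B) ?_ (ae_of_all _ fun ζ => by simpa using hB _)
    exact (Complex.continuous_conj.comp ((continuous_fourier_of_integrable hφ.integrable).comp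
      (by fun_prop))).aestronglyMeasurable
  set P : ℝ → ℂ := fun u => φ (2 ^ (-k) * x - u) * ech (-(u * (n + 1 / 4))) with hP
  have hPi : Integrable P := (hφ.integrable.comp_sub_left _).mul_bdd (c := 1)
    (continuous_ech.comp (by fun_prop)).aestronglyMeasurable (ae_of_all _ fun x => (norm_ech _).le)
  have hw : wave φ f k n x = fun u => ech (2 ^ (-k) * (n + 1 / 4) * x) *
      (P u * ∫ ζ, F ζ * ech (2 ^ k * u * ζ)) := by
    ext u
    rw [wave, hφ.coef_comp_sub hf, Tile.packet]
    have (ζ : ℝ) : ech (u * (2 ^ k * ζ - (n + 1 / 4))) =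
        ech (2 ^ k * u * ζ) * ech (-(u * (n + 1 / 4))) := by rw [← ech_add]; congr 1; ring
    simp_rw [this, ← mul_assoc, integral_mul_const, hP, hF, ← mul_assoc]
    simp only [Int.cast_zero, sub_zero]
    ring
  refine ⟨?_, ?_⟩
  · rw [hw]
    refine (hPi.mul_bdd (c := ∫ ζ, ‖F ζ‖) ?_ (ae_of_all _ fun u => ?_)).const_mul _
    · refine StronglyMeasurable.aestronglyMeasurable ?_
      refine StronglyMeasurable.integral_prod_right' (f := fun z : ℝ × ℝ =>
        F z.2 * ech (2 ^ k * z.1 * z.2)) ?_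
      refine .mul ?_ (continuous_ech.comp (by fun_prop)).stronglyMeasurable
      refine Continuous.stronglyMeasurable ((hf.continuous_fourier.comp continuous_snd).mul ?_)
      exact Complex.continuous_conj.comp ((continuous_fourier_of_integrable hφ.integrable).comp
        (by fun_prop))
    · exact (norm_integral_le_integral_norm _).trans_eq (by simp [norm_ech])
  · rw [hw, integral_const_mul, integral_ech_swap hPi hFi, ← integral_const_mul]
    congr 1; ext ζ
    have h2 : ∫ u, P u * ech (2 ^ k * u * ζ) =
        ∫ u, φ (2 ^ (-k) * x - u) * ech (u * (2 ^ k * ζ - (n + 1 / 4))) := by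
      congr 1; ext u
      rw [hP, mul_assoc, ← ech_add]; congr 2; ring
    have e : ech (x * ζ) = ech (2 ^ (-k) * (n + 1 / 4) * x) *
        ech (2 ^ (-k) * x * (2 ^ k * ζ - (n + 1 / 4))) := by
      rw [← ech_add]; congr 1
      have : (2:ℝ) ^ (-k) * 2 ^ k = 1 := by rw [← zpow_add₀ two_ne_zero]; simp
      linear_combination (-(x * ζ)) * this
    rw [h2, integral_comp_sub_ech, Complex.real_smul, Complex.ofReal_pow, ← Complex.mul_conj', e,
      hF]
    ring

end IsPacket

/-- The linearised maximal multiplier operator with symbol `σ`, at the parameter value `a`. -/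
noncomputable def symOp (σ : ℝ → ℝ → ℝ) (f : ℝ → ℂ) (a x : ℝ) : ℂ :=
  ∫ ξ, σ a ξ • (𝓕 f ξ * ech (x * ξ))

/-- Symbols whose linearised maximal multiplier operator is bounded on `L^p`. -/
structure IsMaxSymbol (p : ℝ) (A : ℝ≥0∞) (σ : ℝ → ℝ → ℝ) : Prop where
  meas : Measurable (Function.uncurry σ)
  bdd : ∃ B, ∀ a b, |σ a b| ≤ B
  le : ∀ (N : ℝ → ℝ) (f : ℝ → ℂ), Measurable N → IsWiener f →
    ∫⁻ x, ‖symOp σ f (N x) x‖ₑ ^ p ≤ A * ∫⁻ x, ‖f x‖ₑ ^ p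

lemma IsWiener.integrable_symbol {f : ℝ → ℂ} (hf : IsWiener f) {s : ℝ → ℝ} (hs : Measurable s)
    {B : ℝ} (hB : ∀ ξ, |s ξ| ≤ B) (x : ℝ) : Integrable fun ξ => s ξ • (𝓕 f ξ * ech (x * ξ)) :=
  (hf.fint.mul_bdd (c := 1) (continuous_ech.comp (by fun_prop)).aestronglyMeasurable
    (ae_of_all _ fun x => (norm_ech _).le)).bdd_smul B hs.aestronglyMeasurable (ae_of_all _ hB)

lemma IsWiener.measurable_symOp {f : ℝ → ℂ} (hf : IsWiener f) {α : Type*} [MeasurableSpace α]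
    {σ : α → ℝ → ℝ} (hσ : Measurable (Function.uncurry σ)) {N : α → ℝ} (hN : Measurable N) :
    Measurable fun z => ∫ ξ, σ z ξ • (𝓕 f ξ * ech (N z * ξ)) := by
  refine (StronglyMeasurable.integral_prod_right' (f := fun w : α × ℝ =>
    σ w.1 w.2 • (𝓕 f w.2 * ech (N w.1 * w.2))) (Measurable.stronglyMeasurable ?_)).measurable
  exact hσ.smul ((hf.continuous_fourier.measurable.comp measurable_snd).mul
    (continuous_ech.measurable.comp ((hN.comp measurable_fst).mul measurable_snd)))

namespace IsMaxSymbol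
variable {p : ℝ} {A : ℝ≥0∞} {σ : ℝ → ℝ → ℝ}

lemma translate (h : IsMaxSymbol p A σ) (θ : ℝ) :
    IsMaxSymbol p A fun a b => σ (a + θ) (b + θ) where
  meas := h.meas.comp (f := fun z : ℝ × ℝ => (z.1 + θ, z.2 + θ)) (by fun_prop)
  bdd := h.bdd.imp fun B hB a b => hB _ _
  le N f hN hf := by
    refine (lintegral_congr fun x => ?_).trans_le
      ((h.le (fun x => N x + θ) _ (by fun_prop) (hf.ech_mul (-θ))).trans_eq ?_)
    · have : symOp σ (fun x => ech (-(x * -θ)) * f x) (N x + θ) x = ech (x * θ) *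
          symOp (fun a b => σ (a + θ) (b + θ)) f (N x) x := by
        rw [symOp, ← integral_add_right_eq_self _ θ, symOp, ← integral_const_mul]
        congr 1; ext ξ
        rw [fourier_ech_mul, add_neg_cancel_right, mul_add, ech_add, Complex.real_smul,
          Complex.real_smul]
        ring
      rw [this, enorm_mul, enorm_ech, one_mul]
    · simp [enorm_mul, enorm_ech]

lemma dilate (h : IsMaxSymbol p A σ) {l : ℝ} (hl : 0 < l) :
    IsMaxSymbol p A fun a b => σ (l * a) (l * b) where
  meas := h.meas.comp (f := fun z : ℝ × ℝ => (l * z.1, l * z.2)) (by fun_prop)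
  bdd := h.bdd.imp fun B hB a b => hB _ _
  le N f hN hf := by
    have hc (F : ℝ → ℝ≥0∞) : ∫⁻ x, F (l * x) = ENNReal.ofReal l⁻¹ * ∫⁻ x, F x := by
      rw [← abs_of_pos (inv_pos.2 hl), ← smul_eq_mul, ← lintegral_smul_measure,
        ← Real.map_volume_mul_left hl.ne',
        (measurableEmbedding_mulLeft₀ hl.ne').lintegral_map]
    have h1 := h.le (fun x => l * N (l * x)) _ (by fun_prop) (hf.comp_mul hl)
    have h2 (x : ℝ) : symOp σ (fun x => f (l * x)) (l * N (l * x)) x =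
        symOp (fun a b => σ (l * a) (l * b)) f (N (l * x)) (l * x) := by
      have := Measure.integral_comp_mul_left (fun ξ =>
        σ (l * N (l * x)) ξ • (𝓕 (fun x => f (l * x)) ξ * ech (x * ξ))) l
      rw [abs_of_pos (inv_pos.2 hl)] at this
      rw [symOp, symOp, ← inv_smul_smul₀ (inv_pos.2 hl).ne' (∫ ξ, _), ← this, inv_inv,
        ← integral_smul]
      congr 1; ext ξ
      rw [IsWiener.fourier_comp_mul f hl, inv_mul_cancel_left₀ hl.ne', smul_comm, mul_assoc,
        ← Complex.real_smul, smul_inv_smul₀ hl.ne']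
      congr 3; ring
    simp_rw [h2] at h1
    rw [hc fun y => ‖symOp (fun a b => σ (l * a) (l * b)) f (N y) y‖ₑ ^ p,
      hc fun y => ‖f y‖ₑ ^ p, mul_left_comm] at h1
    exact (ENNReal.mul_le_mul_iff_right (by simpa using hl) ENNReal.ofReal_ne_top).1 h1

lemma average {ν : Measure ℝ} [IsProbabilityMeasure ν] (hp : 1 ≤ p) {σ : ℝ → ℝ → ℝ → ℝ}
    (hσ : Measurable fun z : ℝ × ℝ × ℝ => σ z.1 z.2.1 z.2.2) {B : ℝ}
    (hB : ∀ t a b, |σ t a b| ≤ B) (h : ∀ t, IsMaxSymbol p A (σ t)) :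
    IsMaxSymbol p A fun a b => ∫ t, σ t a b ∂ν where
  meas := (StronglyMeasurable.integral_prod_left' (f := fun z : ℝ × ℝ × ℝ => σ z.1 z.2.1 z.2.2)
    hσ.stronglyMeasurable).measurable
  bdd := ⟨B, fun a b => by
    simpa using norm_integral_le_of_norm_le_const (μ := ν) (f := fun t => σ t a b)
      (ae_of_all _ fun t => hB t a b)⟩
  le N f hN hf := by
    refine (lintegral_congr fun x => ?_).trans_le (lintegral_average_rpow_le (ν := ν) hp
      (F := fun t x => symOp (σ t) f (N x) x) (hf.measurable_symOp (α := ℝ × ℝ)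
        (σ := fun z ξ => σ z.1 (N z.2) ξ) (N := fun z => z.2) ?_ measurable_snd)
      (ae_of_all _ fun t => (h t).le N f hN hf))
    · simp_rw [symOp]
      rw [integral_integral_swap]
      · simp_rw [integral_smul_const]
      · have h1 : Integrable fun ξ => 𝓕 f ξ * ech (x * ξ) := by
          simpa using hf.integrable_symbol (s := fun _ => 1) measurable_const (B := 1) (by simp) x
        exact (h1.comp_snd ν).bdd_smul B (φ := fun z : ℝ × ℝ => σ z.1 (N x) z.2)
          (hσ.comp (f := fun z : ℝ × ℝ => (z.1, N x, z.2)) (by fun_prop)).aestronglyMeasurable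
          (ae_of_all _ fun z => hB _ _ _)
    · exact hσ.comp (f := fun z : (ℝ × ℝ) × ℝ => (z.1.1, N z.1.2, z.2)) (by fun_prop)

lemma of_tendsto {s : ℕ → ℝ → ℝ → ℝ} (h : ∀ n, IsMaxSymbol p A (s n))
    (hσ : Measurable (Function.uncurry σ)) {B : ℝ} (hB : ∀ n a b, |s n a b| ≤ B)
    (hl : ∀ a b, Filter.Tendsto (fun n => s n a b) .atTop (nhds (σ a b))) :
    IsMaxSymbol p A σ where
  meas := hσ
  bdd := ⟨B, fun a b => le_of_tendsto (hl a b).abs (.of_forall fun n => hB n a b)⟩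
  le N f hN hf := by
    refine lintegral_rpow_le_of_tendsto (F := fun n x => symOp (s n) f (N x) x)
      (fun n => hf.measurable_symOp (σ := fun x ξ => s n (N x) ξ)
        ((h n).meas.comp (f := fun z : ℝ × ℝ => (N z.1, z.2)) (by fun_prop)) measurable_id)
      (fun n => (h n).le N f hN hf) fun x => ?_
    refine tendsto_integral_of_dominated_convergence (fun ξ => B * ‖𝓕 f ξ‖) (fun n =>
      (hf.integrable_symbol ((h n).meas.comp (f := fun ξ => (N x, ξ)) (by fun_prop))
        (hB n _) x).aestronglyMeasurable) (hf.fint.norm.const_mul B)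
      (fun n => ae_of_all _ fun ξ => ?_) (ae_of_all _ fun ξ => (hl _ _).smul_const _)
    rw [norm_smul, norm_mul, norm_ech, mul_one]
    exact mul_le_mul_of_nonneg_right (hB n _ _) (norm_nonneg _)

end IsMaxSymbol

lemma Tile.mem_ω₂_iff {s : Tile} {ξ : ℝ} :
    ξ ∈ s.ω₂ ↔ s.n = ⌊(2:ℝ) ^ s.k * ξ⌋ ∧ 1 / 2 ≤ Int.fract ((2:ℝ) ^ s.k * ξ) := by
  refine ⟨fun h => ?_, fun ⟨h1, h2⟩ => ?_⟩
  · obtain ⟨h1, h2⟩ := le_and_lt_of_mem_ω₂ h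
    have h3 : ⌊(2:ℝ) ^ s.k * ξ⌋ = s.n := Int.floor_eq_iff.2 ⟨by linarith, h2⟩
    exact ⟨h3.symm, by rw [Int.fract, h3]; linarith⟩
  · have h3 := Int.fract_lt_one ((2:ℝ) ^ s.k * ξ)
    rw [Int.fract, ← h1] at h2 h3
    refine mem_dy.2 (Int.floor_eq_iff.2 ?_)
    rw [zpow_sub₀ two_ne_zero, zpow_neg, zpow_one, div_div_eq_mul_div, div_inv_eq_mul]
    push_cast
    constructor <;> linarith

/-- The finite set of tiles with bounded parameters. -/
noncomputable def Tile.box (K R : ℕ) : Finset Tile :=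
  (Finset.Icc (-K : ℤ) K ×ˢ Finset.Icc (-R : ℤ) R ×ˢ Finset.Icc (-R : ℤ) R).map
    ⟨fun z => ⟨z.1, z.2.1, z.2.2⟩, fun z w h => by simpa [Prod.ext_iff] using h⟩

/-- One scale of the symbol of the averaged model operator. -/
noncomputable def scaleSym (g : ℝ → ℝ) (a b : ℝ) : ℝ :=
  if 1 / 2 ≤ Int.fract a then g (b - (⌊a⌋ + 1 / 4)) else 0

lemma measurable_scaleSym {g : ℝ → ℝ} (hg : Measurable g) :
    Measurable (Function.uncurry (scaleSym g)) := by
  refine Measurable.ite (measurableSet_le measurable_const (measurable_fract.comp measurable_fst))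
    (hg.comp ?_) measurable_const
  exact measurable_snd.sub ((measurable_from_top.comp (Int.measurable_floor.comp
    measurable_fst)).add_const _)

lemma abs_scaleSym_le {g : ℝ → ℝ} {B : ℝ} (hB : ∀ x, |g x| ≤ B) (a b : ℝ) :
    |scaleSym g a b| ≤ B := by
  unfold scaleSym
  split_ifs
  · exact hB _
  · simpa using (abs_nonneg _).trans (hB 0)

lemma abs_norm_fourier_sq_le (φ : ℝ → ℂ) (ζ : ℝ) : |‖𝓕 φ ζ‖ ^ 2| ≤ (∫ x, ‖φ x‖) ^ 2 := by
  rw [abs_of_nonneg (by positivity), fourier_eq_ech]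
  exact pow_le_pow_left₀ (norm_nonneg _)
    ((norm_integral_le_integral_norm _).trans_eq (by simp [norm_ech])) _

namespace IsPacket
variable {φ f : ℝ → ℂ} {C : ℝ≥0} {N : ℝ → ℝ}

lemma measurable_modelSum_comp_sub (hφ : IsPacket φ C) (hf : IsWiener f) (hN : Measurable N)
    (P : Finset Tile) : Measurable fun z : ℝ × ℝ =>
      modelSum (fun y => φ (y - z.1)) (coef (fun y => φ (y - z.1)) f) N P z.2 := by
  have h1 := hφ.cont
  have h2 := hf.cont
  have h3 := continuous_ech
  refine Finset.measurable_fun_sum _ fun s _ => ?_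
  refine Measurable.indicator (s := (fun z : ℝ × ℝ => N z.2) ⁻¹' s.ω₂) (f := fun z : ℝ × ℝ =>
    coef (fun y => φ (y - z.1)) f s * s.packet (fun y => φ (y - z.1)) z.2) ?_
    ((hN.comp measurable_snd) s.measurableSet_ω₂)
  refine (Measurable.const_mul ?_ _).mul ?_
  · refine (StronglyMeasurable.integral_prod_right' (f := fun w : ℝ × ℝ =>
      inner ℂ (s.packet (fun y => φ (y - w.1)) w.2) (f w.2)) (Continuous.stronglyMeasurable
      ?_)).measurable.comp measurable_fst
    unfold Tile.packet
    fun_prop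
  · unfold Tile.packet
    exact Continuous.measurable (by fun_prop)

lemma modelSum_box (φ f : ℝ → ℂ) (N : ℝ → ℝ) (K R : ℕ) (τ x : ℝ)
    (h : ∀ k ∈ Finset.Icc (-K : ℤ) K, ⌊(2:ℝ) ^ k * N x⌋ ∈ Finset.Icc (-R : ℤ) R) :
    modelSum (fun y => φ (y - τ)) (coef (fun y => φ (y - τ)) f) N (Tile.box K R) x =
      ∑ k ∈ Finset.Icc (-K : ℤ) K, ∑ m ∈ Finset.Icc (-R : ℤ) R,
        if 1 / 2 ≤ Int.fract ((2:ℝ) ^ k * N x) then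
          wave φ f k ⌊(2:ℝ) ^ k * N x⌋ x (τ + m) else 0 := by
  rw [modelSum, Tile.box, Finset.sum_map, Finset.sum_product]
  refine Finset.sum_congr rfl fun k hk => ?_
  rw [Finset.sum_product]
  refine Finset.sum_congr rfl fun m _ => ?_
  rw [Finset.sum_eq_single_of_mem _ (h k hk)]
  · split_ifs with hx
    · exact (indicator_of_mem (mem_preimage.2 (Tile.mem_ω₂_iff.2 ⟨rfl, hx⟩)) _).trans
        (coef_mul_packet_eq_wave ..)
    · exact indicator_of_notMem (s := N ⁻¹' (⟨k, m, ⌊(2:ℝ) ^ k * N x⌋⟩ : Tile).ω₂) (a := x)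
        (fun h => hx (Tile.mem_ω₂_iff.1 h).2) _
  · intro n _ hn
    exact indicator_of_notMem (s := N ⁻¹' (⟨k, m, n⟩ : Tile).ω₂) (a := x)
      (fun h => hn ((Tile.mem_ω₂_iff (s := ⟨k, m, n⟩)).1 h).1) _

lemma isMaxSymbol_sum (C : ℝ≥0) {p : ℝ} (hp : 3 / 2 < p) : ∃ A : ℝ≥0∞, A ≠ ∞ ∧
    ∀ φ K, IsPacket φ C → IsMaxSymbol p A fun a b =>
      ∑ k ∈ Finset.Icc (-(K : ℕ) : ℤ) K, scaleSym (fun ζ => ‖𝓕 φ ζ‖ ^ 2) (2 ^ k * a) (2 ^ k * b) := by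
  obtain ⟨A, hA, hmain⟩ := model_strong (C * 2 ^ 20) hp
  refine ⟨A, hA, fun φ K hφ => ?_⟩
  have hgc : Continuous fun ζ => ‖𝓕 φ ζ‖ ^ 2 :=
    (continuous_fourier_of_integrable hφ.integrable).norm.pow 2
  have hm := measurable_scaleSym hgc.measurable
  have hB := abs_scaleSym_le (abs_norm_fourier_sq_le φ)
  have hmk (k : ℤ) : Measurable (Function.uncurry fun a b =>
      scaleSym (fun ζ => ‖𝓕 φ ζ‖ ^ 2) (2 ^ k * a) (2 ^ k * b)) :=
    hm.comp (f := fun z : ℝ × ℝ => ((2:ℝ) ^ k * z.1, (2:ℝ) ^ k * z.2)) (by fun_prop)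
  refine ⟨Finset.measurable_fun_sum _ fun k _ => hmk k,
    ⟨∑ k ∈ Finset.Icc (-K : ℤ) K, (∫ x, ‖φ x‖) ^ 2, fun a b =>
      (Finset.abs_sum_le_sum_abs _ _).trans (Finset.sum_le_sum fun k _ => hB _ _)⟩,
    fun N f hN hf => ?_⟩
  have hmod (R : ℕ) := hφ.measurable_modelSum_comp_sub hf hN (Tile.box K R)
  have hav (τ : ℝ) (hτ : τ ∈ Ioc 0 1) (R : ℕ) : ∫⁻ x, ‖modelSum (fun y => φ (y - τ))
      (coef (fun y => φ (y - τ)) f) N (Tile.box K R) x‖ₑ ^ p ≤ A * ∫⁻ x, ‖f x‖ₑ ^ p := by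
    have hφ' := hφ.comp_sub (Ioc_subset_Icc_self hτ)
    refine lintegral_rpow_le_of_truncate (by linarith) (T := fun f => modelSum
      (fun y => φ (y - τ)) (coef (fun y => φ (y - τ)) f) N (Tile.box K R)) (fun f hf =>
        ⟨hφ'.measurable_modelSum _ hN _, hmain _ _ _ hφ' hN f hf⟩)
      hf.cont.stronglyMeasurable hf.norm_le fun x => tendsto_finsetSum _ fun s _ => ?_
    by_cases hx : x ∈ N ⁻¹' s.ω₂ <;> simp only [modelTerm, hx, not_false_eq_true, indicator_of_mem,
      indicator_of_notMem]
    · refine Filter.Tendsto.mul_const _ (Filter.Tendsto.const_mul _ ?_)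
      refine tendsto_integral_of_dominated_convergence
        (fun z => ‖s.packet (fun y => φ (y - τ)) z‖ * ∫ ζ, ‖𝓕 f ζ‖) (fun n => ?_)
        ((hφ'.integrable_packet s).norm.mul_const _) (fun n => ae_of_all _ fun z => ?_)
        (ae_of_all _ fun z => tendsto_const_nhds.inner (tendsto_indicator_Icc f z))
      · exact (hφ'.continuous_packet s).aestronglyMeasurable.inner
          (hf.cont.aestronglyMeasurable.indicator measurableSet_Icc)
      · exact (norm_inner_le_norm _ _).trans (mul_le_mul_of_nonneg_left
          ((norm_indicator_le_norm_self _ _).trans (hf.norm_le z)) (norm_nonneg _))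
    · exact tendsto_const_nhds
  have : IsProbabilityMeasure (volume.restrict (Ioc (0:ℝ) 1)) := ⟨by simp⟩
  refine lintegral_rpow_le_of_tendsto (F := fun R x => ∫ τ in Ioc (0:ℝ) 1, modelSum
      (fun y => φ (y - τ)) (coef (fun y => φ (y - τ)) f) N (Tile.box K R) x)
    (fun R => (hmod R).stronglyMeasurable.integral_prod_left'.measurable)
    (fun R => lintegral_average_rpow_le (F := fun τ x => modelSum
        (fun y => φ (y - τ)) (coef (fun y => φ (y - τ)) f) N (Tile.box K R) x) (by linarith) (hmod R)
      ((ae_restrict_mem measurableSet_Ioc).mono fun τ hτ => hav τ hτ R)) fun x => ?_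
  have hlim : symOp (fun a b => ∑ k ∈ Finset.Icc (-K : ℤ) K,
      scaleSym (fun ζ => ‖𝓕 φ ζ‖ ^ 2) (2 ^ k * a) (2 ^ k * b)) f (N x) x =
      ∑ k ∈ Finset.Icc (-K : ℤ) K, if 1 / 2 ≤ Int.fract ((2:ℝ) ^ k * N x) then
        ∫ u, wave φ f k ⌊(2:ℝ) ^ k * N x⌋ x u else 0 := by
    have hi (k : ℤ) := hf.integrable_symbol (s := fun ξ => scaleSym (fun ζ => ‖𝓕 φ ζ‖ ^ 2)
      (2 ^ k * N x) (2 ^ k * ξ)) ((hmk k).comp (f := fun ξ => (N x, ξ)) (by fun_prop))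
      (fun ξ => hB _ _) x
    simp_rw [symOp, Finset.sum_smul]
    rw [integral_finsetSum _ fun k _ => hi k]
    refine Finset.sum_congr rfl fun k _ => ?_
    simp only [scaleSym]
    split_ifs
    · rw [(hφ.integrable_wave_and_integral_wave hf k _ x).2]
    · simp
  rw [hlim]
  have hev : ∀ᶠ R : ℕ in .atTop, ∀ k ∈ Finset.Icc (-K : ℤ) K,
      ⌊(2:ℝ) ^ k * N x⌋ ∈ Finset.Icc (-R : ℤ) R := by
    refine (Finset.eventually_all _).2 fun k _ => ?_
    filter_upwards [Filter.eventually_ge_atTop ⌊(2:ℝ) ^ k * N x⌋.natAbs] with R hR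
    rw [Finset.mem_Icc]; omega
  refine Filter.Tendsto.congr' (f₁ := fun R : ℕ => ∑ k ∈ Finset.Icc (-K : ℤ) K,
    if 1 / 2 ≤ Int.fract ((2:ℝ) ^ k * N x) then ∑ m ∈ Finset.Icc (-R : ℤ) R,
      ∫ τ in (0:ℝ)..1, wave φ f k ⌊(2:ℝ) ^ k * N x⌋ x (τ + m) else 0) ?_ ?_
  · filter_upwards [hev] with R hR
    simp_rw [modelSum_box φ f N K R _ x hR]
    have hi (k m : ℤ) : IntegrableOn (fun τ => if 1 / 2 ≤ Int.fract ((2:ℝ) ^ k * N x) then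
          wave φ f k ⌊(2:ℝ) ^ k * N x⌋ x (τ + m) else 0) (Ioc 0 1) := by
      split_ifs
      · exact ((hφ.integrable_wave_and_integral_wave hf k _ x).1.comp_add_right _).integrableOn
      · exact integrableOn_zero
    rw [integral_finsetSum _ fun k _ => integrable_finsetSum _ fun m _ => hi k m]
    refine Finset.sum_congr rfl fun k _ => ?_
    rw [integral_finsetSum _ fun m _ => hi k m]
    split_ifs
    · simp_rw [intervalIntegral.integral_of_le zero_le_one]
    · simp
  · refine tendsto_finsetSum _ fun k _ => ?_
    split_ifs
    · exact (hφ.integrable_wave_and_integral_wave hf k _ x).1.hasSum_intervalIntegral_comp_add_int.comp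
        Finset.tendsto_Icc_neg
    · exact tendsto_const_nhds

end IsPacket

/-- The translation average of `scaleSym g`. -/
noncomputable def avgSym (g : ℝ → ℝ) (w : ℝ) : ℝ := ∫ t in (1/2 : ℝ)..1, g (t + w - 1 / 4)

lemma integral_scaleSym {g : ℝ → ℝ} (hg : Measurable g) {B : ℝ} (hB : ∀ x, |g x| ≤ B) (a w : ℝ)
    {m : ℕ} (hm : m ≠ 0) :
    ∫ t in (0:ℝ)..1, scaleSym g (a + m * t) (a + m * t + w) = avgSym g w := by
  have hp : Function.Periodic (fun t => scaleSym g t (t + w)) 1 := fun t => by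
    simp only [scaleSym, Int.fract_add_one, Int.floor_add_one]
    congr 2; push_cast; ring
  have hi (s t : ℝ) : IntervalIntegrable (fun t => scaleSym g t (t + w)) volume s t := by
    exact (intervalIntegrable_const (c := B)).mono_fun' ((measurable_scaleSym hg).comp
      (f := fun t => (t, t + w)) (by fun_prop)).aestronglyMeasurable
      (ae_of_all _ fun t => abs_scaleSym_le hB _ _)
  have hm' : (m : ℝ) ≠ 0 := by exact_mod_cast hm
  have h1 := hp.intervalIntegral_add_zsmul_eq m a hi
  rw [hp.intervalIntegral_add_eq a 0, zero_add] at h1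
  rw [intervalIntegral.integral_comp_add_mul (fun t => scaleSym g t (t + w)) hm' a, mul_zero,
    add_zero, show a + m * (1 : ℝ) = a + (m : ℤ) • (1 : ℝ) by simp, h1, natCast_zsmul,
    nsmul_eq_mul, smul_eq_mul, inv_mul_cancel_left₀ hm', avgSym,
    ← intervalIntegral.integral_add_adjacent_intervals (hi 0 (1 / 2)) (hi _ _)]
  have h2 (t : ℝ) (h0 : 0 ≤ t) (h1 : t < 1) : scaleSym g t (t + w) =
      if 1 / 2 ≤ t then g (t + w - 1 / 4) else 0 := by
    simp [scaleSym, Int.fract_eq_self.2 ⟨h0, h1⟩, Int.floor_eq_zero_iff.2 ⟨h0, h1⟩]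
  rw [intervalIntegral.integral_congr_Ioo_of_le (g := fun _ => 0) (by norm_num) fun t ht =>
      (h2 t ht.1.le (by linarith [ht.2])).trans (if_neg (not_le.2 ht.2)),
    intervalIntegral.integral_zero, zero_add]
  exact intervalIntegral.integral_congr_Ioo_of_le (by norm_num) fun t ht =>
    (h2 t (by linarith [ht.1]) ht.2).trans (if_pos ht.1.le)

/-- **Carleson's theorem**, linearised: the maximal half-line multiplier is bounded on `L^p`. -/
theorem carleson {p : ℝ} (hp : 3 / 2 < p) : ∃ A : ℝ≥0∞, A ≠ ∞ ∧ ∀ (N : ℝ → ℝ) (f : ℝ → ℂ),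
    Measurable N → IsWiener f →
      ∫⁻ x, ‖∫ ξ in Iio (N x), 𝓕 f ξ * ech (x * ξ)‖ₑ ^ p ≤ A * ∫⁻ x, ‖f x‖ₑ ^ p := by
  obtain ⟨φ, hφ1, hφ0⟩ := exists_schwartz_bump (a := -(1 / 8)) (b := -(1 / 16)) (c := 1 / 16)
    (d := 1 / 8) (by norm_num) (by norm_num)
  obtain ⟨D, hD, hdec, -⟩ := φ.exists_decay 20
  have hφ : IsPacket φ D.toNNReal := ⟨φ.continuous, fun x => by
    rw [chi, ← ENNReal.ofReal_pow (by positivity), ← ENNReal.ofReal, ← ENNReal.ofReal_mul hD,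
      ← ofReal_norm]
    exact ENNReal.ofReal_le_ofReal (by simpa using hdec x), fun ξ hξ => hφ0 ξ fun h => hξ.not_ge (abs_le.2 ⟨h.1.le, h.2.le⟩)⟩
  obtain ⟨A, hA, hmain⟩ := IsPacket.isMaxSymbol_sum D.toNNReal hp
  set g : ℝ → ℝ := fun ζ => ‖𝓕 (φ : ℝ → ℂ) ζ‖ ^ 2 with hg
  have hgc : Continuous g := (continuous_fourier_of_integrable hφ.integrable).norm.pow 2
  have hg0 (x : ℝ) : 0 ≤ g x := sq_nonneg _
  have hgs (x : ℝ) (hx : 1 / 8 ≤ |x|) : g x = 0 := by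
    simp only [hg]
    rw [hφ0 x fun h => hx.not_gt (abs_lt.2 h)]; simp
  obtain ⟨B, hgB⟩ : ∃ B, ∀ x, |g x| ≤ B := ⟨_, abs_norm_fourier_sq_le φ⟩
  have hρc : Continuous (avgSym g) :=
    intervalIntegral.continuous_parametric_intervalIntegral_of_continuous' (by fun_prop) _ _
  have hρ0 (w : ℝ) : 0 ≤ avgSym g w :=
    intervalIntegral.integral_nonneg (by norm_num) fun t _ => hg0 _
  have hρs (w : ℝ) (hw : w ∉ Ioo (-(7 / 8)) (-(1 / 8))) : avgSym g w = 0 := by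
    refine (intervalIntegral.integral_congr fun t ht => hgs _ ?_).trans
      intervalIntegral.integral_zero
    rw [uIcc_of_le (by norm_num)] at ht
    rw [le_abs]
    by_contra! h
    exact hw ⟨by linarith [ht.2], by linarith [ht.1]⟩
  have hρB (w : ℝ) : |avgSym g w| ≤ B := by
    refine (intervalIntegral.norm_integral_le_of_norm_le_const (f := fun t => g (t + w - 1 / 4))
      fun t _ => hgB _).trans ?_
    norm_num
    linarith [(abs_nonneg _).trans (hgB 0)]
  have hprob : IsProbabilityMeasure (volume.restrict (Ioc (0:ℝ) 1)) := ⟨by simp⟩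
  have hsM := measurable_scaleSym hgc.measurable
  have hsB := abs_scaleSym_le hgB
  have h1 (K : ℕ) : IsMaxSymbol p A fun a b =>
      ∑ k ∈ Finset.Icc (-(K:ℤ)) K, avgSym g (2 ^ k * (b - a)) := by
    have hm (k : ℤ) : Measurable fun z : ℝ × ℝ × ℝ =>
        scaleSym g (2 ^ k * (z.2.1 + 2 ^ K * z.1)) (2 ^ k * (z.2.2 + 2 ^ K * z.1)) :=
      hsM.comp (f := fun z : ℝ × ℝ × ℝ => ((2:ℝ) ^ k * (z.2.1 + 2 ^ K * z.1),
        (2:ℝ) ^ k * (z.2.2 + 2 ^ K * z.1))) (by fun_prop)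
    have := IsMaxSymbol.average (ν := volume.restrict (Ioc (0:ℝ) 1)) (by linarith)
      (Finset.measurable_fun_sum _ fun k _ => hm k) (fun t a b =>
        (Finset.abs_sum_le_sum_abs _ _).trans (Finset.sum_le_sum fun k _ => hsB _ _))
      fun t => (hmain φ K hφ).translate (2 ^ K * t)
    convert! this using 3 with a b
    have hi (k : ℤ) : Integrable (fun t => scaleSym g (2 ^ k * (a + 2 ^ K * t))
        (2 ^ k * (b + 2 ^ K * t))) (volume.restrict (Ioc 0 1)) := .of_bound ((hm k).comp
      (f := fun t => (t, a, b)) (by fun_prop)).aestronglyMeasurable B (ae_of_all _ fun t => hsB _ _)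
    rw [integral_finsetSum _ fun k _ => hi k]
    refine Finset.sum_congr rfl fun k hk => ?_
    obtain ⟨m, hm⟩ := Int.eq_ofNat_of_zero_le (show 0 ≤ k + K by
      linarith [(Finset.mem_Icc.1 hk).1])
    rw [← integral_scaleSym hgc.measurable hgB (2 ^ k * a) _ (pow_ne_zero m two_ne_zero),
      intervalIntegral.integral_of_le zero_le_one]
    have h2 : ((2 ^ m : ℕ) : ℝ) = 2 ^ k * 2 ^ K := by
      rw [← zpow_natCast _ K, ← zpow_add₀ two_ne_zero, hm]; simp
    rw [h2]
    congr! 3 <;> ring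
  have h2 (K : ℕ) := IsMaxSymbol.average (ν := volume.restrict (Ioc (0:ℝ) 1)) (by linarith)
    (σ := fun t a b => ∑ k ∈ Finset.Icc (-(K:ℤ)) K, avgSym g (2 ^ k * (2 ^ t * b - 2 ^ t * a)))
    (by fun_prop) (fun t a b => (Finset.abs_sum_le_sum_abs _ _).trans
      (Finset.sum_le_sum fun k _ => hρB _)) fun t => (h1 K).dilate (Real.rpow_pos_of_pos two_pos t)
  set c := ∫ s : ℝ, avgSym g (-2 ^ s) with hc
  have hcc : Continuous fun s : ℝ => avgSym g (-2 ^ s) := by fun_prop (disch := norm_num)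
  have hcs : HasCompactSupport fun s : ℝ => avgSym g (-2 ^ s) := by
    refine .of_support_subset_isCompact (isCompact_Icc (a := -3) (b := 0)) fun s hs => ?_
    have h := not_not.1 (mt (hρs _) hs)
    rw [mem_Ioo, neg_lt_neg_iff, neg_lt_neg_iff] at h
    constructor <;> refine ((Real.rpow_lt_rpow_left_iff one_lt_two).1 ?_).le <;> norm_num <;>
      linarith
  have hcp : 0 < c := by
    refine hcc.integral_pos_of_hasCompactSupport_nonneg_nonzero hcs (fun s => hρ0 _) (x := -1) (ne_of_gt ?_)
    refine intervalIntegral.integral_pos (by norm_num) (by fun_prop) (fun t _ => hg0 _)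
      ⟨3 / 4, by norm_num, ?_⟩
    norm_num [hg, Real.rpow_neg_one, hφ1]
  have hh (w : ℝ) : Integrable (fun s : ℝ => avgSym g (2 ^ s * w)) ∧
      ∫ s : ℝ, avgSym g (2 ^ s * w) = if w < 0 then c else 0 := by
    split_ifs with hw
    · have h3 (s : ℝ) : avgSym g (2 ^ s * w) = avgSym g (-2 ^ (s + Real.logb 2 (-w))) := by
        rw [Real.rpow_add two_pos, Real.rpow_logb two_pos (by norm_num) (by linarith)]
        congr 1; ring
      simp_rw [h3]
      exact ⟨(hcc.integrable_of_hasCompactSupport hcs).comp_add_right _,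
        integral_add_right_eq_self (fun s : ℝ => avgSym g (-2 ^ s)) _⟩
    · have h3 (s : ℝ) : avgSym g (2 ^ s * w) = 0 := hρs _ fun h => by
        have := mul_nonneg (Real.rpow_pos_of_pos two_pos s).le (not_lt.1 hw)
        linarith [h.2]
      simp [h3]
  have h4 (K : ℕ) (a b : ℝ) : (∫ t in Ioc (0:ℝ) 1, ∑ k ∈ Finset.Icc (-(K:ℤ)) K,
      avgSym g (2 ^ k * (2 ^ t * b - 2 ^ t * a))) = ∑ k ∈ Finset.Icc (-(K:ℤ)) K,
        ∫ t in (0:ℝ)..1, avgSym g (2 ^ (t + k) * (b - a)) := by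
    rw [← intervalIntegral.integral_of_le zero_le_one, intervalIntegral.integral_finsetSum]
    · congr! 4 with k _ t
      rw [Real.rpow_add two_pos, Real.rpow_intCast]; ring
    · exact fun k _ => Continuous.intervalIntegrable (by fun_prop (disch := norm_num)) _ _
  have h5 (a b : ℝ) := (hh (b - a)).1.hasSum_intervalIntegral_comp_add_int
  have h6 : IsMaxSymbol p A fun a b => if b < a then c else 0 := by
    refine .of_tendsto h2 (Measurable.ite (measurableSet_lt measurable_snd measurable_fst)
      measurable_const measurable_const) (B := c) (fun K a b => ?_) fun a b => ?_
    · rw [h4]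
      have h7 (k : ℤ) : 0 ≤ ∫ t in (0:ℝ)..1, avgSym g (2 ^ (t + k) * (b - a)) :=
        intervalIntegral.integral_nonneg zero_le_one fun _ _ => hρ0 _
      rw [abs_of_nonneg (Finset.sum_nonneg fun k _ => h7 k)]
      refine (sum_le_hasSum _ (fun k _ => h7 k) (h5 a b)).trans ?_
      rw [(hh _).2]
      split_ifs <;> linarith
    · simp_rw [h4]
      convert! (h5 a b).comp Finset.tendsto_Icc_neg using 2
      rw [(hh _).2]; simp
  have hcr : ‖c‖ₑ⁻¹ ^ p ≠ ∞ := ENNReal.rpow_ne_top_of_nonneg (by linarith)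
    (ENNReal.inv_ne_top.2 (by simpa using hcp.ne'))
  refine ⟨‖c‖ₑ⁻¹ ^ p * A, ENNReal.mul_ne_top hcr hA, fun N f hN hf => ?_⟩
  rw [mul_assoc]
  refine le_trans ?_ (mul_le_mul_right (h6.le N f hN hf) _)
  rw [← lintegral_const_mul' _ _ hcr]
  refine lintegral_mono fun x => ?_
  have h7 : symOp (fun a b => if b < a then c else 0) f (N x) x =
      c • ∫ ξ in Iio (N x), 𝓕 f ξ * ech (x * ξ) := by
    rw [← integral_smul, ← integral_indicator measurableSet_Iio, symOp]
    congr 1; ext ξ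
    by_cases hξ : ξ < N x <;> simp [hξ]
  rw [h7, enorm_smul, ← ENNReal.mul_rpow_of_nonneg _ _ (by linarith), ← mul_assoc,
    ENNReal.inv_mul_cancel (by simpa using hcp.ne') enorm_ne_top, one_mul]

/-- The inverse Fourier integral. -/
noncomputable def invF (G : ℝ → ℂ) (x : ℝ) : ℂ := ∫ ξ, G ξ * ech (x * ξ)

lemma Integrable.mul_ech {G : ℝ → ℂ} (hG : Integrable G) (x : ℝ) :
    Integrable fun ξ => G ξ * ech (x * ξ) :=
  hG.mul_bdd (c := 1) (continuous_ech.comp (by fun_prop)).aestronglyMeasurable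
    (ae_of_all _ fun ξ => (norm_ech _).le)

lemma norm_invF_le (G : ℝ → ℂ) (x : ℝ) : ‖invF G x‖ ≤ ∫ ξ, ‖G ξ‖ :=
  (norm_integral_le_integral_norm _).trans_eq (by simp [norm_ech])

lemma continuous_invF {G : ℝ → ℂ} (hG : Integrable G) : Continuous (invF G) :=
  continuous_of_dominated (fun x => (Integrable.mul_ech hG x).aestronglyMeasurable)
    (fun x => ae_of_all _ fun ξ => by rw [norm_mul, norm_ech, mul_one]) hG.norm
    (ae_of_all _ fun ξ => continuous_const.mul (continuous_ech.comp (by fun_prop)))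

lemma invF_sub {F G : ℝ → ℂ} (hF : Integrable F) (hG : Integrable G) (x : ℝ) :
    invF (F - G) x = invF F x - invF G x := by
  simp only [invF, Pi.sub_apply, sub_mul]
  exact integral_sub (Integrable.mul_ech hF x) (Integrable.mul_ech hG x)

lemma enorm_invF_comp_add (G : ℝ → ℂ) (a x : ℝ) :
    ‖invF (fun ξ => G (ξ + a)) x‖ₑ = ‖invF G x‖ₑ := by
  rw [invF, invF, ← integral_add_right_eq_self (fun ξ => G ξ * ech (x * ξ)) a]
  simp_rw [mul_add, ech_add, ← mul_assoc]
  rw [integral_mul_const, enorm_mul, enorm_ech, mul_one]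

lemma sconv_invF {κ G : ℝ → ℂ} (hκ : Integrable κ) (hG : Integrable G) :
    sconv κ (invF G) = invF fun ξ => 𝓕 κ ξ * G ξ := by
  ext x
  have h := integral_ech_swap (hκ.comp_sub_left x) hG 1
  simp only [one_mul, integral_comp_sub_ech] at h
  exact h.trans (integral_congr_ae (ae_of_all _ fun ξ => by ring))

/-- The `p`-th power integral of a square function. -/
noncomputable def sqInt (n : ℕ) (p : ℝ) (u : ℕ → ℝ → ℂ) : ℝ≥0∞ :=
  ∫⁻ x, (∑ j ∈ Finset.range n, ‖u j x‖ₑ ^ 2) ^ (p / 2)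

lemma sqInt_one (p : ℝ) (u : ℕ → ℝ → ℂ) : sqInt 1 p u = ∫⁻ x, ‖u 0 x‖ₑ ^ p := by
  simp only [sqInt, Finset.sum_range_one, ← ENNReal.rpow_two, ← ENNReal.rpow_mul,
    mul_div_cancel₀ p two_ne_zero]

lemma ENNReal.add_rpow_le' (a b : ℝ≥0∞) {p : ℝ} (hp : 0 ≤ p) :
    (a + b) ^ p ≤ 2 ^ p * (a ^ p + b ^ p) := by
  wlog h : a ≤ b generalizing a b
  · rw [add_comm a, add_comm (a ^ p)]; exact this b a (le_of_not_ge h)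
  calc (a + b) ^ p ≤ (2 * b) ^ p := by rw [two_mul]; gcongr
    _ ≤ _ := by rw [ENNReal.mul_rpow_of_nonneg _ _ hp]; gcongr; exact le_add_self

lemma sqInt_sub_le (n : ℕ) {p : ℝ} (hp : 0 ≤ p) {u v : ℕ → ℝ → ℂ} (hv : ∀ j, Measurable (v j)) :
    sqInt n p (fun j x => u j x - v j x) ≤ 2 ^ (3 * p) * (sqInt n p u + sqInt n p v) := by
  have h4 (a b : ℂ) : ‖a - b‖ₑ ^ 2 ≤ 2 ^ (2 : ℝ) * (‖a‖ₑ ^ 2 + ‖b‖ₑ ^ 2) := by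
    refine (pow_le_pow_left₀ zero_le enorm_sub_le 2).trans ?_
    simpa using ENNReal.add_rpow_le' ‖a‖ₑ ‖b‖ₑ (p := 2) zero_le_two
  have hm : Measurable fun x => (∑ j ∈ Finset.range n, ‖v j x‖ₑ ^ 2) ^ (p / 2) :=
    (Finset.measurable_fun_sum _ fun j _ => (hv j).enorm.pow_const 2).pow_const _
  rw [sqInt, sqInt, sqInt, ← lintegral_add_right _ hm, ← lintegral_const_mul' _ _ (by finiteness)]
  refine lintegral_mono fun x => (ENNReal.rpow_le_rpow (Finset.sum_le_sum fun j _ => h4 _ _)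
    (by linarith)).trans ?_
  rw [← Finset.mul_sum, Finset.sum_add_distrib, ENNReal.mul_rpow_of_nonneg _ _ (by linarith),
    ← ENNReal.rpow_mul, show 3 * p = 2 * (p / 2) + (2 * p) by ring]
  refine (mul_le_mul_right (ENNReal.add_rpow_le' _ _ (by linarith)) _).trans ?_
  rw [← mul_assoc, ← ENNReal.rpow_add _ _ two_ne_zero (by simp)]
  gcongr
  · simp
  · linarith

/-- A smooth step function, equal to `0` on `(-∞, 1]` and to `1` on `[2, ∞)`. -/
noncomputable def sstep (x : ℝ) : ℝ := Real.smoothTransition (x - 1)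

lemma sstep_of_le {x : ℝ} (h : x ≤ 1) : sstep x = 0 :=
  Real.smoothTransition.zero_of_nonpos (by linarith)

lemma sstep_of_ge {x : ℝ} (h : 2 ≤ x) : sstep x = 1 :=
  Real.smoothTransition.one_of_one_le (by linarith)

lemma exists_lp_partition : ∃ K L : 𝓢(ℝ, ℂ),
    (∀ ξ, 𝓕 (K : ℝ → ℂ) ξ = ((sstep (2 * ξ) - sstep ξ : ℝ) : ℂ)) ∧ (∃ B, IsLPKernel K B) ∧
    ∀ ξ, 0 ≤ ξ → 𝓕 (L : ℝ → ℂ) ξ = ((1 - sstep ξ : ℝ) : ℂ) := by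
  have hs := Real.smoothTransition.contDiff (n := ⊤)
  obtain ⟨K, hK⟩ := exists_schwartz_fourier_eq (θ := fun ξ => sstep (2 * ξ) - sstep ξ)
    ((hs.comp (by fun_prop)).sub (hs.comp (by fun_prop))) (a := 1 / 2) (b := 2) fun x hx => by
      rw [mem_Ioo, not_and_or, not_lt, not_lt] at hx
      rcases hx with hx | hx
      · rw [sstep_of_le (by linarith), sstep_of_le (by linarith), sub_zero]
      · rw [sstep_of_ge (by linarith), sstep_of_ge (by linarith), sub_self]
  obtain ⟨L, hL⟩ := exists_schwartz_fourier_eq (θ := fun ξ => 1 - sstep ξ - sstep (-ξ))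
    ((contDiff_const.sub (hs.comp (by fun_prop))).sub (hs.comp (by fun_prop))) (a := -2) (b := 2)
    fun x hx => by
      rw [mem_Ioo, not_and_or, not_lt, not_lt] at hx
      rcases hx with hx | hx
      · rw [sstep_of_le (by linarith), sstep_of_ge (x := -x) (by linarith)]; simp
      · rw [sstep_of_ge (by linarith), sstep_of_le (x := -x) (by linarith)]; simp
  refine ⟨K, L, hK, K.isLPKernel (a := 1 / 2) (by norm_num) fun ξ hξ => ?_, fun ξ hξ => ?_⟩
  · rw [abs_lt] at hξ
    rw [hK, sstep_of_le (by linarith), sstep_of_le (by linarith), sub_zero, Complex.ofReal_zero]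
  · rw [hL, sstep_of_le (x := -ξ) (by linarith), sub_zero]

/-- The integers in `[-N, N)`. -/
noncomputable def scales (N : ℕ) : Finset ℤ := (Finset.range (2 * N)).image fun i : ℕ => (i : ℤ) - N

lemma sum_scales (N : ℕ) (ξ : ℝ) :
    ∑ k ∈ scales N, (sstep (2 * (2 ^ (-k) * ξ)) - sstep (2 ^ (-k) * ξ)) =
      sstep (2 ^ (N + 1) * ξ) - sstep (2 / 2 ^ N * ξ) := by
  rw [scales, Finset.sum_image fun a _ b _ h => by simpa using h]
  have h2 : (2:ℝ) ≠ 0 := two_ne_zero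
  convert Finset.sum_range_sub' (fun i : ℕ => sstep ((2:ℝ) ^ ((N:ℤ) + 1 - i) * ξ)) (2 * N) using 3
    with i hi
  · rw [← mul_assoc]; congr 2
    rw [← zpow_one_add₀ h2]; congr 1; ring
  · congr 3; push_cast; ring
  · simp [← zpow_natCast]
  · rw [← zpow_natCast, div_eq_mul_inv, ← zpow_neg, ← zpow_one_add₀ h2]
    congr 2; push_cast; ring

lemma tendsto_sstep (ξ : ℝ) : Filter.Tendsto
    (fun N : ℕ => sstep (2 ^ (N + 1) * ξ) - sstep (2 / 2 ^ N * ξ)) .atTop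
    (nhds ((Ioi 0).indicator 1 ξ)) := by
  have hN (N : ℕ) : (N:ℝ) ≤ 2 ^ N := mod_cast Nat.lt_two_pow_self.le
  refine tendsto_const_nhds.congr' ?_
  filter_upwards [Filter.eventually_ge_atTop (⌈ξ⁻¹⌉₊ + ⌈2 * ξ⌉₊)] with N hN'
  have h1 : ξ⁻¹ ≤ 2 ^ N := ((Nat.le_ceil _).trans (mod_cast (by omega))).trans (hN N)
  have h2 : 2 * ξ ≤ 2 ^ N := ((Nat.le_ceil _).trans (mod_cast (by omega))).trans (hN N)
  rw [sstep_of_le (x := _ / _ * _) (by rw [div_mul_eq_mul_div]; exact div_le_one_of_le₀ h2 (by positivity)), sub_zero]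
  by_cases hξ : 0 < ξ
  · rw [indicator_of_mem (mem_Ioi.2 hξ), sstep_of_ge, Pi.one_apply]
    rw [inv_le_iff_one_le_mul₀ hξ] at h1
    rw [pow_succ]; linarith
  · rw [indicator_of_notMem (by simpa using hξ), sstep_of_le]
    nlinarith [show (0:ℝ) < 2 ^ (N + 1) by positivity]

lemma norm_sstep_sub_le (x y : ℝ) : ‖((sstep x - sstep y : ℝ) : ℂ)‖ ≤ 1 := by
  have h0 := fun x => Real.smoothTransition.nonneg x
  have h1 := fun x => Real.smoothTransition.le_one x
  rw [Complex.norm_real]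
  exact abs_le.2 ⟨by linarith [h0 (x - 1), h1 (y - 1), sstep.eq_1 x, sstep.eq_1 y],
    by linarith [h1 (x - 1), h0 (y - 1), sstep.eq_1 x, sstep.eq_1 y]⟩

lemma Integrable.sstep_mul {G : ℝ → ℂ} (hG : Integrable G) (a b : ℝ) :
    Integrable fun ξ => ((sstep (a * ξ) - sstep (b * ξ) : ℝ) : ℂ) * G ξ := by
  have h : Continuous sstep := Real.smoothTransition.continuous.comp (by fun_prop)
  exact hG.bdd_mul (c := 1) (by fun_prop) (ae_of_all _ fun ξ => norm_sstep_sub_le _ _)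

lemma tendsto_invF_sstep {G : ℝ → ℂ} (hG : Integrable G) (x : ℝ) : Filter.Tendsto
    (fun N : ℕ => invF (fun ξ => ((sstep (2 ^ (N + 1) * ξ) - sstep (2 / 2 ^ N * ξ) : ℝ) : ℂ) * G ξ) x)
    .atTop (nhds (invF ((Ioi 0).indicator G) x)) := by
  refine tendsto_integral_of_dominated_convergence (fun ξ => ‖G ξ‖) (fun N =>
    (Integrable.mul_ech (Integrable.sstep_mul hG _ _) x).aestronglyMeasurable) hG.norm
    (fun N => ae_of_all _ fun ξ => ?_) (ae_of_all _ fun ξ => ?_)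
  · rw [norm_mul, norm_ech, mul_one, norm_mul]
    exact mul_le_of_le_one_left (norm_nonneg _) (norm_sstep_sub_le _ _)
  · convert! (((Complex.continuous_ofReal.tendsto _).comp (tendsto_sstep ξ)).mul_const
      (G ξ)).mul_const (ech (x * ξ)) using 3
    by_cases h : ξ ∈ Ioi 0 <;> simp [h]

lemma sqInt_indicator_Ioi {p : ℝ} (hp : 1 < p) : ∃ C : ℝ≥0∞, C ≠ ∞ ∧ ∀ (n : ℕ) (a : ℕ → ℝ)
    (G : ℕ → ℝ → ℂ), (∀ j, Integrable (G j)) →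
      sqInt n p (fun j => invF ((Ioi (a j)).indicator (G j))) ≤ C * sqInt n p fun j => invF (G j) := by
  obtain ⟨K, L, hK, ⟨B, hB⟩, -⟩ := exists_lp_partition
  obtain ⟨C, hC, h⟩ := lpKernel_strong_of_bound hp B
  refine ⟨C, hC, fun n a G hG => ?_⟩
  let H (j : ℕ) (ξ : ℝ) : ℂ := G j (ξ + a j)
  have hH (j) : Integrable (H j) := (hG j).comp_add_right (a j)
  have e1 (j : ℕ) (x : ℝ) : ‖invF ((Ioi (a j)).indicator (G j)) x‖ₑ =
      ‖invF ((Ioi 0).indicator (H j)) x‖ₑ := by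
    rw [← enorm_invF_comp_add _ (a j)]
    congr 2; ext ξ
    simp [indicator, H]
  have hE (u : ℕ → ℝ → ℂ) : sqInt n p u = ∫⁻ x, ‖WithLp.toLp 2 (fun i : Fin n => u i x)‖ₑ ^ p := by
    simp_rw [EuclideanSpace.enorm_rpow, sqInt, Finset.sum_range]
  have e2 (j : ℕ) (x : ℝ) : ‖invF (G j) x‖ₑ = ‖invF (H j) x‖ₑ := (enorm_invF_comp_add _ (a j) x).symm
  simp only [sqInt, e1, e2]
  change sqInt n p (fun j => invF ((Ioi 0).indicator (H j))) ≤ C * sqInt n p fun j => invF (H j)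
  rw [hE, hE]
  set f : ℝ → EuclideanSpace ℂ (Fin n) := fun x => WithLp.toLp 2 fun i : Fin n => invF (H i) x
  have hf : Continuous f := (PiLp.continuous_toLp 2 _).comp
    (continuous_pi fun i => continuous_invF (hH i))
  have hD (x : ℝ) : ‖f x‖ ≤ ∑ i : Fin n, ∫ ξ, ‖H i ξ‖ := by
    refine le_trans ?_ (Finset.sum_le_sum fun i _ => norm_invF_le (H i) x)
    rw [EuclideanSpace.norm_eq]
    exact Real.sqrt_le_iff.2 ⟨by positivity, Finset.sum_sq_le_sq_sum_of_nonneg fun _ _ => norm_nonneg _⟩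
  have hc (N : ℕ) : convOp (lpKernel K (scales N) fun _ => ContinuousLinearMap.id ℂ _) f =
      fun x => WithLp.toLp 2 fun i : Fin n =>
        invF (fun ξ => ((sstep (2 ^ (N + 1) * ξ) - sstep (2 / 2 ^ N * ξ) : ℝ) : ℂ) * H i ξ) x := by
    ext x i
    refine ((EuclideanSpace.proj (𝕜 := ℂ) i).integral_comp_comm ((hB.isConvKernel (scales N)
      _).integrable_apply_of_bound hf.stronglyMeasurable hD x)).symm.trans ?_
    have h1 : Integrable fun x => ∑ k ∈ scales N, (2 : ℂ) ^ k * K ((2 : ℝ) ^ k * x) :=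
      integrable_finsetSum _ fun k _ => hB.integrable_dilate k
    have h3 (ξ : ℝ) : 𝓕 (fun x => ∑ k ∈ scales N, (2 : ℂ) ^ k * K ((2 : ℝ) ^ k * x)) ξ =
        ((sstep (2 ^ (N + 1) * ξ) - sstep (2 / 2 ^ N * ξ) : ℝ) : ℂ) := by
      have h4 (k : ℤ) : Integrable fun v => ech (-(v * ξ)) * ((2 : ℂ) ^ k * K ((2 : ℝ) ^ k * v)) :=
        (hB.integrable_dilate k).bdd_mul (c := 1)
          (continuous_ech.comp (by fun_prop)).aestronglyMeasurable
          (ae_of_all _ fun ξ => (norm_ech _).le)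
      rw [← sum_scales, Complex.ofReal_sum]
      simp_rw [← hK, ← IsLPKernel.fourier_dilate]
      simp only [fourier_eq_ech, Finset.mul_sum]
      exact integral_finsetSum _ fun k _ => h4 k
    have h2 := congrFun (sconv_invF h1 (hH i)) x
    simp_rw [h3] at h2
    rw [PiLp.toLp_apply, ← h2]
    simp [lpKernel, sconv, f, Finset.sum_mul]
  refine lintegral_rpow_le_of_tendsto (F := fun N => convOp (lpKernel K (scales N)
    fun _ => ContinuousLinearMap.id ℂ _) f) (fun N => ?_) (fun N =>
    h _ _ K (scales N) _ hB (fun _ => ContinuousLinearMap.norm_id_le) f _ hf.stronglyMeasurable hD)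
    fun x => ?_
  · rw [hc]
    exact ((PiLp.continuous_toLp 2 _).comp
      (continuous_pi fun i : Fin n =>
      continuous_invF (Integrable.sstep_mul (hH i) (2 ^ (N + 1)) (2 / 2 ^ N)))).measurable
  · simp_rw [hc]
    exact ((PiLp.continuous_toLp 2 _).tendsto _).comp (tendsto_pi_nhds.2 fun i =>
      tendsto_invF_sstep (hH i) x)

lemma MeasureTheory.Integrable.memLp_two {E : Type*} [NormedAddCommGroup E] {w : ℝ → E}
    (hw : Integrable w) {C : ℝ} (hC : ∀ x, ‖w x‖ ≤ C) : MemLp w 2 volume := by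
  refine (memLp_two_iff_integrable_sq_norm hw.1).2 ((hw.norm.const_mul C).mono'
    (hw.1.norm.pow 2) (ae_of_all _ fun x => ?_))
  rw [norm_pow, norm_norm, sq]
  exact mul_le_mul_of_nonneg_right (hC x) (norm_nonneg _)

lemma sum_enorm_fourier_sq_le {w : ℝ → ℂ} (h1 : Integrable w) (h2 : MemLp w 2 volume)
    (h1' : Integrable fun u : ℝ => (-2 * Real.pi * Complex.I * u) • w u)
    (h2' : MemLp (fun u : ℝ => (-2 * Real.pi * Complex.I * u) • w u) 2 volume) (s : Finset ℤ) :
    ∑ j ∈ s, ‖𝓕 w j‖ₑ ^ 2 ≤ ∫⁻ u : ℝ, 4 * (‖w u‖ₑ ^ 2 + ‖(-2 * Real.pi * Complex.I * u) • w u‖ₑ ^ 2) := by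
  set F' := 𝓕 fun u : ℝ => (-2 * Real.pi * Complex.I * u) • w u with hF'
  have hd (ξ : ℝ) : HasDerivAt (𝓕 w) (F' ξ) ξ := Real.hasDerivAt_fourier h1
    ((h1'.norm.const_mul (2 * Real.pi)⁻¹).mono' (continuous_id.aestronglyMeasurable.smul h1.1)
      (ae_of_all _ fun u => le_of_eq <| by
        simp [abs_of_pos Real.pi_pos]; field_simp)) ξ
  have hc := continuous_fourier_of_integrable h1
  have hc' : Continuous F' := continuous_fourier_of_integrable h1'
  have hm : Measurable fun t => 4 * (‖𝓕 w t‖ₑ ^ 2 + ‖F' t‖ₑ ^ 2) := by fun_prop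
  have key (j : ℤ) : ‖𝓕 w j‖ₑ ^ 2 ≤ ∫⁻ t in Ico (j:ℝ) (j + 1), 4 * (‖𝓕 w t‖ₑ ^ 2 + ‖F' t‖ₑ ^ 2) := by
    have e : ∫ t in (j:ℝ)..j + 1, (((j + 1 - t : ℝ) : ℂ) * F' t - 𝓕 w t) = - 𝓕 w j := by
      rw [intervalIntegral.integral_eq_sub_of_hasDerivAt (f := fun t => ((j + 1 - t : ℝ) : ℂ) * 𝓕 w t)]
      · simp
      · intro t _
        have := (((hasDerivAt_id t).const_sub (j + 1 : ℝ)).ofReal_comp).mul (hd t)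
        convert! this using 1
        simp; ring
      · exact Continuous.intervalIntegrable (by fun_prop) _ _
    have h : ‖𝓕 w j‖ₑ ≤ ∫⁻ t in Ico (j:ℝ) (j + 1), (‖𝓕 w t‖ₑ + ‖F' t‖ₑ) := by
      rw [← enorm_neg, ← e, intervalIntegral.integral_of_le (by linarith), ← integral_Ico_eq_integral_Ioc (μ := volume)]
      refine (enorm_integral_le_lintegral_enorm _).trans (setLIntegral_mono' measurableSet_Ico fun t ht => ?_)
      refine enorm_sub_le.trans ?_
      rw [add_comm, enorm_mul]
      gcongr
      refine mul_le_of_le_one_left zero_le ?_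
      rw [← ofReal_norm, Complex.norm_real, ENNReal.ofReal_le_one]
      exact abs_le.2 ⟨by linarith [ht.2], by linarith [ht.1]⟩
    have hI : IsProbabilityMeasure (volume.restrict (Ico (j:ℝ) (j + 1))) := ⟨by simp⟩
    have := eLpNorm'_le_eLpNorm'_mul_rpow_measure_univ (μ := volume.restrict (Ico (j:ℝ) (j + 1)))
      (f := fun t => ‖𝓕 w t‖ₑ + ‖F' t‖ₑ) one_pos one_le_two (by fun_prop)
    simp only [eLpNorm', ENNReal.rpow_one, enorm_eq_self, div_one, measure_univ, ENNReal.one_rpow, mul_one] at this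
    refine (pow_le_pow_left₀ zero_le (h.trans this) 2).trans ?_
    rw [← ENNReal.rpow_two, ← ENNReal.rpow_mul, one_div_mul_cancel two_ne_zero, ENNReal.rpow_one]
    refine lintegral_mono fun t => (ENNReal.add_rpow_le' _ _ zero_le_two).trans_eq ?_
    norm_num
  calc _ ≤ ∑ j ∈ s, ∫⁻ t in Ico (j:ℝ) (j + 1), 4 * (‖𝓕 w t‖ₑ ^ 2 + ‖F' t‖ₑ ^ 2) :=
        Finset.sum_le_sum fun j _ => key j
    _ = ∫⁻ t in ⋃ j ∈ s, Ico (j:ℝ) (j + 1), 4 * (‖𝓕 w t‖ₑ ^ 2 + ‖F' t‖ₑ ^ 2) :=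
        (lintegral_biUnion_finset (fun i _ j _ h => pairwise_disjoint_Ico_intCast ℝ h)
          (fun _ _ => measurableSet_Ico) _).symm
    _ ≤ _ := setLIntegral_le_lintegral _ _
    _ = _ := by
      rw [lintegral_const_mul' _ _ (by simp), lintegral_const_mul' _ _ (by simp),
        lintegral_add_left (by fun_prop), lintegral_add_left' (h1.1.enorm.pow_const 2),
        lintegral_fourier_sq h1 h2, hF', lintegral_fourier_sq h1' h2']

lemma rubio_de_francia (φ : 𝓢(ℝ, ℂ)) {p : ℝ} (hp : 2 ≤ p) : ∃ C : ℝ≥0∞, C ≠ ∞ ∧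
    ∀ (s : Finset ℤ) (f : ℝ → ℂ) (D : ℝ), StronglyMeasurable f → (∀ x, ‖f x‖ ≤ D) →
      ∫⁻ x, (∑ j ∈ s, ‖sconv (modKernel φ 0 j) f x‖ₑ ^ 2) ^ (p / 2) ≤ C * ∫⁻ x, ‖f x‖ₑ ^ p := by
  let ψ (u : ℝ) : ℂ := φ (-u)
  obtain ⟨A, hA0, hA, -⟩ := φ.exists_decay 1
  have hA' (u : ℝ) : (1 + |u|) * ‖ψ u‖ ≤ A := by
    have h := hA (-u)
    rw [pow_one, abs_neg, ← div_eq_mul_inv, le_div_iff₀' (by positivity)] at h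
    exact h
  have hψc : Continuous ψ := φ.continuous.comp continuous_neg
  have hψ : Integrable ψ := φ.integrable.comp_neg
  have hψA (u : ℝ) : ‖ψ u‖ ≤ A := by
    nlinarith [hA' u, mul_nonneg (abs_nonneg u) (norm_nonneg (ψ u))]
  have hn (u : ℝ) : ‖(-2 * Real.pi * Complex.I * u) • ψ u‖ = 2 * Real.pi * (|u| * ‖ψ u‖) := by
    simp [abs_of_pos Real.pi_pos, mul_assoc]
  have hψc' : Continuous fun u : ℝ => (-2 * Real.pi * Complex.I * u) • ψ u := by fun_prop
  have hψ' : Integrable fun u : ℝ => (-2 * Real.pi * Complex.I * u) • ψ u := by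
    refine ((φ.integrable_pow_mul volume 1).comp_neg.const_mul (2 * Real.pi)).mono'
      hψc'.aestronglyMeasurable (ae_of_all _ fun u => (hn u).trans_le ?_)
    simp [ψ]
  have hψA' (u : ℝ) : ‖(-2 * Real.pi * Complex.I * u) • ψ u‖ ≤ 2 * Real.pi * A := by
    rw [hn]
    gcongr
    linarith [hA' u, norm_nonneg (ψ u)]
  let V (u : ℝ) : ℝ≥0∞ := 4 * (‖ψ u‖ₑ ^ 2 + ‖(-2 * Real.pi * Complex.I * u) • ψ u‖ₑ ^ 2)
  have hfin {w : ℝ → ℂ} (hw : MemLp w 2 volume) : ∫⁻ u, ‖w u‖ₑ ^ 2 < ∞ := by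
    simpa [HasFiniteIntegral] using (hw.integrable_norm_pow two_ne_zero).2
  have hV : ∫⁻ u, V u ≠ ∞ := by
    rw [lintegral_const_mul' _ _ (by simp), lintegral_add_left (by fun_prop)]
    exact ENNReal.mul_ne_top (by simp) (ENNReal.add_ne_top.2
      ⟨(hfin (hψ.memLp_two hψA)).ne, (hfin (hψ'.memLp_two hψA')).ne⟩)
  have hVm : Measurable V := by fun_prop
  have : IsFiniteMeasure (volume.withDensity V) := isFiniteMeasure_withDensity hV
  refine ⟨(∫⁻ u, V u) ^ (p / 2), by finiteness, fun s f D hf hD => ?_⟩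
  have h1 (x : ℝ) : ∑ j ∈ s, ‖sconv (modKernel φ 0 j) f x‖ₑ ^ 2 ≤
      ∫⁻ u, ‖f (x + u)‖ₑ ^ 2 ∂volume.withDensity V := by
    have hfm : StronglyMeasurable fun u => f (x + u) := hf.comp_measurable (by fun_prop)
    have e (j : ℤ) : sconv (modKernel φ 0 j) f x = 𝓕 (fun u => ψ u * f (x + u)) j := by
      rw [fourier_eq_ech, sconv, ← integral_add_left_eq_self _ x]
      refine integral_congr_ae (ae_of_all _ fun u => ?_)
      simp [modKernel, ψ]; ring
    have h2 : (fun u : ℝ => (-2 * Real.pi * Complex.I * u) • (ψ u * f (x + u))) =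
        fun u : ℝ => (-2 * Real.pi * Complex.I * u) • ψ u * f (x + u) := by
      ext u; simp; ring
    have hi {w : ℝ → ℂ} (hw : Integrable w) {C : ℝ} (hC : ∀ u, ‖w u‖ ≤ C) :
        Integrable (fun u => w u * f (x + u)) ∧ MemLp (fun u => w u * f (x + u)) 2 volume := by
      have h := hw.mul_bdd (c := D) hfm.aestronglyMeasurable (ae_of_all _ fun u => hD (x + u))
      refine ⟨h, h.memLp_two (C := C * D) fun u => ?_⟩
      rw [norm_mul]
      gcongr
      exacts [(norm_nonneg _).trans (hC u), hC u, hD _]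
    simp_rw [e]
    refine (sum_enorm_fourier_sq_le (hi hψ hψA).1 (hi hψ hψA).2 ?_ ?_ s).trans_eq ?_
    · rw [h2]; exact (hi hψ' hψA').1
    · rw [h2]; exact (hi hψ' hψA').2
    rw [lintegral_withDensity_eq_lintegral_mul _ hVm (hfm.measurable.enorm.pow_const 2)]
    refine lintegral_congr fun u => ?_
    rw [congrFun h2 u]
    simp only [V, Pi.mul_apply, enorm_mul]; ring
  refine (lintegral_mono fun x => ENNReal.rpow_le_rpow (h1 x) (by linarith)).trans
    ((lintegral_lintegral_rpow_le (F := fun u x => ‖f (x + u)‖ₑ ^ 2) (B := ∫⁻ x, ‖f x‖ₑ ^ p)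
      (by linarith) ?_ (ae_of_all _ fun u => ?_)).trans_eq ?_)
  · exact (hf.measurable.comp (measurable_snd.add measurable_fst)).enorm.pow_const 2
  · simp_rw [← ENNReal.rpow_two, ← ENNReal.rpow_mul, mul_div_cancel₀ p two_ne_zero]
    exact (lintegral_add_right_eq_self (fun x => ‖f x‖ₑ ^ p) u).le
  · simp

lemma IsWiener.eq_invF {f : ℝ → ℂ} (hf : IsWiener f) : invF (𝓕 f) = f :=
  funext fun x => (hf.eq_integral x).symm

lemma invF_congr {F G : ℝ → ℂ} (h : F =ᵐ[volume] G) : invF F = invF G :=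
  funext fun x => integral_congr_ae (by filter_upwards [h] with ξ e using by rw [e])

lemma invF_indicator {s : Set ℝ} (hs : MeasurableSet s) (F : ℝ → ℂ) (x : ℝ) :
    invF (s.indicator F) x = ∫ ξ in s, F ξ * ech (x * ξ) := by
  rw [invF, ← integral_indicator hs]
  refine integral_congr_ae (ae_of_all _ fun ξ => ?_)
  by_cases h : ξ ∈ s <;> simp [h]

/-- Carleson's theorem for finitely many cut-off frequencies. -/
lemma carleson_sup {p : ℝ} (hp : 3 / 2 < p) : ∃ A : ℝ≥0∞, A ≠ ∞ ∧ ∀ (n : ℕ) (b : ℕ → ℝ)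
    (f : ℝ → ℂ), IsWiener f → ∃ U : ℝ → ℝ≥0∞, Measurable U ∧
      (∀ j < n, ∀ x, ‖invF ((Iio (b j)).indicator (𝓕 f)) x‖ₑ ≤ U x) ∧
      ∫⁻ x, U x ^ p ≤ A * ∫⁻ x, ‖f x‖ₑ ^ p := by
  obtain ⟨A, hA, h⟩ := carleson hp
  refine ⟨A, hA, fun n b f hf => ?_⟩
  simp_rw [invF_indicator measurableSet_Iio]
  let c (t x : ℝ) : ℂ := ∫ ξ in Iio t, 𝓕 f ξ * ech (x * ξ)
  have hm {N : ℝ → ℝ} (hN : Measurable N) : Measurable fun x => ‖c (N x) x‖ₑ := by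
    have := hf.measurable_symOp (σ := fun x ξ => {z : ℝ × ℝ | z.2 < N z.1}.indicator 1 (x, ξ))
      (measurable_one.indicator (measurableSet_lt measurable_snd (hN.comp measurable_fst)))
      measurable_id
    refine Measurable.enorm (f := fun x => c (N x) x) ?_
    convert! this using 2 with x
    refine (integral_indicator measurableSet_Iio).symm.trans ?_
    refine integral_congr_ae (ae_of_all _ fun ξ => ?_)
    by_cases h : ξ < N x <;> simp [h]
  suffices ∃ N : ℝ → ℝ, Measurable N ∧ ∀ j < n, ∀ x, ‖c (b j) x‖ₑ ≤ ‖c (N x) x‖ₑ by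
    obtain ⟨N, hN, hj⟩ := this
    exact ⟨_, hm hN, hj, h N f hN hf⟩
  clear h
  induction n with
  | zero => exact ⟨0, measurable_zero, by simp⟩
  | succ n ih =>
    obtain ⟨N, hN, hj⟩ := ih
    classical
    refine ⟨fun x => if ‖c (N x) x‖ₑ < ‖c (b n) x‖ₑ then b n else N x,
      Measurable.ite (measurableSet_lt (hm hN) (hm measurable_const)) measurable_const hN,
      fun j hj' x => ?_⟩
    dsimp only
    split_ifs with h
    · rcases Nat.lt_succ_iff_lt_or_eq.1 hj' with h' | rfl
      exacts [(hj j h' x).trans h.le, le_rfl]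
    · rcases Nat.lt_succ_iff_lt_or_eq.1 hj' with h' | rfl
      exacts [hj j h' x, not_lt.1 h]

lemma sqInt_indicator_Ico {p : ℝ} (hp : 1 < p) : ∃ C : ℝ≥0∞, C ≠ ∞ ∧ ∀ (n : ℕ) (a b : ℕ → ℝ)
    (G : ℕ → ℝ → ℂ), (∀ j, a j ≤ b j) → (∀ j, Integrable (G j)) →
      sqInt n p (fun j => invF ((Ico (a j) (b j)).indicator (G j))) ≤
        C * sqInt n p fun j => invF (G j) := by
  obtain ⟨C, hC, h⟩ := sqInt_indicator_Ioi hp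
  refine ⟨2 ^ (3 * p) * (C + C), by finiteness, fun n a b G hab hG => ?_⟩
  have hi (a : ℝ) (j) : Integrable ((Ioi a).indicator (G j)) := (hG j).indicator measurableSet_Ioi
  have e (j) : invF ((Ico (a j) (b j)).indicator (G j)) = fun x =>
      invF ((Ioi (a j)).indicator (G j)) x - invF ((Ioi (b j)).indicator (G j)) x := by
    ext x
    rw [← invF_sub (hi _ _) (hi _ _), ← indicator_sdiff (Ioi_subset_Ioi (hab j)), Ioi_sdiff_Ioi,
      invF_congr (indicator_ae_eq_of_ae_eq_set Ico_ae_eq_Ioc)]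
  simp_rw [e]
  refine (sqInt_sub_le n (by linarith) fun j => (continuous_invF (hi _ _)).measurable).trans ?_
  rw [mul_assoc, add_mul]
  exact mul_le_mul_right (add_le_add (h n a G hG) (h n b G hG)) _

lemma integral_invF_mul {F G H : ℝ → ℂ} (hF : Integrable F) (hG : Integrable G)
    (hH : Integrable H) : ∫ x, invF F x * invF G x * H x =
      ∫ ξ, F ξ * ∫ η, G η * 𝓕 H (-(ξ + η)) := by
  have h1 : Integrable fun x => invF G x * H x :=
    hH.bdd_mul (continuous_invF hG).aestronglyMeasurable (ae_of_all _ (norm_invF_le G))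
  have h2 := integral_ech_swap h1 hF 1
  simp only [one_mul] at h2
  refine (integral_congr_ae (ae_of_all _ fun x => ?_)).trans (h2.trans ?_)
  · rw [mul_comm (invF F x), ← invF]; ring
  congr! 3 with ξ
  have h3 := integral_ech_swap (Integrable.mul_ech hH ξ) hG 1
  simp only [one_mul] at h3
  refine (integral_congr_ae (ae_of_all _ fun x => ?_)).trans (h3.trans ?_)
  · rw [← invF, mul_comm x]; ring
  congr! 3 with η
  rw [fourier_eq_ech]
  congr! 2 with x
  rw [mul_assoc, ← ech_add, mul_comm]; congr 2; ring

lemma integral_invF_mul_sconv {F G H κ : ℝ → ℂ} (hF : Integrable F) (hG : Integrable G)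
    (hH : Integrable H) (hκ : Integrable κ)
    (h : ∀ ξ η, F ξ ≠ 0 → G η ≠ 0 → 𝓕 κ (-(ξ + η)) = 1) :
    ∫ x, invF F x * invF G x * H x = ∫ x, invF F x * invF G x * sconv κ H x := by
  rw [integral_invF_mul hF hG hH, integral_invF_mul hF hG (integrable_sconv hκ hH)]
  congr! 2 with ξ
  by_cases h1 : F ξ = 0
  · simp [h1]
  congr! 3 with η
  by_cases h2 : G η = 0
  · simp [h2]
  rw [fourier_sconv hκ hH, h ξ η h1 h2, one_mul]

lemma lintegral_sum_mul_le {p q r : ℝ} (hp : 0 < p) (hq : 0 < q) (hr : 0 < r)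
    (h : 1 / p + 1 / q + 1 / r = 1) {U : ℝ → ℝ≥0∞} (hU : Measurable U) {n : ℕ}
    {u v w : ℕ → ℝ → ℂ} (hu : ∀ j < n, ∀ x, ‖u j x‖ₑ ≤ U x) (hv : ∀ j, Measurable (v j))
    (hw : ∀ j, Measurable (w j)) :
    ∑ j ∈ Finset.range n, ‖∫ x, u j x * v j x * w j x‖ₑ ≤
      (∫⁻ x, U x ^ p) ^ (1 / p) * sqInt n q v ^ (1 / q) * sqInt n r w ^ (1 / r) := by
  have hm {v : ℕ → ℝ → ℂ} (hv : ∀ j, Measurable (v j)) (q : ℝ) :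
      Measurable fun x => (∑ j ∈ Finset.range n, ‖v j x‖ₑ ^ 2) ^ (q / 2) :=
    (Finset.measurable_fun_sum _ fun j _ => (hv j).enorm.pow_const 2).pow_const _
  have hol := ENNReal.lintegral_prod_norm_pow_le (μ := volume) (Finset.univ : Finset (Fin 3))
    (f := ![fun x => U x ^ p, fun x => (∑ j ∈ Finset.range n, ‖v j x‖ₑ ^ 2) ^ (q / 2),
      fun x => (∑ j ∈ Finset.range n, ‖w j x‖ₑ ^ 2) ^ (r / 2)]) (p := ![1 / p, 1 / q, 1 / r])
    (fun i _ => by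
      fin_cases i
      exacts [(hU.pow_const p).aemeasurable, (hm hv q).aemeasurable, (hm hw r).aemeasurable])
    (by simpa [Fin.sum_univ_three] using h)
    (fun i _ => by fin_cases i <;> simp <;> positivity)
  simp only [Fin.prod_univ_three, Matrix.cons_val_zero, Matrix.cons_val_one, Matrix.cons_val] at hol
  refine le_trans ?_ hol
  calc _ ≤ ∑ j ∈ Finset.range n, ∫⁻ x, ‖u j x * v j x * w j x‖ₑ :=
        Finset.sum_le_sum fun j _ => enorm_integral_le_lintegral_enorm _
    _ ≤ ∑ j ∈ Finset.range n, ∫⁻ x, U x * (‖v j x‖ₑ * ‖w j x‖ₑ) :=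
        Finset.sum_le_sum fun j hj => lintegral_mono fun x => by
          rw [enorm_mul, enorm_mul, mul_assoc]
          exact mul_le_mul_left (hu j (Finset.mem_range.1 hj) x) _
    _ = ∫⁻ x, ∑ j ∈ Finset.range n, U x * (‖v j x‖ₑ * ‖w j x‖ₑ) :=
        (lintegral_finsetSum _ fun j _ => hU.mul ((hv j).enorm.mul (hw j).enorm)).symm
    _ ≤ _ := lintegral_mono fun x => by
        rw [← Finset.mul_sum, ← ENNReal.rpow_mul, ← ENNReal.rpow_mul, ← ENNReal.rpow_mul,
          mul_one_div_cancel hp.ne', ENNReal.rpow_one, mul_assoc,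
          show q / 2 * (1 / q) = 1 / 2 by field_simp, show r / 2 * (1 / r) = 1 / 2 by field_simp]
        exact mul_le_mul_right (sum_mul_le_sqrt _ _ _) _

lemma sqInt_sconv_dilate {K : 𝓢(ℝ, ℂ)} (hK : ∃ B, IsLPKernel K B) {p : ℝ} (hp : 1 < p) :
    ∃ C : ℝ≥0∞, C ≠ ∞ ∧ ∀ (n : ℕ) (m : ℕ → ℤ) (f : ℝ → ℂ) (D : ℝ), m.Injective →
      StronglyMeasurable f → (∀ x, ‖f x‖ ≤ D) →
      sqInt n p (fun j => sconv (dilate K (m j)) f) ≤ C * ∫⁻ x, ‖f x‖ₑ ^ p := by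
  obtain ⟨B, hB⟩ := hK
  obtain ⟨C, hC, h⟩ := lpKernel_square hp B
  refine ⟨C, hC, fun n m f D hm hf hD => (lintegral_mono fun x => ?_).trans
    (h K ((Finset.range n).image m) hB f D hf hD)⟩
  rw [Finset.sum_image hm.injOn]

lemma sqInt_sconv_modKernel (φ : 𝓢(ℝ, ℂ)) {p : ℝ} (hp : 2 ≤ p) :
    ∃ C : ℝ≥0∞, C ≠ ∞ ∧ ∀ (n : ℕ) (m : ℕ → ℤ) (f : ℝ → ℂ) (D : ℝ), m.Injective →
      StronglyMeasurable f → (∀ x, ‖f x‖ ≤ D) →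
      sqInt n p (fun j => sconv (modKernel φ 0 (m j)) f) ≤ C * ∫⁻ x, ‖f x‖ₑ ^ p := by
  obtain ⟨C, hC, h⟩ := rubio_de_francia φ hp
  refine ⟨C, hC, fun n m f D hm hf hD => (lintegral_mono fun x => ?_).trans
    (h ((Finset.range n).image m) f D hf hD)⟩
  rw [Finset.sum_image hm.injOn]

lemma integrable_fourier_mul {κ G : ℝ → ℂ} (hκ : Integrable κ) (hG : Integrable G) :
    Integrable fun ξ => 𝓕 κ ξ * G ξ :=
  hG.bdd_mul (c := ∫ x, ‖κ x‖) (continuous_fourier_of_integrable hκ).aestronglyMeasurable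
    (ae_of_all _ fun _ => VectorFourier.norm_fourierIntegral_le_integral_norm ..)

lemma sqInt_indicator_Ico_sconv {p : ℝ} (hp : 1 < p) : ∃ C : ℝ≥0∞, C ≠ ∞ ∧ ∀ (n : ℕ)
    (a b : ℕ → ℝ) (κ : ℕ → ℝ → ℂ) (f : ℝ → ℂ), (∀ j, a j ≤ b j) → (∀ j, Integrable (κ j)) →
      IsWiener f →
      sqInt n p (fun j => invF ((Ico (a j) (b j)).indicator fun ξ => 𝓕 (κ j) ξ * 𝓕 f ξ)) ≤
        C * sqInt n p fun j => sconv (κ j) f := by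
  obtain ⟨C, hC, h⟩ := sqInt_indicator_Ico hp
  refine ⟨C, hC, fun n a b κ f hab hκ hf => (h n a b _ hab fun j =>
    integrable_fourier_mul (hκ j) hf.fint).trans_eq ?_⟩
  simp_rw [← sconv_invF (hκ _) hf.fint, hf.eq_invF]

/-- The maximal function of the one-sided frequency truncations at lacunary frequencies. -/
lemma lacunary_sup {p : ℝ} (hp : 1 < p) : ∃ A : ℝ≥0∞, A ≠ ∞ ∧ ∀ (n : ℕ) (f : ℝ → ℂ),
    IsWiener f → ∃ U : ℝ → ℝ≥0∞, Measurable U ∧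
      (∀ j < n, ∀ x, ‖invF ((Ici ((2:ℝ) ^ j)⁻¹).indicator (𝓕 f)) x‖ₑ ≤ U x) ∧
      ∫⁻ x, U x ^ p ≤ A * ∫⁻ x, ‖f x‖ₑ ^ p := by
  obtain ⟨K, L, hK, hKB, hL⟩ := exists_lp_partition
  obtain ⟨D, hD0, hD, -⟩ := L.exists_decay 2
  obtain ⟨C₁, hC₁, h₁⟩ := sqInt_indicator_Ioi hp
  obtain ⟨C₂, hC₂, h₂⟩ := maxFn.strong hp
  obtain ⟨C₃, hC₃, h₃⟩ := sqInt_indicator_Ico_sconv hp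
  obtain ⟨C₄, hC₄, h₄⟩ := sqInt_sconv_dilate hKB hp
  have hp0 : 0 ≤ p := by linarith
  have hc : ENNReal.ofReal D * 32 ≠ ∞ := by finiteness
  refine ⟨2 ^ p * (2 ^ p * (C₁ + (ENNReal.ofReal D * 32) ^ p * (C₂ * C₁)) + C₃ * C₄), ?_,
    fun n f hf => ?_⟩
  · finiteness
  let f₀ := invF ((Ioi 0).indicator (𝓕 f))
  have hi₀ : Integrable ((Ioi 0).indicator (𝓕 f)) := hf.fint.indicator measurableSet_Ioi
  have hf₀ : Continuous f₀ := continuous_invF hi₀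
  have hf₀p : ∫⁻ x, ‖f₀ x‖ₑ ^ p ≤ C₁ * ∫⁻ x, ‖f x‖ₑ ^ p := by
    have := h₁ 1 0 (fun _ => 𝓕 f) fun _ => hf.fint
    rwa [sqInt_one, sqInt_one, hf.eq_invF] at this
  let κ (j : ℕ) := dilate K (-(j : ℤ))
  have hκ (j) : Integrable (κ j) := hKB.choose_spec.integrable_dilate _
  have hFκ (j : ℕ) (ξ : ℝ) : 𝓕 (κ j) ξ = 𝓕 (K : ℝ → ℂ) (2 ^ j * ξ) :=
    (IsLPKernel.fourier_dilate K (-(j : ℤ)) ξ).trans (by simp)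
  let h (j : ℕ) := invF ((Ico ((2:ℝ) ^ j)⁻¹ (2 * ((2:ℝ) ^ j)⁻¹)).indicator fun ξ => 𝓕 (κ j) ξ * 𝓕 f ξ)
  have hhp : sqInt n p h ≤ C₃ * C₄ * ∫⁻ x, ‖f x‖ₑ ^ p := by
    refine (h₃ n _ _ κ f (fun j => ?_) hκ hf).trans ?_
    · linarith [show 0 < ((2:ℝ) ^ j)⁻¹ by positivity]
    rw [mul_assoc]
    exact mul_le_mul_right (h₄ n _ f _ (fun i j hij => by simpa using hij)
      hf.cont.stronglyMeasurable hf.norm_le) _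
  have hih (j) : Integrable ((Ico ((2:ℝ) ^ j)⁻¹ (2 * ((2:ℝ) ^ j)⁻¹)).indicator
      fun ξ => 𝓕 (κ j) ξ * 𝓕 f ξ) := (integrable_fourier_mul (hκ j) hf.fint).indicator
        measurableSet_Ico
  have hhm (j) : Measurable (h j) := (continuous_invF (hih j)).measurable
  let l (j : ℕ) := sconv (modKernel L j 0) f₀
  let S (x : ℝ) : ℝ≥0∞ := (∑ j ∈ Finset.range n, ‖h j x‖ₑ ^ 2) ^ (1 / 2 : ℝ)
  have hS : Measurable S :=
    (Finset.measurable_fun_sum _ fun j _ => (hhm j).enorm.pow_const 2).pow_const _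
  have key (j : ℕ) (x : ℝ) : invF ((Ici ((2:ℝ) ^ j)⁻¹).indicator (𝓕 f)) x = f₀ x - (l j x - h j x) := by
    have hl : Integrable (modKernel L j 0) := integrable_modKernel L.integrable L.continuous j 0
    have hil := integrable_fourier_mul hl hi₀
    simp only [l, f₀, h]
    rw [sconv_invF hl hi₀, ← invF_sub hil (hih j), ← invF_sub hi₀ (hil.sub (hih j))]
    refine congrFun (invF_congr (.of_forall fun ξ => ?_)) x
    have h2 : (0:ℝ) < 2 ^ j := by positivity
    have e1 : ((2:ℝ) ^ j)⁻¹ ≤ ξ ↔ 1 ≤ 2 ^ j * ξ := by rw [inv_le_iff_one_le_mul₀' h2]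
    have e2 : ξ < 2 * ((2:ℝ) ^ j)⁻¹ ↔ 2 ^ j * ξ < 2 := by
      rw [← div_eq_mul_inv, lt_div_iff₀ h2, mul_comm]
    simp only [Pi.sub_apply, indicator, mem_Ici, mem_Ioi, mem_Ico, hFκ, fourier_modKernel,
      sub_zero, zpow_natCast, e1, e2, hK]
    rcases le_or_gt ξ 0 with h0 | h0
    · simp [h0.not_gt, (mul_nonpos_of_nonneg_of_nonpos h2.le h0).trans_lt zero_lt_one |>.not_ge]
    rw [hL _ (mul_pos h2 h0).le]
    rcases lt_or_ge (2 ^ j * ξ) 1 with h1 | h1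
    · simp [h1.not_ge, h0, sstep_of_le h1.le]
    rcases lt_or_ge (2 ^ j * ξ) 2 with h3 | h3
    · simp only [h1, h0, h3, if_true, and_self, sstep_of_ge (show 2 ≤ 2 * (2 ^ j * ξ) by linarith)]
      push_cast; ring
    · simp [h3.not_gt, h0, h1, sstep_of_ge h3]
  refine ⟨fun x => (‖f₀ x‖ₑ + ENNReal.ofReal D * 32 * maxFn (fun y => ‖f₀ y‖ₑ) x) + S x,
    by have := maxFn.measurable (fun y => ‖f₀ y‖ₑ); fun_prop, fun j hj x => ?_, ?_⟩
  · rw [key]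
    refine (enorm_sub_le.trans (add_le_add le_rfl (enorm_sub_le.trans (add_le_add ?_ ?_)))).trans_eq
      (add_assoc _ _ _).symm
    · rw [mul_assoc]
      exact enorm_sconv_modKernel_le hD0 hD j 0 hf₀.measurable (by simp)
    · rw [← ENNReal.rpow_le_rpow_iff (z := 2) (by norm_num), ← ENNReal.rpow_mul,
        ENNReal.rpow_two]
      simpa using Finset.single_le_sum (f := fun j => ‖h j x‖ₑ ^ 2) (fun _ _ => zero_le)
        (Finset.mem_range.2 hj)
  · have hM := maxFn.measurable (fun y => ‖f₀ y‖ₑ)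
    have hfm := hf₀.measurable
    calc _ ≤ ∫⁻ x, 2 ^ p * (2 ^ p * (‖f₀ x‖ₑ ^ p + (ENNReal.ofReal D * 32) ^ p *
            maxFn (fun y => ‖f₀ y‖ₑ) x ^ p) + (∑ j ∈ Finset.range n, ‖h j x‖ₑ ^ 2) ^ (p / 2)) := by
          refine lintegral_mono fun x => (ENNReal.add_rpow_le' _ _ hp0).trans
            (mul_le_mul_right (add_le_add ((ENNReal.add_rpow_le' _ _ hp0).trans_eq ?_) ?_) _)
          · rw [ENNReal.mul_rpow_of_nonneg _ _ hp0]
          · rw [← ENNReal.rpow_mul]; exact (congrArg _ (by ring)).le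
      _ ≤ _ := by
        rw [lintegral_const_mul' _ _ (by finiteness), lintegral_add_left (by fun_prop),
          lintegral_const_mul' _ _ (by finiteness), lintegral_add_left (by fun_prop),
          lintegral_const_mul' _ _ (by finiteness), mul_assoc, add_mul, mul_assoc _ (_ + _),
          add_mul, mul_assoc _ (C₂ * _), mul_assoc C₂]
        exact mul_le_mul_right (add_le_add (mul_le_mul_right (add_le_add hf₀p (mul_le_mul_right
          ((h₂ _ hfm.enorm).trans (mul_le_mul_right hf₀p _)) _)) _) hhp) _

lemma measurable_sconv {κ H : ℝ → ℂ} (hκ : Measurable κ) (hH : Measurable H) :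
    Measurable (sconv κ H) :=
  (StronglyMeasurable.integral_prod_right (f := fun x y => κ (x - y) * H y)
    (by fun_prop : Measurable _).stronglyMeasurable).measurable

/-- The maximal operator of the frequency truncations to the sets `E j` is bounded on `L^p`. -/
def SupBound (p : ℝ) (E : ℕ → Set ℝ) : Prop :=
  ∃ A : ℝ≥0∞, A ≠ ∞ ∧ ∀ (n : ℕ) (f : ℝ → ℂ), IsWiener f → ∃ U : ℝ → ℝ≥0∞, Measurable U ∧
    (∀ j < n, ∀ x, ‖invF ((E j).indicator (𝓕 f)) x‖ₑ ≤ U x) ∧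
    ∫⁻ x, U x ^ p ≤ A * ∫⁻ x, ‖f x‖ₑ ^ p

/-- The square function of the convolutions with the kernels `κ j` is bounded on `L^p`. -/
structure SqBound (p : ℝ) (κ : ℕ → ℝ → ℂ) : Prop where
  cont (j) : Continuous (κ j)
  int (j) : Integrable (κ j)
  le : ∃ C : ℝ≥0∞, C ≠ ∞ ∧ ∀ (n : ℕ) (f : ℝ → ℂ) (D : ℝ), StronglyMeasurable f →
    (∀ x, ‖f x‖ ≤ D) → sqInt n p (fun j => sconv (κ j) f) ≤ C * ∫⁻ x, ‖f x‖ₑ ^ p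

/-- The trilinear estimate for the sum of the products of the frequency truncations to `A j`
and `B j`. -/
def TriBound (p q r : ℝ) (A B : ℕ → Set ℝ) : Prop :=
  ∃ C : ℝ≥0∞, C ≠ ∞ ∧ ∀ (n : ℕ) (f g H : ℝ → ℂ), IsWiener f → IsWiener g → IsTame H →
    ∑ j ∈ Finset.range n, ‖∫ x, invF ((A j).indicator (𝓕 f)) x *
      invF ((B j).indicator (𝓕 g)) x * H x‖ₑ ≤ C * ((∫⁻ x, ‖f x‖ₑ ^ p) ^ (1 / p) *
        (∫⁻ x, ‖g x‖ₑ ^ q) ^ (1 / q) * (∫⁻ x, ‖H x‖ₑ ^ r) ^ (1 / r))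

lemma TriBound.symm {p q r : ℝ} {A B : ℕ → Set ℝ} (h : TriBound p q r A B) :
    TriBound q p r B A := by
  obtain ⟨C, hC, h⟩ := h
  refine ⟨C, hC, fun n f g H hf hg hH => ?_⟩
  simp_rw [mul_comm (invF ((B _).indicator (𝓕 f)) _), mul_comm ((∫⁻ x, ‖f x‖ₑ ^ q) ^ (1 / q))]
  exact h n g f H hg hf hH

lemma SupBound.congr {p : ℝ} {E E' : ℕ → Set ℝ} (h : SupBound p E)
    (hE : ∀ j, E j =ᵐ[volume] E' j) : SupBound p E' := by
  obtain ⟨A, hA, h⟩ := h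
  refine ⟨A, hA, fun n f hf => ?_⟩
  simpa only [invF_congr (indicator_ae_eq_of_ae_eq_set (f := 𝓕 f) (hE _))] using h n f hf

lemma SupBound.sdiff {p : ℝ} (hp : 0 ≤ p) {E E' : ℕ → Set ℝ} (h : SupBound p E)
    (h' : SupBound p E') (hE : ∀ j, MeasurableSet (E j)) (hE' : ∀ j, MeasurableSet (E' j))
    (hs : ∀ j, E' j ⊆ E j) : SupBound p fun j => E j \ E' j := by
  obtain ⟨A, hA, h⟩ := h
  obtain ⟨A', hA', h'⟩ := h'
  refine ⟨2 ^ p * (A + A'), by finiteness, fun n f hf => ?_⟩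
  obtain ⟨U, hU, hu, hi⟩ := h n f hf
  obtain ⟨U', hU', hu', hi'⟩ := h' n f hf
  refine ⟨fun x => U x + U' x, hU.add hU', fun j hj x => ?_, ?_⟩
  · rw [indicator_sdiff (hs j), invF_sub (hf.fint.indicator (hE j)) (hf.fint.indicator (hE' j))]
    exact enorm_sub_le.trans (add_le_add (hu j hj x) (hu' j hj x))
  · refine (lintegral_mono fun x => ENNReal.add_rpow_le' _ _ hp).trans ?_
    rw [lintegral_const_mul' _ _ (by finiteness), lintegral_add_left (by fun_prop), mul_assoc,
      add_mul]
    exact mul_le_mul_right (add_le_add hi hi') _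

lemma triBound_of_supBound {p q r : ℝ} (hp : 1 < p) (hq : 1 < q) (hr : 1 < r)
    (h : 1 / p + 1 / q + 1 / r = 1) {E : ℕ → Set ℝ} {a b : ℕ → ℝ} {κ κ' : ℕ → ℝ → ℂ}
    (hE : SupBound p E) (hEm : ∀ j, MeasurableSet (E j)) (hab : ∀ j, a j ≤ b j)
    (hκ : SqBound q κ) (hκ' : SqBound r κ')
    (h1 : ∀ j, ∀ η ∈ Ico (a j) (b j), 𝓕 (κ j) η = 1)
    (h2 : ∀ j, ∀ ξ ∈ E j, ∀ η ∈ Ico (a j) (b j), 𝓕 (κ' j) (-(ξ + η)) = 1) :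
    TriBound p q r E fun j => Ico (a j) (b j) := by
  obtain ⟨A, hA, hE⟩ := hE
  obtain ⟨B, hB, hs⟩ := hκ.le
  obtain ⟨B', hB', hs'⟩ := hκ'.le
  obtain ⟨C, hC, hI⟩ := sqInt_indicator_Ico_sconv hq
  refine ⟨A ^ (1 / p) * (C * B) ^ (1 / q) * B' ^ (1 / r), ?_, fun n f g H hf hg hH => ?_⟩
  · have (s : ℝ) (hs : 1 < s) : 0 ≤ 1 / s := by positivity
    have hp' := this p hp; have hq' := this q hq; have hr' := this r hr
    finiteness
  obtain ⟨U, hU, hu, hUi⟩ := hE n f hf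
  obtain ⟨D, hD⟩ := hH.bdd
  have hi (j) : Integrable ((Ico (a j) (b j)).indicator (𝓕 g)) :=
    hg.fint.indicator measurableSet_Ico
  have e (j) : ∫ x, invF ((E j).indicator (𝓕 f)) x *
      invF ((Ico (a j) (b j)).indicator (𝓕 g)) x * H x = ∫ x, invF ((E j).indicator (𝓕 f)) x *
      invF ((Ico (a j) (b j)).indicator (𝓕 g)) x * sconv (κ' j) H x :=
    integral_invF_mul_sconv (hf.fint.indicator (hEm j)) (hi j) hH.integrable (hκ'.int j)
      fun ξ η hξ hη => h2 j _ (mem_of_indicator_ne_zero hξ) _ (mem_of_indicator_ne_zero hη)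
  have e' (j) : (Ico (a j) (b j)).indicator (𝓕 g) =
      (Ico (a j) (b j)).indicator fun ξ => 𝓕 (κ j) ξ * 𝓕 g ξ :=
    indicator_congr fun ξ hξ => by rw [h1 j ξ hξ, one_mul]
  simp_rw [e]
  refine (lintegral_sum_mul_le (by linarith) (by linarith) (by linarith) h hU hu
    (fun j => (continuous_invF (hi j)).measurable)
    fun j => measurable_sconv (hκ'.cont j).measurable hH.meas.measurable).trans ?_
  have hv : sqInt n q (fun j => invF ((Ico (a j) (b j)).indicator (𝓕 g))) ≤
      C * B * ∫⁻ x, ‖g x‖ₑ ^ q := by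
    simp_rw [e', mul_assoc]
    exact (hI n a b κ g hab hκ.int hg).trans
      (mul_le_mul_right (hs n g _ hg.cont.stronglyMeasurable hg.norm_le) _)
  have m (s : ℝ) (hs : 1 < s) {c x y : ℝ≥0∞} (hx : x ≤ c * y) :
      x ^ (1 / s) ≤ c ^ (1 / s) * y ^ (1 / s) := by
    rw [← ENNReal.mul_rpow_of_nonneg _ _ (by positivity)]
    exact ENNReal.rpow_le_rpow hx (by positivity)
  refine (mul_le_mul' (mul_le_mul' (m p hp hUi) (m q hq hv))
    (m r hr (hs' n H D hH.meas hD))).trans_eq ?_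
  ring

lemma SqBound.modKernel (φ : 𝓢(ℝ, ℂ)) {p : ℝ} (hp : 2 ≤ p) {m : ℕ → ℤ} (hm : m.Injective) :
    SqBound p fun j => modKernel φ 0 (m j) where
  cont _ := continuous_modKernel φ.continuous 0 _
  int _ := integrable_modKernel φ.integrable φ.continuous 0 _
  le := (sqInt_sconv_modKernel φ hp).imp fun _ h => ⟨h.1, fun n f D => h.2 n m f D hm⟩

lemma SqBound.dilate {K : 𝓢(ℝ, ℂ)} {a : ℝ} (ha : 0 < a) (hK : ∀ ξ, |ξ| < a → 𝓕 (K : ℝ → ℂ) ξ = 0)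
    {p : ℝ} (hp : 1 < p) {m : ℕ → ℤ} (hm : m.Injective) :
    SqBound p fun j => dilate K (m j) where
  cont j := by have := K.continuous; unfold _root_.dilate; fun_prop
  int j := (K.isLPKernel ha hK).choose_spec.integrable_dilate _
  le := (sqInt_sconv_dilate (K.isLPKernel ha hK) hp).imp
    fun _ h => ⟨h.1, fun n f D => h.2 n m f D hm⟩

lemma triBound_Ico_neg {p q r : ℝ} (hp : 2 ≤ p) (hq : 1 < q) (hr : 2 ≤ r)
    (h : 1 / p + 1 / q + 1 / r = 1) : TriBound p q r (fun j => Ico (-(j:ℝ) - 1) (-(j:ℝ)))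
      fun j => Ico (((2:ℝ) ^ j)⁻¹) 1 := by
  obtain ⟨φ, hφ, -⟩ := exists_schwartz_bump (a := -3) (b := -2) (c := 2) (d := 3)
    (by norm_num) (by norm_num)
  have hs : SupBound q fun j : ℕ => Ici (((2:ℝ) ^ j)⁻¹) := lacunary_sup hq
  have hs' : SupBound q fun _ : ℕ => Ici (1:ℝ) := by
    obtain ⟨A, hA, h⟩ := hs
    refine ⟨A, hA, fun n f hf => ?_⟩
    obtain ⟨U, hU, hu, hi⟩ := h 1 f hf
    exact ⟨U, hU, fun j _ x => by simpa using hu 0 one_pos x, hi⟩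
  have hd := hs.sdiff (by linarith) hs' (fun _ => measurableSet_Ici) (fun _ => measurableSet_Ici)
    fun j => Ici_subset_Ici.2 (inv_le_one_of_one_le₀ (one_le_pow₀ one_le_two))
  simp_rw [Ici_sdiff_Ici] at hd
  refine (triBound_of_supBound hq (by linarith) (by linarith) (by linarith) hd
    (fun _ => measurableSet_Ico) (fun j => by linarith)
    (SqBound.modKernel φ hp (m := fun j => -(j:ℤ)) fun i j => by simp)
    (SqBound.modKernel φ hr (m := fun j => (j:ℤ)) fun i j => by simp)
    (fun j η hη => ?_) fun j ξ hξ η hη => ?_).symm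
  · rw [fourier_modKernel]
    exact hφ _ (by push_cast; constructor <;> simp <;> linarith [hη.1, hη.2])
  · rw [fourier_modKernel]
    have : 0 < ((2:ℝ) ^ j)⁻¹ := by positivity
    exact hφ _ (by constructor <;> simp <;> linarith [hη.1, hη.2, hξ.1, hξ.2])

lemma triBound_Ioo {p q r : ℝ} (hp : 2 ≤ p) (hq : 1 < q) (hr : 2 ≤ r)
    (h : 1 / p + 1 / q + 1 / r = 1) : TriBound p q r (fun j => Ioo 0 ((j:ℝ) + 1))
      fun j => Ico ((2:ℝ) ^ (j + 1)) ((2:ℝ) ^ (j + 2)) := by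
  obtain ⟨K, hK, hK0⟩ := exists_schwartz_bump (a := 1 / 2) (b := 1) (c := 2) (d := 4)
    (by norm_num) (by norm_num)
  obtain ⟨K', hK', hK0'⟩ := exists_schwartz_bump (a := -8) (b := -4) (c := -1) (d := -1 / 2)
    (by norm_num) (by norm_num)
  have hs (b : ℕ → ℝ) : SupBound p fun j : ℕ => Iio (b j) :=
    (carleson_sup (by linarith : 3 / 2 < p)).imp fun _ h => ⟨h.1, fun n => h.2 n b⟩
  have hd := ((hs fun j => j + 1).sdiff (by linarith) (hs 0) (fun _ => measurableSet_Iio)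
    (fun _ => measurableSet_Iio) fun j => Iio_subset_Iio (by simp; positivity)).congr
    (E' := fun j => Ioo 0 ((j:ℝ) + 1)) fun j => by
      simpa using Ioo_ae_eq_Ico.symm
  refine triBound_of_supBound (by linarith) hq (by linarith) h hd
    (fun _ => measurableSet_Ioo) (fun j => pow_le_pow_right₀ one_le_two (by omega))
    (SqBound.dilate (K := K) (a := 1 / 2) (by norm_num) (fun ξ hξ => hK0 _ fun h => ?_) hq
      (m := fun j => (j + 1 : ℕ)) fun i j => by simp)
    (SqBound.dilate (K := K') (a := 1 / 2) (by norm_num) (fun ξ hξ => hK0' _ fun h => ?_)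
      (by linarith) (m := fun j => (j + 1 : ℕ)) fun i j => by simp)
    (fun j η hη => ?_) fun j ξ hξ η hη => ?_
  · linarith [(abs_lt.1 hξ).2, h.1]
  · linarith [(abs_lt.1 hξ).1, h.2]
  · refine (IsLPKernel.fourier_dilate ..).trans (hK _ ?_)
    have h2 : (0:ℝ) < 2 ^ (j + 1) := by positivity
    rw [zpow_neg, zpow_natCast, mem_Icc, le_inv_mul_iff₀ h2, inv_mul_le_iff₀ h2]
    exact ⟨by linarith [hη.1], by have := hη.2; rw [pow_succ] at this; linarith⟩
  · refine (IsLPKernel.fourier_dilate ..).trans (hK' _ ?_)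
    have h2 : (0:ℝ) < 2 ^ (j + 1) := by positivity
    have h3 : (j:ℝ) + 1 < 2 ^ (j + 1) := mod_cast (j + 1).lt_two_pow_self
    rw [zpow_neg, zpow_natCast, mem_Icc, le_inv_mul_iff₀ h2, inv_mul_le_iff₀ h2]
    have := hη.2
    rw [pow_succ] at this
    exact ⟨by linarith [hξ.2], by linarith [hη.1, hξ.1]⟩

lemma triBound_Iic {p q r : ℝ} (hp : 2 ≤ p) (hq : 1 < q) (hr : 2 ≤ r)
    (h : 1 / p + 1 / q + 1 / r = 1) : TriBound p q r (fun j => if j = 0 then Iic 0 else ∅)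
      fun j => if j = 0 then Ici 1 else ∅ := by
  obtain ⟨A, hA, hc⟩ := carleson_sup (by linarith : 3 / 2 < p)
  obtain ⟨B, hB, hi⟩ := sqInt_indicator_Ioi hq
  have hp' : 0 ≤ 1 / p := by positivity
  have hq' : 0 ≤ 1 / q := by positivity
  refine ⟨A ^ (1 / p) * B ^ (1 / q), by finiteness, fun n f g H hf hg hH => ?_⟩
  rcases n with _ | n
  · simp
  rw [Finset.sum_range_succ', Finset.sum_eq_zero fun j _ => by simp [invF], zero_add]
  obtain ⟨U, hU, hu, hUi⟩ := hc 1 0 f hf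
  have hv := hi 1 1 (fun _ => 𝓕 g) fun _ => hg.fint
  have := lintegral_sum_mul_le (n := 1) (by linarith) (by linarith) (by linarith) h hU hu
    (v := fun _ => invF ((Ioi 1).indicator (𝓕 g))) (w := fun _ => H)
    (fun _ => (continuous_invF (hg.fint.indicator measurableSet_Ioi)).measurable)
    fun _ => hH.meas.measurable
  simp only [Finset.sum_range_one, sqInt_one, Pi.zero_apply, Pi.one_apply, hg.eq_invF] at this hv
  simp only [if_true, invF_congr (indicator_ae_eq_of_ae_eq_set (f := 𝓕 f) Iio_ae_eq_Iic.symm),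
    invF_congr (indicator_ae_eq_of_ae_eq_set (f := 𝓕 g) Ioi_ae_eq_Ici.symm)]
  refine this.trans ((mul_le_mul' (mul_le_mul' (ENNReal.rpow_le_rpow hUi hp')
    (ENNReal.rpow_le_rpow hv hq')) le_rfl).trans_eq ?_)
  rw [ENNReal.mul_rpow_of_nonneg _ _ hp', ENNReal.mul_rpow_of_nonneg _ _ hq']
  ring

lemma sum_indicator_disjoint {α : Type*} {s : ℕ → Set α} (hs : Pairwise (Function.onFun Disjoint s))
    (z : α) : (∀ n, ‖∑ j ∈ Finset.range n, (s j).indicator (1 : α → ℂ) z‖ ≤ 1) ∧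
      Filter.Tendsto (fun n => ∑ j ∈ Finset.range n, (s j).indicator (1 : α → ℂ) z) .atTop
        (nhds (∑' j, (s j).indicator 1 z)) := by
  obtain ⟨k, hk⟩ : ∃ k, ∀ j ≠ k, z ∉ s j := by
    by_cases h : ∃ k, z ∈ s k
    · obtain ⟨k, hk⟩ := h
      exact ⟨k, fun j hj hz => disjoint_left.1 (hs hj) hz hk⟩
    · exact ⟨0, fun j _ hz => h ⟨j, hz⟩⟩
  have h0 (j) (hj : j ≠ k) : (s j).indicator (1 : α → ℂ) z = 0 := indicator_of_notMem (hk j hj) _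
  refine ⟨fun n => ?_, (summable_of_ne_finset_zero (s := {k}) fun j hj =>
    h0 j (by simpa using hj)).hasSum.tendsto_sum_nat⟩
  by_cases hn : k < n
  · rw [Finset.sum_eq_single_of_mem k (Finset.mem_range.2 hn) fun j _ => h0 j]
    exact (norm_indicator_le_norm_self _ _).trans (by simp)
  · rw [Finset.sum_eq_zero fun j hj => h0 j fun h => hn (h ▸ Finset.mem_range.1 hj)]
    simp

lemma fourierT_eq (f : ℝ → ℂ) : fourierT f = 𝓕 f := by
  ext ξ
  rw [fourier_eq_ech]
  refine integral_congr_ae (ae_of_all _ fun x => ?_)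
  simp only [eChar, ech, Real.fourierChar_apply, mul_comm (f x)]
  push_cast
  ring_nf

lemma eChar_add_eq (ξ η x : ℝ) : eChar (ξ + η) x = ech (x * ξ) * ech (x * η) := by
  rw [← ech_add, eChar, ech, Real.fourierChar_apply]
  push_cast
  ring_nf

lemma tendsto_Bm {ι : Type*} [Fintype ι] {A B : ι → ℕ → Set ℝ}
    (hA : ∀ i j, MeasurableSet (A i j)) (hB : ∀ i j, MeasurableSet (B i j))
    (hd : ∀ i, Pairwise (Function.onFun Disjoint fun j => A i j ×ˢ B i j)) {f g : ℝ → ℂ}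
    (hf : IsWiener f) (hg : IsWiener g) (x : ℝ) :
    Filter.Tendsto (fun n => ∑ i, ∑ j ∈ Finset.range n, invF ((A i j).indicator (𝓕 f)) x *
      invF ((B i j).indicator (𝓕 g)) x) .atTop
      (nhds (Bm (fun ξ η => ∑ i, ∑' j, indC (A i j) ξ * indC (B i j) η) f g x)) := by
  let Φ (z : ℝ × ℝ) := (𝓕 f z.1 * ech (x * z.1)) * (𝓕 g z.2 * ech (x * z.2))
  have hΦ : Integrable Φ := (Integrable.mul_ech hf.fint x).mul_prod (Integrable.mul_ech hg.fint x)
  let M (n : ℕ) (z : ℝ × ℝ) := ∑ i, ∑ j ∈ Finset.range n, (A i j ×ˢ B i j).indicator (1 : ℝ × ℝ → ℂ) z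
  let m (z : ℝ × ℝ) := ∑ i, ∑' j, (A i j ×ˢ B i j).indicator (1 : ℝ × ℝ → ℂ) z
  have hMm (z) : Filter.Tendsto (fun n => M n z) .atTop (nhds (m z)) :=
    tendsto_finsetSum _ fun i _ => (sum_indicator_disjoint (hd i) z).2
  have hM1 (n z) : ‖M n z‖ ≤ Fintype.card ι := (norm_sum_le_of_le _ fun i _ =>
    (sum_indicator_disjoint (hd i) z).1 n).trans (by simp)
  have hMs (n) : Measurable (M n) := Finset.measurable_fun_sum _ fun i _ =>
    Finset.measurable_fun_sum _ fun j _ => measurable_one.indicator ((hA i j).prod (hB i j))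
  have hMΦ (n) (z) : ‖M n z * Φ z‖ ≤ Fintype.card ι * ‖Φ z‖ := by
    rw [norm_mul]; exact mul_le_mul_of_nonneg_right (hM1 n z) (norm_nonneg _)
  have hlim (z) : Filter.Tendsto (fun n => M n z * Φ z) .atTop (nhds (m z * Φ z)) :=
    (hMm z).mul_const _
  have hms : Measurable m := measurable_of_tendsto_metrizable hMs (tendsto_pi_nhds.2 hMm)
  have hi : Integrable fun z => m z * Φ z :=
    hΦ.bdd_mul (c := Fintype.card ι) hms.aestronglyMeasurable
      (ae_of_all _ fun z => le_of_tendsto (hMm z).norm (.of_forall fun n => hM1 n z))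
  have := tendsto_integral_of_dominated_convergence (F := fun n z => M n z * Φ z) (fun z => Fintype.card ι * ‖Φ z‖)
    (fun n => (hMs n).aestronglyMeasurable.mul hΦ.aestronglyMeasurable) (hΦ.norm.const_mul _)
    (fun n => ae_of_all _ (hMΦ n)) (ae_of_all _ hlim)
  convert this using 2 with n
  · have e (i j) (z : ℝ × ℝ) : (A i j ×ˢ B i j).indicator (1 : ℝ × ℝ → ℂ) z * Φ z =
        ((A i j).indicator (𝓕 f) z.1 * ech (x * z.1)) *
          ((B i j).indicator (𝓕 g) z.2 * ech (x * z.2)) := by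
      by_cases h1 : z.1 ∈ A i j <;> by_cases h2 : z.2 ∈ B i j <;> simp [indicator, h1, h2, Φ]
    simp only [M, Finset.sum_mul, e, Measure.volume_eq_prod]
    have hi' (i j) := (Integrable.mul_ech (hf.fint.indicator (hA i j)) x).mul_prod
      (Integrable.mul_ech (hg.fint.indicator (hB i j)) x)
    rw [integral_finsetSum _ fun i _ => integrable_finsetSum _ fun j _ => hi' i j]
    refine Finset.sum_congr rfl fun i _ => ?_
    rw [integral_finsetSum _ fun j _ => hi' i j]
    exact Finset.sum_congr rfl fun j _ => (integral_prod_mul _ _).symm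
  · refine Eq.trans ?_ (integral_prod _ hi).symm
    refine integral_congr_ae (ae_of_all _ fun ξ => integral_congr_ae (ae_of_all _ fun η => ?_))
    have e (i j) : indC (A i j) ξ * indC (B i j) η =
        (A i j ×ˢ B i j).indicator (1 : ℝ × ℝ → ℂ) (ξ, η) := by
      by_cases h1 : ξ ∈ A i j <;> by_cases h2 : η ∈ B i j <;> simp [indicator, h1, h2, indC]
    simp only [e, fourierT_eq, eChar_add_eq, Φ, m]
    ring

lemma IsTame.integrable_invF_mul {F G H : ℝ → ℂ} (hF : Integrable F) (hG : Integrable G)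
    (hH : IsTame H) : Integrable fun x => invF F x * invF G x * H x :=
  hH.integrable.bdd_mul (c := (∫ ξ, ‖F ξ‖) * ∫ ξ, ‖G ξ‖)
    ((continuous_invF hF).mul (continuous_invF hG)).aestronglyMeasurable
    (ae_of_all _ fun x => (norm_mul_le _ _).trans (mul_le_mul (norm_invF_le _ x)
      (norm_invF_le _ x) (norm_nonneg _) (by positivity)))

lemma SchwartzMap.isWiener (f : 𝓢(ℝ, ℂ)) : IsWiener f :=
  ⟨f.continuous, f.integrable, by rw [← SchwartzMap.fourier_coe]; exact (𝓕 f).integrable⟩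

/-- Trilinear estimates for the rectangles bound the bilinear multiplier operator. -/
theorem exists_eLpNorm_Bm_le {ι : Type*} [Fintype ι] {A B : ι → ℕ → Set ℝ}
    (hA : ∀ i j, MeasurableSet (A i j)) (hB : ∀ i j, MeasurableSet (B i j))
    (hd : ∀ i, Pairwise (Function.onFun Disjoint fun j => A i j ×ˢ B i j)) {p q r : ℝ}
    (hp : 1 < p) (hq : 1 < q) (hr : 1 < r) (h : ∀ i, TriBound p q r (A i) (B i)) :
    ∃ C : ℝ, 0 < C ∧ ∀ f g : 𝓢(ℝ, ℂ),
      eLpNorm (Bm (fun ξ η => ∑ i, ∑' j, indC (A i j) ξ * indC (B i j) η) f g)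
        (ENNReal.ofReal (r / (r - 1))) volume ≤ ENNReal.ofReal C *
          eLpNorm f (ENNReal.ofReal p) volume * eLpNorm g (ENNReal.ofReal q) volume := by
  choose C hC h using h
  have hC' : ∑ i, C i ≠ ∞ := (ENNReal.sum_lt_top.2 fun i _ => (hC i).lt_top).ne
  refine ⟨(∑ i, C i).toReal + 1, by positivity, fun f g => ?_⟩
  have e (s : ℝ) (hs : 1 < s) (u : ℝ → ℂ) : eLpNorm u (ENNReal.ofReal s) volume =
      (∫⁻ x, ‖u x‖ₑ ^ s) ^ (1 / s) := by
    rw [eLpNorm_eq_lintegral_rpow_enorm_toReal (by simpa using by linarith) ENNReal.ofReal_ne_top,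
      ENNReal.toReal_ofReal (by linarith)]
  have hr' : r.HolderConjugate (r / (r - 1)) := Real.HolderConjugate.conjExponent hr
  have hf := f.isWiener
  have hg := g.isWiener
  rw [e _ hr'.symm.lt, e p hp, e q hq, mul_assoc]
  set N := (∫⁻ x, ‖f x‖ₑ ^ p) ^ (1 / p) * (∫⁻ x, ‖g x‖ₑ ^ q) ^ (1 / q)
  have hi (i j) := hf.fint.indicator (hA i j)
  have hj (i j) := hg.fint.indicator (hB i j)
  have hc (n) : Continuous fun x => ∑ i, ∑ j ∈ Finset.range n, invF ((A i j).indicator (𝓕 ⇑f)) x *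
      invF ((B i j).indicator (𝓕 ⇑g)) x :=
    continuous_finsetSum _ fun i _ => continuous_finsetSum _ fun j _ =>
      (continuous_invF (hi i j)).mul (continuous_invF (hj i j))
  have key := lintegral_rpow_le_of_tendsto (fun n => (hc n).measurable) (fun n =>
    lintegral_rpow_le_of_dual (C := (∑ i, C i) * N) hr'.symm (hc n).stronglyMeasurable
      fun G hG => ?_) (tendsto_Bm hA hB hd hf hg)
  · refine (ENNReal.rpow_le_rpow key hr'.symm.one_div_nonneg).trans ?_
    rw [one_div, ENNReal.rpow_rpow_inv hr'.symm.ne_zero]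
    refine mul_le_mul_left ?_ _
    exact (ENNReal.ofReal_toReal hC').ge.trans (ENNReal.ofReal_le_ofReal (by linarith))
  · have hH : IsTame fun x => (starRingEnd ℂ) (G x) := ⟨hG.meas.star, by simpa using hG.bdd, by
      convert hG.supp using 2; ext; simp⟩
    have hI (i j) := hH.integrable_invF_mul (hi i j) (hj i j)
    simp only [RCLike.inner_apply, Finset.sum_mul]
    rw [integral_finsetSum _ fun i _ => integrable_finsetSum _ fun j _ => hI i j]
    refine (enorm_sum_le _ _).trans (Finset.sum_le_sum fun i _ => ?_)
    rw [integral_finsetSum _ fun j _ => hI i j]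
    refine (enorm_sum_le _ _).trans ((h i n f g _ hf hg hH).trans_eq ?_)
    simp only [RCLike.enorm_conj, mul_assoc, N]

lemma mpar_eq_sum : mpar = fun ξ η => ∑ i : Fin 3, ∑' j : ℕ,
    indC ((![fun j : ℕ => Ico (-(j : ℝ) - 1) (-(j : ℝ)), fun j : ℕ => Ioo 0 ((j : ℝ) + 1),
      fun j => if j = 0 then Iic 0 else ∅] : Fin 3 → ℕ → Set ℝ) i j) ξ *
    indC ((![fun j : ℕ => Ico (((2 : ℝ) ^ j)⁻¹) 1, fun j : ℕ => Ico ((2 : ℝ) ^ (j + 1)) (2 ^ (j + 2)),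
      fun j => if j = 0 then Ici 1 else ∅] : Fin 3 → ℕ → Set ℝ) i j) η := by
  ext ξ η
  rw [Fin.sum_univ_three]
  simp only [mpar, Matrix.cons_val]
  rw [tsum_eq_single (f := fun j : ℕ => indC (if j = 0 then Iic 0 else ∅) ξ * _) 0 fun j hj => by
    simp [hj, indC]]
  simp

/-- The exponential staircase paraproduct is bounded for `2 ≤ p₁, p₃ < ∞`, `1 < p₂ < ∞`,
`1/p₁ + 1/p₂ + 1/p₃ = 1`. -/
theorem exponential_paraproduct_bound (p1 p2 p3 : ℝ)
    (hp1 : 2 ≤ p1) (hp2 : 1 < p2) (hp3 : 2 ≤ p3)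
    (hsum : 1 / p1 + 1 / p2 + 1 / p3 = 1) :
    ∃ C : ℝ, 0 < C ∧
      ∀ f g : SchwartzMap ℝ ℂ,
        eLpNorm (Bm mpar (⇑f) (⇑g)) (ENNReal.ofReal (p3 / (p3 - 1))) volume ≤
          ENNReal.ofReal C * eLpNorm (⇑f) (ENNReal.ofReal p1) volume *
            eLpNorm (⇑g) (ENNReal.ofReal p2) volume := by
  rw [mpar_eq_sum]
  refine exists_eLpNorm_Bm_le (p := p1) (q := p2) (r := p3) (fun i j => ?_) (fun i j => ?_)
    (fun i j k hjk => ?_) (by linarith) hp2 (by linarith) fun i => ?_ <;> fin_cases i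
  · exact measurableSet_Ico
  · exact measurableSet_Ioo
  · change MeasurableSet (if j = 0 then Iic (0:ℝ) else ∅)
    split_ifs <;> simp
  · exact measurableSet_Ico
  · exact measurableSet_Ico
  · change MeasurableSet (if j = 0 then Ici (1:ℝ) else ∅)
    split_ifs <;> simp
  · have h : Antitone fun n : ℕ => -(n:ℝ) := fun a b h => by simpa using h
    exact disjoint_prod.2 (.inl (by
      simpa [Function.onFun, sub_eq_add_neg, add_comm] using h.pairwise_disjoint_on_Ico_succ hjk))
  · have h : Monotone fun n : ℕ => (2:ℝ) ^ (n + 1) := fun a b h =>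
      pow_le_pow_right₀ one_le_two (by omega)
    exact disjoint_prod.2 (.inr (h.pairwise_disjoint_on_Ico_succ hjk))
  · rcases eq_or_ne j 0 with rfl | hj
    · simp [Function.onFun, hjk.symm]
    · simp [Function.onFun, hj]
  · exact triBound_Ico_neg hp1 hp2 hp3 hsum
  · exact triBound_Ioo hp1 hp2 hp3 hsum
  · exact triBound_Iic hp1 hp2 hp3 hsum
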